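/- For the planar disk with either Dirichlet or Neumann boundary conditions, the remainder in the two-term Weyl law satisfies 𝓡_disk(μ) = O(μ^{2/3 − 1/495}) as μ → ∞; that is, there is a constant C such that |𝒩_disk(μ) − (Area(disk)/4π)μ² ± (Length(∂ disk)/4π)μ| ≤ C μ^{2/3 − 1/495} for all μ > 1, where the sign is + for Dirichlet and − for Neumann boundary conditions. -/

import Mathlib

open Real Set

/-- The open unit disk in ℝ². -/
def unitDisk : Set (ℝ × ℝ) := {x | x.1^2 + x.2^2 < 1}

/-- The unit circle (the boundary of the disk). -/
def unitCircle : Set (ℝ × ℝ) := {x | x.1^2 + x.2^2 = 1}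

/-- The closed unit disk. -/
def closedDisk : Set (ℝ × ℝ) := {x | x.1^2 + x.2^2 ≤ 1}

noncomputable def pd1 (f : ℝ × ℝ → ℝ) : ℝ × ℝ → ℝ := fun x => fderiv ℝ f x (1, 0)
noncomputable def pd2 (f : ℝ × ℝ → ℝ) : ℝ × ℝ → ℝ := fun x => fderiv ℝ f x (0, 1)

/-- The Laplacian on ℝ². -/
noncomputable def lap (u : ℝ × ℝ → ℝ) : ℝ × ℝ → ℝ :=
  fun x => pd1 (pd1 u) x + pd2 (pd2 u) x

/-- Dirichlet eigenfunctions of `-Δ` on the unit disk with eigenvalue `lam`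
(extended by zero outside the closed disk, so that the eigenspace has the correct
dimension as a space of functions on the disk). -/
def dirichletEigSet (lam : ℝ) : Set (ℝ × ℝ → ℝ) :=
  {u | ContDiffOn ℝ (⊤ : ℕ∞) u closedDisk ∧
       (∀ x ∈ unitCircle, u x = 0) ∧
       (∀ x ∈ unitDisk, lap u x = -lam * u x) ∧
       (∀ x, x ∉ closedDisk → u x = 0)}

/-- Neumann eigenfunctions of `-Δ` on the unit disk with eigenvalue `lam`:
the normal derivative (the derivative in the direction of the outward normal `x`)
vanishes on the boundary circle. -/
def neumannEigSet (lam : ℝ) : Set (ℝ × ℝ → ℝ) :=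
  {u | ContDiffOn ℝ (⊤ : ℕ∞) u closedDisk ∧
       (∀ x ∈ unitCircle, fderivWithin ℝ u closedDisk x x = 0) ∧
       (∀ x ∈ unitDisk, lap u x = -lam * u x) ∧
       (∀ x, x ∉ closedDisk → u x = 0)}

/-- Multiplicity of `lam` as a Dirichlet eigenvalue. -/
noncomputable def multD (lam : ℝ) : ℕ :=
  Module.finrank ℝ (Submodule.span ℝ (dirichletEigSet lam))

/-- Multiplicity of `lam` as a Neumann eigenvalue. -/
noncomputable def multN (lam : ℝ) : ℕ :=
  Module.finrank ℝ (Submodule.span ℝ (neumannEigSet lam))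

/-- The Dirichlet eigenvalue counting function: the number (with multiplicity) of
eigenvalues `μₙ²` with `μₙ < μ`, i.e. of eigenvalues `lam < μ²`. -/
noncomputable def NdiskD (μ : ℝ) : ℝ :=
  ∑' lam : ℝ, Set.indicator {l : ℝ | l < μ^2} (fun l => (multD l : ℝ)) lam

/-- The Neumann eigenvalue counting function. -/
noncomputable def NdiskN (μ : ℝ) : ℝ :=
  ∑' lam : ℝ, Set.indicator {l : ℝ | l < μ^2} (fun l => (multN l : ℝ)) lam

open _root_.Complex (I norm_real norm_exp_ofReal_mul_I ofReal_neg norm_I re_ofReal_mul)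
open _root_.Complex renaming exp → cexp
open _root_.Finset (sum_const sum_congr mul_sum card_range sum_range_succ sum_sub_distrib sum_add_distrib sum_le_sum sum_Ico_consecutive sum_Ico_eq_sum_range abs_sum_le_sum_abs sum_comm)
open _root_.Finset renaming range → rg, Ico → fIco, Ioo → fIoo, mem_range → mem_rg, mem_Ico → mem_fIco
open _root_.Filter (atTop Tendsto eventually_ge_atTop eventually_gt_atTop tendsto_pow_atTop tendsto_id)
open _root_.Nat (factorial_succ card_Ico ceil_lt_add_one lt_floor_add_one le_ceil)
open _root_.Int (fract)
open _root_.intervalIntegral (integral_const_mul integral_add_adjacent_intervals)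
open _root_.MeasureTheory (volume)
local notation "pz" => by positivity
local notation "lz" => by linarith
local notation "nz" => by norm_num
local notation "oz" => by omega
local notation "sz" => by simp
local notation "fz" => by fun_prop
local notation "rz" => by ring

noncomputable def ee (x : ℝ) : ℂ := cexp ((2 * π * x : ℝ) * I)

lemma ee_norm (x : ℝ) : ‖ee x‖ = 1 := by
  exact norm_exp_ofReal_mul_I _

lemma ee_add (x y : ℝ) : ee (x + y) = ee x * ee y := by
  unfold ee; rw [← Complex.exp_add]; congr 1; push_cast; ring

lemma ee_zero : ee 0 = 1 := by simp [ee]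

lemma ee_int (k : ℤ) : ee k = 1 := by
  unfold ee
  rw [show ((2 * π * (k:ℝ) : ℝ) : ℂ) * I = k * (2 * π * I) by push_cast; ring]
  exact Complex.exp_int_mul_two_pi_mul_I k

lemma ee_conj (x : ℝ) : (starRingEnd ℂ) (ee x) = ee (-x) := by
  unfold ee; rw [← Complex.exp_conj]; congr 1; rw [map_mul, Complex.conj_ofReal, Complex.conj_I]; push_cast; ring

lemma ee_sub_conj (x y : ℝ) : ee x * (starRingEnd ℂ) (ee y) = ee (x - y) := by
  rw [ee_conj, ← ee_add, sub_eq_add_neg]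

lemma ee_lip (x y : ℝ) : ‖ee x - ee y‖ ≤ 2 * π * |x - y| := by
  have h1 : ee x - ee y = ee y * (ee (x - y) - 1) := by
    rw [mul_sub, ← ee_add]; congr 2 <;> ring
  rw [h1, norm_mul, ee_norm, one_mul]
  have := Real.norm_exp_I_mul_ofReal_sub_one_le (x := 2 * π * (x - y))
  unfold ee
  rw [mul_comm]
  refine this.trans ?_
  rw [norm_eq_abs, abs_mul, abs_of_pos two_pi_pos]

lemma ee_norm_sub_one (x : ℝ) : ‖ee x - 1‖ ≤ 2 := by
  calc ‖ee x - 1‖ ≤ ‖ee x‖ + ‖(1:ℂ)‖ := norm_sub_le _ _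
    _ = 2 := by rw [ee_norm]; norm_num

/-- cot-type coefficient -/
lemma ee_coef (x : ℝ) (hs : sin (π * x) ≠ 0) :
    (1 - ee x) * ((1 / 2 : ℂ) + ((cos (π * x) / (2 * sin (π * x)) : ℝ) : ℂ) * I) = 1 := by
  have h : ee x = ((cos (π * x) : ℝ) + (sin (π * x) : ℝ) * I) ^ 2 := by
    unfold ee
    rw [Complex.ofReal_cos, Complex.ofReal_sin, ← Complex.exp_mul_I, ← Complex.exp_nat_mul]
    congr 1; push_cast; ring
  have hs' : ((sin (π * x) : ℝ) : ℂ) ≠ 0 := by exact_mod_cast hs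
  have hcs : ((cos (π * x) : ℝ) : ℂ) ^ 2 = 1 - ((sin (π * x) : ℝ) : ℂ) ^ 2 := by
    rw [eq_sub_iff_add_eq]; exact_mod_cast Real.cos_sq_add_sin_sq (π * x)
  rw [h]
  generalize cos (π * x) = c at *
  generalize sin (π * x) = s at *
  push_cast
  field_simp
  have hI : I ^ 2 = -1 := Complex.I_sq
  have hI3 : I ^ 3 = -I := by rw [pow_succ, hI]; ring
  ring_nf
  simp only [hI, hI3]
  have hc3 : (c:ℂ) ^ 3 = c * (1 - (s:ℂ) ^ 2) := by rw [← hcs]; ring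
  rw [hc3, hcs]; ring

lemma sum_parts (N : ℕ) (E c : ℕ → ℂ) :
    ∑ n ∈ rg (N+1), (E n - E (n+1)) * c n
      = E 0 * c 0 - E (N+1) * c N + ∑ n ∈ rg N, E (n+1) * (c (n+1) - c n) := by
  induction N with
  | zero => simp; ring
  | succ N ih => rw [sum_range_succ, ih, sum_range_succ _ N]; ring

lemma cot_anti {a b : ℝ} (ha : 0 < a) (hab : a ≤ b) (hb : b < π) :
    cos b / (2 * sin b) ≤ cos a / (2 * sin a) := by
  have h1 := Real.sin_pos_of_pos_of_lt_pi ha (lz)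
  have h2 := Real.sin_pos_of_pos_of_lt_pi (ha.trans_le hab) hb
  rw [div_le_div_iff₀ (pz) (pz)]
  have h3 : 0 ≤ sin (b - a) := Real.sin_nonneg_of_nonneg_of_le_pi (lz) (lz)
  rw [Real.sin_sub] at h3
  nlinarith

/-- Kusmin–Landau, range version. -/
lemma kl_range (g : ℕ → ℝ) (N : ℕ) (ρ : ℝ) (hρ : 0 < ρ)
    (hmono : ∀ n, n + 1 < N → g (n+1) - g n ≤ g (n+2) - g (n+1))
    (hlo : ∀ n, n < N → ρ ≤ g (n+1) - g n) (hhi : ∀ n, n < N → g (n+1) - g n ≤ 1 - ρ) :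
    ‖∑ n ∈ rg N, ee (g n)‖ ≤ 2 / ρ := by
  rcases N with _ | N
  · simp; positivity
  set D : ℕ → ℝ := fun n => g (n+1) - g n with hD
  set r : ℕ → ℝ := fun n => cos (π * D n) / (2 * sin (π * D n)) with hr
  set c : ℕ → ℂ := fun n => (1/2 : ℂ) + ((r n : ℝ) : ℂ) * I with hc
  have hρ2 : ρ ≤ 1/2 := by have := hlo 0 (oz); have := hhi 0 (oz); linarith
  have hsin : ∀ n, n < N + 1 → 2 * ρ ≤ sin (π * D n) := by
    intro n hn
    have h1 := hlo n hn; have h2 := hhi n hn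
    have key : ∀ y, ρ ≤ y → y ≤ 1/2 → 2 * ρ ≤ sin (π * y) := by
      intro y hy1 hy2
      have := mul_le_sin (x := π * y) (by have := pi_pos; nlinarith) (by have := pi_pos; nlinarith)
      have e : 2 / π * (π * y) = 2 * y := by field_simp
      rw [e] at this; linarith
    rcases le_total (D n) (1/2) with h | h
    · exact key _ h1 h
    · have := key (1 - D n) (by simp only [hD]; linarith) (lz)
      rwa [show π * (1 - D n) = π - π * D n by ring, Real.sin_pi_sub] at this
  have hterm : ∀ n, n < N+1 → ee (g n) = (ee (g n) - ee (g (n+1))) * c n := by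
    intro n hn
    have h1 := ee_coef (D n) (by have := hsin n hn; intro h; rw [h] at this; linarith)
    have h2 : ee (g (n+1)) = ee (g n) * ee (D n) := by rw [← ee_add]; congr 1; simp [hD]
    rw [h2, show ee (g n) - ee (g n) * ee (D n) = ee (g n) * (1 - ee (D n)) by ring, mul_assoc, h1, mul_one]
  have hrb : ∀ n, n < N + 1 → |r n| ≤ 1 / (4 * ρ) := by
    intro n hn
    have := hsin n hn
    have hp : 0 < sin (π * D n) := lz
    simp only [hr]
    rw [abs_div, abs_of_pos (show 0 < 2 * sin (π * D n) by linarith)]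
    rw [div_le_div_iff₀ (lz) (lz)]
    have := Real.abs_cos_le_one (π * D n)
    nlinarith [abs_nonneg (cos (π * D n))]
  have hcb : ∀ n, n < N + 1 → ‖c n‖ ≤ 1 / (2 * ρ) := by
    intro n hn
    calc ‖c n‖ ≤ ‖(1/2 : ℂ)‖ + ‖((r n : ℝ) : ℂ) * I‖ := norm_add_le _ _
      _ = 1/2 + |r n| := sz
      _ ≤ 1 / (4 * ρ) + 1 / (4 * ρ) := by
          refine add_le_add ?_ (hrb n hn)
          rw [div_le_div_iff₀ (nz) (lz)]; linarith
      _ = 1 / (2 * ρ) := by field_simp; norm_num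
  rw [sum_congr rfl (fun n hn => hterm n (mem_rg.1 hn)), sum_parts N (fun n => ee (g n)) c]
  have hdiff : ∀ n ∈ rg N, ‖ee (g (n+1)) * (c (n+1) - c n)‖ = r n - r (n+1) := by
    intro n hn
    have hn := mem_rg.1 hn
    have h0 : c (n+1) - c n = ((r (n+1) - r n : ℝ) : ℂ) * I := by simp only [hc]; push_cast; ring
    rw [norm_mul, ee_norm, h0, norm_mul, norm_I, norm_real, one_mul, mul_one, norm_eq_abs, abs_sub_comm,
      abs_of_nonneg]
    have h1 := hlo n (oz); have h2 := hhi (n+1) (oz); have h3 := hmono n (oz)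
    have := cot_anti (a := π * D n) (b := π * D (n+1)) (by have := pi_pos; have : 0 < D n := by simp only [hD]; linarith
                                                           positivity)
      (mul_le_mul_of_nonneg_left h3 pi_pos.le) (by have := pi_pos; have : D (n+1) < 1 := by simp only [hD]; linarith
                                                   nlinarith)
    simp only [hr]; linarith
  have hs : ‖∑ n ∈ rg N, ee (g (n+1)) * (c (n+1) - c n)‖ ≤ r 0 - r N := by
    refine (norm_sum_le _ _).trans ?_
    rw [sum_congr rfl hdiff, Finset.sum_range_sub']
  calc _ ≤ ‖ee (g 0) * c 0‖ + ‖ee (g (N+1)) * c N‖ + ‖∑ n ∈ rg N, ee (g (n+1)) * (c (n+1) - c n)‖ :=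
        (norm_add_le _ _).trans (add_le_add_left (norm_sub_le _ _) _)
    _ ≤ 1 / (2 * ρ) + 1 / (2 * ρ) + (1 / (4 * ρ) + 1 / (4 * ρ)) := by
        rw [norm_mul, norm_mul, ee_norm, ee_norm, one_mul, one_mul]
        have h0 := abs_le.1 (hrb 0 (oz)); have h1 := abs_le.1 (hrb N (oz))
        have := hcb 0 (oz); have := hcb N (oz)
        linarith
    _ ≤ 2 / ρ := by
        rw [show 1 / (2 * ρ) + 1 / (2 * ρ) + (1 / (4 * ρ) + 1 / (4 * ρ)) = (3/2) / ρ by field_simp; norm_num]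
        gcongr; norm_num

/-- Kusmin–Landau on an interval with integer shift. -/
lemma kl (g : ℕ → ℝ) (p q : ℕ) (k : ℤ) (ρ : ℝ) (hρ : 0 < ρ)
    (hmono : ∀ n, p ≤ n → n + 1 < q → g (n+1) - g n ≤ g (n+2) - g (n+1))
    (hlo : ∀ n, p ≤ n → n < q → k + ρ ≤ g (n+1) - g n)
    (hhi : ∀ n, p ≤ n → n < q → g (n+1) - g n ≤ k + 1 - ρ) :
    ‖∑ n ∈ fIco p q, ee (g n)‖ ≤ 2 / ρ := by
  rw [sum_Ico_eq_sum_range]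
  have h := kl_range (fun n => g (p + n) - k * n) (q - p) ρ hρ ?_ ?_ ?_
  · convert h using 3 with n hn
    rw [sub_eq_add_neg, ee_add, show -((k:ℝ) * n) = ((-(k * n) : ℤ) : ℝ) by push_cast; ring, ee_int, mul_one]
  · intro n hn
    have := hmono (p + n) (oz) (oz)
    simp only [← add_assoc]; push_cast; linarith
  · intro n hn
    have := hlo (p + n) (oz) (oz)
    simp only [← add_assoc]; push_cast; linarith
  · intro n hn
    have := hhi (p + n) (oz) (oz)
    simp only [← add_assoc]; push_cast; linarith

noncomputable def wY (z : ℕ → ℂ) (N j k : ℕ) : ℂ := if k ≤ j ∧ j - k < N then z (j - k) else 0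

lemma wY_corr (z : ℕ → ℂ) (N K k l : ℕ) (hkl : k ≤ l) (hl : l < K) :
    ∑ j ∈ rg (N + K), wY z N j k * (starRingEnd ℂ) (wY z N j l)
      = ∑ m ∈ rg (N - (l - k)), z (m + (l - k)) * (starRingEnd ℂ) (z m) := by
  have h1 : ∑ m ∈ rg (N - (l - k)), z (m + (l - k)) * (starRingEnd ℂ) (z m)
      = ∑ j ∈ fIco l (l + (N - (l - k))), wY z N j k * (starRingEnd ℂ) (wY z N j l) := by
    rw [sum_Ico_eq_sum_range, Nat.add_sub_cancel_left]
    refine sum_congr rfl fun m hm => ?_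
    unfold wY
    grind
  rw [h1]
  symm
  apply Finset.sum_subset
  · grind
  · intro j hj hj2
    unfold wY
    grind

lemma weyl_step (z : ℕ → ℂ) (hz : ∀ n, ‖z n‖ ≤ 1) (N K R P : ℕ) (hN : N ≤ P) (hK : K ≤ P) (hR : 1 ≤ R)
    (hRK : R ≤ K) (B : ℝ) (hB : 0 ≤ B)
    (h : ∀ r, R ≤ r → r < K → ‖∑ m ∈ rg (N - r), z (m + r) * (starRingEnd ℂ) (z m)‖ ≤ B) :
    ‖∑ m ∈ rg N, z m‖ ^ 2 ≤ 4 * (P:ℝ) ^ 2 * R / K + 2 * P * B := by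
  set S := ∑ m ∈ rg N, z m with hS
  set c : ℕ → ℂ := fun j => ∑ k ∈ rg K, wY z N j k with hc
  have h1 : (K : ℂ) * S = ∑ j ∈ rg (N + K), c j := by
    rw [sum_comm]
    have : ∀ k ∈ rg K, ∑ j ∈ rg (N + K), wY z N j k = S := by
      intro k hk
      have e : S = ∑ j ∈ fIco k (k + N), wY z N j k := by
        rw [sum_Ico_eq_sum_range, Nat.add_sub_cancel_left]
        refine sum_congr rfl fun m hm => ?_
        have hm := mem_rg.1 hm
        unfold wY
        rw [if_pos (oz)]; congr 1; omega
      rw [e]; symm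
      apply Finset.sum_subset
      · grind
      · intro j hj hj2
        simp only [mem_fIco, mem_rg] at *
        unfold wY; rw [if_neg]; omega
    rw [sum_congr rfl this]; simp
  have hA : ∀ k ∈ rg K, ∀ l ∈ rg K,
      ‖∑ j ∈ rg (N + K), wY z N j k * (starRingEnd ℂ) (wY z N j l)‖
        ≤ B + (if k < l + R ∧ l < k + R then (P:ℝ) else 0) := by
    have key : ∀ k l, k ≤ l → l < K → 
        ‖∑ j ∈ rg (N + K), wY z N j k * (starRingEnd ℂ) (wY z N j l)‖
        ≤ B + (if k < l + R ∧ l < k + R then (P:ℝ) else 0) := by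
      intro k l hkl hl
      rw [wY_corr z N K k l hkl hl]
      by_cases hr : l < k + R
      · rw [if_pos ⟨oz, hr⟩]
        have : ‖∑ m ∈ rg (N - (l - k)), z (m + (l - k)) * (starRingEnd ℂ) (z m)‖ ≤ P := by
          refine (norm_sum_le_of_le _ (f := fun m => z (m + (l - k)) * (starRingEnd ℂ) (z m)) (n := fun _ => (1:ℝ)) ?_).trans ?_
          · intro m _
            rw [norm_mul, RCLike.norm_conj]
            exact mul_le_one₀ (hz _) (norm_nonneg _) (hz _)
          · simp only [sum_const, card_range, nsmul_eq_mul, mul_one]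
            exact_mod_cast (Nat.sub_le _ _).trans hN
        linarith
      grind
    intro k hk l hl
    have hk := mem_rg.1 hk
    have hl := mem_rg.1 hl
    rcases le_total k l with hkl | hkl
    · exact key k l hkl hl
    · have := key l k hkl hk
      rw [← RCLike.norm_conj, map_sum] at this
      simp only [map_mul, RingHomCompTriple.comp_apply, RingHom.id_apply] at this
      simp only [and_comm] at this ⊢
      rw [sum_congr rfl fun j _ => mul_comm (wY z N j k) _]
      exact this
  have h2 : ∑ j ∈ rg (N + K), ‖c j‖ ^ 2 ≤ K * (2 * R * P) + K ^ 2 * B := by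
    have e : ((∑ j ∈ rg (N + K), ‖c j‖ ^ 2 : ℝ) : ℂ)
        = ∑ k ∈ rg K, ∑ l ∈ rg K, ∑ j ∈ rg (N + K), wY z N j k * (starRingEnd ℂ) (wY z N j l) := by
      push_cast
      simp_rw [← Complex.mul_conj', hc, map_sum, Finset.sum_mul_sum]
      rw [sum_comm]
      refine sum_congr rfl fun k _ => ?_
      rw [sum_comm]
    have e2 : ∑ j ∈ rg (N + K), ‖c j‖ ^ 2 = ‖((∑ j ∈ rg (N + K), ‖c j‖ ^ 2 : ℝ) : ℂ)‖ := by
      rw [norm_real, norm_eq_abs, abs_of_nonneg (pz)]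
    rw [e2, e]
    refine (norm_sum_le _ _).trans ?_
    have : ∀ k ∈ rg K, ‖∑ l ∈ rg K, ∑ j ∈ rg (N + K), wY z N j k * (starRingEnd ℂ) (wY z N j l)‖
        ≤ K * B + 2 * R * P := by
      intro k hk
      refine (norm_sum_le_of_le _ (hA k hk)).trans ?_
      rw [sum_add_distrib, sum_const, card_range, nsmul_eq_mul, ← Finset.sum_filter,
        sum_const, nsmul_eq_mul]
      have : (Finset.filter (fun l => k < l + R ∧ l < k + R) (rg K)).card ≤ 2 * R := by
        refine (Finset.card_le_card (t := fIco (k + 1 - R) (k + R)) ?_).trans ?_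
        · grind
        · rw [card_Ico]; omega
      have : ((Finset.filter (fun l => k < l + R ∧ l < k + R) (rg K)).card : ℝ) ≤ 2 * R := by exact_mod_cast this
      gcongr
    refine (sum_le_sum this).trans ?_
    rw [sum_const, card_range, nsmul_eq_mul]
    apply le_of_eq; ring
  have h3 : ((K:ℝ) * ‖S‖) ^ 2 ≤ (N + K) * (K * (2 * R * P) + K ^ 2 * B) := by
    have : (K:ℝ) * ‖S‖ = ‖(K : ℂ) * S‖ := by rw [norm_mul, Complex.norm_natCast]
    rw [this, h1]
    calc ‖∑ j ∈ rg (N + K), c j‖ ^ 2 ≤ (∑ j ∈ rg (N + K), ‖c j‖) ^ 2 := by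
          gcongr; exact norm_sum_le _ _
      _ ≤ (rg (N + K)).card * ∑ j ∈ rg (N + K), ‖c j‖ ^ 2 := sq_sum_le_card_mul_sum_sq
      _ ≤ (N + K) * (K * (2 * R * P) + K ^ 2 * B) := by
          rw [card_range]; push_cast; gcongr
  have hK0 : (0:ℝ) < K := by exact_mod_cast (oz : 0 < K)
  have hN' : (N:ℝ) ≤ P := by exact_mod_cast hN
  have hK' : (K:ℝ) ≤ P := by exact_mod_cast hK
  have h4 : ((K:ℝ) * ‖S‖) ^ 2 ≤ (2 * P) * (K * (2 * R * P) + K ^ 2 * B) := h3.trans (by gcongr; linarith)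
  have h5 : 4 * (P:ℝ) ^ 2 * R / K + 2 * P * B = ((2 * P) * (K * (2 * R * P) + K ^ 2 * B)) / K ^ 2 := by
    field_simp; ring
  rw [h5, le_div_iff₀ (pz)]
  linarith [mul_pow (K:ℝ) ‖S‖ 2]

/-- all sums `∑_{m<N} ee (A s(ωm+β))` with admissible parameters are at most `B` -/
def levB (s : ℝ → ℝ) (ω Y : ℝ) (P : ℕ) (lo up B : ℝ) : Prop :=
  ∀ (A β : ℝ) (N : ℕ), lo ≤ A → A ≤ up → 0 ≤ β → β + ω * N ≤ Y → N ≤ P →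
    ‖∑ m ∈ rg N, ee (A * s (ω * m + β))‖ ≤ B

lemma lev_step (s s' : ℝ → ℝ) (hs : ∀ x r, s (x + r) - s x = 2 * sin (r/2) * s' (x + r/2))
    (ω Y : ℝ) (hω : 0 < ω) (hY : Y ≤ π/2) (P K R : ℕ) (hK : K ≤ P) (hR : 1 ≤ R) (hRK : R ≤ K)
    (lo up B B' : ℝ) (hlo : 0 ≤ lo) (hB : 0 ≤ B) (hB' : 0 ≤ B')
    (hBB : 4 * (P:ℝ) ^ 2 * R / K + 2 * P * B ≤ B' ^ 2)
    (H : levB s' ω Y P (lo * (2 * ω / π) * R) (up * ω * K) B) : levB s ω Y P lo up B' := by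
  intro A β N h1 h2 h3 h4 h5
  refine abs_le_of_sq_le_sq' ?_ hB' |>.2
  refine (weyl_step (fun m => ee (A * s (ω * m + β))) (fun n => (ee_norm _).le) N K R P h5 hK hR hRK B hB ?_).trans hBB
  intro r hr1 hr2
  rcases le_or_gt N r with hN | hN
  · simp_all
  have hA : 0 ≤ A := hlo.trans h1
  have hNr : (r:ℝ) ≤ N := by exact_mod_cast hN.le
  have hωr : ω * r / 2 ≤ π / 2 := by have := mul_le_mul_of_nonneg_left hNr hω.le; linarith [pi_pos]
  have hωr0 : 0 ≤ ω * r / 2 := pz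
  have e : ∀ m : ℕ, ee (A * s (ω * ((m + r : ℕ):ℝ) + β)) * (starRingEnd ℂ) (ee (A * s (ω * m + β)))
      = ee ((2 * A * sin (ω * r / 2)) * s' (ω * m + (β + ω * r / 2))) := by
    intro m
    rw [ee_sub_conj]; congr 1
    have := hs (ω * m + β) (ω * r)
    rw [← mul_sub, show ω * ((m + r : ℕ):ℝ) + β = ω * m + β + ω * r by push_cast; ring, this]
    ring
  simp only [e]
  apply H
  · have := mul_le_sin hωr0 hωr
    calc lo * (2 * ω / π) * R ≤ A * (2 * ω / π) * r := by gcongr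
      _ = 2 * A * (2 / π * (ω * r / 2)) := rz
      _ ≤ _ := by gcongr
  · have hsr : sin (ω * r / 2) ≤ ω * K / 2 := (Real.sin_le hωr0).trans (by gcongr)
    calc 2 * A * sin (ω * r / 2) ≤ 2 * A * (ω * K / 2) := by gcongr
      _ ≤ 2 * up * (ω * K / 2) := by gcongr
      _ = _ := rz
  · positivity
  · rw [Nat.cast_sub hN.le]
    nlinarith
  · omega

lemma lev_base (ω Y σ : ℝ) (hω : 0 < ω) (hY : Y ≤ π/2) (hσ : 0 < σ) (hσY : σ ≤ cos Y) (P : ℕ)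
    (lo up B : ℝ) (hlo : 0 < lo) (hup : up * ω ≤ 1/2) (hB : 2 * π / (lo * ω * σ) ≤ B) :
    levB sin ω Y P lo up B := by
  intro A β N h1 h2 h3 h4 h5
  rcases Nat.eq_zero_or_pos N with rfl | hN
  · simp; refine le_trans ?_ hB; positivity
  have hN1 : (1:ℝ) ≤ N := by exact_mod_cast hN
  have hA : 0 < A := hlo.trans_le h1
  have hω2 : ω / 2 ≤ π / 2 := by nlinarith
  have hs1 := mul_le_sin (x := ω/2) (pz) hω2
  have hs2 := Real.sin_le (x := ω/2) (pz)
  have e1 : 2 / π * (ω / 2) = ω / π := rz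
  rw [e1] at hs1
  have hd : ∀ n : ℕ, -(A * sin (ω * ((n+1:ℕ):ℝ) + β)) - -(A * sin (ω * n + β))
      = -(2 * A * sin (ω/2) * cos (ω * n + β + ω/2)) := by
    intro n
    have h := Real.sin_sub_sin (ω * ((n+1:ℕ):ℝ) + β) (ω * n + β)
    rw [show (ω * ((n+1:ℕ):ℝ) + β - (ω * n + β))/2 = ω/2 by push_cast; ring,
      show (ω * ((n+1:ℕ):ℝ) + β + (ω * n + β))/2 = ω * n + β + ω/2 by push_cast; ring] at h
    linear_combination (-A) * h
  have harg : ∀ n : ℕ, n < N → 0 ≤ ω * n + β + ω / 2 ∧ ω * n + β + ω/2 ≤ Y := by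
    intro n hn
    have : (n:ℝ) + 1 ≤ N := by exact_mod_cast hn
    constructor
    · positivity
    · nlinarith
  have hcos : ∀ n : ℕ, n < N → σ ≤ cos (ω * n + β + ω/2) := fun n hn =>
    hσY.trans (Real.cos_le_cos_of_nonneg_of_le_pi (harg n hn).1 (by linarith [pi_pos]) (harg n hn).2)
  have hn1 : ‖∑ m ∈ rg N, ee (A * sin (ω * m + β))‖
      = ‖∑ m ∈ rg N, ee (-(A * sin (ω * m + β)))‖ := by
    rw [← Complex.norm_conj, map_sum]; simp only [ee_conj]
  rw [hn1]
  set ρ := A * (ω / π) * σ with hρ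
  have hσ1 : σ ≤ 1 := hσY.trans (cos_le_one _)
  have hAs : 2 * A * sin (ω/2) ≤ 1/2 := by
    nlinarith
  have hρs : ρ ≤ A * sin (ω/2) * σ := by rw [hρ]; gcongr
  have hρ0 : 0 < ρ := pz
  have := kl (fun m : ℕ => -(A * sin (ω * m + β))) 0 N (-1) ρ hρ0 ?_ ?_ ?_
  · rw [Finset.range_eq_Ico]
    refine this.trans (le_trans ?_ hB)
    rw [hρ, div_le_div_iff₀ (pz) (pz)]
    have : A * (ω/π) * σ * π = A * ω * σ := by field_simp
    calc 2 * (lo * ω * σ) ≤ 2 * (A * ω * σ) := by gcongr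
      _ = 2 * π * (A * (ω/π) * σ) := by rw [← this]; ring
  · intro n _ hn
    rw [hd, hd]
    have := Real.cos_le_cos_of_nonneg_of_le_pi (harg n (oz)).1 (by linarith [pi_pos, (harg (n+1) hn).2])
      (show ω * n + β + ω/2 ≤ ω * ((n+1:ℕ):ℝ) + β + ω/2 by push_cast; linarith)
    nlinarith
  · intro n _ hn
    simp only [hd]
    have := cos_le_one (ω * n + β + ω/2)
    nlinarith
  · intro n _ hn
    simp only [hd]
    have h7 := hcos n hn
    nlinarith

lemma lev_all (ω Y σ : ℝ) (hω : 0 < ω) (hY : Y ≤ π/2) (hσ : 0 < σ) (hσY : σ ≤ cos Y) (P R : ℕ)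
    (hR : 1 ≤ R) (hP : R ^ 8 ≤ P) (A : ℝ) (hA : 0 < A) (hup : A * ω ^ 5 * R ^ 32 ≤ 1/2)
    (hlow : 2 * π ≤ P * A * ω * (2 * ω / π) ^ 4 * R ^ 9 * σ) :
    levB sin ω Y P A A (4 * P / Real.sqrt R) := by
  have hR0 : (1:ℝ) ≤ R := by exact_mod_cast hR
  have hRp : (0:ℝ) < R := lz
  have h1 : levB sin ω Y P (A * (2 * ω / π) * ((R^7:ℕ):ℝ) * (2 * ω / π) * ((R^6:ℕ):ℝ) * (2 * ω / π) * ((R^4:ℕ):ℝ) * (2 * ω / π) * ((1:ℕ):ℝ))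
      (A * ω * ((R^8:ℕ):ℝ) * ω * ((R^8:ℕ):ℝ) * ω * ((R^8:ℕ):ℝ) * ω * ((R^8:ℕ):ℝ)) (P / R ^ 8) := by
    apply lev_base ω Y σ hω hY hσ hσY
    · positivity
    · refine le_trans (le_of_eq ?_) hup; push_cast; ring
    · rw [div_le_div_iff₀ (pz) (pz)]
      calc 2 * π * R ^ 8 ≤ P * A * ω * (2 * ω / π) ^ 4 * R ^ 9 * σ * R ^ 8 := by gcongr
        _ = _ := by push_cast; ring
  have hRK : ∀ j, j ≤ 8 → R ^ j ≤ R ^ 8 := fun j hj => Nat.pow_le_pow_right hR hj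
  have h2 := lev_step (fun x => -cos x) sin (by
    intro x r
    have := Real.cos_sub_cos x (x + r)
    rw [show (x + (x + r))/2 = x + r/2 by ring, show (x - (x+r))/2 = -(r/2) by ring, sin_neg] at this
    linarith) ω Y hω hY P (R^8) 1 hP le_rfl (Nat.one_le_pow _ _ hR) _ _ _ (3 * P / R ^ 4) (pz) (pz) (pz)
    (by
      have : 4 * (P:ℝ) ^ 2 * (1:ℕ) / ((R ^ 8 : ℕ):ℝ) + 2 * P * (P / R ^ 8) = 6 * P ^ 2 / R ^ 8 := by push_cast; ring
      rw [this, div_pow, ← pow_mul, div_le_div_iff_of_pos_right (pz)]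
      nlinarith [sq_nonneg (P:ℝ)]) h1
  have h3 := lev_step (fun x => -sin x) (fun x => -cos x) (by
    intro x r
    have := Real.sin_sub_sin x (x + r)
    rw [show (x + (x + r))/2 = x + r/2 by ring, show (x - (x+r))/2 = -(r/2) by ring, sin_neg] at this
    linarith) ω Y hω hY P (R^8) (R^4) hP (Nat.one_le_pow _ _ hR) (hRK 4 (nz)) _ _ _ (4 * P / R ^ 2) (pz) (pz) (pz)
    (by
      have : 4 * (P:ℝ) ^ 2 * ((R ^ 4 : ℕ):ℝ) / ((R ^ 8 : ℕ):ℝ) + 2 * P * (3 * P / R ^ 4) = 10 * P ^ 2 / R ^ 4 := by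
        push_cast; field_simp; ring
      rw [this, div_pow, ← pow_mul, div_le_div_iff_of_pos_right (pz)]
      nlinarith [sq_nonneg (P:ℝ)]) h2
  have h4 := lev_step cos (fun x => -sin x) (by
    intro x r
    have := Real.cos_sub_cos x (x + r)
    rw [show (x + (x + r))/2 = x + r/2 by ring, show (x - (x+r))/2 = -(r/2) by ring, sin_neg] at this
    linarith) ω Y hω hY P (R^8) (R^6) hP (Nat.one_le_pow _ _ hR) (hRK 6 (nz)) _ _ _ (4 * P / R) (pz) (pz) (pz)
    (by
      have : 4 * (P:ℝ) ^ 2 * ((R ^ 6 : ℕ):ℝ) / ((R ^ 8 : ℕ):ℝ) + 2 * P * (4 * P / R ^ 2) = 12 * P ^ 2 / R ^ 2 := by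
        push_cast; field_simp; ring
      rw [this, div_pow, div_le_div_iff_of_pos_right (pz)]
      nlinarith [sq_nonneg (P:ℝ)]) h3
  refine lev_step sin cos (by
    intro x r
    have := Real.sin_sub_sin x (x + r)
    rw [show (x + (x + r))/2 = x + r/2 by ring, show (x - (x+r))/2 = -(r/2) by ring, sin_neg] at this
    linarith) ω Y hω hY P (R^8) (R^7) hP (Nat.one_le_pow _ _ hR) (hRK 7 (nz)) _ _ _ (4 * P / Real.sqrt R) (pz) (pz) (pz)
    (by
      have : 4 * (P:ℝ) ^ 2 * ((R ^ 7 : ℕ):ℝ) / ((R ^ 8 : ℕ):ℝ) + 2 * P * (4 * P / R) = 12 * P ^ 2 / R := by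
        push_cast; field_simp; ring
      rw [this, div_pow, sq_sqrt hRp.le, div_le_div_iff_of_pos_right hRp]
      nlinarith [sq_nonneg (P:ℝ)]) h4

noncomputable def FF (M x : ℝ) : ℝ := (1/π) * (√(M^2 - x^2) - x * arccos (x/M))

lemma FF_deriv (M x : ℝ) (h1 : -M < x) (h2 : x < M) :
    HasDerivAt (FF M) (-(arccos (x/M)/π)) x := by
  have hM : 0 < M := lz
  have hq : 0 < M^2 - x^2 := by nlinarith
  have d1 : HasDerivAt (fun x => √(M^2 - x^2)) (-(2*x) / (2 * √(M^2 - x^2))) x := by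
    have : HasDerivAt (fun x : ℝ => M^2 - x^2) (-(2*x)) x := by
      simpa using (hasDerivAt_pow 2 x).const_sub (M^2)
    exact this.sqrt hq.ne'
  have hx1 : x / M ≠ -1 := by intro h; rw [div_eq_iff hM.ne'] at h; linarith
  have hx2 : x / M ≠ 1 := by intro h; rw [div_eq_iff hM.ne'] at h; linarith
  have d2 : HasDerivAt (fun x => arccos (x/M)) (-(1 / √(1 - (x/M)^2)) * (1/M)) x :=
    HasDerivAt.comp (h₂ := arccos) x (hasDerivAt_arccos hx1 hx2) ((hasDerivAt_id x).div_const M)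
  have d3 := ((d1.sub ((hasDerivAt_id x).mul d2)).const_mul (1/π))
  have e : √(1 - (x/M)^2) = √(M^2 - x^2) / M := by
    have h0 : √(M^2 - x^2) / M = √((M^2 - x^2) / M^2) := by rw [sqrt_div hq.le, sqrt_sq hM.le]
    rw [h0]; congr 1; field_simp
  refine HasDerivAt.congr_deriv (f := FF M) d3 ?_
  rw [e]; simp only [id]; field_simp; ring

lemma FF_slope (M x y : ℝ) (h1 : -M < x) (h : x ≤ y) (h2 : y < M) :
    -(arccos (x/M)/π) * (y - x) ≤ FF M y - FF M x ∧ FF M y - FF M x ≤ -(arccos (y/M)/π) * (y - x) := by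
  rcases h.eq_or_lt with rfl | h
  · simp
  have hM : 0 < M := lz
  obtain ⟨c, hc, hc'⟩ := exists_hasDerivAt_eq_slope (FF M) (fun x => -(arccos (x/M)/π)) h
    (fun z hz => (FF_deriv M z (by linarith [hz.1]) (by linarith [hz.2])).continuousAt.continuousWithinAt)
    (fun z hz => FF_deriv M z (by linarith [hz.1]) (by linarith [hz.2]))
  rw [eq_div_iff (lz)] at hc'
  rw [← hc']
  have a1 : arccos (c/M) ≤ arccos (x/M) := arccos_le_arccos (by gcongr; exact hc.1.le)
  have a2 : arccos (y/M) ≤ arccos (c/M) := arccos_le_arccos (by gcongr; exact hc.2.le)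
  constructor
  · gcongr
  · gcongr

/-- normalized derivative -/
noncomputable def DD (M h k x : ℝ) : ℝ := k - h * arccos (x/M) / π

lemma DD_mono (M h k x y : ℝ) (hM : 0 < M) (hh : 0 ≤ h) (hxy : x ≤ y) : DD M h k x ≤ DD M h k y := by
  unfold DD
  gcongr

lemma DD_cos (M h k a : ℝ) (hM : 0 < M) (hh : 0 < h) (h1 : 0 ≤ a) (h2 : a ≤ h) :
    DD M h k (M * cos (π * a / h)) = k - a := by
  unfold DD
  rw [mul_div_cancel_left₀ _ hM.ne', arccos_cos (pz)]
  · field_simp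
  · rw [div_le_iff₀ hh]; gcongr

lemma DD_diff (M h k x y : ℝ) (hM : 0 < M) (hh : 0 < h) (hx : -M ≤ x) (hxy : x ≤ y) (hy : y ≤ M) :
    h / (π * M) * (y - x) ≤ DD M h k y - DD M h k x := by
  unfold DD
  have a1 : cos (arccos (x/M)) = x/M := cos_arccos (by rw [le_div_iff₀ hM]; linarith) (by rw [div_le_iff₀ hM]; linarith)
  have a2 : cos (arccos (y/M)) = y/M := cos_arccos (by rw [le_div_iff₀ hM]; linarith) (by rw [div_le_iff₀ hM]; linarith)
  have a3 := arccos_le_arccos (show x/M ≤ y/M by gcongr)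
  have a4 : cos (arccos (y/M)) - cos (arccos (x/M)) ≤ arccos (x/M) - arccos (y/M) := by
    have := Real.abs_cos_sub_cos_le (arccos (y/M)) (arccos (x/M))
    have h2 := (abs_le.1 this).2
    rw [abs_sub_comm, abs_of_nonneg (lz)] at h2
    exact h2
  rw [a1, a2] at a4
  have : h / (π * M) * (y - x) = h / π * (y/M - x/M) := by field_simp
  rw [this]
  have : h / π * (y/M - x/M) ≤ h / π * (arccos (x/M) - arccos (y/M)) := by gcongr
  refine this.trans (le_of_eq ?_); ring

lemma arccos_diff (M x y s : ℝ) (hM : 0 < M) (hx : 0 ≤ x) (hxy : x ≤ y) (hs : 0 < s) (hy : y ≤ M) (hsy : s ^ 2 ≤ 1 - (y/M)^2) :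
    arccos (x/M) - arccos (y/M) ≤ π / 2 * ((y - x) / (M * s)) := by
  set α := arccos (x/M) with hα
  set β := arccos (y/M) with hβ
  have b1 : 0 ≤ x/M := pz
  have b2 : 0 ≤ y/M := div_nonneg (lz) hM.le
  have a1 : cos α = x/M := cos_arccos (lz) (by rw [div_le_iff₀ hM]; linarith)
  have a2 : cos β = y/M := cos_arccos (lz) (by rw [div_le_iff₀ hM]; linarith)
  have a3 : β ≤ α := arccos_le_arccos (show x/M ≤ y/M by gcongr)
  have a4 : α ≤ π/2 := arccos_le_pi_div_two.2 (pz)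
  have a5 : 0 ≤ β := arccos_nonneg _
  have a6 : s ≤ sin β := by
    rw [hβ, sin_arccos]; exact le_sqrt_of_sq_le hsy
  have a7 := Real.cos_sub_cos β α
  have a8 : sin β ≤ sin ((β + α)/2) := Real.sin_le_sin_of_le_of_le_pi_div_two (by linarith [pi_pos]) (lz) (lz)
  have a9 := mul_le_sin (x := (α - β)/2) (lz) (lz)
  rw [show (β - α)/2 = -((α-β)/2) by ring, sin_neg] at a7
  have a10 : s * (2/π*((α-β)/2)) ≤ sin ((β+α)/2) * sin ((α-β)/2) := by
    apply mul_le_mul (a6.trans a8) a9 _ (lz)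
    positivity
  have a11 : (y - x)/M = 2 * (sin ((β+α)/2) * sin ((α-β)/2)) := by
    rw [sub_div, ← a1, ← a2, a7]; ring
  have e1 : (y-x)/(M*s) = (y-x)/M/s := by field_simp
  rw [e1, a11]
  calc α - β = π/2 * (2 * (s * (2/π*((α-β)/2))) / s) := by field_simp
    _ ≤ _ := by
      generalize s * (2/π*((α-β)/2)) = X at a10
      gcongr

lemma Ico_norm_le (f : ℕ → ℂ) (hf : ∀ n, ‖f n‖ ≤ 1) (p q : ℕ) (B : ℝ) (hB : 0 ≤ B) (h : (q:ℝ) - p ≤ B) :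
    ‖∑ n ∈ fIco p q, f n‖ ≤ B := by
  refine (norm_sum_le_of_le _ (fun n _ => hf n)).trans ?_
  simp only [sum_const, card_Ico, nsmul_eq_mul, mul_one]
  rcases le_total p q with h1 | h1
  · rw [Nat.cast_sub h1]; exact h
  simp_all

/-- phase in class k -/
noncomputable def GG (M h k x : ℝ) : ℝ := h * FF M x + k * x

lemma GG_diff (M h k x y : ℝ) (hh : 0 < h) (h1 : -M < x) (hxy : x ≤ y) (h2 : y < M) :
    DD M h k x * (y - x) ≤ GG M h k y - GG M h k x ∧ GG M h k y - GG M h k x ≤ DD M h k y * (y - x) := by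
  obtain ⟨a, b⟩ := FF_slope M x y h1 hxy h2
  have a' := mul_le_mul_of_nonneg_left a hh.le
  have b' := mul_le_mul_of_nonneg_left b hh.le
  unfold DD GG
  grind

lemma GG_step (M h k : ℝ) (n : ℕ) (hh : 0 < h) (h2 : ((n+1:ℕ):ℝ) < M) :
    DD M h k n ≤ GG M h k (n+1:ℕ) - GG M h k n ∧ GG M h k (n+1:ℕ) - GG M h k n ≤ DD M h k (n+1:ℕ) := by
  have := GG_diff M h k n (n+1:ℕ) hh (lz) (by push_cast; linarith) h2
  simpa using this

lemma class_right (M h k : ℝ) (hh : 0 < h) (p q : ℕ) (hq : (q:ℝ) < M) (ρ : ℝ) (hρ : 0 < ρ) (hρ1 : ρ ≤ 1/4)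
    (h1 : ρ ≤ DD M h k p) (h2 : DD M h k q ≤ 3/4) :
    ‖∑ n ∈ fIco p q, ee (GG M h k n)‖ ≤ 2 / ρ := by
  have hM : 0 < M := lt_of_le_of_lt (pz) hq
  have hlt : ∀ n, n < q → ((n+1:ℕ):ℝ) < M := fun n hn => lt_of_le_of_lt (by exact_mod_cast hn) hq
  refine kl (fun n => GG M h k n) p q 0 ρ hρ ?_ ?_ ?_
  · intro n h3 h4
    exact (GG_step M h k n hh (hlt n (oz))).2.trans (GG_step M h k (n+1) hh (hlt (n+1) h4)).1
  · intro n h3 h4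
    push_cast
    have := DD_mono M h k p n hM hh.le (by exact_mod_cast h3)
    have := (GG_step M h k n hh (hlt n h4)).1
    push_cast at this; linarith
  · intro n h3 h4
    push_cast
    have h5 := DD_mono M h k (n+1:ℕ) q hM hh.le (by exact_mod_cast h4)
    have := (GG_step M h k n hh (hlt n h4)).2
    push_cast at this h5; linarith

lemma class_left (M h k : ℝ) (hh : 0 < h) (p q : ℕ) (hq : (q:ℝ) < M) (ρ : ℝ) (hρ : 0 < ρ) (hρ1 : ρ ≤ 1/4)
    (h1 : -(3/4) ≤ DD M h k p) (h2 : DD M h k q ≤ -ρ) :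
    ‖∑ n ∈ fIco p q, ee (GG M h k n)‖ ≤ 2 / ρ := by
  have hM : 0 < M := lt_of_le_of_lt (pz) hq
  have hlt : ∀ n, n < q → ((n+1:ℕ):ℝ) < M := fun n hn => lt_of_le_of_lt (by exact_mod_cast hn) hq
  refine kl (fun n => GG M h k n) p q (-1) ρ hρ ?_ ?_ ?_
  · intro n h3 h4
    exact (GG_step M h k n hh (hlt n (oz))).2.trans (GG_step M h k (n+1) hh (hlt (n+1) h4)).1
  · intro n h3 h4
    push_cast
    have := DD_mono M h k p n hM hh.le (by exact_mod_cast h3)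
    have := (GG_step M h k n hh (hlt n h4)).1
    push_cast at this; linarith
  · intro n h3 h4
    push_cast
    have h5 := DD_mono M h k (n+1:ℕ) q hM hh.le (by exact_mod_cast h4)
    have := (GG_step M h k n hh (hlt n h4)).2
    push_cast at this h5; linarith

lemma ee_GG (M h : ℝ) (k n : ℕ) : ee (GG M h k n) = ee (h * FF M n) := by
  unfold GG
  rw [ee_add, show (k:ℝ) * n = ((k * n : ℤ):ℝ) by push_cast; ring, ee_int, mul_one]


lemma class_split (M h k xk δ : ℝ) (hh : 0 < h) (hx0 : -M ≤ xk) (hxM : xk ≤ M) (hxk : DD M h k xk = 0) (p q : ℕ) (hpq : p ≤ q)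
    (hq : (q:ℝ) < M) (hδ : 0 < δ) (hδ1 : h / (π * M) * δ ≤ 1/4)
    (h1 : -(3/4) ≤ DD M h k p) (h2 : DD M h k q ≤ 3/4) (q1 q2 : ℕ) (hq1 : q1 = max p (min q ⌊xk - δ⌋₊))
    (hq2 : q2 = max q1 (min q ⌈xk + δ⌉₊)) :
    (q2:ℝ) - q1 ≤ 2 * δ + 3 ∧
      ‖∑ n ∈ fIco p q, ee (GG M h k n) - ∑ n ∈ fIco q1 q2, ee (GG M h k n)‖ ≤ 4 / (h / (π * M) * δ) := by
  have hM : 0 < M := lt_of_le_of_lt (pz) hq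
  have hp1 : p ≤ q1 := hq1 ▸ le_max_left _ _
  have h12 : q1 ≤ q2 := hq2 ▸ le_max_left _ _
  have hq1q : q1 ≤ q := by rw [hq1]; exact max_le hpq (min_le_left _ _)
  have hq2q : q2 ≤ q := by rw [hq2]; exact max_le hq1q (min_le_left _ _)
  set ρ := h / (π * M) * δ with hρ
  have hρ0 : 0 < ρ := pz
  have cast_lt : ∀ n : ℕ, n ≤ q → (n:ℝ) < M := fun n hn => lt_of_le_of_lt (by exact_mod_cast hn) hq
  constructor
  · rcases h12.eq_or_lt with he | hl
    · rw [he]; simp; positivity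
    have a1 : q2 ≤ ⌈xk + δ⌉₊ := oz
    have a2 : ⌊xk - δ⌋₊ ≤ q1 := oz
    have b1 : (q2:ℝ) ≤ ⌈xk + δ⌉₊ := by exact_mod_cast a1
    have b2 : (⌊xk - δ⌋₊:ℝ) ≤ q1 := by exact_mod_cast a2
    have hpos : 0 < xk + δ := Nat.ceil_pos.1 (oz)
    have := ceil_lt_add_one hpos.le
    have := lt_floor_add_one (xk - δ)
    linarith
  have e : ∑ n ∈ fIco p q, ee (GG M h k n) - ∑ n ∈ fIco q1 q2, ee (GG M h k n)
      = ∑ n ∈ fIco p q1, ee (GG M h k n) + ∑ n ∈ fIco q2 q, ee (GG M h k n) := by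
    rw [← sum_Ico_consecutive _ hp1 hq1q, ← sum_Ico_consecutive _ h12 hq2q]; ring
  rw [e]
  have L : ‖∑ n ∈ fIco p q1, ee (GG M h k n)‖ ≤ 2 / ρ := by
    rcases hp1.eq_or_lt with he | hl
    · rw [he]; simp; positivity
    have a : q1 ≤ ⌊xk - δ⌋₊ := oz
    have b : (q1:ℝ) ≤ xk - δ := by
      have := (Nat.le_floor_iff' (show q1 ≠ 0 by omega)).1 a
      exact this
    have := DD_diff M h k q1 xk hM hh (by linarith [show (0:ℝ) ≤ q1 by positivity]) (lz) hxM
    refine class_left M h k hh p q1 (cast_lt _ hq1q) ρ hρ0 hδ1 h1 ?_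
    have : ρ ≤ h / (π * M) * (xk - q1) := by rw [hρ]; gcongr; linarith
    linarith
  have Rr : ‖∑ n ∈ fIco q2 q, ee (GG M h k n)‖ ≤ 2 / ρ := by
    rcases hq2q.eq_or_lt with he | hl
    · rw [he]; simp; positivity
    have a : ⌈xk + δ⌉₊ ≤ q2 := oz
    have b : xk + δ ≤ q2 := (Nat.ceil_le).1 a
    have := DD_diff M h k xk q2 hM hh (lz) (lz) (cast_lt _ hq2q).le
    refine class_right M h k hh q2 q hq ρ hρ0 hδ1 ?_ h2
    have : ρ ≤ h / (π * M) * (q2 - xk) := by rw [hρ]; gcongr; linarith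
    linarith
  calc _ ≤ 2 / ρ + 2 / ρ := (norm_add_le _ _).trans (add_le_add L Rr)
    _ = _ := rz

lemma class_bound (M h k xk δ : ℝ) (hh : 0 < h) (hx0 : -M ≤ xk) (hxM : xk ≤ M) (hxk : DD M h k xk = 0) (p q : ℕ) (hpq : p ≤ q)
    (hq : (q:ℝ) < M) (hδ : 0 < δ) (hδ1 : h / (π * M) * δ ≤ 1/4)
    (h1 : -(3/4) ≤ DD M h k p) (h2 : DD M h k q ≤ 3/4) :
    ‖∑ n ∈ fIco p q, ee (GG M h k n)‖ ≤ 4 / (h / (π * M) * δ) + (2 * δ + 3) := by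
  obtain ⟨a, b⟩ := class_split M h k xk δ hh hx0 hxM hxk p q hpq hq hδ hδ1 h1 h2 _ _ rfl rfl
  have := Ico_norm_le (fun n => ee (GG M h k n)) (fun n => (ee_norm _).le) _ _ _ (pz) a
  have h3 := norm_add_le_of_le b this
  rwa [sub_add_cancel] at h3

lemma ee_cont : Continuous ee := by unfold ee; fun_prop

lemma ee_hasDeriv (f : ℝ → ℝ) (f' x : ℝ) (hf : HasDerivAt f f' x) :
    HasDerivAt (fun x => ee (f x)) (ee (f x) * (2 * π * f' * I)) x := by
  unfold ee
  have h1 : HasDerivAt (fun x => ((2 * π * f x : ℝ):ℂ) * I) (((2 * π * f' : ℝ):ℂ) * I) x :=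
    ((hf.const_mul (2*π)).ofReal_comp).mul_const _
  have := h1.cexp
  push_cast at this ⊢
  exact this

lemma fresnel_tail (X Y : ℝ) (hX : 0 < X) (hXY : X ≤ Y) :
    ‖∫ s in X..Y, ee (s^2/2)‖ ≤ 1 / X := by
  have hI : ∀ a b : ℝ, IntervalIntegrable (fun s : ℝ => ee (s^2/2)) volume a b :=
    fun a b => (ee_cont.comp (fz)).intervalIntegrable _ _
  let Ψ : ℝ → ℂ := fun y => (∫ s in X..y, ee (s^2/2)) - ee (y^2/2) * (1 / (2 * π * I * y)) + ee (X^2/2) * (1 / (2 * π * I * X))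
  have hd : ∀ y, 0 < y → HasDerivAt Ψ (ee (y^2/2) * (1/(2 * π * I * y^2))) y := by
    intro y hy
    have hy' : (y:ℂ) ≠ 0 := by exact_mod_cast hy.ne'
    have h1 : HasDerivAt (fun y => ∫ s in X..y, ee (s^2/2)) (ee (y^2/2)) y :=
      intervalIntegral.integral_hasDerivAt_right (hI _ _)
        ((ee_cont.comp (fz)).stronglyMeasurableAtFilter _ _) (ee_cont.comp (fz)).continuousAt
    have h2 : HasDerivAt (fun y : ℝ => y^2/2) y y := by
      have := (hasDerivAt_pow 2 y).div_const 2
      simpa using this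
    have h3 := ee_hasDeriv _ _ _ h2
    have h4 : HasDerivAt (fun y : ℝ => (1 / (2 * π * I * y) : ℂ)) (-(1 / (2 * π * I * y^2))) y := by
      have := ((hasDerivAt_id y).ofReal_comp.const_mul (2 * π * I)).fun_inv (by simp [hy.ne', Complex.I_ne_zero])
      simp only [one_div]
      refine this.congr_deriv ?_
      simp only [id, Complex.ofReal_one]; field_simp
    have := (h1.sub (h3.mul h4)).add_const (ee (X^2/2) * (1 / (2 * π * I * X)))
    refine this.congr_deriv ?_
    field_simp; ring
  have hB : ‖Ψ Y‖ ≤ (1/(2*π)) * (1/X - 1/Y) := by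
    refine image_norm_le_of_norm_deriv_right_le_deriv_boundary' (x := Y) (f := Ψ) (f' := fun y => ee (y^2/2) * (1/(2 * π * I * y^2)))
      (a := X) (b := Y) (B := fun y => (1/(2*π)) * (1/X - 1/y)) (B' := fun y => (1/(2*π)) * (1/y^2))
      (fun y hy => (hd y (by linarith [hy.1])).continuousAt.continuousWithinAt)
      (fun y hy => (hd y (by linarith [hy.1])).hasDerivWithinAt) ?_ ?_ ?_ ?_ (right_mem_Icc.2 hXY)
    · simp [Ψ]
    · refine continuousOn_const.mul (continuousOn_const.sub (continuousOn_const.div continuousOn_id ?_))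
      intro y hy; exact (show (0:ℝ) < y by linarith [hy.1]).ne'
    · intro y hy
      have hy0 : y ≠ 0 := by linarith [hy.1]
      have := ((hasDerivAt_inv hy0).const_sub (1/X)).const_mul (1/(2*π))
      simp only [one_div, neg_neg] at this ⊢
      exact this.hasDerivWithinAt
    · intro y hy
      rw [norm_mul, ee_norm]; simp
      rw [abs_of_pos pi_pos]; exact (mul_comm _ _).le
  have hY0 : 0 < Y := lz
  have e : (∫ s in X..Y, ee (s^2/2)) = Ψ Y + ee (Y^2/2) * (1 / (2 * π * I * Y)) - ee (X^2/2) * (1 / (2 * π * I * X)) := by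
    ring
  have n1 : ∀ y : ℝ, 0 < y → ‖ee (y^2/2) * (1 / (2 * π * I * y))‖ = 1/(2*π) * (1/y) := by
    intro y hy
    rw [norm_mul, ee_norm]; simp [abs_of_pos pi_pos, abs_of_pos hy]
    field_simp
  rw [e]
  have := norm_sub_le_of_le (norm_add_le_of_le hB (n1 Y hY0).le) (n1 X hX).le
  refine this.trans ?_
  have : 1/(2*π) * (1/X - 1/Y) + 1/(2*π) * (1/Y) + 1/(2*π)*(1/X) = 1/π * (1/X) := rz
  rw [this]
  have : 1/π ≤ 1 := by rw [div_le_one pi_pos]; linarith [pi_gt_three]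
  calc 1/π * (1/X) ≤ 1 * (1/X) := by gcongr
    _ = _ := one_mul _

lemma fresnel : ∃ κ : ℂ, ∀ X : ℝ, 0 < X → ‖(∫ s in -X..X, ee (s^2/2)) - κ‖ ≤ 2 / X := by
  have hI : ∀ a b : ℝ, IntervalIntegrable (fun s : ℝ => ee (s^2/2)) volume a b :=
    fun a b => (ee_cont.comp (fz)).intervalIntegrable _ _
  have hdiff : ∀ X Y : ℝ, 0 < X → X ≤ Y → ‖(∫ s in -Y..Y, ee (s^2/2)) - ∫ s in -X..X, ee (s^2/2)‖ ≤ 2/X := by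
    intro X Y hX hXY
    have e1 : (∫ s in -Y..Y, ee (s^2/2)) = (∫ s in -Y..(-X), ee (s^2/2)) + (∫ s in -X..X, ee (s^2/2)) + ∫ s in X..Y, ee (s^2/2) := by
      rw [integral_add_adjacent_intervals (hI _ _) (hI _ _), integral_add_adjacent_intervals (hI _ _) (hI _ _)]
    have e2 : (∫ s in -Y..(-X), ee (s^2/2)) = ∫ s in X..Y, ee (s^2/2) := by
      rw [← intervalIntegral.integral_comp_neg]; simp
    rw [e1, e2]
    have := fresnel_tail X Y hX hXY
    calc _ = ‖(∫ s in X..Y, ee (s^2/2)) + ∫ s in X..Y, ee (s^2/2)‖ := by congr 1; ring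
      _ ≤ 1/X + 1/X := norm_add_le_of_le this this
      _ = _ := rz
  let u : ℕ → ℂ := fun n => ∫ s in -((n:ℝ)+1)..((n:ℝ)+1), ee (s^2/2)
  have hu : CauchySeq u := by
    refine cauchySeq_of_le_tendsto_0' (fun n : ℕ => 2 / ((n:ℝ)+1)) ?_ ?_
    · intro n m hnm
      rw [dist_comm, dist_eq_norm]
      exact hdiff _ _ (pz) (by gcongr)
    · have := (tendsto_one_div_add_atTop_nhds_zero_nat (𝕜 := ℝ)).const_mul 2
      simp only [mul_one_div, mul_zero] at this
      exact this
  obtain ⟨κ, hκ⟩ := cauchySeq_tendsto_of_complete hu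
  refine ⟨κ, fun X hX => ?_⟩
  have ht : Tendsto (fun n => ‖(∫ s in -X..X, ee (s^2/2)) - u n‖) atTop (nhds ‖(∫ s in -X..X, ee (s^2/2)) - κ‖) :=
    (tendsto_const_nhds.sub hκ).norm
  refine le_of_tendsto ht ?_
  filter_upwards [eventually_ge_atTop ⌈X⌉₊] with n hn
  rw [norm_sub_rev]
  refine hdiff X _ hX ?_
  have := Nat.ceil_le.1 hn
  linarith

lemma GG_hasDeriv (M h k x : ℝ) (h1 : -M < x) (h2 : x < M) : HasDerivAt (GG M h k) (DD M h k x) x := by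
  have := ((FF_deriv M x h1 h2).const_mul h).add ((hasDerivAt_id x).const_mul k)
  refine HasDerivAt.congr_deriv (f := GG M h k) this ?_
  unfold DD; ring

lemma cos_taylor (a b : ℝ) : |cos a - cos b + sin b * (a - b)| ≤ (a - b)^2 := by
  have := Convex.norm_image_sub_le_of_norm_hasDerivWithin_le (f := fun x => cos x + sin b * x) (f' := fun x => -sin x + sin b * 1)
    (s := uIcc b a) (x := b) (y := a) (C := |a - b|) (fun x _ => ((hasDerivAt_cos x).add ((hasDerivAt_id x).const_mul _)).hasDerivWithinAt)
    ?_ (convex_uIcc _ _) left_mem_uIcc right_mem_uIcc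
  · simp only [norm_eq_abs] at this
    rw [abs_mul_abs_self, ← sq] at this
    convert this using 2; ring
  · intro x hx
    rw [norm_eq_abs, mul_one, show -sin x + sin b = sin b - sin x by ring]
    refine (Real.abs_sin_sub_sin_le b x).trans ?_
    rw [abs_sub_comm]; exact abs_sub_left_of_mem_uIcc hx

lemma DD_taylor (M h k xk x s : ℝ) (hM : 0 < M) (hh : 0 < h) (hs : 0 < s) (hxk : DD M h k xk = 0)
    (h0 : 0 ≤ x) (h0' : 0 ≤ xk) (hx : x ≤ M) (hx' : xk ≤ M) (hsx : s^2 ≤ 1 - (x/M)^2) (hsx' : s^2 ≤ 1 - (xk/M)^2) :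
    |DD M h k x - h / (π * M * √(1 - (xk/M)^2)) * (x - xk)| ≤ h / (M^2 * s^3) * (x - xk)^2 := by
  set θ := arccos (x/M) with hθ
  set θk := arccos (xk/M) with hθk
  have b1 : 0 ≤ x/M := pz
  have b2 : 0 ≤ xk/M := pz
  have a1 : cos θ = x/M := cos_arccos (lz) (by rw [div_le_iff₀ hM]; linarith)
  have a2 : cos θk = xk/M := cos_arccos (lz) (by rw [div_le_iff₀ hM]; linarith)
  have a3 : sin θk = √(1 - (xk/M)^2) := by rw [hθk, sin_arccos]
  have a4 : s ≤ sin θk := by rw [a3]; exact le_sqrt_of_sq_le hsx'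
  have hu : |θ - θk| ≤ π/2 * (|x - xk| / (M * s)) := by
    rcases le_total x xk with h | h
    · have := arccos_diff M x xk s hM h0 h hs hx' hsx'
      rw [abs_of_nonneg (sub_nonneg.2 (arccos_le_arccos (by gcongr))), abs_sub_comm, abs_of_nonneg (lz)]; exact this
    · have := arccos_diff M xk x s hM h0' h hs hx hsx
      rw [abs_sub_comm, abs_of_nonneg (sub_nonneg.2 (arccos_le_arccos (by gcongr))), abs_of_nonneg (lz)]; exact this
  have hk : k = h * θk / π := by unfold DD at hxk; linarith
  have hsk : 0 < sin θk := lt_of_lt_of_le hs a4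
  rw [← a3]
  have e : DD M h k x - h / (π * M * sin θk) * (x - xk) = -(h / (π * sin θk)) * (cos θ - cos θk + sin θk * (θ - θk)) := by
    unfold DD; rw [← hθ, hk, a1, a2]; field_simp; ring
  rw [e, abs_mul, abs_neg, abs_of_pos (pz)]
  have hsq : (θ - θk)^2 ≤ (π/2 * (|x - xk| / (M * s)))^2 := by
    rw [← sq_abs (θ - θk)]; gcongr
  calc h / (π * sin θk) * |cos θ - cos θk + sin θk * (θ - θk)| ≤ h / (π * s) * (π/2 * (|x - xk| / (M * s)))^2 := by
        gcongr
        exact (cos_taylor _ _).trans hsq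
    _ = (π/4) * (h / (M^2 * s^3) * (x - xk)^2) := by
        rw [mul_pow, div_pow |x - xk|, sq_abs]; field_simp; ring
    _ ≤ 1 * (h / (M^2 * s^3) * (x - xk)^2) := by
        gcongr; linarith [pi_lt_four]
    _ = _ := one_mul _

lemma GG_taylor (M h k xk x s : ℝ) (hM : 0 < M) (hh : 0 < h) (hs : 0 < s) (hxk : DD M h k xk = 0)
    (h0 : 0 ≤ x) (h0' : 0 ≤ xk) (hx : x < M) (hx' : xk < M) (hsx : s^2 ≤ 1 - (x/M)^2) (hsx' : s^2 ≤ 1 - (xk/M)^2) :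
    |GG M h k x - (GG M h k xk + h / (π * M * √(1 - (xk/M)^2)) * (x - xk)^2/2)| ≤ h / (M^2 * s^3) * |x - xk|^3 := by
  set lam := h / (π * M * √(1 - (xk/M)^2))
  have hmem : ∀ y ∈ uIcc xk x, 0 ≤ y ∧ y < M ∧ s^2 ≤ 1 - (y/M)^2 := by
    intro y hy
    have hy0 : 0 ≤ y := le_trans (le_min h0' h0) hy.1
    refine ⟨hy0, lt_of_le_of_lt hy.2 (max_lt hx' hx), ?_⟩
    rcases le_total xk x with h | h
    · rw [uIcc_of_le h] at hy
      have : (y/M)^2 ≤ (x/M)^2 := by gcongr; exact hy.2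
      linarith
    · rw [uIcc_of_ge h] at hy
      have : (y/M)^2 ≤ (xk/M)^2 := by gcongr; exact hy.2
      linarith
  have := Convex.norm_image_sub_le_of_norm_hasDerivWithin_le (f := fun x => GG M h k x - lam * (x - xk)^2/2) (f' := fun x => DD M h k x - lam * (x - xk))
    (s := uIcc xk x) (x := xk) (y := x) (C := h / (M^2 * s^3) * (x - xk)^2) (fun y hy => HasDerivAt.hasDerivWithinAt ?_)
    ?_ (convex_uIcc _ _) left_mem_uIcc right_mem_uIcc
  · simp only [norm_eq_abs, sub_self] at this
    refine le_trans (le_of_eq ?_) (this.trans (le_of_eq ?_))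
    · congr 1; ring
    grind
  · obtain ⟨m1, m2, -⟩ := hmem y hy
    have d := (GG_hasDeriv M h k y (lz) m2).sub ((((hasDerivAt_id y).sub_const xk).pow 2).const_mul (lam/2))
    refine HasDerivAt.congr_of_eventuallyEq (d.congr_deriv ?_) (Filter.Eventually.of_forall fun z => ?_)
    · simp; ring
    · simp; ring
  · intro y hy
    obtain ⟨m1, m2, m3⟩ := hmem y hy
    refine (DD_taylor M h k xk y s hM hh hs hxk m1 h0' m2.le hx'.le m3 hsx').trans ?_
    have : (y - xk)^2 ≤ (x - xk)^2 := sq_le_sq.2 (abs_sub_left_of_mem_uIcc hy)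
    gcongr

lemma quad_sum (lam xk δ L : ℝ) (q1 q2 : ℕ) (hq : q1 ≤ q2) (g : ℕ → ℝ) (c : ℝ) (hl : 0 ≤ lam) 
    (h1 : xk - δ ≤ q1) (h2 : (q2:ℝ) ≤ xk + δ) (hg : ∀ n, q1 ≤ n → n < q2 → |g n - (c + lam * (n - xk)^2/2)| ≤ L) :
    ‖∑ n ∈ fIco q1 q2, ee (g n) - ee c * ∫ t in (q1 - xk)..(q2 - xk), ee (lam * t^2/2)‖ ≤ ((q2:ℝ) - q1) * (2 * π * (L + lam * δ)) := by
  have hc : Continuous (fun t : ℝ => ee (lam * t^2/2)) := ee_cont.comp (fz)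
  have e1 : ∫ t in (q1 - xk)..(q2 - xk), ee (lam * t^2/2) = ∑ n ∈ fIco q1 q2, ∫ t in ((n:ℝ) - xk)..(((n+1:ℕ):ℝ) - xk), ee (lam * t^2/2) := by
    rw [intervalIntegral.sum_integral_adjacent_intervals_Ico (a := fun n : ℕ => (n:ℝ) - xk) hq]
    intro k _
    exact hc.intervalIntegrable _ _
  rw [e1, mul_sum, ← sum_sub_distrib]
  refine (norm_sum_le_of_le _ (f := _) (n := fun _ => 2 * π * (L + lam * δ)) ?_).trans ?_
  · intro n hn
    rw [mem_fIco] at hn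
    have hn1 : (q1:ℝ) ≤ n := by exact_mod_cast hn.1
    have hn2 : (n:ℝ) + 1 ≤ q2 := by exact_mod_cast hn.2
    have e2 : ee (g n) = ∫ t in ((n:ℝ) - xk)..(((n+1:ℕ):ℝ) - xk), ee (g n) := by
      simp
    rw [e2, ← integral_const_mul, ← intervalIntegral.integral_sub (sz) ((hc.const_mul _).intervalIntegrable _ _)]
    have := intervalIntegral.norm_integral_le_of_norm_le_const (a := (n:ℝ) - xk) (b := ((n+1:ℕ):ℝ) - xk) (C := 2 * π * (L + lam * δ))
      (f := fun t => ee (g n) - ee c * ee (lam * t^2/2)) ?_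
    · refine this.trans (le_of_eq ?_)
      simp
    · intro t ht
      rw [uIoc_of_le (by push_cast; linarith)] at ht
      push_cast at ht
      rw [← ee_add]
      refine (ee_lip _ _).trans ?_
      gcongr
      have := hg n hn.1 hn.2
      have h3 : |lam * (n - xk)^2/2 - lam * t^2/2| ≤ lam * δ := by
        rw [show lam * (n - xk)^2/2 - lam * t^2/2 = lam * (((n - xk) - t) * (((n-xk) + t)/2)) by ring, abs_mul, abs_of_nonneg hl]
        gcongr
        rw [abs_mul]
        have a1 : |(n:ℝ) - xk - t| ≤ 1 := abs_le.2 ⟨by linarith [ht.2], by linarith [ht.1]⟩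
        have a2 : |((n:ℝ) - xk + t)/2| ≤ δ := abs_le.2 ⟨by linarith [ht.1], by linarith [ht.2]⟩
        calc _ ≤ 1 * δ := by gcongr
          _ = δ := one_mul _
      calc |g n - (c + lam * t^2/2)| = |(g n - (c + lam * (n - xk)^2/2)) + (lam * (n - xk)^2/2 - lam * t^2/2)| := by congr 1; ring
        _ ≤ _ := (abs_add_le _ _).trans (add_le_add this h3)
  simp_all

lemma quad_int (lam δ a b : ℝ) (κ : ℂ) (hκ : ∀ X : ℝ, 0 < X → ‖(∫ s in -X..X, ee (s^2/2)) - κ‖ ≤ 2 / X) (hl : 0 < lam) (hδ : 0 < δ)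
    (ha : |a + δ| ≤ 1) (hb : |b - δ| ≤ 1) :
    ‖(∫ t in a..b, ee (lam * t^2/2)) - κ / √lam‖ ≤ 2 + 2 / (lam * δ) := by
  have hc : Continuous (fun t : ℝ => ee (lam * t^2/2)) := ee_cont.comp (fz)
  have hI : ∀ a b : ℝ, IntervalIntegrable (fun s : ℝ => ee (lam * s^2/2)) volume a b :=
    fun a b => hc.intervalIntegrable _ _
  have hsl : 0 < √lam := sqrt_pos.2 hl
  have hss : √lam ^ 2 = lam := sq_sqrt hl.le
  have e1 : (∫ t in -δ..δ, ee (lam * t^2/2)) = (1 / √lam : ℝ) • ∫ s in -(√lam * δ)..(√lam * δ), ee (s^2/2) := by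
    have := intervalIntegral.integral_comp_mul_left (a := -δ) (b := δ) (fun s => ee (s^2/2)) hsl.ne'
    rw [one_div, show -(√lam * δ) = √lam * -δ by ring, ← this]
    congr 1; ext t; rw [mul_pow, hss]
  have e2 : (∫ t in a..b, ee (lam * t^2/2)) = (∫ t in a..(-δ), ee (lam * t^2/2)) + (∫ t in -δ..δ, ee (lam * t^2/2)) + ∫ t in δ..b, ee (lam * t^2/2) := by
    rw [integral_add_adjacent_intervals (hI _ _) (hI _ _), integral_add_adjacent_intervals (hI _ _) (hI _ _)]
  have n1 : ∀ u v : ℝ, ‖∫ t in u..v, ee (lam * t^2/2)‖ ≤ 1 * |v - u| := fun u v =>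
    intervalIntegral.norm_integral_le_of_norm_le_const (fun t _ => (ee_norm _).le)
  have n2 := n1 a (-δ)
  have n3 := n1 δ b
  rw [show -δ - a = -(a + δ) by ring, abs_neg] at n2
  have n4 : ‖(∫ t in -δ..δ, ee (lam * t^2/2)) - κ / √lam‖ ≤ 2 / (lam * δ) := by
    have : (∫ t in -δ..δ, ee (lam * t^2/2)) - κ / √lam = (1 / √lam : ℝ) • ((∫ s in -(√lam * δ)..(√lam * δ), ee (s^2/2)) - κ) := by
      rw [e1, smul_sub]; congr 1; rw [Complex.real_smul]; push_cast; ring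
    rw [this, norm_smul, Real.norm_of_nonneg (pz)]
    have h5 := hκ (√lam * δ) (pz)
    calc 1 / √lam * _ ≤ 1 / √lam * (2 / (√lam * δ)) := by gcongr
      _ = 2 / (√lam^2 * δ) := by field_simp
      _ = _ := by rw [hss]
  rw [e2]
  calc _ = ‖(∫ t in a..(-δ), ee (lam * t^2/2)) + ((∫ t in -δ..δ, ee (lam * t^2/2)) - κ / √lam) + ∫ t in δ..b, ee (lam * t^2/2)‖ := by congr 1; ring
    _ ≤ 1 * |a + δ| + 2 / (lam * δ) + 1 * |b - δ| := norm_add_le_of_le (norm_add_le_of_le n2 n4) n3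
    _ ≤ _ := lz

/-- full class asymptotics -/
lemma class_full (κ : ℂ) (hκ : ∀ X : ℝ, 0 < X → ‖(∫ s in -X..X, ee (s^2/2)) - κ‖ ≤ 2 / X)
    (M h k xk δ s : ℝ) (hh : 0 < h) (hxk : DD M h k xk = 0) (p q : ℕ)
    (hq : (q:ℝ) < M) (hδ : 1 ≤ δ) (hδ1 : h / (π * M) * δ ≤ 1/4) (hs : 0 < s) (hsq : s^2 ≤ 1 - (q/M)^2)
    (h1 : -(3/4) ≤ DD M h k p) (h2 : DD M h k q ≤ 3/4) (hp : p ≤ xk - δ - 1) (hq' : xk + δ + 1 ≤ q) :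
    ‖∑ n ∈ fIco p q, ee (GG M h k n) - ee (GG M h k xk) * (κ / √(h / (π * M * √(1 - (xk/M)^2))))‖ ≤
      300 * (M / (h * δ) + 1 + h * δ^4 / (M^2 * s^3) + h * δ^2 / (M * s)) := by
  have hM : 0 < M := lt_of_le_of_lt (pz) hq
  have hp0 : (0:ℝ) ≤ p := pz
  set lam := h / (π * M * √(1 - (xk/M)^2)) with hlam
  have hxk0 : 0 ≤ xk := lz
  have hxkM : xk < M := lz
  have hmon : ∀ y : ℝ, 0 ≤ y → y ≤ q → s^2 ≤ 1 - (y/M)^2 := by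
    intro y hy hy'
    have : (y/M)^2 ≤ ((q:ℝ)/M)^2 := by gcongr
    linarith
  have hsk : s ≤ √(1 - (xk/M)^2) := le_sqrt_of_sq_le (hmon xk hxk0 (lz))
  have hsk1 : √(1 - (xk/M)^2) ≤ 1 := Real.sqrt_le_one.2 (by linarith [sq_nonneg (xk/M)])
  have hsk0 : 0 < √(1 - (xk/M)^2) := lt_of_lt_of_le hs hsk
  have hlam0 : 0 < lam := pz
  have hMs : 0 < M * √(1 - (xk/M)^2) := pz
  have hlam1 : lam ≤ h / (M * s) := by
    have : M * s ≤ π * M * √(1 - (xk/M)^2) := by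
      have : M * s ≤ M * √(1 - (xk/M)^2) := by gcongr
      nlinarith [pi_gt_three]
    rw [hlam]; exact div_le_div_of_nonneg_left hh.le (pz) this
  have hlam2 : 1 / (lam * δ) ≤ 4 * (M / (h * δ)) := by
    have e : 1 / (lam * δ) = π * M * √(1 - (xk/M)^2) / (h * δ) := by rw [hlam]; field_simp
    have : π * M * √(1 - (xk/M)^2) ≤ 4 * M := by
      have : π * M * √(1 - (xk/M)^2) ≤ π * M * 1 := by gcongr
      nlinarith [pi_lt_four]
    rw [e, ← mul_div_assoc]
    exact div_le_div_of_nonneg_right this (pz)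
  have hpq : p ≤ q := by exact_mod_cast (show (p:ℝ) ≤ q by linarith)
  have f1 : p ≤ ⌊xk - δ⌋₊ := Nat.le_floor (lz)
  have f2 : ⌈xk + δ⌉₊ ≤ q := Nat.ceil_le.2 (lz)
  have f3 := Nat.floor_le (show 0 ≤ xk - δ by linarith)
  have f4 := lt_floor_add_one (xk - δ)
  have f5 := le_ceil (xk + δ)
  have f6 := ceil_lt_add_one (show 0 ≤ xk + δ by linarith)
  have f7 : ⌊xk - δ⌋₊ ≤ ⌈xk + δ⌉₊ := by exact_mod_cast (show (⌊xk - δ⌋₊:ℝ) ≤ ⌈xk + δ⌉₊ by linarith)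
  have hs1 := (class_split M h k xk δ hh (lz) hxkM.le hxk p q hpq hq (lz) hδ1 h1 h2 ⌊xk - δ⌋₊ ⌈xk + δ⌉₊ (oz) (oz)).2
  have f8 : (⌈xk + δ⌉₊:ℝ) ≤ q := by exact_mod_cast f2
  generalize ⌊xk - δ⌋₊ = q1 at *
  generalize ⌈xk + δ⌉₊ = q2 at *
  have hs2 := quad_sum lam xk (δ+1) (h / (M^2 * s^3) * (δ+1)^3) q1 q2 f7 (fun n => GG M h k n) (GG M h k xk) hlam0.le
    (lz) (lz) (by
      intro n hn1 hn2
      have g1 : (q1:ℝ) ≤ n := by exact_mod_cast hn1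
      have g2 : (n:ℝ) < q2 := by exact_mod_cast hn2
      have g3 : (n:ℝ) ≤ q := lz
      refine (GG_taylor M h k xk n s hM hh hs hxk (pz) hxk0 (lz) hxkM (hmon n (pz) g3) (hmon xk hxk0 (lz))).trans ?_
      gcongr
      rw [abs_le]; constructor <;> linarith)
  have hs3 := quad_int lam δ (q1 - xk) (q2 - xk) κ hκ hlam0 (lz) (by rw [abs_le]; constructor <;> linarith) (by rw [abs_le]; constructor <;> linarith)
  have hs4 : ‖ee (GG M h k xk) * (∫ t in (q1 - xk)..(q2 - xk), ee (lam * t^2/2)) - ee (GG M h k xk) * (κ / √lam)‖ ≤ 2 + 2 / (lam * δ) := by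
    rw [← mul_sub, norm_mul, ee_norm, one_mul]; exact hs3
  have tot := norm_add_le_of_le (norm_add_le_of_le hs1 hs2) hs4
  rw [sub_add_sub_cancel, sub_add_sub_cancel] at tot
  refine tot.trans ?_
  have t1 : 4 / (h / (π * M) * δ) ≤ 16 * (M / (h * δ)) := by
    have : 4 / (h / (π * M) * δ) = 4 * π * (M / (h * δ)) := by field_simp
    rw [this]; gcongr; linarith [pi_lt_four]
  have t2 : 2 / (lam * δ) ≤ 8 * (M / (h * δ)) := by
    rw [show 2 / (lam * δ) = 2 * (1 / (lam * δ)) by ring]; linarith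
  have t3 : ((q2:ℝ) - q1) * (2 * π * (h / (M^2 * s^3) * (δ+1)^3 + lam * (δ+1))) ≤ 4 * δ * (2 * 3.5 * (h / (M^2 * s^3) * (2*δ)^3 + h / (M * s) * (2 * δ))) := by
    gcongr
    · linarith
    · linarith [pi_lt_d2]
    · linarith
    · linarith
  have t4 : 4 * δ * (2 * 3.5 * (h / (M^2 * s^3) * (2*δ)^3 + h / (M * s) * (2 * δ))) = 224 * (h * δ^4 / (M^2 * s^3)) + 56 * (h * δ^2 / (M * s)) := by
    field_simp; ring
  have p1 : 0 ≤ M / (h * δ) := pz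
  have p2 : 0 ≤ h * δ^4 / (M^2 * s^3) := pz
  have p3 : 0 ≤ h * δ^2 / (M * s) := pz
  linarith

noncomputable def dd (b : ℕ) (M : ℝ) (h : ℕ) (j : ℕ) : ℕ :=
  if j = 0 then b else min b ⌈M * cos (π * ((j:ℝ) - 1/2) / h)⌉₊

/-- class sum -/
noncomputable def cls (b : ℕ) (M : ℝ) (h k : ℕ) : ℂ := ∑ n ∈ fIco (dd b M h (k+1)) (dd b M h k), ee (h * FF M n)

lemma dd_le (b : ℕ) (M : ℝ) (h j : ℕ) : dd b M h j ≤ b := by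
  unfold dd; split_ifs
  · exact le_rfl
  · exact min_le_left _ _

lemma dd_anti (b : ℕ) (M : ℝ) (hM : 0 < M) (h j : ℕ) (hj : j ≤ h / 2) (h0 : 1 ≤ h) : dd b M h (j+1) ≤ dd b M h j := by
  rcases Nat.eq_zero_or_pos j with rfl | hj0
  · simp [dd]
  have hh : (0:ℝ) < h := by exact_mod_cast h0
  have hj1 : (1:ℝ) ≤ j := by exact_mod_cast hj0
  have hj2 : (j:ℝ) + 1/2 ≤ h := by
    have : (2 * j : ℝ) ≤ h := by exact_mod_cast (show 2 * j ≤ h by omega)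
    have : (1:ℝ) ≤ h := by exact_mod_cast h0
    linarith
  unfold dd
  rw [if_neg (oz), if_neg (oz)]
  apply min_le_min le_rfl
  apply Nat.ceil_le_ceil
  push_cast
  have : cos (π * ((j:ℝ) + 1 - 1/2) / h) ≤ cos (π * ((j:ℝ) - 1/2) / h) := by
    apply cos_le_cos_of_nonneg_of_le_pi
    · have : 0 ≤ (j:ℝ) - 1/2 := lz
      positivity
    · rw [div_le_iff₀ hh]; gcongr; linarith
    · gcongr; linarith
  gcongr

lemma dd_last (b : ℕ) (M : ℝ) (hM : 0 < M) (h : ℕ) (h0 : 1 ≤ h) : dd b M h (h/2+1) = 0 := by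
  have hh : (0:ℝ) < h := by exact_mod_cast h0
  have a1 : (h:ℝ) ≤ 2 * (h/2:ℕ) + 1 := by exact_mod_cast (show h ≤ 2 * (h/2) + 1 by omega)
  have a2 : 2 * ((h/2:ℕ):ℝ) ≤ h := by exact_mod_cast (show 2 * (h/2) ≤ h by omega)
  have a3 : (1:ℝ) ≤ h := by exact_mod_cast h0
  unfold dd
  rw [if_neg (oz)]
  have : ⌈M * cos (π * (((h/2+1:ℕ):ℝ) - 1/2) / h)⌉₊ = 0 := by
    rw [Nat.ceil_eq_zero]
    apply mul_nonpos_of_nonneg_of_nonpos hM.le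
    apply cos_nonpos_of_pi_div_two_le_of_le
    · rw [le_div_iff₀ hh]; push_cast; nlinarith [pi_pos]
    · rw [div_le_iff₀ hh]; push_cast; nlinarith [pi_pos]
  rw [this]; simp

lemma sum_cls (b : ℕ) (M : ℝ) (hM : 0 < M) (h : ℕ) (h0 : 1 ≤ h) :
    ∑ n ∈ rg b, ee (h * FF M n) = ∑ k ∈ rg (h/2+1), cls b M h k := by
  have : ∀ j, j ≤ h/2+1 → ∑ k ∈ rg j, cls b M h k = ∑ n ∈ fIco (dd b M h j) b, ee (h * FF M n) := by
    intro j
    induction j with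
    | zero => intro _; simp [dd]
    | succ j ih =>
      intro hj
      rw [sum_range_succ, ih (oz), cls, add_comm, sum_Ico_consecutive _ (dd_anti b M hM h j (oz) h0) (dd_le _ _ _ _)]
  rw [this _ le_rfl, dd_last b M hM h h0, Finset.range_eq_Ico]

lemma cls_ends (b : ℕ) (M s : ℝ) (hb : (b:ℝ) < M) (h k : ℕ) (h0 : 1 ≤ h) (hk : k ≤ h/2) (hs : 0 < s) (hsb : s^2 ≤ 1 - (b/M)^2)
    (hMs : h / (M * s) ≤ 1/2) (hlt : dd b M h (k+1) < dd b M h k) :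
    -(3/4) ≤ DD M h k (dd b M h (k+1)) ∧ DD M h k (dd b M h k) ≤ 3/4 := by
  have hh : (0:ℝ) < h := by exact_mod_cast h0
  have hM : 0 < M := lt_of_le_of_lt (pz) hb
  have hk2 : (2 * k : ℝ) ≤ h := by exact_mod_cast (show 2 * k ≤ h by omega)
  have h1' : (1:ℝ) ≤ h := by exact_mod_cast h0
  constructor
  · have h1 : ⌈M * cos (π * ((k:ℝ) + 1/2) / h)⌉₊ ≤ dd b M h (k+1) := by
      have hle := dd_le b M h k
      have e : dd b M h (k+1) = min b ⌈M * cos (π * ((k:ℝ) + 1/2) / h)⌉₊ := by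
        unfold dd; rw [if_neg (oz)]; push_cast; ring_nf
      omega
    have h2 : M * cos (π * ((k:ℝ) + 1/2) / h) ≤ dd b M h (k+1) := Nat.ceil_le.1 h1
    have h3 := DD_mono M h k _ _ hM hh.le h2
    rw [DD_cos M h k _ hM hh (pz) (lz)] at h3
    linarith
  · rcases Nat.eq_zero_or_pos k with rfl | hk0
    · have : DD M h (0:ℕ) (dd b M h 0) ≤ 0 := by
        unfold DD
        have := arccos_nonneg ((dd b M h 0:ℝ)/M)
        have : 0 ≤ h * arccos ((dd b M h 0:ℝ)/M) / π := pz
        simpa using this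
      exact this.trans (nz)
    have hk1 : (1:ℝ) ≤ k := by exact_mod_cast hk0
    have e : dd b M h k = min b ⌈M * cos (π * ((k:ℝ) - 1/2) / h)⌉₊ := by
      unfold dd; rw [if_neg (oz)]
    obtain ⟨m, hm⟩ : ∃ m, dd b M h k = m + 1 := Nat.exists_eq_succ_of_ne_zero (oz)
    have h1 : m < ⌈M * cos (π * ((k:ℝ) - 1/2) / h)⌉₊ := oz
    have h2 := Nat.lt_ceil.1 h1
    have h3 := DD_mono M h k _ _ hM hh.le h2.le
    rw [DD_cos M h k _ hM hh (lz) (lz)] at h3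
    rw [hm]
    have hmb : ((m+1:ℕ):ℝ) ≤ b := by exact_mod_cast hm ▸ dd_le b M h k
    have h4 := arccos_diff M m (m+1:ℕ) s hM (pz) (by push_cast; linarith) hs (lz) (by
      have : (((m+1:ℕ):ℝ)/M)^2 ≤ ((b:ℝ)/M)^2 := by gcongr
      linarith)
    have h5 : DD M h k (m+1:ℕ) - DD M h k m = h / π * (arccos ((m:ℝ)/M) - arccos (((m+1:ℕ):ℝ)/M)) := by
      unfold DD; field_simp; ring
    have h6 : h / π * (arccos ((m:ℝ)/M) - arccos (((m+1:ℕ):ℝ)/M)) ≤ h / π * (π/2 * (1/(M*s))) := by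
      refine mul_le_mul_of_nonneg_left (h4.trans (le_of_eq ?_)) (pz)
      push_cast; ring
    have h7 : h / π * (π/2 * (1/(M*s))) = h / (M * s) / 2 := by field_simp
    linarith

lemma cls_triv (b : ℕ) (M s : ℝ) (hb : (b:ℝ) < M) (h k : ℕ) (h0 : 1 ≤ h) (hk : k ≤ h/2) (hs : 0 < s) (hsb : s^2 ≤ 1 - (b/M)^2)
    (hMs : h / (M * s) ≤ 1/2) (hMh : 9 * (h:ℝ) ≤ M) : ‖cls b M h k‖ ≤ 21 * √(M / h) := by
  have hh : (0:ℝ) < h := by exact_mod_cast h0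
  have hM : 0 < M := lt_of_le_of_lt (pz) hb
  rcases le_or_gt (dd b M h k) (dd b M h (k+1)) with hle | hlt
  · rw [cls, Finset.Ico_eq_empty_of_le hle]; simp only [Finset.sum_empty, norm_zero]; positivity
  have hk2 : (2 * k : ℝ) ≤ h := by exact_mod_cast (show 2 * k ≤ h by omega)
  obtain ⟨e1, e2⟩ := cls_ends b M s hb h k h0 hk hs hsb hMs hlt
  have hδ0 : 0 < √(M/h) := sqrt_pos.2 (pz)
  have hδ3 : 3 ≤ √(M/h) := by
    apply le_sqrt_of_sq_le; rw [le_div_iff₀ hh]; linarith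
  have hδδ : √(M/h) * √(M/h) = M/h := mul_self_sqrt (pz)
  have c1 := cos_le_one (π * k / h)
  have c2 := Real.neg_one_le_cos (π * k / h)
  have := class_bound M h k (M * cos (π * k / h)) (√(M/h)) hh (by nlinarith) (by nlinarith)
    (by rw [DD_cos M h k _ hM hh (pz) (lz)]; ring) _ _ hlt.le
    (lt_of_le_of_lt (by exact_mod_cast dd_le _ _ _ _) hb) hδ0 ?_ e1 e2
  · simp only [ee_GG] at this
    refine this.trans ?_
    have : 4 / (h / (π * M) * √(M/h)) = 4 * π * √(M/h) := by
      rw [div_eq_iff (pz)]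
      have : 4 * π * √(M/h) * (h / (π * M) * √(M/h)) = 4 * π * (h / (π * M)) * (√(M/h) * √(M/h)) := rz
      rw [this, hδδ]; field_simp
    rw [this]
    nlinarith [pi_lt_four]
  · have : h / (π * M) * √(M/h) * √(M/h) = 1/π := by rw [mul_assoc, hδδ]; field_simp
    have h4 : h / (π * M) * √(M/h) = 1/π / √(M/h) := by rw [eq_div_iff hδ0.ne', this]
    rw [h4, div_div, div_le_div_iff₀ (pz) (nz)]
    nlinarith [pi_gt_three]

lemma S_triv (b : ℕ) (M s : ℝ) (hb : (b:ℝ) < M) (h : ℕ) (h0 : 1 ≤ h) (hs : 0 < s) (hsb : s^2 ≤ 1 - (b/M)^2)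
    (hMs : h / (M * s) ≤ 1/2) (hMh : 9 * (h:ℝ) ≤ M) : ‖∑ n ∈ rg b, ee (h * FF M n)‖ ≤ 42 * √M * √h := by
  have hh : (1:ℝ) ≤ h := by exact_mod_cast h0
  have hM : 0 < M := lt_of_le_of_lt (pz) hb
  rw [sum_cls b M hM h h0]
  refine (norm_sum_le_of_le _ (fun k hk => cls_triv b M s hb h k h0 (by rw [mem_rg] at hk; omega) hs hsb hMs hMh)).trans ?_
  rw [sum_const, card_range, nsmul_eq_mul, sqrt_div hM.le]
  have a2 : ((h/2+1:ℕ):ℝ) ≤ 2 * h := by exact_mod_cast (show h/2+1 ≤ 2 * h by omega)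
  calc ((h/2+1:ℕ):ℝ) * (21 * (√M / √h)) ≤ (2 * h) * (21 * (√M / √h)) := by gcongr
    _ = 42 * √M * (h / √h) := rz
    _ = _ := by rw [Real.div_sqrt]

lemma abel_mono (c : ℕ → ℝ) (e : ℕ → ℂ) (p : ℕ) (T : ℝ) (q : ℕ) (hpq : p ≤ q)
    (hc : ∀ i, p ≤ i → i < q → c i ≤ c (i+1)) (hc0 : 0 ≤ c p)
    (hT : ∀ j, p ≤ j → j ≤ q → ‖∑ k ∈ fIco p j, e k‖ ≤ T) :
    ‖∑ k ∈ fIco p q, (c k : ℂ) * e k‖ ≤ 2 * c q * T := by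
  have key : ∀ j, p ≤ j → j ≤ q → c p ≤ c j ∧ ‖∑ k ∈ fIco p j, ((c k - c j : ℝ) : ℂ) * e k‖ ≤ (c j - c p) * T := by
    intro j hj
    induction j, hj using Nat.le_induction with
    | base => intro _; simp
    | succ j hj ih =>
      intro hjq
      obtain ⟨i1, i2⟩ := ih (oz)
      have hcj := hc j hj (oz)
      refine ⟨i1.trans hcj, ?_⟩
      have e1 : ∑ k ∈ fIco p (j+1), ((c k - c (j+1) : ℝ) : ℂ) * e k =
          ∑ k ∈ fIco p j, ((c k - c j : ℝ) : ℂ) * e k + ((c j - c (j+1) : ℝ) : ℂ) * ∑ k ∈ fIco p (j+1), e k := by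
        rw [Finset.sum_Ico_succ_top hj, Finset.sum_Ico_succ_top hj, mul_add, mul_sum, ← add_assoc, ← sum_add_distrib]
        congr 1
        refine sum_congr rfl fun k _ => ?_
        push_cast; ring
      rw [e1]
      have h3 : ‖((c j - c (j+1) : ℝ) : ℂ) * ∑ k ∈ fIco p (j+1), e k‖ ≤ (c (j+1) - c j) * T := by
        rw [norm_mul, norm_real, norm_eq_abs, abs_sub_comm, abs_of_nonneg (lz)]
        exact mul_le_mul_of_nonneg_left (hT _ (oz) hjq) (lz)
      refine (norm_add_le_of_le i2 h3).trans (le_of_eq (rz))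
  obtain ⟨k1, k2⟩ := key q hpq le_rfl
  have hTq := hT q hpq le_rfl
  have hT0 : 0 ≤ T := (norm_nonneg _).trans hTq
  have e2 : ∑ k ∈ fIco p q, (c k : ℂ) * e k = ∑ k ∈ fIco p q, ((c k - c q : ℝ) : ℂ) * e k + (c q : ℂ) * ∑ k ∈ fIco p q, e k := by
    rw [mul_sum, ← sum_add_distrib]
    refine sum_congr rfl fun k _ => ?_
    push_cast; ring
  rw [e2]
  have h4 : ‖(c q : ℂ) * ∑ k ∈ fIco p q, e k‖ ≤ c q * T := by
    rw [norm_mul, norm_real, norm_eq_abs, abs_of_nonneg (lz)]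
    exact mul_le_mul_of_nonneg_left hTq (lz)
  refine (norm_add_le_of_le k2 h4).trans ?_
  nlinarith [mul_nonneg hc0 hT0]

lemma T_bound (M σ : ℝ) (hM : 0 < M) (hσ : 0 < σ) (hσ1 : σ ≤ 1) (h R : ℕ) (h0 : 1 ≤ h) (hR : 1 ≤ R) (hRh : R^8 ≤ h)
    (h1 : π^4 * M * R^32 / h^4 ≤ 1/2) (h2 : 2 * π * h^3 ≤ 16 * M * R^9 * σ) (p j : ℕ) (hpj : p ≤ j) (hj : j ≤ h/2) :
    ‖∑ k ∈ fIco p j, ee (h * M / π * sin (π * k / h))‖ ≤ 4 * h / √R + h * σ / 2 + 1 := by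
  have hlev := lev_all (π/h) (π/2*(1-σ)) σ (pz) (by nlinarith [pi_pos]) hσ
    (by
      have : π/2*(1-σ) = π/2 - π * σ/2 := rz
      rw [this, cos_pi_div_two_sub]
      have := mul_le_sin (x := π * σ/2) (pz) (by nlinarith [pi_pos])
      have e : 2 / π * (π * σ/2) = σ := by field_simp
      linarith) h R hR hRh (h*M/π) (pz)
    (by
      have : h*M/π * (π/h)^5 * R^32 = π^4 * M * R^32 / h^4 := by field_simp
      rw [this]; exact h1)
    (by
      have : h * (h*M/π) * (π/h) * (2*(π/h)/π)^4 * R^9 * σ = 16 * M * R^9 * σ / h^3 := by field_simp; norm_num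
      rw [this, le_div_iff₀ (pz)]; exact h2)
  set Y := π/2*(1-σ) with hY
  have hY0 : 0 ≤ Y := by
    positivity
  set j' := min j ⌊Y/(π/h)⌋₊ with hj'
  have hYe : Y/(π/h) = h/2 - h*σ/2 := by rw [hY]; field_simp
  have hfl : (⌊Y/(π/h)⌋₊:ℝ) ≤ Y/(π/h) := Nat.floor_le (pz)
  have hfl2 := lt_floor_add_one (Y/(π/h))
  have hjh : (j:ℝ) ≤ h/2 := by
    have : (2 * j:ℝ) ≤ h := by exact_mod_cast (show 2 * j ≤ h by omega)
    linarith
  have hjj : (j:ℝ) - j' ≤ h*σ/2 + 1 := by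
    rcases le_total j ⌊Y/(π/h)⌋₊ with hc | hc
    · rw [hj', min_eq_left hc]; simp; positivity
    · rw [hj', min_eq_right hc]; linarith
  have hj'j : j' ≤ j := min_le_left _ _
  have hj'Y : π/h * j' ≤ Y := by
    have : (j':ℝ) ≤ Y/(π/h) := le_trans (by exact_mod_cast min_le_right _ _) hfl
    rw [le_div_iff₀ (pz)] at this; linarith
  have hpos : 0 ≤ 4 * h / √(R:ℝ) := pz
  rcases le_total j' p with hc | hc
  · have := norm_sum_le_of_le (fIco p j) (f := fun k : ℕ => ee (h * M / π * sin (π * k / h))) (n := fun _ => 1) (fun k _ => (ee_norm _).le)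
    simp only [sum_const, card_Ico, nsmul_eq_mul, mul_one] at this
    have h4 : ((j - p : ℕ):ℝ) ≤ (j:ℝ) - j' := by
      rw [Nat.cast_sub hpj]
      have : (j':ℝ) ≤ p := by exact_mod_cast hc
      linarith
    linarith
  · rw [← sum_Ico_consecutive _ hc hj'j]
    have b1 := hlev (h*M/π) (π/h*p) (j'-p) le_rfl le_rfl (pz) (by
      rw [Nat.cast_sub hc]
      linarith) (oz)
    have b2 := norm_sum_le_of_le (fIco j' j) (f := fun k : ℕ => ee (h * M / π * sin (π * k / h))) (n := fun _ => 1) (fun k _ => (ee_norm _).le)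
    simp only [sum_const, card_Ico, nsmul_eq_mul, mul_one] at b2
    rw [Nat.cast_sub hj'j] at b2
    have b3 : ∑ k ∈ fIco p j', ee (h * M / π * sin (π * k / h)) = ∑ m ∈ rg (j'-p), ee (h*M/π * sin (π/h * m + π/h * p)) := by
      rw [sum_Ico_eq_sum_range]
      refine sum_congr rfl fun m _ => ?_
      congr 3; push_cast; ring
    rw [← b3] at b1
    exact (norm_add_le_of_le b1 b2).trans (lz)

lemma cos_gap (a b s : ℝ) (ha : 0 ≤ a) (hab : a ≤ b) (hb : b ≤ π/2) (hs : s ≤ sin a) (hs0 : 0 ≤ s) : 2/π * s * (b - a) ≤ cos a - cos b := by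
  rw [cos_sub_cos]
  have e : (a - b)/2 = -((b-a)/2) := rz
  rw [e, sin_neg]
  have h1 := mul_le_sin (x := (b-a)/2) (lz) (lz)
  have h2 : sin a ≤ sin ((a+b)/2) := sin_le_sin_of_le_of_le_pi_div_two (by linarith [pi_pos]) (lz) (lz)
  have h3 : s * (2/π * ((b-a)/2)) ≤ sin ((a+b)/2) * sin ((b-a)/2) := by
    apply mul_le_mul (hs.trans h2) h1
    · positivity
    · linarith
  nlinarith

lemma GG_cos (M h k β : ℝ) (hM : 0 < M) (h0 : 0 ≤ β) (h1 : β ≤ π/2) (hk : k = h * β / π) :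
    GG M h k (M * cos β) = h * M / π * sin β := by
  unfold GG FF
  rw [mul_div_cancel_left₀ _ hM.ne', arccos_cos h0 (by linarith [pi_pos])]
  have hs := sin_nonneg_of_nonneg_of_le_pi h0 (by linarith [pi_pos])
  have : M^2 - (M * cos β)^2 = (M * sin β)^2 := by
    linear_combination (-M^2) * (sin_sq_add_cos_sq β)
  rw [this, sqrt_sq (pz), hk]
  ring

lemma cls_good (κ : ℂ) (hκ : ∀ X : ℝ, 0 < X → ‖(∫ s in -X..X, ee (s^2/2)) - κ‖ ≤ 2 / X) (b : ℕ) (M s δ : ℝ) (hb : (b:ℝ) < M) (h k : ℕ) (h0 : 1 ≤ h)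
    (hk1 : 1 ≤ k) (hk : k < h/2) (hs : 0 < s) (hsb : s^2 ≤ 1 - (b/M)^2) (hδ : 1 ≤ δ)
    (hMs : h / (M * s) ≤ 1/2) (hδM : δ + 2 ≤ M * s / h) (hδ1 : h / (π * M) * δ ≤ 1/4)
    (hkb : M * cos (π * ((k:ℝ) - 1/2) / h) ≤ b) :
    ‖cls b M h k - κ * √(π * M / h) * (((√(sin (π * k / h)) : ℝ) : ℂ) * ee (h * M / π * sin (π * k / h)))‖ ≤
      300 * (M / (h * δ) + 1 + h * δ^4 / (M^2 * s^3) + h * δ^2 / (M * s)) := by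
  have hh : (0:ℝ) < h := by exact_mod_cast h0
  have hM : 0 < M := lt_of_le_of_lt (pz) hb
  have hkr : (1:ℝ) ≤ k := by exact_mod_cast hk1
  have hk2 : (2 * k + 2 : ℝ) ≤ h := by exact_mod_cast (show 2 * k + 2 ≤ h by omega)
  set α := π * ((k:ℝ) - 1/2) / h with hα
  set β := π * (k:ℝ) / h with hβ
  set γ := π * ((k:ℝ) + 1/2) / h with hγ
  have hα0 : 0 ≤ α := by
    have : 0 ≤ (k:ℝ) - 1/2 := lz
    positivity
  have hαβ : β - α = π / (2 * h) := rz
  have hβγ : γ - β = π / (2 * h) := rz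
  have hp2 : 0 < π / (2 * h) := pz
  have hγ2 : γ ≤ π/2 := by
    rw [hγ, div_le_iff₀ hh]; nlinarith [pi_pos]
  have hcα : 0 ≤ cos α := cos_nonneg_of_neg_pi_div_two_le_of_le (lz) (lz)
  have hsα : s ≤ sin α := by
    apply abs_le_of_sq_le_sq' _ (sin_nonneg_of_nonneg_of_le_pi hα0 (by linarith [pi_pos])) |>.2
    have : cos α ≤ b/M := by rw [le_div_iff₀ hM]; linarith
    nlinarith [sin_sq_add_cos_sq α]
  have hsβ : s ≤ sin β := hsα.trans (sin_le_sin_of_le_of_le_pi_div_two (lz) (lz) (lz))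
  have g1 := cos_gap α β s hα0 (lz) (lz) hsα hs.le
  have g2 := cos_gap β γ s (lz) (lz) (lz) hsβ hs.le
  rw [hαβ] at g1
  rw [hβγ] at g2
  have e1 : 2/π * s * (π / (2*h)) = s / h := by field_simp
  rw [e1] at g1 g2
  have e2 : M * s / h = M * (s / h) := rz
  have g1' : M * (s/h) ≤ M * (cos α - cos β) := by gcongr
  have g2' : M * (s/h) ≤ M * (cos β - cos γ) := by gcongr
  have hddk : dd b M h k = ⌈M * cos α⌉₊ := by
    unfold dd; rw [if_neg (oz), min_eq_right]; exact Nat.ceil_le.2 hkb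
  have hcγ : 0 ≤ cos γ := cos_nonneg_of_neg_pi_div_two_le_of_le (lz) (lz)
  have hddk1 : dd b M h (k+1) = ⌈M * cos γ⌉₊ := by
    have e : π * (((k+1:ℕ):ℝ) - 1/2) / h = γ := by push_cast; ring
    unfold dd; rw [if_neg (oz), e, min_eq_right]; apply Nat.ceil_le.2; nlinarith
  have hq1 : M * cos α ≤ dd b M h k := by rw [hddk]; exact le_ceil _
  have hp1 : dd b M h (k+1) < M * cos γ + 1 := by rw [hddk1]; exact ceil_lt_add_one (pz)
  have hlt : dd b M h (k+1) < dd b M h k := by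
    have : (dd b M h (k+1) : ℝ) < dd b M h k := lz
    exact_mod_cast this
  obtain ⟨c1, c2⟩ := cls_ends b M s hb h k h0 (oz) hs hsb hMs hlt
  have hqb : (dd b M h k:ℝ) ≤ b := by exact_mod_cast dd_le b M h k
  have hsinβ : √(1 - (M * cos β/M)^2) = sin β := by
    rw [mul_div_cancel_left₀ _ hM.ne', ← sin_sq, sqrt_sq (lz)]
  have := class_full κ hκ M h k (M * cos β) δ s hh
    (by rw [hβ, DD_cos M h k _ hM hh (pz) (lz)]; ring) (dd b M h (k+1)) (dd b M h k) (lz) hδ hδ1 hs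
    (by
      have : ((dd b M h k:ℝ)/M)^2 ≤ ((b:ℝ)/M)^2 := by gcongr
      linarith) c1 c2 (lz) (lz)
  simp only [ee_GG, hsinβ] at this
  have eG : GG M h k (M * cos β) = h * M / π * sin β := GG_cos M h k β hM (lz) (lz) (by rw [hβ]; field_simp)
  rw [eG] at this
  have esq : √((h:ℝ) / (π * M * sin β)) = (√(π * M / h) * √(sin β))⁻¹ := by
    rw [← Real.sqrt_mul (pz), ← Real.sqrt_inv]; congr 1; field_simp
  rw [esq] at this
  have hconv : κ * √(π * M / h) * (((√(sin β) : ℝ) : ℂ) * ee (h * M / π * sin β)) = ee (h * M / π * sin β) * (κ / (((√(π * M / h) * √(sin β))⁻¹ : ℝ) : ℂ)) := by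
    push_cast; rw [div_inv_eq_mul]; ring
  rw [hconv]; exact this

lemma S_good (κ : ℂ) (hκ : ∀ X : ℝ, 0 < X → ‖(∫ s in -X..X, ee (s^2/2)) - κ‖ ≤ 2 / X) (b : ℕ) (M s δ σ : ℝ) (hb : (b:ℝ) < M) (h R k0 : ℕ) (h0 : 1 ≤ h)
    (hk1 : 1 ≤ k0) (hs : 0 < s) (hsb : s^2 ≤ 1 - (b/M)^2) (hδ : 1 ≤ δ)
    (hMs : h / (M * s) ≤ 1/2) (hMh : 9 * (h:ℝ) ≤ M) (hδM : δ + 2 ≤ M * s / h) (hδ1 : h / (π * M) * δ ≤ 1/4)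
    (hkb : M * cos (π * ((k0:ℝ) - 1/2) / h) ≤ b)
    (hσ : 0 < σ) (hσ1 : σ ≤ 1) (hR : 1 ≤ R) (hRh : R^8 ≤ h)
    (h1 : π^4 * M * R^32 / h^4 ≤ 1/2) (h2 : 2 * π * h^3 ≤ 16 * M * R^9 * σ) :
    ‖∑ n ∈ rg b, ee (h * FF M n)‖ ≤ 
      ‖κ‖ * √(π * M / h) * (2 * (4 * h / √R + h * σ / 2 + 1))
      + h * (300 * (M / (h * δ) + 1 + h * δ^4 / (M^2 * s^3) + h * δ^2 / (M * s)))
      + (k0 + 1) * (21 * √(M / h)) := by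
  have hh : (0:ℝ) < h := by exact_mod_cast h0
  have hM : 0 < M := lt_of_le_of_lt (pz) hb
  rw [sum_cls b M hM h h0, sum_range_succ]
  set Z := 21 * √(M / h) with hZ
  have ct : ∀ k, k ≤ h/2 → ‖cls b M h k‖ ≤ Z := fun k hk => cls_triv b M s hb h k h0 hk hs hsb hMs hMh
  set p := min k0 (h/2) with hp
  have hp2 : p ≤ h/2 := min_le_right _ _
  rw [Finset.range_eq_Ico, ← sum_Ico_consecutive _ (Nat.zero_le p) hp2]
  set e : ℕ → ℂ := fun k => ((√(sin (π * k / h)) : ℝ) : ℂ) * ee (h * M / π * sin (π * k / h)) with he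
  set E := 300 * (M / (h * δ) + 1 + h * δ^4 / (M^2 * s^3) + h * δ^2 / (M * s)) with hE
  have b1 : ‖∑ k ∈ fIco 0 p, cls b M h k‖ ≤ k0 * Z := by
    refine (norm_sum_le_of_le _ (fun k hk => ct k (by rw [mem_fIco] at hk; omega))).trans ?_
    rw [sum_const, card_Ico, nsmul_eq_mul]
    gcongr
    omega
  have b2 : ‖∑ k ∈ fIco p (h/2), (cls b M h k - κ * √(π * M / h) * e k)‖ ≤ h * E := by
    refine (norm_sum_le_of_le _ (n := fun _ => E) (fun k hk => ?_)).trans ?_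
    · rw [mem_fIco] at hk
      have hk0 : k0 ≤ k := oz
      refine cls_good κ hκ b M s δ hb h k h0 (oz) hk.2 hs hsb hδ hMs hδM hδ1 (le_trans ?_ hkb)
      have hk1r : (1:ℝ) ≤ k0 := by exact_mod_cast hk1
      have hk2 : (2 * k + 2 : ℝ) ≤ h := by exact_mod_cast (show 2 * k + 2 ≤ h by omega)
      have : cos (π * ((k:ℝ) - 1/2) / h) ≤ cos (π * ((k0:ℝ) - 1/2) / h) := by
        apply cos_le_cos_of_nonneg_of_le_pi
        · have : 0 ≤ (k0:ℝ) - 1/2 := lz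
          positivity
        · rw [div_le_iff₀ hh]; gcongr; linarith
        · gcongr
      gcongr
    · rw [sum_const, card_Ico, nsmul_eq_mul]
      gcongr
      omega
  have b3 : ‖∑ k ∈ fIco p (h/2), e k‖ ≤ 2 * (4 * h / √R + h * σ / 2 + 1) := by
    have mono : ∀ i, i < h/2 → √(sin (π * i / h)) ≤ √(sin (π * (i+1:ℕ) / h)) := by
      intro i hi
      apply sqrt_le_sqrt
      have hi2 : (2 * i + 2 : ℝ) ≤ h := by exact_mod_cast (show 2 * i + 2 ≤ h by omega)
      apply sin_le_sin_of_le_of_le_pi_div_two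
      · have : 0 ≤ π * (i:ℝ) / h := pz
        linarith [pi_pos]
      · rw [div_le_iff₀ hh]; push_cast; nlinarith [pi_pos]
      · gcongr; omega
    have := abel_mono (fun k => √(sin (π * k / h))) (fun k => ee (h * M / π * sin (π * k / h))) p (4 * h / √R + h * σ / 2 + 1) (h/2) hp2
      (fun i _ hi => mono i hi) (sqrt_nonneg _)
      (fun j hpj hj => T_bound M σ hM hσ hσ1 h R h0 hR hRh h1 h2 p j hpj hj)
    refine this.trans ?_
    have : √(sin (π * (h/2:ℕ) / h)) ≤ 1 := Real.sqrt_le_one.2 (sin_le_one _)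
    have : 0 ≤ 4 * h / √(R:ℝ) + h * σ / 2 + 1 := pz
    nlinarith
  have b4 : ∑ k ∈ fIco p (h/2), cls b M h k = ∑ k ∈ fIco p (h/2), (cls b M h k - κ * √(π * M / h) * e k) + κ * √(π * M / h) * ∑ k ∈ fIco p (h/2), e k := by
    rw [mul_sum, ← sum_add_distrib]; simp
  rw [b4]
  have b5 : ‖κ * √(π * M / h) * ∑ k ∈ fIco p (h/2), e k‖ ≤ ‖κ‖ * √(π * M / h) * (2 * (4 * h / √R + h * σ / 2 + 1)) := by
    rw [norm_mul, norm_mul, norm_real, norm_eq_abs, abs_of_nonneg (sqrt_nonneg _)]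
    gcongr
  refine (norm_add_le_of_le (norm_add_le_of_le b1 (norm_add_le_of_le b2 b5)) (ct (h/2) le_rfl)).trans (le_of_eq (rz))

noncomputable def HH (x : ℝ) : ℝ := x^2/2 - x/2 - (fract x^2 - fract x + 1/6)/2

lemma HH_sub (x y : ℝ) : (y - x) * ⌊x⌋ ≤ HH y - HH x := by
  have hx := Int.floor_add_fract x
  have hy := Int.floor_add_fract y
  have fy0 := Int.fract_nonneg y
  have fy1 := Int.fract_lt_one y
  set m := ⌊y⌋
  set n := ⌊x⌋
  set g := fract y
  set f := fract x
  have e : HH y - HH x - (y - x) * n = ((m:ℝ)-n)*(((m:ℝ)-n-1)/2+g) := by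
    have e1 : HH y = y^2/2 - y/2 - (g^2-g+1/6)/2 := rfl
    have e2 : HH x = x^2/2 - x/2 - (f^2-f+1/6)/2 := rfl
    rw [e1, e2, ← hx, ← hy]; ring
  have : 0 ≤ ((m:ℝ)-n)*(((m:ℝ)-n-1)/2+g) := by
    rcases lt_trichotomy m n with h | h | h
    · have : (m:ℝ) + 1 ≤ n := by exact_mod_cast h
      exact mul_nonneg_of_nonpos_of_nonpos (lz) (lz)
    · simp [h]
    · have : (n:ℝ) + 1 ≤ m := by exact_mod_cast h
      exact mul_nonneg (lz) (lz)
  linarith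

lemma PP_hasSum (x : ℝ) : HasSum (fun n : ℕ => 1/(n:ℝ)^2 * cos (2*π*n*x)) (π^2 * (fract x^2 - fract x + 1/6)) := by
  have h := hasSum_one_div_nat_pow_mul_cos (k := 1) one_ne_zero (x := fract x) ⟨Int.fract_nonneg x, (Int.fract_lt_one x).le⟩
  have e1 : (fun n : ℕ => 1/(n:ℝ)^(2*1) * cos (2*π*n*fract x)) = fun n : ℕ => 1/(n:ℝ)^2 * cos (2*π*n*x) := by
    ext n
    have : 2*π*n*fract x = 2*π*n*x - ((n:ℤ)*⌊x⌋ : ℤ) * (2*π) := by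
      unfold fract; push_cast; ring
    rw [this, cos_sub_int_mul_two_pi]
  rw [e1] at h
  convert h using 1
  rw [show 2 * 1 = 2 from rfl, Polynomial.bernoulli]
  simp [sum_range_succ, bernoulli_one, bernoulli_two, Polynomial.eval_add]
  ring

lemma cos_diff_sum (b : ℕ) (x : ℕ → ℝ) (h : ℕ) (u v w : ℝ) (hw : 0 < w) (huv : |u - v| ≤ w) :
    |∑ n ∈ rg b, (cos (2*π*h*(x n + u)) - cos (2*π*h*(x n + v)))| ≤ min 2 (2*π*h*w) * ‖∑ n ∈ rg b, ee (h * x n)‖ := by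
  have e : ∑ n ∈ rg b, (cos (2*π*h*(x n + u)) - cos (2*π*h*(x n + v))) = ((ee (h*u) - ee (h*v)) * ∑ n ∈ rg b, ee (h * x n)).re := by
    rw [mul_sum, Complex.re_sum]
    refine sum_congr rfl fun n _ => ?_
    rw [sub_mul, ← ee_add, ← ee_add, Complex.sub_re]
    unfold ee
    rw [Complex.exp_ofReal_mul_I_re, Complex.exp_ofReal_mul_I_re]
    congr 2 <;> ring
  rw [e]
  refine (Complex.abs_re_le_norm _).trans ?_
  rw [norm_mul]
  gcongr
  apply le_min
  · refine (norm_sub_le _ _).trans ?_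
    rw [ee_norm, ee_norm]; norm_num
  · refine (ee_lip _ _).trans ?_
    rw [← mul_sub, abs_mul, abs_of_nonneg (pz : (0:ℝ) ≤ h)]
    nlinarith [mul_le_mul_of_nonneg_left huv (pz : (0:ℝ) ≤ 2 * π * h)]

lemma HH_diff (b : ℕ) (x : ℕ → ℝ) (u v w X : ℝ) (hw : 0 < w) (huv : |u - v| ≤ w)
    (hX : ∀ H : ℕ, ∑ i ∈ rg H, min (1/(w*((i:ℝ)+1)^2)) (1/((i:ℝ)+1)) * ‖∑ n ∈ rg b, ee ((i+1:ℕ) * x n)‖ ≤ X) :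
    |∑ n ∈ rg b, ((fract (x n + u)^2 - fract (x n + u) + 1/6) - (fract (x n + v)^2 - fract (x n + v) + 1/6))| ≤ 2 * w * X := by
  have h1 : HasSum (fun h : ℕ => ∑ n ∈ rg b, (1/(h:ℝ)^2 * cos (2*π*h*(x n + u)) - 1/(h:ℝ)^2 * cos (2*π*h*(x n + v))))
      (∑ n ∈ rg b, (π^2 * (fract (x n + u)^2 - fract (x n + u) + 1/6) - π^2 * (fract (x n + v)^2 - fract (x n + v) + 1/6))) :=
    hasSum_sum fun n _ => (PP_hasSum _).sub (PP_hasSum _)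
  have h2 := h1.tendsto_sum_nat.abs
  have h3 : ∀ H : ℕ, |∑ h ∈ rg H, ∑ n ∈ rg b, (1/(h:ℝ)^2 * cos (2*π*h*(x n + u)) - 1/(h:ℝ)^2 * cos (2*π*h*(x n + v)))| ≤ π^2 * (2 * w * X) := by
    intro H
    refine (abs_sum_le_sum_abs _ _).trans ?_
    have X0 : 0 ≤ X := by simpa using hX 0
    rcases Nat.eq_zero_or_pos H with rfl | hH
    · positivity
    obtain ⟨K, rfl⟩ : ∃ K, H = K + 1 := ⟨H-1, oz⟩
    rw [Finset.sum_range_succ']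
    simp only [Nat.cast_zero, ne_eq, OfNat.ofNat_ne_zero, not_false_eq_true, zero_pow, div_zero, zero_mul, sub_self, Finset.sum_const_zero, abs_zero, add_zero]
    have h4 : ∀ i ∈ rg K, |∑ n ∈ rg b, (1/((i+1:ℕ):ℝ)^2 * cos (2*π*(i+1:ℕ)*(x n + u)) - 1/((i+1:ℕ):ℝ)^2 * cos (2*π*(i+1:ℕ)*(x n + v)))|
        ≤ 2 * π^2 * w * (min (1/(w*((i:ℝ)+1)^2)) (1/((i:ℝ)+1)) * ‖∑ n ∈ rg b, ee ((i+1:ℕ) * x n)‖) := by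
      intro i _
      have := cos_diff_sum b x (i+1) u v w hw huv
      simp only [← mul_sub, ← mul_sum]
      rw [abs_mul, abs_of_nonneg (pz)]
      refine (mul_le_mul_of_nonneg_left this (pz)).trans ?_
      rw [← mul_assoc, ← mul_assoc]
      refine mul_le_mul_of_nonneg_right ?_ (norm_nonneg _)
      rw [mul_min_of_nonneg _ _ (pz), mul_min_of_nonneg _ _ (pz)]
      push_cast
      have hp : 1 ≤ π^2 := by nlinarith [pi_gt_three]
      apply min_le_min
      · have : 2 * π^2 * w * (1/(w*((i:ℝ)+1)^2)) = 1/((i:ℝ)+1)^2 * (2 * π^2) := by field_simp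
        rw [this]; gcongr; linarith
      · have : 2 * π^2 * w * (1/((i:ℝ)+1)) = 1/((i:ℝ)+1)^2 * (2*π^2*((i:ℝ)+1)*w) := by field_simp
        rw [this]; gcongr; nlinarith [pi_gt_three]
    refine (sum_le_sum h4).trans ?_
    rw [← mul_sum]
    refine (mul_le_mul_of_nonneg_left (hX K) (pz)).trans (le_of_eq (rz))
  have h5 := le_of_tendsto' h2 h3
  simp only [← mul_sub, ← mul_sum] at h5
  rw [abs_mul, abs_of_nonneg (pz)] at h5
  exact le_of_mul_le_mul_left h5 (pz)

lemma saw (b : ℕ) (x : ℕ → ℝ) (c w X : ℝ) (hw : 0 < w)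
    (hX : ∀ H : ℕ, ∑ i ∈ rg H, min (1/(w*((i:ℝ)+1)^2)) (1/((i:ℝ)+1)) * ‖∑ n ∈ rg b, ee ((i+1:ℕ) * x n)‖ ≤ X) :
    |∑ n ∈ rg b, ((⌊x n + c⌋:ℝ) - (x n + c - 1/2))| ≤ b * w + X := by
  rw [abs_le]
  constructor
  · have h1 := (abs_le.1 (HH_diff b x c (c-w) w X hw (by simp [abs_of_pos hw]) hX)).2
    have h2 : ∑ n ∈ rg b, (HH (x n + c) - HH (x n + (c - w))) ≤ ∑ n ∈ rg b, w * (⌊x n + c⌋:ℝ) := by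
      refine sum_le_sum fun n _ => ?_
      have := HH_sub (x n + c) (x n + (c-w))
      nlinarith
    have h3 : ∑ n ∈ rg b, (HH (x n + c) - HH (x n + (c - w))) = ∑ n ∈ rg b, (w * (x n + c - 1/2) - w^2/2)
       - (∑ n ∈ rg b, ((fract (x n + c)^2 - fract (x n + c) + 1/6) - (fract (x n + (c-w))^2 - fract (x n + (c-w)) + 1/6)))/2 := by
      rw [Finset.sum_div, ← sum_sub_distrib]
      refine sum_congr rfl fun n _ => ?_
      unfold HH; ring
    rw [h3, sum_sub_distrib, sum_const, card_range, nsmul_eq_mul, ← mul_sum, ← mul_sum] at h2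
    rw [sum_sub_distrib]
    have : w * (-(b*w+X)) ≤ w * (∑ n ∈ rg b, (⌊x n + c⌋:ℝ) - ∑ n ∈ rg b, (x n + c - 1/2)) := by nlinarith
    exact le_of_mul_le_mul_left this hw
  · have h1 := (abs_le.1 (HH_diff b x (c+w) c w X hw (by simp [abs_of_pos hw]) hX)).1
    have h2 : ∑ n ∈ rg b, w * (⌊x n + c⌋:ℝ) ≤ ∑ n ∈ rg b, (HH (x n + (c+w)) - HH (x n + c)) := by
      refine sum_le_sum fun n _ => ?_
      have := HH_sub (x n + c) (x n + (c+w))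
      nlinarith
    have h3 : ∑ n ∈ rg b, (HH (x n + (c+w)) - HH (x n + c)) = ∑ n ∈ rg b, (w * (x n + c - 1/2) + w^2/2)
       - (∑ n ∈ rg b, ((fract (x n + (c+w))^2 - fract (x n + (c+w)) + 1/6) - (fract (x n + c)^2 - fract (x n + c) + 1/6)))/2 := by
      rw [Finset.sum_div, ← sum_sub_distrib]
      refine sum_congr rfl fun n _ => ?_
      unfold HH; ring
    rw [h3, sum_add_distrib, sum_const, card_range, nsmul_eq_mul, ← mul_sum, ← mul_sum] at h2
    rw [sum_sub_distrib]
    have : w * (∑ n ∈ rg b, (⌊x n + c⌋:ℝ) - ∑ n ∈ rg b, (x n + c - 1/2)) ≤ w * (b*w+X) := by nlinarith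
    exact le_of_mul_le_mul_left this hw

lemma tail_sum (φ a : ℝ → ℝ) (X : ℝ) (hX : 0 < X) (h0 : ∀ x, 0 < x → 0 ≤ φ x) (ha : ∀ x y, 0 < x → x ≤ y → φ y ≤ φ x)
    (hφ : ∀ x, 1 ≤ x → a x ≤ φ x - φ (x+1)) (H : ℕ) :
    ∑ i ∈ rg H, (if X ≤ (i:ℝ)+1 then a ((i:ℝ)+1) else 0) ≤ φ X := by
  have : ∑ i ∈ rg H, (if X ≤ (i:ℝ)+1 then a ((i:ℝ)+1) else 0) ≤ φ X - φ (max ((H:ℝ)+1) X) := by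
    induction H with
    | zero => 
      have := ha X (max (((0:ℕ):ℝ)+1) X) hX (le_max_right _ _)
      simp only [Finset.range_zero, Finset.sum_empty]; linarith
    | succ H ih =>
      rw [sum_range_succ]
      split_ifs with hc
      · grind
      · have := ha (max ((H:ℝ)+1) X) (max (((H+1:ℕ):ℝ)+1) X) (lt_max_of_lt_right hX) (max_le_max (by push_cast; linarith) le_rfl)
        linarith
  have h2 := h0 (max ((H:ℝ)+1) X) (lt_max_of_lt_right hX)
  linarith

lemma tail2 (X : ℝ) (hX : 0 < X) (H : ℕ) : ∑ i ∈ rg H, (if X ≤ (i:ℝ)+1 then 1/((i:ℝ)+1)^2 else 0) ≤ 2/X := by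
  refine tail_sum (fun x => 2/x) (fun x => 1/x^2) X hX (fun x hx => pz) (fun x y hx hxy => by gcongr) (fun x hx => ?_) H
  have : 2/x - 2/(x+1) = 2/(x*(x+1)) := by field_simp; ring
  rw [this, div_le_div_iff₀ (pz) (pz)]; nlinarith

lemma tail32 (X : ℝ) (hX : 0 < X) (H : ℕ) : ∑ i ∈ rg H, (if X ≤ (i:ℝ)+1 then 1/(((i:ℝ)+1)*√((i:ℝ)+1)) else 0) ≤ 4/√X := by
  refine tail_sum (fun x => 4/√x) (fun x => 1/(x*√x)) X hX (fun x hx => pz) (fun x y hx hxy => by gcongr) (fun x hx => ?_) H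
  have a1 : 0 < √x := sqrt_pos.2 (lz)
  have a3 : √x * √x = x := mul_self_sqrt (lz)
  have a4 : √(x+1) * √(x+1) = x+1 := mul_self_sqrt (lz)
  have a6 : 1/(√x * √(x+1)*(√x+√(x+1))) = 1/√x - 1/√(x+1) := by
    field_simp
    nlinarith
  have a7 : 4/√x - 4/√(x+1) = 4 * (1/(√x * √(x+1)*(√x+√(x+1)))) := by rw [a6]; ring
  have a8 : √(x+1) ≤ 3/2 * √x := by
    apply abs_le_of_sq_le_sq' _ (pz) |>.2
    nlinarith
  rw [a7, mul_one_div, div_le_div_iff₀ (by nlinarith) (pz), one_mul]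
  have : √x * √(x+1) * (√x+√(x+1)) ≤ √x * (3/2*√x) * (√x+3/2*√x) := by gcongr
  refine this.trans ?_
  nlinarith [mul_pos (show 0 < x by linarith) a1]

lemma head12 (X : ℝ) (hX : 0 ≤ X) (H : ℕ) : ∑ i ∈ rg H, (if (i:ℝ)+1 ≤ X then 1/√((i:ℝ)+1) else 0) ≤ 2*√X := by
  have : ∑ i ∈ rg H, (if (i:ℝ)+1 ≤ X then 1/√((i:ℝ)+1) else 0) ≤ 2*√(min H X) := by
    induction H with
    | zero => simp
    | succ H ih =>
      rw [sum_range_succ]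
      split_ifs with hc
      · rw [min_eq_left (lz)] at ih
        rw [min_eq_left (by push_cast; linarith)]
        push_cast
        have hH : (0:ℝ) ≤ H := pz
        have a1 : 0 < √((H:ℝ)+1) := sqrt_pos.2 (lz)
        have a3 : √(H:ℝ) * √H = H := mul_self_sqrt hH
        have a4 : √((H:ℝ)+1) * √((H:ℝ)+1) = H+1 := mul_self_sqrt (lz)
        have : 1/√((H:ℝ)+1) ≤ 2*√((H:ℝ)+1) - 2*√H := by
          rw [div_le_iff₀ a1]; nlinarith [sq_nonneg (√((H:ℝ)+1) - √H)]
        linarith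
      · have : √(min (H:ℝ) X) ≤ √(min ((H+1:ℕ):ℝ) X) := sqrt_le_sqrt (min_le_min (by push_cast; linarith) le_rfl)
        linarith
  have h2 : √(min (H:ℝ) X) ≤ √X := sqrt_le_sqrt (min_le_right _ _)
  linarith

lemma pw (t : ℝ) (ht : 1000 ≤ t) (m n : ℕ) (h : m < n) : 1000 * t^m ≤ t^n := by
  calc 1000 * t^m ≤ t * t^m := by gcongr
    _ = t^(m+1) := (pow_succ' t m).symm
    _ ≤ t^n := pow_le_pow_right₀ (lz) h

lemma sb_aux (t : ℝ) (ht : 1000 ≤ t) (b : ℕ) (hb2 : (b:ℝ) ≤ t^1000 - t^660) : (1/t^170)^2 ≤ 1 - ((b:ℝ)/t^1000)^2 := by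
  have h1 : (b:ℝ)/t^1000 ≤ 1 - 1/t^340 := by
    rw [div_le_iff₀ (pz)]
    have : (1 - 1/t^340) * t^1000 = t^1000 - t^660 := by
      rw [sub_mul, one_mul, one_div, show t^1000 = t^340*t^660 by rw [← pow_add], inv_mul_cancel_left₀ (pz)]
    linarith
  have h2 : ((b:ℝ)/t^1000)^2 ≤ (1 - 1/t^340)^2 := by gcongr
  have h3 : (1/t^170)^2 = 1/t^340 := by rw [div_pow, ← pow_mul, one_pow]
  have h4 : 1/t^340 ≤ 1 := by rw [div_le_one (pz)]; exact one_le_pow₀ (lz)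
  nlinarith

lemma S1 (t : ℝ) (ht : 1000 ≤ t) (b : ℕ) (hb2 : (b:ℝ) ≤ t^1000 - t^660) (h : ℕ) (h0 : 1 ≤ h) (hh : (h:ℝ) ≤ t^680) :
    ‖∑ n ∈ rg b, ee (h * FF (t^1000) n)‖ ≤ 42 * t^500 * √h := by
  have hp : 0 < t^660 := pz
  have := S_triv b (t^1000) (1/t^170) (lz) h h0 (pz) (sb_aux t ht b hb2)
    (by
      have : t^1000*(1/t^170) = t^830 := by rw [mul_one_div, div_eq_iff (pz), ← pow_add]
      rw [this, div_le_iff₀ (pz)]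
      linarith [pw t ht 680 830 (nz)])
    (by linarith [pw t ht 680 1000 (nz)])
  have e : √(t^1000) = t^500 := by rw [show t^1000 = (t^500)^2 by rw [← pow_mul], sqrt_sq (pz)]
  rwa [e] at this

lemma S2_aux (t : ℝ) (ht : 1000 ≤ t) (h : ℝ) (h1 : t^325 ≤ h) (h2 : h ≤ t^345) :
    300 * (t^1000 / (h * t^360) + 1 + h * (t^360)^4 / ((t^1000)^2 * (1/t^170)^3) + h * (t^360)^2 / (t^1000 * (1/t^170))) ≤ 1200 * t^315 := by
  have t1 : 1 ≤ t := lz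
  have hh : 0 < h := lt_of_lt_of_le (pz) h1
  have a1 : t^1000 / (h * t^360) ≤ t^315 := by
    rw [div_le_iff₀ (pz)]
    calc t^1000 = t^315 * (t^325 * t^360) := by rw [← pow_add, ← pow_add]
      _ ≤ _ := by gcongr
  have a2 : 1 ≤ t^315 := one_le_pow₀ t1
  have a3 : h * (t^360)^4 / ((t^1000)^2 * (1/t^170)^3) ≤ t^315 := by
    have e : (t^1000)^2 * (1/t^170)^3 = t^1490 := by
      rw [one_div, inv_pow, ← pow_mul, ← pow_mul, ← div_eq_mul_inv, div_eq_iff (pz), ← pow_add]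
    rw [e, div_le_iff₀ (pz), ← pow_mul, ← pow_add]
    calc h * t^(360*4) ≤ t^345 * t^(360*4) := by gcongr
      _ = t^1785 := by rw [← pow_add]
      _ ≤ _ := pow_le_pow_right₀ t1 (nz)
  have a4 : h * (t^360)^2 / (t^1000 * (1/t^170)) ≤ t^315 := by
    have e : t^1000 * (1/t^170) = t^830 := by
      rw [one_div, ← div_eq_mul_inv, div_eq_iff (pz), ← pow_add]
    rw [e, div_le_iff₀ (pz), ← pow_mul, ← pow_add]
    calc h * t^(360*2) ≤ t^345 * t^(360*2) := by gcongr
      _ = t^1065 := by rw [← pow_add]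
      _ ≤ _ := pow_le_pow_right₀ t1 (nz)
  linarith

lemma S2_k0 (t : ℝ) (ht : 1000 ≤ t) (b : ℕ) (hb1 : t^1000 - 2*t^660 ≤ b) (h : ℕ) (h1 : t^325 ≤ (h:ℝ)) :
    ∃ k0 : ℕ, 1 ≤ k0 ∧ t^1000 * cos (π * ((k0:ℝ) - 1/2) / h) ≤ b ∧ ((k0:ℝ)+1) ≤ 4 * h / t^170 := by
  have t1 : 1 ≤ t := lz
  have hh : (0:ℝ) < h := lt_of_lt_of_le (pz) h1
  have hr : 1 ≤ h/t^170 := by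
    rw [le_div_iff₀ (pz), one_mul]
    exact le_trans (pow_le_pow_right₀ t1 (nz)) h1
  have hb0 : (0:ℝ) ≤ b := pz
  by_cases hc : (h:ℝ)/t^170 + 1 ≤ h
  · refine ⟨⌈(h:ℝ)/t^170⌉₊ + 1, oz, ?_, ?_⟩
    · have c1 := le_ceil ((h:ℝ)/t^170)
      have c2 := ceil_lt_add_one (show 0 ≤ (h:ℝ)/t^170 by positivity)
      set k := ⌈(h:ℝ)/t^170⌉₊
      push_cast
      have c3 : π * ((k:ℝ)+1-1/2)/h ≤ π * (3/2) := by
        rw [div_le_iff₀ hh, mul_assoc]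
        refine mul_le_mul_of_nonneg_left ?_ pi_pos.le
        linarith
      have c4 : π/t^170 ≤ π * ((k:ℝ)+1-1/2)/h := by
        have : π / t^170 = π * ((h:ℝ)/t^170)/h := by field_simp
        rw [this]; gcongr; linarith
      have c0 : 0 < π/t^170 := pz
      rcases le_total (π * ((k:ℝ)+1-1/2)/h) π with c5 | c5
      · have c6 : cos (π * ((k:ℝ)+1-1/2)/h) ≤ cos (π/t^170) := cos_le_cos_of_nonneg_of_le_pi c0.le c5 c4
        have c7 : cos (π/t^170) ≤ 1 - 2/π^2 * (π/t^170)^2 := cos_le_one_sub_mul_cos_sq (by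
          rw [abs_of_pos c0]; exact div_le_self pi_pos.le (one_le_pow₀ t1))
        have c8 : 2/π^2 * (π/t^170)^2 = 2/t^340 := by
          field_simp
        calc t^1000 * cos (π * ((k:ℝ)+1-1/2)/h) ≤ t^1000 * (1 - 2/t^340) := by gcongr; linarith
          _ = t^1000 - 2*t^660 := by
            field_simp
          _ ≤ b := hb1
      · refine le_trans ?_ hb0
        exact mul_nonpos_of_nonneg_of_nonpos (pz) (cos_nonpos_of_pi_div_two_le_of_le (by linarith [pi_pos]) (lz))
    · have c2 := ceil_lt_add_one (show 0 ≤ (h:ℝ)/t^170 by positivity)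
      push_cast
      have : 4 * (h:ℝ) / t^170 = 4 * (h/t^170) := rz
      linarith
  · exfalso
    apply hc
    have e1 : (h:ℝ)/t^170 ≤ h/2 := by
      gcongr
      exact le_trans (lz) (le_self_pow₀ t1 (nz))
    linarith

lemma S2 (κ : ℂ) (hκ : ∀ X : ℝ, 0 < X → ‖(∫ s in -X..X, ee (s^2/2)) - κ‖ ≤ 2 / X) (t : ℝ) (ht : 1000 ≤ t) (b : ℕ)
    (hb1 : t^1000 - 2*t^660 ≤ b) (hb2 : (b:ℝ) ≤ t^1000 - t^660) (h : ℕ) (h1 : t^325 ≤ (h:ℝ)) (h2 : (h:ℝ) ≤ t^345) :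
    ‖∑ n ∈ rg b, ee (h * FF (t^1000) n)‖ ≤ (60 * ‖κ‖ + 1300) * t^496 * √h := by
  have t0 : 0 < t := lz
  have t1 : 1 ≤ t := lz
  have hh : (0:ℝ) < h := lt_of_lt_of_le (pz) h1
  have hh1 : 1 ≤ h := by exact_mod_cast hh
  obtain ⟨k0, k1, k2, k3⟩ := S2_k0 t ht b hb1 h h1
  have hp : 0 < t^660 := pz
  have eMs : t^1000*(1/t^170) = t^830 := by rw [mul_one_div, div_eq_iff (pz), ← pow_add]
  set R := ⌊t^9⌋₊ with hR
  have R1 : (R:ℝ) ≤ t^9 := Nat.floor_le (pz)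
  have R2 : t^9/2 ≤ R := by
    have := lt_floor_add_one (t^9)
    have : t ≤ t^9 := le_self_pow₀ t1 (nz)
    linarith
  have R0 : (1:ℝ) ≤ R := by
    have : t ≤ t^9 := le_self_pow₀ t1 (nz)
    linarith
  have hS := S_good κ hκ b (t^1000) (1/t^170) (t^360) (1/t^20) (lz) h R k0 hh1 k1 (pz) (sb_aux t ht b hb2)
    (one_le_pow₀ t1)
    (by rw [eMs, div_le_iff₀ (pz)]; linarith [pw t ht 345 830 (nz)])
    (by linarith [pw t ht 345 1000 (nz)])
    (by
      rw [eMs, le_div_iff₀ hh]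
      have a1 : t^360 + 2 ≤ 2 * t^360 := by
        have : t ≤ t^360 := le_self_pow₀ t1 (nz)
        linarith
      calc (t^360+2)*h ≤ (2*t^360)*t^345 := by gcongr
        _ = 2 * t^705 := by rw [mul_assoc, ← pow_add]
        _ ≤ t^830 := by linarith [pw t ht 705 830 (nz), pow_pos t0 705])
    (by
      rw [div_mul_eq_mul_div, div_le_iff₀ (pz)]
      calc (h:ℝ)*t^360 ≤ t^345*t^360 := by gcongr
        _ = t^705 := by rw [← pow_add]
        _ ≤ 1/4*(3*t^1000) := by linarith [pw t ht 705 1000 (nz), pow_pos t0 705]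
        _ ≤ 1/4*(π*t^1000) := by gcongr; exact pi_gt_three.le)
    k2 (pz) (by rw [div_le_one (pz)]; exact one_le_pow₀ t1) (by exact_mod_cast R0)
    (by
      have : (R:ℝ)^8 ≤ h := by
        calc (R:ℝ)^8 ≤ (t^9)^8 := by gcongr
          _ = t^72 := by rw [← pow_mul]
          _ ≤ t^325 := pow_le_pow_right₀ t1 (nz)
          _ ≤ h := h1
      exact_mod_cast this)
    (by
      rw [div_le_iff₀ (pz)]
      have p4 : π^4 ≤ 256 := by
        calc π^4 ≤ 4^4 := by gcongr; exact pi_lt_four.le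
          _ = 256 := nz
      calc π^4*t^1000*(R:ℝ)^32 ≤ 256*t^1000*(t^9)^32 := by gcongr
        _ = 256 * t^1288 := by rw [← pow_mul, mul_assoc, ← pow_add]
        _ ≤ 1/2 * t^1300 := by linarith [pw t ht 1288 1300 (nz), pow_pos t0 1288]
        _ = 1/2 * (t^325)^4 := by rw [← pow_mul]
        _ ≤ _ := by gcongr)
    (by
      calc 2*π*(h:ℝ)^3 ≤ 2*4*(t^345)^3 := by gcongr; exact pi_lt_four.le
        _ = 8 * t^1035 := by rw [← pow_mul]; norm_num
        _ ≤ 1/32*t^1061 := by linarith [pw t ht 1035 1061 (nz), pow_pos t0 1035]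
        _ = 16*t^1000*(t^9/2)^9*(1/t^20) := by
          rw [mul_one_div, eq_div_iff (pz), div_pow, ← pow_mul]
          have e1 : t^1000 * t^81 = t^1061 * t^20 := by rw [← pow_add, ← pow_add]
          have e2 : 16 * t^1000*(t^81/2^9) = 1/32 * (t^1000*t^81) := by generalize t^1000 = x; generalize t^81 = y; ring
          rw [show 9*9 = 81 from rfl, e2, e1, mul_assoc]
        _ ≤ _ := by gcongr)
  refine hS.trans ?_
  have eM : √(t^1000) = t^500 := by rw [show t^1000 = (t^500)^2 by rw [← pow_mul], sqrt_sq (pz)]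
  have hss : √(h:ℝ) * √h = h := mul_self_sqrt hh.le
  have q1 : √(π * t^1000 / h) ≤ 2 * t^500 / √h := by
    rw [sqrt_div (pz), Real.sqrt_mul pi_pos.le, eM]
    gcongr
    rw [Real.sqrt_le_left (nz)]; linarith [pi_lt_four]
  have q2 : 2 * (4 * h / √(R:ℝ) + h * (1/t^20) / 2 + 1) ≤ 30 * h / t^4 := by
    have r1 : t^4 / 2 ≤ √(R:ℝ) := by
      apply le_sqrt_of_sq_le
      refine le_trans ?_ R2
      have := pw t ht 8 9 (nz)
      linarith [pow_pos t0 8]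
    have r2 : 4 * h / √(R:ℝ) ≤ 8 * (h / t^4) := by
      calc 4 * h / √(R:ℝ) ≤ 4 * h / (t^4/2) := by gcongr
        _ = _ := by generalize t^4 = x; ring
    have r3 : h * (1/t^20) ≤ h / t^4 := by
      rw [mul_one_div]; gcongr <;> norm_num
    have r4 : 1 ≤ h / t^4 := by
      rw [le_div_iff₀ (pz), one_mul]; exact le_trans (pow_le_pow_right₀ t1 (nz)) h1
    have : 30 * (h:ℝ)/t^4 = 30 * (h/t^4) := rz
    linarith
  have q3 : ‖κ‖ * √(π * t^1000 / h) * (2 * (4 * h / √(R:ℝ) + h * (1/t^20) / 2 + 1)) ≤ 60 * ‖κ‖ * t^496 * √h := by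
    calc _ ≤ ‖κ‖ * (2 * t^500 / √h) * (30 * h / t^4) := by gcongr
      _ = _ := by
        rw [show t^500 = t^496 * t^4 by rw [← pow_add]]
        nth_rw 2 [← hss]
        have : t^4 ≠ 0 := pz
        generalize t^4 = x at *; generalize t^496 = y
        field_simp; ring
  have q4 : √(h:ℝ) ≤ t^173 := by
    rw [Real.sqrt_le_left (pz), ← pow_mul]
    exact h2.trans (pow_le_pow_right₀ t1 (nz))
  have q5 := mul_le_mul_of_nonneg_left (S2_aux t ht h h1 h2) hh.le
  have q6 : (h:ℝ) * (1200 * t^315) ≤ 1200 * t^496 * √h := by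
    calc (h:ℝ) * (1200 * t^315) = 1200 * t^315 * √h * √h := by rw [mul_assoc (1200 * t^315), hss]; ring
      _ ≤ 1200 * t^315 * t^173 * √h := by gcongr
      _ = 1200 * t^488 * √h := by rw [mul_assoc (1200:ℝ), ← pow_add]
      _ ≤ _ := by gcongr <;> norm_num
  have q7 : ((k0:ℝ)+1) * (21 * √(t^1000/h)) ≤ 84 * t^496 * √h := by
    rw [sqrt_div (pz), eM]
    calc ((k0:ℝ)+1) * (21 * (t^500 / √h)) ≤ (4 * h / t^170) * (21 * (t^500 / √h)) := by gcongr
      _ = 84 * t^330 * √h := by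
        rw [show t^500 = t^330 * t^170 by rw [← pow_add]]
        nth_rw 1 [← hss]
        have : t^170 ≠ 0 := pz
        generalize t^170 = x at *; generalize t^330 = y
        field_simp; ring
      _ ≤ _ := by gcongr <;> norm_num
  have : 0 ≤ 16 * t^496 * √(h:ℝ) := pz
  linarith

lemma pt_bound (C t : ℝ) (hC : 0 ≤ C) (ht : 1000 ≤ t) (y S : ℝ) (hy : 1 ≤ y) (hS0 : 0 ≤ S)
    (h1 : y ≤ t^680 → S ≤ 42 * t^500 * √y) (h2 : t^325 ≤ y → y ≤ t^345 → S ≤ C * t^496 * √y) (h3 : S ≤ t^1000) :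
    min (1/(1/t^336*y^2)) (1/y) * S ≤ 42*t^500*(if y ≤ t^325 then 1/√y else 0) + C*t^496*(if y ≤ t^336 then 1/√y else 0)
      + C*t^832*(if t^336 ≤ y then 1/(y*√y) else 0) + 42*t^836*(if t^345 ≤ y then 1/(y*√y) else 0) + t^1336*(if t^680 ≤ y then 1/y^2 else 0) := by
  have y0 : 0 < y := lz
  have q0 : 0 < √y := sqrt_pos.2 y0
  have qq : √y * √y = y := mul_self_sqrt y0.le
  have n1 : 0 ≤ 42*t^500*(if y ≤ t^325 then 1/√y else 0) := mul_nonneg (pz) (ite_nonneg (pz) le_rfl)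
  have n2 : 0 ≤ C*t^496*(if y ≤ t^336 then 1/√y else 0) := mul_nonneg (pz) (ite_nonneg (pz) le_rfl)
  have n3 : 0 ≤ C*t^832*(if t^336 ≤ y then 1/(y*√y) else 0) := mul_nonneg (pz) (ite_nonneg (pz) le_rfl)
  have n4 : 0 ≤ 42*t^836*(if t^345 ≤ y then 1/(y*√y) else 0) := mul_nonneg (pz) (ite_nonneg (pz) le_rfl)
  have n5 : 0 ≤ t^1336*(if t^680 ≤ y then 1/y^2 else 0) := mul_nonneg (pz) (ite_nonneg (pz) le_rfl)
  have m1 : min (1/(1/t^336*y^2)) (1/y) * S ≤ 1/y * S := by gcongr; exact min_le_right _ _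
  have e2 : 1/(1/t^336*y^2) = t^336/y^2 := by
    generalize t^336 = x at *; field_simp
  have m2 : min (1/(1/t^336*y^2)) (1/y) * S ≤ t^336/y^2 * S := by
    rw [← e2]; gcongr; exact min_le_left _ _
  have s1 : ∀ B : ℝ, 1/y * (B * √y) = B * (1/√y) := by
    intro B; rw [← qq]; field_simp; simp [sqrt_sq, q0.le]; ring
  have s2 : ∀ A B : ℝ, A/y^2 * (B * √y) = A * B * (1/(y*√y)) := by
    intro A B
    rw [mul_one_div, div_mul_eq_mul_div, div_eq_div_iff (pz) (pz)]
    calc A * (B * √y) * (y * √y) = A * B * y * (√y * √y) := rz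
      _ = _ := by rw [qq]; ring
  rcases le_total y (t^325) with c1 | c1
  · rw [if_pos c1] at n1 ⊢
    have := mul_le_mul_of_nonneg_left (h1 (c1.trans (pow_le_pow_right₀ (lz) (nz)))) (pz : 0 ≤ 1/y)
    rw [s1] at this
    linarith
  rcases le_total y (t^345) with c3 | c3
  · rcases le_total y (t^336) with c2 | c2
    · rw [if_pos c2] at n2 ⊢
      have := mul_le_mul_of_nonneg_left (h2 c1 c3) (pz : 0 ≤ 1/y)
      rw [s1] at this
      linarith
    · rw [if_pos c2] at n3 ⊢
      have := mul_le_mul_of_nonneg_left (h2 c1 c3) (pz : 0 ≤ t^336/y^2)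
      rw [s2, show t^336 * (C * t^496) = C * (t^336*t^496) by generalize t^336 = u; generalize t^496 = v; ring, ← pow_add] at this
      linarith
  rcases le_total y (t^680) with c4 | c4
  · rw [if_pos c3] at n4 ⊢
    have := mul_le_mul_of_nonneg_left (h1 c4) (pz : 0 ≤ t^336/y^2)
    rw [s2, show t^336 * (42 * t^500) = 42 * (t^336*t^500) by generalize t^336 = u; generalize t^500 = v; ring, ← pow_add] at this
    linarith
  · rw [if_pos c4] at n5 ⊢
    have := mul_le_mul_of_nonneg_left h3 (pz : 0 ≤ t^336/y^2)
    rw [show t^336/y^2 * t^1000 = (t^336*t^1000)*(1/y^2) by generalize t^336 = u; generalize t^1000 = v; ring, ← pow_add] at this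
    linarith

lemma five_sum (C t : ℝ) (hC : 0 ≤ C) (ht : 1000 ≤ t) (H : ℕ) :
    ∑ i ∈ rg H, (42*t^500*(if (i:ℝ)+1 ≤ t^325 then 1/√((i:ℝ)+1) else 0) + C*t^496*(if (i:ℝ)+1 ≤ t^336 then 1/√((i:ℝ)+1) else 0)
      + C*t^832*(if t^336 ≤ (i:ℝ)+1 then 1/(((i:ℝ)+1)*√((i:ℝ)+1)) else 0) + 42*t^836*(if t^345 ≤ (i:ℝ)+1 then 1/(((i:ℝ)+1)*√((i:ℝ)+1)) else 0) + t^1336*(if t^680 ≤ (i:ℝ)+1 then 1/((i:ℝ)+1)^2 else 0))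
    ≤ (254 + 6 * C) * t^664 := by
  have t1 : 1 ≤ t := lz
  simp only [sum_add_distrib, ← mul_sum]
  have p1 := mul_le_mul_of_nonneg_left (head12 (t^325) (pz) H) (pz : 0 ≤ 42*t^500)
  have p2 := mul_le_mul_of_nonneg_left (head12 (t^336) (pz) H) (pz : 0 ≤ C*t^496)
  have p3 := mul_le_mul_of_nonneg_left (tail32 (t^336) (pz) H) (pz : 0 ≤ C*t^832)
  have p4 := mul_le_mul_of_nonneg_left (tail32 (t^345) (pz) H) (pz : 0 ≤ 42*t^836)
  have p5 := mul_le_mul_of_nonneg_left (tail2 (t^680) (pz) H) (pz : 0 ≤ t^1336)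
  have e336 : √(t^336) = t^168 := by rw [show t^336 = (t^168)^2 by rw [← pow_mul], sqrt_sq (pz)]
  have r1 : 42*t^500*(2*√(t^325)) ≤ 84 * t^664 := by
    have : √(t^325) ≤ t^164 := by
      rw [Real.sqrt_le_left (pz), ← pow_mul]; exact pow_le_pow_right₀ t1 (nz)
    calc 42*t^500*(2*√(t^325)) ≤ 42*t^500*(2*t^164) := by gcongr
      _ = 84 * (t^500*t^164) := by generalize t^500 = u; generalize t^164 = v; ring
      _ = _ := by rw [← pow_add]
  have r2 : C*t^496*(2*√(t^336)) = 2*C*t^664 := by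
    rw [e336, show t^664 = t^496*t^168 by rw [← pow_add]]
    generalize t^496 = u; generalize t^168 = v; ring
  have r3 : C*t^832*(4/√(t^336)) = 4*C*t^664 := by
    rw [e336, show t^832 = t^664*t^168 by rw [← pow_add]]
    have : t^168 ≠ 0 := pz
    generalize t^664 = u; generalize t^168 = v at *; field_simp
  have r4 : 42*t^836*(4/√(t^345)) ≤ 168 * t^664 := by
    have : t^172 ≤ √(t^345) := by
      apply le_sqrt_of_sq_le; rw [← pow_mul]; exact pow_le_pow_right₀ t1 (nz)
    calc 42*t^836*(4/√(t^345)) ≤ 42*t^836*(4/t^172) := by gcongr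
      _ = _ := by
        rw [show t^836 = t^664*t^172 by rw [← pow_add]]
        have : t^172 ≠ 0 := pz
        generalize t^664 = u; generalize t^172 = v at *; field_simp; ring
  have r5 : t^1336*(2/t^680) ≤ 2 * t^664 := by
    have : t^656 ≤ t^664 := pow_le_pow_right₀ t1 (nz)
    calc t^1336*(2/t^680) = 2 * t^656 := by
          rw [show t^1336 = t^656*t^680 by rw [← pow_add]]
          have : t^680 ≠ 0 := pz
          generalize t^656 = u; generalize t^680 = v at *; field_simp
      _ ≤ _ := lz
  linarith

lemma floor_main : ∃ C : ℝ, 0 < C ∧ ∀ t : ℝ, 1000 ≤ t → ∀ b : ℕ, t^1000 - 2*t^660 ≤ b → (b:ℝ) ≤ t^1000 - t^660 → ∀ c : ℝ,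
    |∑ n ∈ rg b, ((⌊FF (t^1000) n + c⌋:ℝ) - (FF (t^1000) n + c - 1/2))| ≤ C * t^664 := by
  obtain ⟨κ, hκ⟩ := fresnel
  refine ⟨255 + 6 * (60 * ‖κ‖ + 1300), pz, fun t ht b hb1 hb2 c => ?_⟩
  have t0 : 0 < t := lz
  have hb : (b:ℝ) ≤ t^1000 := hb2.trans (by linarith [pow_pos t0 660])
  have := saw b (FF (t^1000)  ·) c (1/t^336) ((254 + 6 * (60 * ‖κ‖ + 1300)) * t^664) (pz) (fun H => by
    refine le_trans (sum_le_sum fun i _ => ?_) (five_sum (60 * ‖κ‖ + 1300) t (pz) ht H)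
    refine pt_bound (60 * ‖κ‖ + 1300) t (pz) ht ((i:ℝ)+1) _ (by linarith [(Nat.cast_nonneg i : (0:ℝ) ≤ i)]) (norm_nonneg _) ?_ ?_ ?_
    · intro h
      have := S1 t ht b hb2 (i+1) (oz) (by push_cast; exact h)
      push_cast at this ⊢; exact this
    · intro h h'
      have := S2 κ hκ t ht b hb1 hb2 (i+1) (by push_cast; exact h) (by push_cast; exact h')
      push_cast at this ⊢; exact this
    · refine le_trans (norm_sum_le_of_le _ (n := fun _ => 1) (fun n _ => (ee_norm _).le)) ?_
      simpa using hb)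
  refine this.trans ?_
  have : (b:ℝ) * (1/t^336) ≤ t^664 := by
    rw [mul_one_div, div_le_iff₀ (pz), ← pow_add]; exact hb
  linarith

/-- main output of the exponential sum part -/
lemma count_main : ∃ C : ℝ, 0 < C ∧ ∀ t : ℝ, 1000 ≤ t → ∀ b : ℕ, t^1000 - 2*t^660 ≤ b → (b:ℝ) ≤ t^1000 - t^660 → ∀ c : ℝ, ∀ N : ℕ → ℝ,
    (∀ n < b, (⌊FF (t^1000) n + c - 1/t^336⌋:ℝ) ≤ N n ∧ N n ≤ ⌊FF (t^1000) n + c + 1/t^336⌋) →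
    |∑ n ∈ rg b, (N n - (FF (t^1000) n + c - 1/2))| ≤ C * t^664 := by
  obtain ⟨C, hC, h⟩ := floor_main
  refine ⟨C+1, pz, fun t ht b hb1 hb2 c N hN => ?_⟩
  have t0 : 0 < t := lz
  have hb : (b:ℝ) ≤ t^1000 := hb2.trans (by linarith [pow_pos t0 660])
  have hbw : (b:ℝ) * (1/t^336) ≤ t^664 := by
    rw [mul_one_div, div_le_iff₀ (pz), ← pow_add]; exact hb
  have u1 := (abs_le.1 (h t ht b hb1 hb2 (c + 1/t^336))).2
  have u2 := (abs_le.1 (h t ht b hb1 hb2 (c - 1/t^336))).1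
  have v1 : ∑ n ∈ rg b, (N n - (FF (t^1000) n + c - 1/2)) ≤ ∑ n ∈ rg b, (((⌊FF (t^1000) n + (c + 1/t^336)⌋:ℝ) - (FF (t^1000) n + (c + 1/t^336) - 1/2)) + 1/t^336) := by
    refine sum_le_sum fun n hn => ?_
    have := (hN n (mem_rg.1 hn)).2
    rw [← add_assoc]; linarith
  have v2 : ∑ n ∈ rg b, (((⌊FF (t^1000) n + (c - 1/t^336)⌋:ℝ) - (FF (t^1000) n + (c - 1/t^336) - 1/2)) - 1/t^336) ≤ ∑ n ∈ rg b, (N n - (FF (t^1000) n + c - 1/2)) := by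
    refine sum_le_sum fun n hn => ?_
    have := (hN n (mem_rg.1 hn)).1
    rw [← add_sub_assoc]; linarith
  rw [sum_add_distrib, sum_const, card_range, nsmul_eq_mul] at v1
  rw [sum_sub_distrib, sum_const, card_range, nsmul_eq_mul] at v2
  rw [add_mul, one_mul, abs_le]
  constructor <;> linarith

noncomputable def gterm (n : ℕ) (s : ℝ) (j : ℕ) : ℝ := (-s)^j / (j.factorial * (n+j).factorial)

/-- entire part of the Bessel function -/
noncomputable def bg (n : ℕ) (s : ℝ) : ℝ := ∑' j : ℕ, gterm n s j

lemma gterm_bound (n : ℕ) (s r : ℝ) (h : |s| ≤ r) (j : ℕ) : ‖gterm n s j‖ ≤ r^j / j.factorial := by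
  unfold gterm
  have h0 : 0 ≤ r := (abs_nonneg _).trans h
  rw [norm_div, norm_pow, norm_neg, norm_eq_abs, Real.norm_of_nonneg (pz : (0:ℝ) ≤ j.factorial*(n+j).factorial)]
  have h1 : (1:ℝ) ≤ (n+j).factorial := by exact_mod_cast Nat.succ_le_of_lt (Nat.factorial_pos _)
  have h2 : (0:ℝ) < j.factorial := pz
  have h3 : (j.factorial:ℝ) ≤ j.factorial * (n+j).factorial := by nlinarith
  gcongr

lemma gterm_summable (n : ℕ) (s : ℝ) : Summable (gterm n s) :=
  Summable.of_norm_bounded (Real.summable_pow_div_factorial |s|) (gterm_bound n s |s| le_rfl)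

lemma bg_deriv (n : ℕ) (s : ℝ) : HasDerivAt (bg n) (-bg (n+1) s) s := by
  set r := |s| + 1
  have key := hasDerivAt_tsum_of_isPreconnected (g := fun j s => gterm n s j)
    (g' := fun j y => j * (-y)^(j-1) * (-1) / (j.factorial * (n+j).factorial)) (u := fun j : ℕ => if j = 0 then 0 else r^(j-1) / (j-1).factorial)
    (t := Metric.ball (0:ℝ) r) (y₀ := 0) (y := s) ?_ Metric.isOpen_ball (convex_ball _ _).isPreconnected ?_ ?_ ?_ (gterm_summable n 0) ?_
  · refine HasDerivAt.congr_deriv key ?_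
    rw [Summable.tsum_eq_zero_add]
    · simp only [Nat.cast_zero, zero_mul, zero_div, zero_add]
      unfold bg
      rw [← tsum_neg]
      congr 1; ext j
      unfold gterm
      rw [Nat.add_sub_cancel, factorial_succ, show n + (j+1) = n+1+j by ring]
      push_cast
      have : (j:ℝ)+1 ≠ 0 := pz
      field_simp
    · rw [← summable_nat_add_iff 1]
      refine (gterm_summable (n+1) s).neg.congr fun j => ?_
      unfold gterm
      rw [Nat.add_sub_cancel, factorial_succ, show n + (j+1) = n+1+j by ring]
      push_cast
      have : (j:ℝ)+1 ≠ 0 := pz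
      field_simp
  · rw [← summable_nat_add_iff 1]
    simpa using Real.summable_pow_div_factorial r
  · intro j y _
    unfold gterm
    exact (((hasDerivAt_id y).neg.pow j).div_const _).congr_deriv (sz)
  · intro j y hy
    rcases j with _ | j
    · simp
    · have hy' : |y| ≤ r := by simpa using (Metric.mem_ball.1 hy).le
      have := gterm_bound (n+1) y r hy' j
      simp only [Nat.add_eq_zero_iff, one_ne_zero, and_false, if_false, Nat.add_sub_cancel]
      convert this using 1
      rw [← norm_neg]
      congr 1
      unfold gterm
      rw [factorial_succ, show n + (j+1) = n+1+j by ring]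
      push_cast
      have : (j:ℝ)+1 ≠ 0 := pz
      field_simp
  · simp; positivity
  · simp [r]

lemma bg_rec (n : ℕ) (s : ℝ) : (n+1) * bg (n+1) s - s * bg (n+2) s = bg n s := by
  have h1 : s * bg (n+2) s = - ∑' j : ℕ, (if j = 0 then 0 else j * gterm (n+1) s j) := by
    have hs : ∀ j, s * gterm (n+2) s j = -((fun j : ℕ => if j = 0 then 0 else j * gterm (n+1) s j) (j+1)) := by
      intro j
      simp only [Nat.add_eq_zero_iff, one_ne_zero, and_false, if_false]
      unfold gterm
      rw [factorial_succ j, show n+1+(j+1) = n+2+j by ring, pow_succ]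
      push_cast
      have : (j:ℝ)+1 ≠ 0 := pz
      field_simp
    have hsum : Summable (fun j : ℕ => if j = 0 then 0 else j * gterm (n+1) s j) := by
      rw [← summable_nat_add_iff 1]
      have := ((gterm_summable (n+2) s).mul_left s).neg
      refine this.congr fun j => ?_
      rw [hs j]; simp
    rw [hsum.tsum_eq_zero_add]
    unfold bg
    rw [← tsum_mul_left]
    simp only [if_true, zero_add, ← tsum_neg]
    exact tsum_congr hs
  have hsum : Summable (fun j : ℕ => if j = 0 then 0 else j * gterm (n+1) s j) := by
    have : Summable (fun j => gterm n s j - (n+1) * gterm (n+1) s j) := (gterm_summable n s).sub ((gterm_summable (n+1) s).mul_left _)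
    refine this.congr fun j => ?_
    split_ifs with h
    · subst h; unfold gterm
      rw [add_zero, factorial_succ]; push_cast; field_simp; simp
    · unfold gterm
      rw [show n+1+j = n+j+1 by ring, factorial_succ (n+j)]; push_cast
      have : (n:ℝ)+j+1 ≠ 0 := pz
      field_simp; ring
  rw [h1, sub_neg_eq_add]
  unfold bg
  rw [← tsum_mul_left, ← Summable.tsum_add ((gterm_summable (n+1) s).mul_left _) hsum]
  refine tsum_congr fun j => ?_
  split_ifs with h
  · subst h; unfold gterm
    rw [add_zero, add_zero, factorial_succ]; push_cast; field_simp; simp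
  · unfold gterm
    rw [show n+1+j = n+j+1 by ring, factorial_succ (n+j)]; push_cast
    have : (n:ℝ)+j+1 ≠ 0 := pz
    field_simp; ring

lemma bg_zero (n : ℕ) : bg n 0 = 1 / n.factorial := by
  unfold bg
  rw [tsum_eq_single 0]
  · simp [gterm]
  · intro j hj; simp [gterm, hj]

lemma bg_cont (n : ℕ) : Continuous (bg n) := continuous_iff_continuousAt.2 fun s => (bg_deriv n s).continuousAt

lemma bg_contDiff (n : ℕ) : ContDiff ℝ (⊤ : ℕ∞) (bg n) := by
  rw [contDiff_infty]
  intro k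
  induction k generalizing n with
  | zero => exact contDiff_zero.2 (bg_cont n)
  | succ k ih =>
    rw [show ((k+1:ℕ) : WithTop ℕ∞) = (k:WithTop ℕ∞) + 1 by push_cast; rfl, contDiff_succ_iff_deriv]
    refine ⟨fun s => (bg_deriv n s).differentiableAt, sz, ?_⟩
    have : deriv (bg n) = fun s => -bg (n+1) s := funext fun s => (bg_deriv n s).deriv
    rw [this]
    exact (ih (n+1)).neg

/-- Bessel function of integer order. -/
noncomputable def bJ (n : ℕ) (x : ℝ) : ℝ := (x/2)^n * bg n (x^2/4)
/-- x J_n'(x) -/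
noncomputable def bK (n : ℕ) (x : ℝ) : ℝ := n * bJ n x - x * bJ (n+1) x

lemma bJ_cont (n : ℕ) : Continuous (bJ n) := by
  unfold bJ; exact ((continuous_id.div_const 2).pow n).mul ((bg_cont n).comp (fz))

lemma bK_cont (n : ℕ) : Continuous (bK n) := by
  unfold bK; exact (continuous_const.mul (bJ_cont n)).sub (continuous_id.mul (bJ_cont _))

lemma bJ_deriv (n : ℕ) (x : ℝ) (hx : x ≠ 0) : HasDerivAt (bJ n) (bK n x / x) x := by
  have h1 : HasDerivAt (fun x : ℝ => x^2/4) (x/2) x := by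
    have := (hasDerivAt_pow 2 x).div_const 4
    refine this.congr_deriv ?_
    norm_num; ring
  have h2 : HasDerivAt (fun x : ℝ => (x/2)^n) (n * (x/2)^(n-1) * (1/2)) x := ((hasDerivAt_id x).div_const 2).pow n
  have h3 := h2.mul ((bg_deriv n (x^2/4)).comp x h1)
  refine h3.congr_deriv ?_
  unfold bK bJ
  simp only [Function.comp]
  rw [eq_div_iff hx]
  rcases n with _ | n
  · simp; ring
  · rw [Nat.add_sub_cancel]; push_cast; ring

lemma bJ_rec (n : ℕ) (x : ℝ) : x * bJ n x = 2 * (n+1) * bJ (n+1) x - x * bJ (n+2) x := by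
  unfold bJ
  rw [← bg_rec n (x^2/4)]; ring

lemma bK_succ (n : ℕ) (x : ℝ) : bK (n+1) x = x * bJ n x - (n+1) * bJ (n+1) x := by
  rw [bJ_rec]; unfold bK; push_cast; ring

lemma bK_deriv (n : ℕ) (x : ℝ) (hx : x ≠ 0) : HasDerivAt (bK n) (-((x^2-n^2)/x * bJ n x)) x := by
  have h := ((bJ_deriv n x hx).const_mul (n:ℝ)).sub ((hasDerivAt_id x).mul (bJ_deriv (n+1) x hx))
  refine h.congr_deriv ?_
  simp only [id]
  rw [bK_succ]; unfold bK; field_simp; ring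

lemma bJ_zero_succ (n : ℕ) : bJ (n+1) 0 = 0 := by simp [bJ]
lemma bJ_zero_zero : bJ 0 0 = 1 := by simp [bJ, bg_zero]
lemma bK_zero (n : ℕ) : bK n 0 = 0 := by
  unfold bK; rcases n with _ | n
  · simp
  · simp [bJ_zero_succ]

lemma bJ_pos_near (n : ℕ) (x : ℝ) (hx : 0 < x) : ∃ d, 0 < d ∧ d < x ∧ bJ n d ≠ 0 := by
  have h1 : ContinuousAt (fun d : ℝ => bg n (d^2/4)) 0 := ((bg_cont n).comp (fz)).continuousAt
  have h2 : ∀ᶠ d in nhds (0:ℝ), bg n (d^2/4) ≠ 0 := by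
    refine h1.eventually_ne ?_
    simp [bg_zero, Nat.factorial_ne_zero]
  obtain ⟨e, he, h⟩ := Metric.eventually_nhds_iff.1 h2
  refine ⟨min (e/2) (x/2), pz, by linarith [min_le_right (e/2) (x/2)], ?_⟩
  have h3 : 0 < min (e/2) (x/2) := pz
  refine mul_ne_zero (pz) (h ?_)
  rw [Real.dist_eq, sub_zero, abs_of_pos h3]
  linarith [min_le_left (e/2) (x/2)]

lemma bJK_deriv (n : ℕ) (x : ℝ) (hx : x ≠ 0) : HasDerivAt (fun x => bJ n x * bK n x)
    (bK n x^2/x + (n^2-x^2)/x * bJ n x^2) x := by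
  refine ((bJ_deriv n x hx).mul (bK_deriv n x hx)).congr_deriv ?_
  ring

lemma bJ2_deriv (n : ℕ) (x : ℝ) (hx : x ≠ 0) : HasDerivAt (fun x => bJ n x ^2)
    (2 * (bJ n x * bK n x) / x) x := by
  refine ((bJ_deriv n x hx).pow 2).congr_deriv ?_
  norm_num; field_simp

lemma bJK_nonneg (n : ℕ) (x : ℝ) (hx : 0 ≤ x) (hxn : x ≤ n) : 0 ≤ bJ n x * bK n x := by
  have hm : MonotoneOn (fun x => bJ n x * bK n x) (Icc 0 (n:ℝ)) := by
    refine monotoneOn_of_deriv_nonneg (convex_Icc _ _) ((bJ_cont n).mul (bK_cont n)).continuousOn ?_ ?_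
    · rw [interior_Icc]; intro y hy; exact (bJK_deriv n y hy.1.ne').differentiableAt.differentiableWithinAt
    · rw [interior_Icc]; intro y hy
      rw [(bJK_deriv n y hy.1.ne').deriv]
      have h1 := hy.1
      have h2 : 0 ≤ (n:ℝ)^2 - y^2 := by nlinarith [hy.2]
      positivity
  have := hm ⟨le_rfl, hx.trans hxn⟩ ⟨hx, hxn⟩ hx
  simpa [bK_zero] using this

lemma bJ_ne (n : ℕ) (x : ℝ) (hx : 0 < x) (hxn : x ≤ n) : bJ n x ≠ 0 := by
  have hm : MonotoneOn (fun x => bJ n x ^ 2) (Icc 0 (n:ℝ)) := by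
    refine monotoneOn_of_deriv_nonneg (convex_Icc _ _) ((bJ_cont n).pow 2).continuousOn ?_ ?_
    · rw [interior_Icc]; intro y hy; exact (bJ2_deriv n y hy.1.ne').differentiableAt.differentiableWithinAt
    · rw [interior_Icc]; intro y hy
      rw [(bJ2_deriv n y hy.1.ne').deriv]
      have h1 := hy.1
      have := bJK_nonneg n y h1.le hy.2.le
      positivity
  obtain ⟨d, hd, hdx, hJ⟩ := bJ_pos_near n x hx
  have := hm ⟨hd.le, hdx.le.trans hxn⟩ ⟨hx.le, hxn⟩ hdx.le
  intro h
  simp only [h] at this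
  norm_num at this; exact hJ this

lemma bK_ne (n : ℕ) (x : ℝ) (hx : 0 < x) (hxn : x ≤ n) : bK n x ≠ 0 := by
  have hm : StrictMonoOn (fun x => bJ n x * bK n x) (Icc 0 (n:ℝ)) := by
    refine strictMonoOn_of_deriv_pos (convex_Icc _ _) ((bJ_cont n).mul (bK_cont n)).continuousOn ?_
    rw [interior_Icc]; intro y hy
    rw [(bJK_deriv n y hy.1.ne').deriv]
    have h1 := hy.1
    have h2 : 0 < (n:ℝ)^2 - y^2 := by nlinarith [hy.2]
    have h3 := bJ_ne n y h1 hy.2.le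
    positivity
  have := hm ⟨le_rfl, hx.le.trans hxn⟩ ⟨hx.le, hxn⟩ hx
  intro h
  simp [bK_zero, h] at this

lemma bJ_n_ne (n : ℕ) : bJ n n ≠ 0 := by
  rcases n with _ | n
  · simp [bJ_zero_zero]
  · exact bJ_ne _ _ (pz) le_rfl

/-- abstract asymptotic integration -/
lemma wkb_abstract (a : ℝ) (v v' : ℝ → ℂ) (E E' : ℝ → ℝ)
    (hv : ∀ x, a < x → HasDerivAt v (v' x) x) (hE : ∀ x, a < x → HasDerivAt E (E' x) x)
    (hb : ∀ x, a < x → ‖v' x‖ ≤ -E' x * ‖v x‖) (hE0 : ∀ x, a < x → 0 ≤ E x)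
    (hEn : ∀ x, a < x → E' x ≤ 0) (hlim : Tendsto E atTop (nhds 0)) :
    ∃ w : ℂ, Tendsto v atTop (nhds w) ∧
      (∀ x, a < x → ‖v x - w‖ ≤ ‖w‖ * (E x * exp (E x))) ∧
      (∀ x, a < x → v x = 0 → w = 0) := by
  have hw : ∀ x, a < x → HasDerivAt (fun x => ‖v x‖^2) (2 * inner ℝ (v x) (v' x)) x := fun x hx => (hv x hx).norm_sq
  have hw' : ∀ x, a < x → |2 * inner ℝ (v x) (v' x)| ≤ 2 * (-E' x) * ‖v x‖^2 := by
    intro x hx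
    rw [abs_mul, abs_two]
    have h1 := abs_real_inner_le_norm (v x) (v' x)
    have h2 := mul_le_mul_of_nonneg_left (hb x hx) (norm_nonneg (v x))
    nlinarith
  have hg : ∀ (s : ℝ) x, a < x → HasDerivAt (fun x => ‖v x‖^2 * exp (s * E x))
      ((2 * inner ℝ (v x) (v' x) + s * E' x * ‖v x‖^2) * exp (s * E x)) x := by
    intro s x hx
    refine ((hw x hx).mul ((hE x hx).const_mul s).exp).congr_deriv ?_
    ring
  have m1 : AntitoneOn (fun x => ‖v x‖^2 * exp (2 * E x)) (Ioi a) := by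
    refine antitoneOn_of_deriv_nonpos (convex_Ioi a) (fun x hx => (hg 2 x hx).continuousAt.continuousWithinAt) ?_ ?_
    · rw [interior_Ioi]; exact fun x hx => (hg 2 x hx).differentiableAt.differentiableWithinAt
    · rw [interior_Ioi]; intro x hx; rw [(hg 2 x hx).deriv]
      have := (abs_le.1 (hw' x hx)).2
      exact mul_nonpos_of_nonpos_of_nonneg (lz) (exp_pos _).le
  have m2 : MonotoneOn (fun x => ‖v x‖^2 * exp (-2 * E x)) (Ioi a) := by
    refine monotoneOn_of_deriv_nonneg (convex_Ioi a) (fun x hx => (hg (-2) x hx).continuousAt.continuousWithinAt) ?_ ?_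
    · rw [interior_Ioi]; exact fun x hx => (hg (-2) x hx).differentiableAt.differentiableWithinAt
    · rw [interior_Ioi]; intro x hx; rw [(hg (-2) x hx).deriv]
      have := (abs_le.1 (hw' x hx)).1
      exact mul_nonneg (lz) (exp_pos _).le
  have sq2 : ∀ e : ℝ, exp (2*e) = exp e ^ 2 := fun e => by rw [← exp_nat_mul]; norm_num
  have sqm2 : ∀ e : ℝ, exp (-2*e) = exp (-e) ^ 2 := fun e => by rw [← exp_nat_mul]; norm_num
  have b1 : ∀ x y, a < x → x ≤ y → ‖v y‖ ≤ ‖v x‖ * exp (E x) := by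
    intro x y hx hxy
    have h := m1 hx (lt_of_lt_of_le hx hxy) hxy
    simp only [sq2, ← mul_pow] at h
    have h2 := (pow_le_pow_iff_left₀ (pz) (pz) two_ne_zero).1 h
    refine le_trans ?_ h2
    exact le_mul_of_one_le_right (norm_nonneg _) (one_le_exp (hE0 y (lz)))
  have b2 : ∀ x y, a < x → x ≤ y → ‖v x‖ ≤ ‖v y‖ * exp (E x) := by
    intro x y hx hxy
    have h := m2 hx (lt_of_lt_of_le hx hxy) hxy
    simp only [sqm2, ← mul_pow] at h
    have h2 := (pow_le_pow_iff_left₀ (pz) (pz) two_ne_zero).1 h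
    have h3 : ‖v y‖ * exp (-E y) ≤ ‖v y‖ := mul_le_of_le_one_right (norm_nonneg _) (exp_le_one_iff.2 (by linarith [hE0 y (lz)]))
    have h4 := h2.trans h3
    rw [exp_neg, ← div_eq_mul_inv, div_le_iff₀ (exp_pos _)] at h4
    exact h4
  have Eanti : AntitoneOn E (Ioi a) := by
    refine antitoneOn_of_deriv_nonpos (convex_Ioi a) (fun y hy => (hE y hy).continuousAt.continuousWithinAt) ?_ ?_
    · rw [interior_Ioi]; exact fun y hy => (hE y hy).differentiableAt.differentiableWithinAt
    · rw [interior_Ioi]; intro y hy; rw [(hE y hy).deriv]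
      exact hEn y hy
  have b3 : ∀ x Y, a < x → x ≤ Y → ‖v Y - v x‖ ≤ ‖v Y‖ * exp (E x) * E x := by
    intro x Y hx hxY
    have key := image_norm_le_of_norm_deriv_right_le_deriv_boundary' (f := fun y => v y - v x) (f' := v') (a := x) (b := Y)
      (B := fun y => ‖v Y‖ * exp (E x) * (E x - E y)) (B' := fun y => ‖v Y‖ * exp (E x) * (- E' y)) ?_ ?_ ?_ ?_ ?_ ?_
    · have h1 := key ⟨hxY, le_rfl⟩
      refine h1.trans ?_
      have := hE0 Y (lz)
      exact mul_le_mul_of_nonneg_left (lz) (pz)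
    · exact fun y hy => ((hv y (by linarith [hy.1])).continuousAt.sub continuousAt_const).continuousWithinAt
    · exact fun y hy => ((hv y (by linarith [hy.1])).sub_const _).hasDerivWithinAt
    · simp
    · exact fun y hy => ((continuousAt_const.sub (hE y (by linarith [hy.1])).continuousAt).const_mul _).continuousWithinAt
    · exact fun y hy => (((hE y (by linarith [hy.1])).const_sub _).const_mul _).hasDerivWithinAt
    · intro y hy
      have hy' : a < y := by linarith [hy.1]
      refine (hb y hy').trans ?_
      rw [mul_comm]
      refine mul_le_mul_of_nonneg_right ((b2 y Y hy' hy.2.le).trans ?_) (by linarith [hEn y hy'])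
      gcongr
      exact Eanti hx hy' hy.1
  have hc : CauchySeq v := by
    rw [Metric.cauchySeq_iff']
    intro ε hε
    set x0 := a + 1
    have hx0 : a < x0 := by simp [x0]
    set D := ‖v x0‖ * exp (E x0) * exp (E x0)
    have hD : 0 ≤ D := pz
    have h1 : ∀ᶠ x in atTop, E x < ε / (D + 1) := hlim.eventually_lt_const (pz)
    obtain ⟨N, hN1, hN2⟩ := (h1.and (eventually_ge_atTop x0)).exists
    refine ⟨N, fun y hy => ?_⟩
    rw [dist_eq_norm]
    have haN : a < N := lz
    refine (b3 N y haN hy).trans_lt ?_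
    have h3 : ‖v y‖ * exp (E N) ≤ D := mul_le_mul (b1 x0 y hx0 (lz)) (exp_le_exp.2 (Eanti hx0 haN hN2)) (exp_pos _).le (pz)
    calc _ ≤ D * E N := mul_le_mul_of_nonneg_right h3 (hE0 N haN)
      _ ≤ D * (ε / (D+1)) := by gcongr
      _ < (D+1) * (ε / (D+1)) := by
        have : 0 < ε / (D+1) := pz
        nlinarith
      _ = ε := by field_simp
  obtain ⟨w, hw⟩ := cauchySeq_tendsto_of_complete hc
  refine ⟨w, hw, ?_, ?_⟩
  · intro x hx
    have h1 : Tendsto (fun Y => ‖v Y - v x‖) atTop (nhds ‖w - v x‖) := (hw.sub_const _).norm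
    have h2 : Tendsto (fun Y => ‖v Y‖ * exp (E x) * E x) atTop (nhds (‖w‖ * exp (E x) * E x)) := (hw.norm.mul_const _).mul_const _
    have := le_of_tendsto_of_tendsto h1 h2 ((eventually_ge_atTop x).mono fun Y hY => b3 x Y hx hY)
    rw [norm_sub_rev] at this
    linarith
  · intro x hx h0
    refine tendsto_nhds_unique hw ?_
    refine tendsto_const_nhds.congr' ?_
    filter_upwards [eventually_ge_atTop x] with Y hY
    have := b1 x Y hx hY
    rw [h0, norm_zero, zero_mul] at this
    exact (norm_le_zero_iff.1 this).symm

noncomputable def qq (n : ℕ) (x : ℝ) : ℝ := √(√(x^2-n^2))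
noncomputable def ph (n : ℕ) (x : ℝ) : ℝ := √(x^2-n^2) - n * arccos (n/x)
noncomputable def zr (n : ℕ) (x : ℝ) : ℝ := qq n x * bJ n x
noncomputable def zi (n : ℕ) (x : ℝ) : ℝ := -(bK n x / qq n x + x^2 * bJ n x / (2 * qq n x^5))
noncomputable def vv (n : ℕ) (x : ℝ) : ℂ := ((zr n x : ℂ) + (zi n x : ℂ) * I) * cexp (-(ph n x : ℂ) * I)
noncomputable def EE (n : ℕ) (x : ℝ) : ℝ := (9/4) / qq n x^2 + (5/12) * n^2 / qq n x^6

lemma Qpos (n : ℕ) (x : ℝ) (hx : (n:ℝ) < x) : 0 < x^2 - n^2 := by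
  have : (0:ℝ) ≤ n := pz
  nlinarith

lemma qq_pos (n : ℕ) (x : ℝ) (hx : (n:ℝ) < x) : 0 < qq n x := by
  have := Qpos n x hx
  unfold qq; positivity

lemma qq_sq (n : ℕ) (x : ℝ) : qq n x ^ 2 = √(x^2-n^2) := by
  unfold qq; rw [sq_sqrt (sqrt_nonneg _)]

lemma qq_four (n : ℕ) (x : ℝ) (hx : (n:ℝ) < x) : qq n x ^ 4 = x^2-n^2 := by
  rw [show qq n x ^ 4 = (qq n x ^2)^2 by ring, qq_sq, sq_sqrt (Qpos n x hx).le]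

lemma xpos (n : ℕ) (x : ℝ) (hx : (n:ℝ) < x) : 0 < x := lt_of_le_of_lt (pz) hx

lemma qq_deriv (n : ℕ) (x : ℝ) (hx : (n:ℝ) < x) : HasDerivAt (qq n) (x / (2 * qq n x^3)) x := by
  have h1 : HasDerivAt (fun x : ℝ => x^2 - (n:ℝ)^2) (2*x) x := by
    simpa using (hasDerivAt_pow 2 x).sub_const ((n:ℝ)^2)
  have hQ := Qpos n x hx
  have h2 := (h1.sqrt hQ.ne').sqrt (pz)
  refine h2.congr_deriv ?_
  have hq := qq_pos n x hx
  change 2 * x / (2 * √(x^2-n^2)) / (2 * qq n x) = _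
  rw [← qq_sq]
  field_simp

lemma ph_deriv (n : ℕ) (x : ℝ) (hx : (n:ℝ) < x) : HasDerivAt (ph n) (qq n x^2/x) x := by
  have h1 : HasDerivAt (fun x : ℝ => x^2 - (n:ℝ)^2) (2*x) x := by
    simpa using (hasDerivAt_pow 2 x).sub_const ((n:ℝ)^2)
  have hQ := Qpos n x hx
  have x0 := xpos n x hx
  have hn : (0:ℝ) ≤ n := pz
  have h2 := h1.sqrt hQ.ne'
  have h3 : HasDerivAt (fun x : ℝ => (n:ℝ)/x) (-n/x^2) x := by
    refine ((hasDerivAt_const x (n:ℝ)).div (hasDerivAt_id x) x0.ne').congr_deriv ?_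
    simp
  have hlt : (n:ℝ)/x < 1 := (div_lt_one x0).2 hx
  have hnn : 0 ≤ (n:ℝ)/x := pz
  have h4 := (hasDerivAt_arccos (x := n/x) (lz) hlt.ne).comp x h3
  refine (h2.sub (h4.const_mul (n:ℝ))).congr_deriv ?_
  have h5 : √(1 - (n/x)^2) = qq n x^2 / x := by
    rw [qq_sq, show 1 - ((n:ℝ)/x)^2 = (x^2-n^2)/x^2 by field_simp, sqrt_div' _ (pz), sqrt_sq x0.le]
  rw [h5, ← qq_sq]
  have hq := qq_pos n x hx
  have h6 := qq_four n x hx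
  field_simp
  rw [h6]

lemma zr_deriv (n : ℕ) (x : ℝ) (hx : (n:ℝ) < x) : HasDerivAt (zr n) (-(qq n x^2/x) * zi n x) x := by
  have x0 := xpos n x hx
  have hq := qq_pos n x hx
  refine ((qq_deriv n x hx).mul (bJ_deriv n x x0.ne')).congr_deriv ?_
  unfold zi
  field_simp; ring

noncomputable def gg (n : ℕ) (x : ℝ) : ℝ := x / qq n x^6 - (5/4) * x^3 / qq n x^10

lemma zi_deriv (n : ℕ) (x : ℝ) (hx : (n:ℝ) < x) : HasDerivAt (zi n) ((qq n x^2/x) * zr n x - gg n x * zr n x) x := by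
  have x0 := xpos n x hx
  have hq := qq_pos n x hx
  have hK := (bK_deriv n x x0.ne').div (qq_deriv n x hx) hq.ne'
  have h5 : HasDerivAt (fun x => 2 * qq n x ^5) (5 * x * qq n x) x := by
    refine (((qq_deriv n x hx).pow 5).const_mul 2).congr_deriv ?_
    norm_num; field_simp
  have h2 : HasDerivAt (fun x : ℝ => x^2) (2*x) x := by simpa using hasDerivAt_pow 2 x
  have hJ := (h2.mul (bJ_deriv n x x0.ne')).div h5 (pz)
  refine (hK.add hJ).neg.congr_deriv ?_
  unfold gg zr
  simp only [Pi.mul_apply]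
  rw [← qq_four n x hx]
  field_simp; ring

lemma vv_deriv (n : ℕ) (x : ℝ) (hx : (n:ℝ) < x) : HasDerivAt (vv n)
    (-((gg n x * zr n x : ℝ) : ℂ) * I * cexp (-(ph n x : ℂ) * I)) x := by
  have h1 := (zr_deriv n x hx).ofReal_comp.add ((zi_deriv n x hx).ofReal_comp.mul_const I)
  have h2 := ((ph_deriv n x hx).ofReal_comp.neg.mul_const I).cexp
  refine (h1.mul h2).congr_deriv ?_
  push_cast
  simp only [Pi.add_apply, Pi.neg_apply]
  linear_combination -(qq n x^2/x * zi n x : ℂ) * cexp (-(ph n x : ℂ) * I) * Complex.I_mul_I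

lemma EE_deriv (n : ℕ) (x : ℝ) (hx : (n:ℝ) < x) : HasDerivAt (EE n)
   (-((9/4) * x / qq n x^6 + (5/4) * n^2 * x / qq n x^10)) x := by
  have hq := qq_pos n x hx
  have h1 := ((hasDerivAt_const x (9/4:ℝ)).div ((qq_deriv n x hx).pow 2) (pow_ne_zero _ hq.ne'))
  have h2 := ((hasDerivAt_const x ((5/12:ℝ) * n^2)).div ((qq_deriv n x hx).pow 6) (pow_ne_zero _ hq.ne'))
  refine (h1.add h2).congr_deriv ?_
  simp only [Pi.pow_apply]
  norm_num
  field_simp; ring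

lemma vv_norm (n : ℕ) (x : ℝ) : ‖vv n x‖ = √(zr n x^2 + zi n x^2) := by
  unfold vv
  rw [norm_mul, ← ofReal_neg, norm_exp_ofReal_mul_I, mul_one, Complex.norm_add_mul_I]

lemma zr_le (n : ℕ) (x : ℝ) : |zr n x| ≤ ‖vv n x‖ := by
  rw [vv_norm]; exact abs_le_sqrt (by nlinarith [sq_nonneg (zi n x)])

lemma qq_tendsto (n : ℕ) : Tendsto (qq n) atTop atTop := by
  unfold qq
  refine tendsto_sqrt_atTop.comp (tendsto_sqrt_atTop.comp ?_)
  exact Filter.tendsto_atTop_add_const_right _ _ (tendsto_pow_atTop (nz))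

lemma EE_tendsto (n : ℕ) : Tendsto (EE n) atTop (nhds 0) := by
  have h : ∀ k, k ≠ 0 → Tendsto (fun x => qq n x ^ k) atTop atTop := fun k hk =>
    (tendsto_pow_atTop hk).comp (qq_tendsto n)
  have := ((h 2 (nz)).const_div_atTop (9/4)).add ((h 6 (nz)).const_div_atTop ((5/12)*(n:ℝ)^2))
  unfold EE; simpa using this

theorem wkb (n : ℕ) : ∃ w : ℂ, w ≠ 0 ∧ Tendsto (vv n) atTop (nhds w) ∧
    (∀ x, (n:ℝ) < x → ‖vv n x - w‖ ≤ ‖w‖ * (EE n x * exp (EE n x))) ∧ (∀ x, (n:ℝ) < x → vv n x ≠ 0) := by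
  have key := wkb_abstract n (vv n) _ (EE n) _ (vv_deriv n) (EE_deriv n)
  obtain ⟨w, hw, hb, h0⟩ := (by
    refine key ?_ ?_ ?_ (EE_tendsto n)
    · intro x hx
      have x0 := xpos n x hx
      have hq := qq_pos n x hx
      rw [norm_mul, norm_mul, norm_I, norm_neg, ← ofReal_neg, norm_exp_ofReal_mul_I, mul_one, mul_one, norm_real, norm_mul, norm_eq_abs, norm_eq_abs, neg_neg]
      refine mul_le_mul ?_ (zr_le n x) (abs_nonneg _) (pz)
      unfold gg
      have h3 : (5/4) * x^3 / qq n x^10 = (5/4) * x / qq n x^6 + (5/4) * n^2 * x / qq n x^10 := by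
        have : x^3 = (qq n x^4 + n^2) * x := by rw [qq_four n x hx]; ring
        rw [this]; field_simp
      have h1 : 0 ≤ x / qq n x^6 := pz
      have h2 : 0 ≤ (5/4) * x^3 / qq n x^10 := pz
      have h4 : (5/4) * x / qq n x^6 = (5/4) * (x / qq n x^6) := rz
      have h5 : (9/4) * x / qq n x^6 = (9/4) * (x / qq n x^6) := rz
      rw [abs_le]
      constructor <;> linarith
    · intro x hx
      unfold EE; positivity
    · intro x hx
      have x0 := xpos n x hx
      have hq := qq_pos n x hx
      rw [neg_nonpos]; positivity :
    ∃ w : ℂ, Tendsto (vv n) atTop (nhds w) ∧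
      (∀ x, (n:ℝ) < x → ‖vv n x - w‖ ≤ ‖w‖ * (EE n x * exp (EE n x))) ∧
      (∀ x, (n:ℝ) < x → vv n x = 0 → w = 0))
  have hne : w ≠ 0 := by
    intro h
    have hJ : ∀ x, (n:ℝ) < x → bJ n x = 0 := by
      intro x hx
      have h1 := hb x hx
      rw [h, norm_zero, zero_mul, sub_zero] at h1
      have h2 := (zr_le n x).trans h1
      have h3 : zr n x = 0 := abs_eq_zero.1 (le_antisymm h2 (abs_nonneg _))
      exact (mul_eq_zero.1 h3).resolve_left (qq_pos n x hx).ne'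
    have hc : Tendsto (bJ n) (nhdsWithin (n:ℝ) (Ioi n)) (nhds (bJ n n)) := (bJ_cont n).continuousAt.mono_left nhdsWithin_le_nhds
    have hc0 : Tendsto (bJ n) (nhdsWithin (n:ℝ) (Ioi n)) (nhds 0) := by
      refine tendsto_const_nhds.congr' ?_
      filter_upwards [self_mem_nhdsWithin] with x hx using (hJ x hx).symm
    exact bJ_n_ne n (tendsto_nhds_unique hc hc0)
  exact ⟨w, hne, hw, hb, fun x hx h => hne (h0 x hx h)⟩

noncomputable def yy (n : ℕ) (x : ℝ) : ℂ :=
  ((√x * bJ n x : ℝ) - (bK n x / √x : ℝ) * I) * cexp (-(x - n * (π/2) : ℝ) * I)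

lemma qx_tendsto (n : ℕ) : Tendsto (fun x => qq n x / √x) atTop (nhds 1) := by
  have h1 : Tendsto (fun x : ℝ => 1 - (n:ℝ)^2 / x^2) atTop (nhds 1) := by
    have := ((tendsto_pow_atTop (α := ℝ) (n := 2) (nz)).const_div_atTop ((n:ℝ)^2)).const_sub 1
    simpa using this
  have h2 := h1.sqrt.sqrt
  simp only [sqrt_one] at h2
  refine h2.congr' ?_
  filter_upwards [eventually_gt_atTop 0] with x hx
  unfold qq
  rw [show 1 - (n:ℝ)^2/x^2 = (x^2-n^2)/x^2 by field_simp, sqrt_div' _ (pz), sqrt_sq hx.le, sqrt_div' _ hx.le]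

lemma ph_tendsto (n : ℕ) : Tendsto (fun x => ph n x - (x - n * (π/2))) atTop (nhds 0) := by
  have h1 : Tendsto (fun x : ℝ => (n:ℝ) / x) atTop (nhds 0) := Tendsto.const_div_atTop tendsto_id _
  have h2 := (continuous_arccos.tendsto 0).comp h1
  have h3 : Tendsto (fun x : ℝ => √(x^2-n^2) - x) atTop (nhds 0) := by
    have h4 : Tendsto (fun x : ℝ => (n:ℝ)^2 / x) atTop (nhds 0) := Tendsto.const_div_atTop tendsto_id _
    refine squeeze_zero_norm' ?_ h4
    filter_upwards [eventually_gt_atTop (n:ℝ)] with x hx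
    have x0 := xpos n x hx
    have hQ := Qpos n x hx
    have hs := sq_sqrt hQ.le
    have hle : √(x^2-n^2) ≤ x := by nlinarith [sq_nonneg (n:ℝ)]
    rw [norm_eq_abs, abs_of_nonpos (lz), le_div_iff₀ x0]
    nlinarith [sqrt_nonneg (x^2-n^2)]
  have h5 := h3.add ((h2.const_sub (π/2)).const_mul (n:ℝ))
  rw [arccos_zero, sub_self, mul_zero, add_zero] at h5
  refine h5.congr fun x => ?_
  unfold ph
  grind

lemma zbound (n : ℕ) (w : ℂ) (h : Tendsto (vv n) atTop (nhds w)) :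
    ∀ᶠ x in atTop, |zr n x| ≤ ‖w‖ + 1 ∧ |zi n x| ≤ ‖w‖ + 1 := by
  have := h.norm.eventually_lt_const (show ‖w‖ < ‖w‖ + 1 by linarith)
  filter_upwards [this] with x hx
  have h2 : |zi n x| ≤ ‖vv n x‖ := by
    rw [vv_norm]; exact abs_le_sqrt (by nlinarith [sq_nonneg (zr n x)])
  exact ⟨(zr_le n x).trans hx.le, h2.trans hx.le⟩

lemma yy_tendsto (n : ℕ) (w : ℂ) (h : Tendsto (vv n) atTop (nhds w)) :
    Tendsto (yy n) atTop (nhds w) := by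
  have hz := zbound n w h
  have hq := qx_tendsto n
  have hp := ph_tendsto n
  have h1 : Tendsto (fun x => vv n x * cexp (((ph n x - (x - n * (π/2)) : ℝ) : ℂ) * I)) atTop (nhds w) := by
    have h2 : Tendsto (fun x => cexp (((ph n x - (x - n * (π/2)) : ℝ) : ℂ) * I)) atTop (nhds 1) := by
      have h3 : Continuous (fun t : ℝ => cexp ((t:ℂ) * I)) := fz
      have := (h3.tendsto 0).comp hp
      simp only [Complex.ofReal_zero, zero_mul, Complex.exp_zero] at this
      exact this
    simpa using h.mul h2
  have hq6 : Tendsto (fun x => x^2 / qq n x ^ 6) atTop (nhds 0) := by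
    have a1 := (hq.pow 4).inv₀ (nz)
    have a2 : Tendsto (fun x => 1 / qq n x ^ 2) atTop (nhds 0) :=
      ((tendsto_pow_atTop (n := 2) (nz)).comp (qq_tendsto n)).const_div_atTop 1
    have := a1.mul a2
    rw [mul_zero] at this
    refine this.congr' ?_
    filter_upwards [eventually_gt_atTop (n:ℝ)] with x hx
    have x0 := xpos n x hx
    have hs : √x ^ 4 = x^2 := by rw [show √x ^ 4 = (√x^2)^2 by ring, sq_sqrt x0.le]
    rw [div_pow, hs]
    field_simp
  have e1 : Tendsto (fun x => |(qq n x / √x)⁻¹ - 1| * (‖w‖+1) + (|qq n x / √x - 1| * (‖w‖+1) + |qq n x / √x| * (x^2 / qq n x^6) * (‖w‖+1))) atTop (nhds 0) := by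
    have b1 := ((hq.inv₀ one_ne_zero).sub_const 1).abs.mul_const (‖w‖+1)
    have b2 := (hq.sub_const 1).abs.mul_const (‖w‖+1)
    have b3 := (hq.abs.mul hq6).mul_const (‖w‖+1)
    have := b1.add (b2.add b3)
    simpa using this
  have h3 : Tendsto (fun x => yy n x - vv n x * cexp (((ph n x - (x - n * (π/2)) : ℝ) : ℂ) * I)) atTop (nhds 0) := by
    refine squeeze_zero_norm' ?_ e1
    filter_upwards [eventually_gt_atTop (n:ℝ), hz] with x hx hz
    have hqp := qq_pos n x hx
    have e2 : yy n x - vv n x * cexp (((ph n x - (x - n * (π/2)) : ℝ) : ℂ) * I) =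
      ((((qq n x / √x)⁻¹ - 1) * zr n x : ℝ) + (((qq n x / √x - 1) * zi n x + (qq n x / √x) * (x^2/qq n x^6) * zr n x/2 : ℝ)) * I) * cexp (-(x - n * (π/2) : ℝ) * I) := by
      have e3 : cexp (-(ph n x : ℂ) * I) * cexp (((ph n x - (x - n * (π/2)) : ℝ) : ℂ) * I) = cexp (-(x - n * (π/2) : ℝ) * I) := by
        rw [← Complex.exp_add]; congr 1; push_cast; ring
      unfold yy vv
      rw [mul_assoc, e3, ← sub_mul]
      congr 1
      have r1 : √x * bJ n x = (qq n x / √x)⁻¹ * zr n x := by unfold zr; field_simp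
      have r2 : bK n x / √x = -((qq n x / √x) * zi n x + (qq n x / √x) * (x^2/qq n x^6) * zr n x/2) := by
        unfold zi zr; field_simp; ring
      rw [r1, r2]; push_cast; ring
    rw [e2, norm_mul, ← ofReal_neg, norm_exp_ofReal_mul_I, mul_one]
    refine (norm_add_le _ _).trans ?_
    rw [norm_mul, norm_I, mul_one, norm_real, norm_real, norm_eq_abs, norm_eq_abs]
    refine add_le_add ?_ ((abs_add_le _ _).trans (add_le_add ?_ ?_))
    · rw [abs_mul]; gcongr; exact hz.1
    · rw [abs_mul]; gcongr; exact hz.2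
    · rw [abs_div, abs_mul, abs_mul, abs_of_nonneg (pz : 0 ≤ x^2/qq n x^6), abs_two]
      refine (half_le_self (pz)).trans ?_
      gcongr; exact hz.1
  have := h1.add h3
  rw [add_zero] at this
  refine this.congr fun x => rz

lemma yy_bound (n : ℕ) (x : ℝ) : |√x * bJ n x| ≤ ‖yy n x‖ := by
  unfold yy
  rw [norm_mul, ← ofReal_neg, norm_exp_ofReal_mul_I, mul_one, sub_eq_add_neg, ← neg_mul, ← ofReal_neg, Complex.norm_add_mul_I]
  exact abs_le_sqrt (by nlinarith [sq_nonneg (-(bK n x / √x))])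

lemma yy_succ (n : ℕ) (w w' : ℂ) (h : Tendsto (yy n) atTop (nhds w))
   (h' : Tendsto (yy (n+1)) atTop (nhds w')) : w' = w := by
  have hx : Tendsto (fun x : ℝ => (n+1) / x) atTop (nhds 0) := Tendsto.const_div_atTop tendsto_id _
  have h1 := (hx.mul h.norm).add (hx.mul h'.norm)
  rw [zero_mul, zero_mul, add_zero] at h1
  have h2 : Tendsto (fun x => yy (n+1) x - yy n x) atTop (nhds 0) := by
    refine squeeze_zero_norm' ?_ h1
    filter_upwards [eventually_gt_atTop 0] with x x0
    have e1 : yy (n+1) x - yy n x = ((-((n+1)/x * (√x * bJ (n+1) x)) : ℝ) + (n / x * (√x * bJ n x) : ℝ) * I) * cexp (-(x - n * (π/2) : ℝ) * I) := by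
      unfold yy
      have e2 : cexp (-(x - (n+1:ℕ) * (π/2) : ℝ) * I) = I * cexp (-(x - n * (π/2) : ℝ) * I) := by
        nth_rewrite 2 [← Complex.exp_pi_div_two_mul_I]
        rw [← Complex.exp_add]; congr 1; push_cast; ring
      have r1 : √x * bJ (n+1) x = n/x * (√x * bJ n x) - bK n x / √x := by
        unfold bK; grind
      have r2 : bK (n+1) x / √x = √x * bJ n x - (n+1)/x * (√x * bJ (n+1) x) := by
        rw [bK_succ]; field_simp
        rw [sq_sqrt x0.le]; ring
      rw [e2, r2, ← mul_assoc, ← sub_mul]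
      congr 1
      rw [show ((√x * bJ (n+1) x : ℝ) : ℂ) = ((n/x * (√x * bJ n x) - bK n x / √x : ℝ) : ℂ) by rw [r1]]
      push_cast
      linear_combination -(√x * bJ n x - (n+1)/x * (√x * bJ (n+1) x) : ℂ) * Complex.I_mul_I
    rw [e1, norm_mul, ← ofReal_neg, norm_exp_ofReal_mul_I, mul_one]
    refine (norm_add_le _ _).trans ?_
    rw [norm_mul, norm_I, mul_one, norm_real, norm_real, norm_eq_abs, norm_eq_abs, abs_neg, add_comm]
    refine add_le_add ?_ ?_
    · rw [abs_mul, abs_of_nonneg (pz)]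
      refine mul_le_mul ?_ (yy_bound n x) (abs_nonneg _) (pz)
      gcongr; linarith
    · rw [abs_mul, abs_of_nonneg (pz)]
      exact mul_le_mul_of_nonneg_left (yy_bound _ x) (pz)
  have h3 := h'.sub h
  exact sub_eq_zero.1 (tendsto_nhds_unique h3 h2)

lemma gexp_le (b : ℂ) (hb : 0 ≤ b.re) (s : ℝ) : ‖cexp (-b * s^2)‖ ≤ 1 := by
  rw [Complex.norm_exp, ← Complex.ofReal_pow]
  simp only [Complex.mul_re, Complex.neg_re, Complex.ofReal_re, Complex.ofReal_im, mul_zero, sub_zero]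
  rw [exp_le_one_iff]
  nlinarith [sq_nonneg s, mul_nonneg hb (sq_nonneg s)]

lemma gauss_tail (b : ℂ) (hb : 0 ≤ b.re) (hb0 : b ≠ 0) (X Y : ℝ) (hX : 0 < X) (hXY : X ≤ Y) :
    ‖∫ s in X..Y, cexp (-b * (s:ℂ)^2)‖ ≤ 1 / (‖b‖ * X) := by
  have hc : Continuous (fun s : ℝ => cexp (-b * (s:ℂ)^2)) := fz
  have hbn : 0 < ‖b‖ := norm_pos_iff.2 hb0
  let P : ℝ → ℂ := fun y => (∫ s in X..y, cexp (-b * (s:ℂ)^2)) + cexp (-b * (y:ℂ)^2) * (1 / (2 * b * y)) - cexp (-b * (X:ℂ)^2) * (1 / (2 * b * X))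
  have hd : ∀ y : ℝ, 0 < y → HasDerivAt P (-(cexp (-b * (y:ℂ)^2) * (1/(2 * b * y^2)))) y := by
    intro y hy
    have hy' : (y:ℂ) ≠ 0 := by exact_mod_cast hy.ne'
    have h1 : HasDerivAt (fun y => ∫ s in X..y, cexp (-b * (s:ℂ)^2)) (cexp (-b * (y:ℂ)^2)) y :=
      intervalIntegral.integral_hasDerivAt_right (hc.intervalIntegrable _ _)
        (hc.stronglyMeasurableAtFilter _ _) hc.continuousAt
    have h2 : HasDerivAt (fun y : ℝ => (y:ℂ)^2) (2 * y) y := by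
      have := (hasDerivAt_id y).ofReal_comp.pow 2
      refine this.congr_deriv ?_
      simp
    have h3 := (h2.const_mul (-b)).cexp
    have h4 : HasDerivAt (fun y : ℝ => (1 / (2 * b * y) : ℂ)) (-(1 / (2 * b * y^2))) y := by
      have := ((hasDerivAt_id y).ofReal_comp.const_mul (2 * b)).fun_inv (by simp [hy.ne', hb0])
      simp only [one_div]
      refine this.congr_deriv ?_
      simp only [id, Complex.ofReal_one]; field_simp
    have := (h1.add (h3.mul h4)).sub_const (cexp (-b * (X:ℂ)^2) * (1 / (2 * b * X)))
    refine this.congr_deriv ?_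
    field_simp; ring
  have hB : ‖P Y‖ ≤ (1/(2*‖b‖)) * (1/X - 1/Y) := by
    refine image_norm_le_of_norm_deriv_right_le_deriv_boundary' (x := Y) (f := P) (f' := fun y : ℝ => -(cexp (-b * (y:ℂ)^2) * (1/(2 * b * y^2))))
      (a := X) (b := Y) (B := fun y => (1/(2*‖b‖)) * (1/X - 1/y)) (B' := fun y => (1/(2*‖b‖)) * (1/y^2))
      (fun y hy => (hd y (by linarith [hy.1])).continuousAt.continuousWithinAt)
      (fun y hy => (hd y (by linarith [hy.1])).hasDerivWithinAt) ?_ ?_ ?_ ?_ (right_mem_Icc.2 hXY)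
    · simp [P]
    · refine continuousOn_const.mul (continuousOn_const.sub (continuousOn_const.div continuousOn_id ?_))
      intro y hy; exact (show (0:ℝ) < y by linarith [hy.1]).ne'
    · intro y hy
      have hy0 : y ≠ 0 := by linarith [hy.1]
      have := ((hasDerivAt_inv hy0).const_sub (1/X)).const_mul (1/(2*‖b‖))
      simp only [one_div, neg_neg] at this ⊢
      exact this.hasDerivWithinAt
    · intro y hy
      rw [norm_neg, norm_mul]
      refine (mul_le_of_le_one_left (norm_nonneg _) (gexp_le b hb y)).trans ?_
      simp
      exact (mul_comm _ _).le
  have hY0 : 0 < Y := lz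
  have e : (∫ s in X..Y, cexp (-b * (s:ℂ)^2)) = P Y - cexp (-b * (Y:ℂ)^2) * (1 / (2 * b * Y)) + cexp (-b * (X:ℂ)^2) * (1 / (2 * b * X)) := by
    simp only [P]; ring
  have n1 : ∀ y : ℝ, 0 < y → ‖cexp (-b * (y:ℂ)^2) * (1 / (2 * b * y))‖ ≤ 1/(2*‖b‖) * (1/y) := by
    intro y hy
    rw [norm_mul]
    refine (mul_le_of_le_one_left (norm_nonneg _) (gexp_le b hb y)).trans ?_
    simp [abs_of_pos hy]
    exact (mul_comm _ _).le
  rw [e]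
  have := norm_add_le_of_le (norm_sub_le_of_le hB (n1 Y hY0)) (n1 X hX)
  refine this.trans (le_of_eq ?_)
  field_simp; ring

lemma gauss_sym (b : ℂ) (X : ℝ) : (∫ s in -X..X, cexp (-b * (s:ℂ)^2)) = 2 * ∫ s in (0:ℝ)..X, cexp (-b * (s:ℂ)^2) := by
  have hc : Continuous (fun s : ℝ => cexp (-b * (s:ℂ)^2)) := fz
  rw [← integral_add_adjacent_intervals (hc.intervalIntegrable (-X) 0) (hc.intervalIntegrable 0 X)]
  have := intervalIntegral.integral_comp_neg (a := 0) (b := X) (fun s : ℝ => cexp (-b * (s:ℂ)^2))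
  simp only [ofReal_neg, neg_sq, neg_zero] at this
  rw [← this]; ring

lemma gauss_re (b : ℂ) (hb : 0 < b.re) (X : ℝ) (hX : 0 < X) :
    ‖(∫ s in -X..X, cexp (-b * (s:ℂ)^2)) - (π / b)^(1/2:ℂ)‖ ≤ 2 / (‖b‖ * X) := by
  have hb0 : b ≠ 0 := by intro h; simp [h] at hb
  have hc : Continuous (fun s : ℝ => cexp (-b * (s:ℂ)^2)) := fz
  have h1 := MeasureTheory.intervalIntegral_tendsto_integral (integrable_cexp_neg_mul_sq hb) Filter.tendsto_neg_atTop_atBot tendsto_id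
  rw [integral_gaussian_complex hb] at h1
  have h2 := (h1.const_sub (∫ s in -X..X, cexp (-b * (s:ℂ)^2))).norm
  refine le_of_tendsto h2 ?_
  filter_upwards [eventually_ge_atTop X] with Y hY
  simp only [id]
  rw [gauss_sym, gauss_sym, ← mul_sub, intervalIntegral.integral_interval_sub_left (hc.intervalIntegrable _ _) (hc.intervalIntegrable _ _), norm_mul, intervalIntegral.integral_symm, norm_neg]
  have := gauss_tail b hb.le hb0 X Y hX hY
  simp only [Complex.norm_ofNat]
  calc _ ≤ 2 * (1 / (‖b‖ * X)) := by gcongr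
    _ = _ := rz

lemma gauss_im (x : ℝ) (hx : 0 < x) (X : ℝ) (hX : 0 < X) :
    ‖(∫ s in -X..X, cexp (-(x * I) * (s:ℂ)^2)) - (π / (x * I))^(1/2:ℂ)‖ ≤ 2 / (x * X) := by
  let B : ℝ → ℂ := fun e => e + x * I
  have hB : Continuous B := fz
  have hF : Continuous (fun e => ∫ s in -X..X, cexp (-(B e) * (s:ℂ)^2)) := by
    refine intervalIntegral.continuous_parametric_intervalIntegral_of_continuous' ?_ _ _
    fun_prop
  have hxI : (x * I : ℂ) ≠ 0 := by simp [hx.ne']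
  have h1 : Tendsto (fun e => (π / B e)^(1/2:ℂ)) (nhdsWithin 0 (Ioi 0)) (nhds ((π / (x * I))^(1/2:ℂ))) := by
    have hB0 : B 0 = x * I := by simp [B]
    have : ContinuousAt (fun e => (π / B e)^(1/2:ℂ)) 0 := by
      refine ContinuousAt.cpow (continuousAt_const.div hB.continuousAt (by rw [hB0]; exact hxI)) continuousAt_const ?_
      right
      rw [hB0, show (π / (x * I) : ℂ) = ((-(π / x) : ℝ) : ℂ) * I by
        push_cast
        have : (x:ℂ) ≠ 0 := by exact_mod_cast hx.ne'
        field_simp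
        simp]
      simp [hx.ne', pi_ne_zero]
    have h := this.tendsto.mono_left (nhdsWithin_le_nhds (s := Ioi 0))
    rwa [hB0] at h
  have h2 := (hF.tendsto 0).mono_left (nhdsWithin_le_nhds (s := Ioi 0))
  have h3 := (h2.sub h1).norm
  have h4 : Tendsto (fun e => 2 / (‖B e‖ * X)) (nhdsWithin 0 (Ioi 0)) (nhds (2 / (‖B 0‖ * X))) := by
    have hB0 : B 0 = x * I := by simp [B]
    have : ContinuousAt (fun e => 2 / (‖B e‖ * X)) 0 := by
      refine continuousAt_const.div (fz) ?_
      rw [hB0]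
      exact mul_ne_zero (norm_ne_zero_iff.2 hxI) hX.ne'
    exact this.tendsto.mono_left nhdsWithin_le_nhds
  have h5 := le_of_tendsto_of_tendsto h3 h4 ?_
  · simpa [B, abs_of_pos hx] using h5
  · filter_upwards [self_mem_nhdsWithin] with e he
    exact gauss_re (B e) (by simpa [B] using he) X hX

lemma sin_moment (j : ℕ) : (∫ x in 0..π, sin x ^ (2*j)) = π * ((2*j).factorial / (4^j * (j.factorial:ℝ)^2)) := by
  rw [integral_sin_pow_even]
  congr 1
  induction j with
  | zero => simp
  | succ k ih =>
    rw [Finset.prod_range_succ, ih, show 2*(k+1) = 2*k+1+1 by ring, factorial_succ, factorial_succ, factorial_succ]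
    push_cast
    field_simp
    ring

lemma series_int (x : ℝ) (p : ℕ) (F : ℕ → ℝ → ℝ) (f : ℝ → ℝ) (c : ℕ → ℝ)
    (hF : ∀ j t, F j t = c j * (x^(2*j+p) / (2*j+p).factorial * sin t ^ (2*(j+p)))) (hc : ∀ j, |c j| ≤ 1)
    (hf : ∀ t, HasSum (fun j => F j t) (f t)) :
    HasSum (fun j => c j * (x^(2*j+p) / (2*j+p).factorial * (π * ((2*(j+p)).factorial / (4^(j+p) * ((j+p).factorial:ℝ)^2)))))
      (∫ t in 0..π, f t) := by
  have hs : Summable (fun j : ℕ => |x|^(2*j+p) / (2*j+p).factorial) :=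
    (Real.summable_pow_div_factorial |x|).comp_injective (i := fun j : ℕ => 2*j+p) (fun a b h => by simpa using h)
  have := intervalIntegral.hasSum_integral_of_dominated_convergence (a := 0) (b := π) (μ := volume)
    (F := F) (f := f) (fun (j : ℕ) (_ : ℝ) => |x|^(2*j+p) / (2*j+p).factorial) ?_ ?_ ?_ ?_ ?_
  · refine this.congr_fun fun j => ?_
    simp only [hF, integral_const_mul, sin_moment]
  · intro j
    have : Continuous (F j) := by
      rw [show F j = fun t => c j * (x^(2*j+p) / (2*j+p).factorial * sin t ^ (2*(j+p))) from funext (hF j)]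
      fun_prop
    exact this.aestronglyMeasurable
  · intro j
    refine Filter.Eventually.of_forall fun t _ => ?_
    rw [hF, norm_mul, norm_mul, norm_div, norm_pow, norm_pow, Real.norm_natCast, norm_eq_abs, norm_eq_abs, norm_eq_abs]
    have h1 : |sin t|^(2*(j+p)) ≤ 1 := pow_le_one₀ (abs_nonneg _) (abs_sin_le_one t)
    have h2 := hc j
    calc _ ≤ 1 * (|x|^(2*j+p) / (2*j+p).factorial * 1) := by gcongr
      _ = _ := rz
  · simp_all
  · simp
  simp_all

lemma bJ0_int (x : ℝ) : π * bJ 0 x = ∫ t in 0..π, cos (x * sin t) := by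
  have h := series_int x 0 (fun j t => (-1)^j * (x * sin t)^(2*j) / (2*j).factorial) (fun t => cos (x * sin t)) (fun j => (-1)^j)
    (fun j t => rz) (fun j => sz) (fun t => Real.hasSum_cos _)
  rw [← h.tsum_eq]
  unfold bJ bg
  rw [pow_zero, one_mul, ← tsum_mul_left]
  refine tsum_congr fun j => ?_
  simp only [add_zero, gterm, zero_add]
  rw [neg_pow, div_pow, ← pow_mul]
  field_simp

lemma bJ1_int (x : ℝ) : π * bJ 1 x = ∫ t in 0..π, sin t * sin (x * sin t) := by
  have h := series_int x 1 (fun j t => sin t * ((-1)^j * (x * sin t)^(2*j+1) / (2*j+1).factorial)) (fun t => sin t * sin (x * sin t)) (fun j => (-1)^j)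
    (fun j t => rz) (fun j => sz) (fun t => (Real.hasSum_sin _).mul_left _)
  rw [← h.tsum_eq]
  unfold bJ bg
  rw [← mul_assoc, ← tsum_mul_left]
  refine tsum_congr fun j => ?_
  simp only [gterm]
  rw [neg_pow, div_pow (x^2), ← pow_mul, show 2*(j+1) = 2*j+1+1 by ring, factorial_succ (2*j+1), add_comm 1 j, factorial_succ j]
  push_cast
  field_simp
  ring

lemma shift_int (f : ℝ → ℝ) : (∫ t in 0..π, f (sin t)) = ∫ t in -(π/2)..(π/2), f (cos t) := by
  have := intervalIntegral.integral_comp_add_right (a := -(π/2)) (b := π/2) (fun t => f (sin t)) (π/2)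
  simp only [sin_add_pi_div_two] at this
  rw [this]; congr 1 <;> ring

lemma parts_osc (h h' : ℝ → ℝ) (hd : ∀ t ∈ Icc (-(π/2)) (π/2), HasDerivAt h (h' t) t)
    (hc : ContinuousOn h' (Icc (-(π/2)) (π/2))) : ∃ C : ℝ, ∀ x : ℝ, x ≠ 0 →
    ‖∫ t in -(π/2)..(π/2), ((h t * sin t : ℝ) : ℂ) * cexp ((x * cos t : ℝ) * I)‖ ≤ C / |x| := by
  have hI : uIcc (-(π/2)) (π/2) = Icc (-(π/2)) (π/2) := uIcc_of_le (by linarith [pi_pos])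
  refine ⟨|h (π/2)| + |h (-(π/2))| + ∫ t in -(π/2)..(π/2), |h' t|, fun x hx => ?_⟩
  have key := intervalIntegral.integral_mul_deriv_eq_deriv_mul (a := -(π/2)) (b := π/2)
    (u := fun t => ((h t : ℝ) : ℂ)) (u' := fun t => ((h' t : ℝ):ℂ))
    (v := fun t => cexp ((x * cos t : ℝ) * I))
    (v' := fun t => cexp ((x * cos t : ℝ) * I) * (((x * -sin t : ℝ) : ℂ) * I))
    (fun t ht => (hd t (hI ▸ ht)).ofReal_comp)
    (fun t _ => (((hasDerivAt_cos t).const_mul x).ofReal_comp.mul_const I).cexp)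
    (by apply ContinuousOn.intervalIntegrable; rw [hI]; exact Complex.continuous_ofReal.comp_continuousOn hc) (by apply Continuous.intervalIntegrable; fun_prop)
  have e : (∫ t in -(π/2)..(π/2), ((h t : ℝ) : ℂ) * (cexp ((x * cos t : ℝ) * I) * (((x * -sin t : ℝ) : ℂ) * I)))
     = (-(x * I)) * ∫ t in -(π/2)..(π/2), ((h t * sin t : ℝ) : ℂ) * cexp ((x * cos t : ℝ) * I) := by
    rw [← integral_const_mul]
    congr 1; ext t; push_cast; ring
  rw [e] at key
  have h3 := congrArg norm key
  rw [norm_mul, norm_neg, norm_mul, norm_I, mul_one, norm_real, norm_eq_abs] at h3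
  rw [le_div_iff₀ (abs_pos.2 hx), mul_comm, h3]
  refine norm_sub_le_of_le (norm_sub_le_of_le ?_ ?_) ?_
  · rw [norm_mul, norm_exp_ofReal_mul_I, mul_one, norm_real, norm_eq_abs]
  · rw [norm_mul, norm_exp_ofReal_mul_I, mul_one, norm_real, norm_eq_abs]
  · refine (intervalIntegral.norm_integral_le_integral_norm (by linarith [pi_pos])).trans (le_of_eq ?_)
    congr 1; ext t
    rw [norm_mul, norm_exp_ofReal_mul_I, mul_one, norm_real, norm_eq_abs]

lemma cos_half_ne (t c : ℝ) (hc : 0 ≤ c) (hc1 : c ≤ 1/2) (ht : t ∈ Icc (-(π/2)) (π/2)) : cos (t * c) ≠ 0 := by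
  refine (cos_pos_of_mem_Ioo ⟨?_, ?_⟩).ne' <;> nlinarith [ht.1, ht.2, pi_pos]

lemma osc1 : ∃ C : ℝ, ∀ x : ℝ, x ≠ 0 →
    ‖∫ t in -(π/2)..(π/2), ((1 - cos (t*(1/2)) : ℝ) : ℂ) * cexp ((x * cos t : ℝ) * I)‖ ≤ C / |x| := by
  have hne : ∀ t ∈ Icc (-(π/2)) (π/2), 2 * (cos (t*(1/4)) * cos (t * (1/2))) ≠ 0 := fun t ht =>
    mul_ne_zero two_ne_zero (mul_ne_zero (cos_half_ne t _ (nz) (nz) ht) (cos_half_ne t _ (nz) le_rfl ht))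
  have hl : ∀ (c t : ℝ), HasDerivAt (fun t : ℝ => t * c) c t := fun c t => by simpa using (hasDerivAt_id t).mul_const c
  obtain ⟨C, hC⟩ := parts_osc (fun t => sin (t*(1/4)) / (2 * (cos (t*(1/4)) * cos (t * (1/2))))) _
    (fun t ht => (hl (1/4) t).sin.div (((hl (1/4) t).cos.mul (hl (1/2) t).cos).const_mul 2) (hne t ht))
    (by refine ContinuousOn.div (fz) (fz) fun t ht => pow_ne_zero _ (hne t ht))
  refine ⟨C, fun x hx => ?_⟩
  rw [← intervalIntegral.integral_congr (g := fun t => ((1 - cos (t*(1/2)) : ℝ) : ℂ) * cexp ((x * cos t : ℝ) * I)) ?_]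
  · exact hC x hx
  · rw [uIcc_of_le (by linarith [pi_pos])]
    intro t ht
    congr 2
    have e1 : sin t = 2 * (2 * sin (t*(1/4)) * cos (t*(1/4))) * cos (t*(1/2)) := by
      rw [← sin_two_mul, show 2*(t*(1/4)) = t*(1/2) by ring, ← sin_two_mul]; congr 1; ring
    have e2 : cos (t*(1/2)) = 1 - 2 * sin (t*(1/4))^2 := by
      rw [show t*(1/2) = 2*(t*(1/4)) by ring, cos_two_mul, cos_sq']; ring
    grind

lemma osc2 : ∃ C : ℝ, ∀ x : ℝ, x ≠ 0 →
    ‖∫ t in -(π/2)..(π/2), ((1 - cos t : ℝ) : ℂ) * cexp ((x * cos t : ℝ) * I)‖ ≤ C / |x| := by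
  have hl : ∀ (c t : ℝ), HasDerivAt (fun t : ℝ => t * c) c t := fun c t => by simpa using (hasDerivAt_id t).mul_const c
  have hne : ∀ t ∈ Icc (-(π/2)) (π/2), cos (t * (1/2)) ≠ 0 := fun t ht => cos_half_ne t _ (nz) le_rfl ht
  obtain ⟨C, hC⟩ := parts_osc (fun t => sin (t*(1/2)) / cos (t * (1/2))) _
    (fun t ht => (hl (1/2) t).sin.div (hl (1/2) t).cos (hne t ht))
    (by refine ContinuousOn.div (fz) (fz) fun t ht => pow_ne_zero _ (hne t ht))
  refine ⟨C, fun x hx => ?_⟩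
  rw [← intervalIntegral.integral_congr (g := fun t => ((1 - cos t : ℝ) : ℂ) * cexp ((x * cos t : ℝ) * I)) ?_]
  · exact hC x hx
  · rw [uIcc_of_le (by linarith [pi_pos])]
    intro t ht
    simp only
    congr 2
    have h0 := hne t ht
    have e1 : sin t = 2 * sin (t*(1/2)) * cos (t*(1/2)) := by
      rw [← sin_two_mul]; congr 1; ring
    have e2 : cos t = 1 - 2 * sin (t*(1/2))^2 := by
      nth_rewrite 1 [show t = 2*(t*(1/2)) by ring]
      rw [cos_two_mul, cos_sq']; ring
    rw [div_mul_eq_mul_div, div_eq_iff h0, e1, e2]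
    ring

lemma main_osc (x : ℝ) : (∫ t in -(π/2)..(π/2), ((cos (t*(1/2)) : ℝ) : ℂ) * cexp ((x * cos t : ℝ) * I))
   = cexp (x * I) * ∫ s in -√2..√2, cexp (-((x/2:ℝ) * I) * (s:ℂ)^2) := by
  have hd : ∀ t, HasDerivAt (fun t : ℝ => 2 * sin (t*(1/2))) (cos (t*(1/2))) t := fun t => by
    have hl : HasDerivAt (fun t : ℝ => t * (1/2)) (1/2) t := by simpa using (hasDerivAt_id t).mul_const (1/2:ℝ)
    refine (hl.sin.const_mul 2).congr_deriv (rz)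
  have key := intervalIntegral.integral_deriv_smul_comp (a := -(π/2)) (b := π/2) (f := fun t : ℝ => 2 * sin (t*(1/2))) (f' := fun t => cos (t*(1/2)))
    (g := fun s : ℝ => cexp (-((x/2:ℝ) * I) * (s:ℂ)^2)) (fun t _ => hd t) (fz) (fz)
  have e1 : 2 * sin (π/2*(1/2)) = √2 := by rw [show π/2*(1/2) = π/4 by ring, sin_pi_div_four]; ring
  have e2 : 2 * sin (-(π/2)*(1/2)) = -√2 := by rw [show -(π/2)*(1/2) = -(π/4) by ring, sin_neg, sin_pi_div_four]; ring
  rw [e1, e2] at key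
  rw [← key, ← integral_const_mul]
  congr 1; ext t
  simp only [Function.comp, Complex.real_smul]
  rw [mul_left_comm, ← Complex.exp_add]
  congr 2
  have e3 : cos t = 1 - 2 * sin (t*(1/2))^2 := by
    nth_rewrite 1 [show t = 2*(t*(1/2)) by ring]
    rw [cos_two_mul, cos_sq']; ring
  rw [e3]; push_cast; ring

lemma gauss_val (x : ℝ) (hx : 0 < x) : (√x : ℂ) * (π / ((x/2:ℝ) * I))^(1/2:ℂ) = (√(2*π) : ℝ) * cexp (-(π/4:ℝ) * I) := by
  have hx' : (x:ℂ) ≠ 0 := by exact_mod_cast hx.ne'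
  have hr : 0 < 2*π/x := pz
  have e1 : (π / ((x/2:ℝ) * I) : ℂ) = ((2*π/x : ℝ) : ℂ) * (-I) := by
    push_cast; field_simp; simp
  have hne : (((2*π/x : ℝ) : ℂ) * (-I)) ≠ 0 := mul_ne_zero (by exact_mod_cast hr.ne') (sz)
  rw [e1, Complex.cpow_def_of_ne_zero hne, Complex.log_ofReal_mul hr (sz), Complex.log_neg_I]
  rw [show ((Real.log (2*π/x) : ℝ) + -(π/2) * I) * (1/2:ℂ) = ((Real.log (2*π/x)/2 : ℝ) : ℂ) + -(π/4:ℝ) * I by push_cast; ring]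
  rw [Complex.exp_add, ← mul_assoc, ← Complex.ofReal_exp, exp_half, exp_log hr, ← Complex.ofReal_mul, ← sqrt_mul hx.le, mul_div_cancel₀ _ hx.ne']

lemma bJ01 : ∃ C : ℝ, ∀ x : ℝ, 0 < x → ‖π * ((bJ 0 x : ℂ) + bJ 1 x * I) -
    cexp (x * I) * ∫ s in -√2..√2, cexp (-((x/2:ℝ) * I) * (s:ℂ)^2)‖ ≤ C / x := by
  obtain ⟨C1, h1⟩ := osc1
  obtain ⟨C2, h2⟩ := osc2
  refine ⟨C1 + C2, fun x hx => ?_⟩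
  have a1 := h1 x hx.ne'
  have a2 := h2 x hx.ne'
  have a3 := h2 (-x) (neg_ne_zero.2 hx.ne')
  rw [abs_neg] at a3
  rw [abs_of_pos hx] at a1 a2 a3
  have e0 : (π * bJ 0 x : ℝ) = ∫ t in -(π/2)..(π/2), cos (x * cos t) := by
    rw [bJ0_int, shift_int (fun s => cos (x * s))]
  have e1 : (π * bJ 1 x : ℝ) = ∫ t in -(π/2)..(π/2), cos t * sin (x * cos t) := by
    rw [bJ1_int, shift_int (fun s => s * sin (x * s))]
  have hII : ∀ f : ℝ → ℂ, Continuous f → IntervalIntegrable f volume (-(π/2)) (π/2) := fun f hf => hf.intervalIntegrable _ _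
  have e2 : π * ((bJ 0 x : ℂ) + bJ 1 x * I) -
    cexp (x * I) * ∫ s in -√2..√2, cexp (-((x/2:ℝ) * I) * (s:ℂ)^2)
    = (∫ t in -(π/2)..(π/2), ((1 - cos (t*(1/2)) : ℝ) : ℂ) * cexp ((x * cos t : ℝ) * I))
      - (1/2) * (∫ t in -(π/2)..(π/2), ((1 - cos t : ℝ) : ℂ) * cexp ((x * cos t : ℝ) * I))
      + (1/2) * (∫ t in -(π/2)..(π/2), ((1 - cos t : ℝ) : ℂ) * cexp ((-x * cos t : ℝ) * I)) := by
    rw [← main_osc, mul_add, ← mul_assoc, ← Complex.ofReal_mul, ← Complex.ofReal_mul, e0, e1, ← intervalIntegral.integral_ofReal, ← intervalIntegral.integral_ofReal,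
      ← intervalIntegral.integral_mul_const, ← integral_const_mul, ← integral_const_mul,
      ← intervalIntegral.integral_add (hII _ (fz)) (hII _ (fz)),
      ← intervalIntegral.integral_sub (hII _ (fz)) (hII _ (fz)),
      ← intervalIntegral.integral_sub (hII _ (fz)) (hII _ (fz)),
      ← intervalIntegral.integral_add (hII _ (fz)) (hII _ (fz))]
    congr 1; ext t
    rw [neg_mul, Complex.exp_ofReal_mul_I, Complex.exp_ofReal_mul_I, cos_neg, sin_neg]
    push_cast; ring
  rw [e2]
  refine (norm_add_le_of_le (norm_sub_le_of_le a1 (?_ : _ ≤ C2 / x / 2)) (?_ : _ ≤ C2 / x / 2)).trans (le_of_eq ?_)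
  · rw [norm_mul, show ‖(1/2:ℂ)‖ = 1/2 by norm_num]; linarith
  · rw [norm_mul, show ‖(1/2:ℂ)‖ = 1/2 by norm_num]; linarith
  · ring

noncomputable def rho : ℝ := √(2*π)/π
lemma rho_pos : 0 < rho := by unfold rho; positivity

lemma yy0_tendsto : Tendsto (yy 0) atTop (nhds (rho * cexp (-(π/4:ℝ) * I))) := by
  obtain ⟨C, hC⟩ := bJ01
  rw [tendsto_iff_norm_sub_tendsto_zero]
  have h0 : Tendsto (fun x : ℝ => (C + 4/√2)/π / √x) atTop (nhds 0) := (tendsto_sqrt_atTop).const_div_atTop _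
  refine squeeze_zero' (Filter.Eventually.of_forall fun _ => norm_nonneg _) ?_ h0
  filter_upwards [eventually_gt_atTop 0] with x hx
  have a1 := hC x hx
  have a2 := gauss_im (x/2) (pz) (√2) (pz)
  have hs : 0 < √x := sqrt_pos.2 hx
  have hss : √x * √x = x := mul_self_sqrt hx.le
  set G := ∫ s in -√2..√2, cexp (-((x/2:ℝ) * I) * (s:ℂ)^2) with hG
  have ex : cexp (x * I) * cexp (-x * I) = 1 := by
    rw [← Complex.exp_add]; simp
  have e : yy 0 x - rho * cexp (-(π/4:ℝ) * I) =
     (√x / π : ℝ) * ((π * ((bJ 0 x : ℂ) + bJ 1 x * I) - cexp (x * I) * G) * cexp (-x * I)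
       + (G - (π / ((x/2:ℝ) * I))^(1/2:ℂ))) := by
    have e1 := gauss_val x hx
    have e2 : yy 0 x = √x * ((bJ 0 x : ℂ) + bJ 1 x * I) * cexp (-x * I) := by
      unfold yy bK
      have : ((0:ℕ) * bJ 0 x - x * bJ (0+1) x) / √x = -(√x * bJ 1 x) := by
        field_simp
        rw [sq_sqrt hx.le]; ring
      rw [this]; push_cast; ring
    rw [e2]
    have e3 : (rho:ℂ) * cexp (-(π/4:ℝ) * I) = (√x / π) * (π / ((x/2:ℝ) * I))^(1/2:ℂ) := by
      rw [div_mul_eq_mul_div, e1]; unfold rho; push_cast; ring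
    rw [e3]
    push_cast
    generalize cexp (x * I) = ea at ex ⊢
    generalize cexp (-x * I) = eb at ex ⊢
    field_simp
    linear_combination (√x:ℂ) * G * ex
  rw [e, norm_mul, norm_real, Real.norm_of_nonneg (pz)]
  have n1 : ‖(π * ((bJ 0 x : ℂ) + bJ 1 x * I) - cexp (x * I) * G) * cexp (-x * I)‖ ≤ C / x := by
    rw [norm_mul, ← ofReal_neg, norm_exp_ofReal_mul_I, mul_one]; exact a1
  calc _ ≤ √x / π * (C / x + 2 / (x/2 * √2)) := by
        gcongr; exact norm_add_le_of_le n1 a2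
    _ = _ := by
        rw [show x = √x * √x from hss.symm]
        rw [sqrt_mul_self hs.le]
        field_simp; ring

/-- the amplitude and phase are the same for all orders -/
theorem vv_limit (n : ℕ) : Tendsto (vv n) atTop (nhds (rho * cexp (-(π/4:ℝ) * I))) := by
  have key : Tendsto (yy n) atTop (nhds (rho * cexp (-(π/4:ℝ) * I))) := by
    induction n with
    | zero => exact yy0_tendsto
    | succ n ih =>
      obtain ⟨w, _, h1, _⟩ := wkb (n+1)
      have h2 := yy_tendsto _ _ h1
      rw [← yy_succ n _ _ ih h2]; exact h2
  obtain ⟨w, _, h1, _⟩ := wkb n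
  have h2 := yy_tendsto _ _ h1
  rwa [tendsto_nhds_unique h2 key] at h1

/-- the error size -/
noncomputable def er (n : ℕ) (x : ℝ) : ℝ := 5 * (x^2 / qq n x^6)

lemma JK_ne (n : ℕ) (x : ℝ) (hx : 0 < x) (h1 : bJ n x = 0) (h2 : bK n x = 0) : False := by
  rcases le_or_gt x n with h | h
  · exact bJ_ne n x hx h h1
  · obtain ⟨w, _, _, _, h3⟩ := wkb n
    refine h3 x h ?_
    simp [vv, zr, zi, h1, h2]

lemma er_pos (n : ℕ) (x : ℝ) (hx : (n:ℝ) < x) : 0 < er n x := by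
  have := qq_pos n x hx; have := xpos n x hx
  unfold er; positivity

lemma JK_asymp (n : ℕ) (x : ℝ) (hx : (n:ℝ) < x) (he : er n x ≤ 1/4) :
    |bJ n x - (rho / qq n x) * cos (ph n x - π/4)| ≤ (rho / qq n x) * er n x ∧
    |bK n x + (rho * qq n x) * sin (ph n x - π/4)| ≤ (rho * qq n x) * er n x := by
  obtain ⟨w, _, h1, h2, _⟩ := wkb n
  have hw := tendsto_nhds_unique h1 (vv_limit n)
  have h3 := h2 x hx
  have hq := qq_pos n x hx
  have x0 := xpos n x hx
  have hr := rho_pos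
  have hwn : ‖w‖ = rho := by
    rw [hw, norm_mul, ← ofReal_neg, norm_exp_ofReal_mul_I, mul_one, norm_real, norm_of_nonneg hr.le]
  set s := x^2 / qq n x^6 with hs
  have hs0 : 0 < s := pz
  have hes : er n x = 5 * s := rfl
  have hE : EE n x ≤ (8/3) * s := by
    unfold EE
    have e1 : (9/4) / qq n x^2 = (9/4) * (x^2 - n^2) / qq n x^6 := by
      rw [← qq_four n x hx]; field_simp
    rw [e1, hs, ← add_div, ← mul_div_assoc]
    gcongr
    have : (n:ℝ)^2 ≤ x^2 := by have := Qpos n x hx; linarith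
    nlinarith
  have hE0 : 0 ≤ EE n x := by unfold EE; positivity
  have hd : EE n x * exp (EE n x) ≤ 4 * s := by
    have : exp (EE n x) ≤ 3/2 := by
      have h4 : EE n x ≤ 1/3 := lz
      have := exp_bound_div_one_sub_of_interval hE0 (lz)
      refine this.trans ?_
      rw [div_le_div_iff₀ (lz) (nz)]; linarith
    calc _ ≤ ((8/3) * s) * (3/2) := by gcongr
      _ = 4 * s := rz
  set a := ph n x - π/4 with ha
  have h5 : ‖((zr n x - rho * cos a : ℝ) : ℂ) + ((zi n x - rho * sin a : ℝ) : ℂ) * I‖ ≤ rho * (4 * s) := by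
    have e : ((zr n x - rho * cos a : ℝ) : ℂ) + ((zi n x - rho * sin a : ℝ) : ℂ) * I =
        (vv n x - w) * cexp (ph n x * I) := by
      have e2 : rho * cexp (-(π/4:ℝ) * I) * cexp (ph n x * I) = rho * cexp (a * I) := by
        rw [mul_assoc, ← Complex.exp_add, ha]; congr 2; push_cast; ring
      have e3 : cexp (-(ph n x : ℂ) * I) * cexp (ph n x * I) = 1 := by
        rw [← Complex.exp_add]; simp
      rw [hw, sub_mul, e2]
      unfold vv
      rw [mul_assoc, e3, Complex.exp_ofReal_mul_I]; push_cast; ring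
    rw [e, norm_mul, norm_exp_ofReal_mul_I, mul_one]
    rw [hwn] at h3
    exact h3.trans (by gcongr)
  have h6 : |zr n x - rho * cos a| ≤ rho * (4*s) := by
    refine le_trans ?_ h5
    rw [Complex.norm_add_mul_I]; exact abs_le_sqrt (by nlinarith [sq_nonneg (zi n x - rho * sin a)])
  have h7 : |zi n x - rho * sin a| ≤ rho * (4*s) := by
    refine le_trans ?_ h5
    rw [Complex.norm_add_mul_I]; exact abs_le_sqrt (by nlinarith [sq_nonneg (zr n x - rho * cos a)])
  rw [hes] at he ⊢
  constructor
  · have e : bJ n x - rho / qq n x * cos a = (zr n x - rho * cos a) / qq n x := by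
      unfold zr; field_simp
    rw [e, abs_div, abs_of_pos hq, div_mul_eq_mul_div]
    gcongr
    refine h6.trans (by gcongr; linarith)
  · have e : bK n x + rho * qq n x * sin a = qq n x * (-(zi n x - rho * sin a) - s/2 * (zr n x)) := by
      unfold zi zr; rw [hs]; field_simp; ring
    rw [e, abs_mul, abs_of_pos hq, mul_comm rho (qq n x), mul_assoc]
    refine mul_le_mul_of_nonneg_left ?_ hq.le
    have h8 : |zr n x| ≤ rho * 2 := by
      have h9 : |rho * cos a| ≤ rho := by
        rw [abs_mul, abs_of_pos hr]; have := abs_cos_le_one a; nlinarith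
      have := abs_le.1 h6; have := abs_le.1 h9
      rw [abs_le]; constructor <;> nlinarith
    calc |-(zi n x - rho * sin a) - s/2 * zr n x| ≤ |-(zi n x - rho * sin a)| + |s/2 * zr n x| := abs_sub _ _
      _ ≤ rho * (4*s) + s/2 * (rho * 2) := by
          rw [abs_neg, abs_mul, abs_of_pos (show 0 < s/2 by positivity)]; gcongr
      _ = rho * (5*s) := rz

lemma er_tendsto (n : ℕ) : Tendsto (er n) atTop (nhds 0) := by
  have h := EE_tendsto n
  have h2 : Tendsto (fun x => (1:ℝ) / qq n x ^ 2) atTop (nhds 0) :=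
    ((tendsto_pow_atTop (nz)).comp (qq_tendsto n)).const_div_atTop 1
  have h6 : Tendsto (fun x => (n:ℝ)^2 / qq n x ^ 6) atTop (nhds 0) :=
    ((tendsto_pow_atTop (nz)).comp (qq_tendsto n)).const_div_atTop _
  have := (h2.add h6).const_mul 5
  simp only [add_zero, mul_zero] at this
  refine this.congr' ?_
  filter_upwards [eventually_gt_atTop (n:ℝ)] with x hx
  have hq := qq_pos n x hx
  unfold er
  rw [show x^2 = qq n x^4 + n^2 by rw [qq_four n x hx]; ring]
  field_simp

/-- the error decreases -/
lemma er_anti (n : ℕ) (x y : ℝ) (hx : (n:ℝ) < x) (hxy : x ≤ y) : er n y ≤ er n x := by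
  have hy : (n:ℝ) < y := lt_of_lt_of_le hx hxy
  have hq := qq_pos n x hx
  have hqy := qq_pos n y hy
  have hqq : qq n x ≤ qq n y := by unfold qq; have := xpos n x hx; gcongr
  have e : ∀ z, (n:ℝ) < z → er n z = 5 * (1 / qq n z^2 + n^2 / qq n z^6) := by
    intro z hz
    have hq := qq_pos n z hz
    unfold er
    rw [show z^2 = qq n z^4 + n^2 by rw [qq_four n z hz]; ring]
    field_simp
  rw [e x hx, e y hy]
  gcongr

/-- once nonpositive, stays negative, within one half-period -/
lemma neg_persist (g g' γ A B e : ℝ → ℝ) (p t : ℝ) (hpt : p < t)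
    (hg : ∀ x ∈ Icc p t, HasDerivAt g (g' x) x) (hmono : MonotoneOn γ (Icc p t))
    (hA : ∀ x ∈ Icc p t, 0 < A x) (hB : ∀ x ∈ Icc p t, 0 < B x) (he : ∀ x ∈ Icc p t, e x ≤ 1/4)
    (h1 : ∀ x ∈ Icc p t, |g x - A x * cos (γ x)| ≤ A x * e x)
    (h2 : ∀ x ∈ Icc p t, |g' x + B x * sin (γ x)| ≤ B x * e x)
    (hp0 : 0 ≤ γ p) (ht : γ t ≤ π) (hgp : g p ≤ 0) : g t < 0 := by
  by_contra hcon
  push Not at hcon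
  have mp : p ∈ Icc p t := ⟨le_rfl, hpt.le⟩
  have mt : t ∈ Icc p t := ⟨hpt.le, le_rfl⟩
  have c1 : cos (γ p) ≤ 1/4 := by
    have a1 := (abs_le.1 (h1 p mp)).1
    have a2 := hA p mp
    have a3 := he p mp
    by_contra hc; push Not at hc
    nlinarith
  have c2 : -(1/4) ≤ cos (γ t) := by
    have a1 := (abs_le.1 (h1 t mt)).2
    have a2 := hA t mt
    have a3 := he t mt
    by_contra hc; push Not at hc
    nlinarith
  have hanti : StrictAntiOn g (Icc p t) := by
    refine strictAntiOn_of_hasDerivWithinAt_neg (convex_Icc _ _) (fun x hx => (hg x hx).continuousAt.continuousWithinAt)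
      (f' := g') (fun x hx => (hg x (interior_subset hx)).hasDerivWithinAt) ?_
    intro x hx
    have hx := interior_subset hx
    have g1 := hmono mp hx hx.1
    have g2 := hmono hx mt hx.2
    have k1 : cos (γ x) ≤ 1/4 := (cos_le_cos_of_nonneg_of_le_pi hp0 (g2.trans ht) g1).trans c1
    have k2 : -(1/4) ≤ cos (γ x) := c2.trans (cos_le_cos_of_nonneg_of_le_pi (hp0.trans g1) ht g2)
    have k3 : 0 ≤ sin (γ x) := sin_nonneg_of_nonneg_of_le_pi (hp0.trans g1) (g2.trans ht)
    have k4 : 1/2 < sin (γ x) := by nlinarith [sin_sq_add_cos_sq (γ x)]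
    have a1 := (abs_le.1 (h2 x hx)).2
    have a2 := hB x hx
    have a3 := he x hx
    nlinarith
  have := hanti mp mt hpt
  linarith

/-- the number of zeros in `(0,x)` -/
noncomputable def zc (f : ℝ → ℝ) (x : ℝ) : ℕ := ({z | 0 < z ∧ z < x ∧ f z = 0} : Set ℝ).ncard

structure OscData (f f' β A B e : ℝ → ℝ) (X : ℝ) : Prop where
  X0 : 0 < X
  hf : ∀ x, X ≤ x → HasDerivAt f (f' x) x
  hmono : StrictMonoOn β (Ici X)
  hcont : ContinuousOn β (Ici X)
  hlim : Tendsto β atTop atTop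
  hA : ∀ x, X ≤ x → 0 < A x
  hB : ∀ x, X ≤ x → 0 < B x
  he : ∀ x, X ≤ x → e x ≤ 1/4
  he0 : ∀ x, X ≤ x → 0 < e x
  h1 : ∀ x, X ≤ x → |f x - A x * cos (β x)| ≤ A x * e x
  h2 : ∀ x, X ≤ x → |f' x + B x * sin (β x)| ≤ B x * e x
  fin : ∀ x, ({z | 0 < z ∧ z < x ∧ f z = 0} : Set ℝ).Finite

lemma sgn_sq (k : ℤ) : ((-1:ℝ)^k)*((-1:ℝ)^k) = 1 := by
  rw [← mul_zpow]; norm_num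

lemma sgn_ne (k : ℤ) : ((-1:ℝ)^k) ≠ 0 := zpow_ne_zero _ (nz)

lemma OscData.persist {f f' β A B e : ℝ → ℝ} {X : ℝ} (D : OscData f f' β A B e X) (k : ℤ) (p t : ℝ) (hp : X ≤ p) (hpt : p < t)
    (h0 : k * π ≤ β p) (h1 : β t ≤ (k+1) * π) (hg : (-1)^k * f p ≤ 0) : (-1)^k * f t < 0 := by
  have habs : |(-1:ℝ)^k| = 1 := sz
  refine neg_persist (fun x => (-1)^k * f x) (fun x => (-1)^k * f' x) (fun x => β x - k*π) A B e p t hpt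
    (fun x hx => (D.hf x (hp.trans hx.1)).const_mul _) ?_ (fun x hx => D.hA x (hp.trans hx.1)) (fun x hx => D.hB x (hp.trans hx.1))
    (fun x hx => D.he x (hp.trans hx.1)) ?_ ?_ (lz) (lz) hg
  · intro x hx y hy hxy
    have := D.hmono.monotoneOn (hp.trans hx.1) (hp.trans hy.1) hxy
    simpa using this
  · intro x hx
    have := D.h1 x (hp.trans hx.1)
    rw [cos_sub_int_mul_pi, show (-1)^k * f x - A x * ((-1)^k * cos (β x)) = (-1)^k * (f x - A x * cos (β x)) by ring, abs_mul, habs, one_mul]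
    exact this
  · intro x hx
    have := D.h2 x (hp.trans hx.1)
    rw [sin_sub_int_mul_pi, show (-1)^k * f' x + B x * ((-1)^k * sin (β x)) = (-1)^k * (f' x + B x * sin (β x)) by ring, abs_mul, habs, one_mul]
    exact this

lemma OscData.cell {f f' β A B e : ℝ → ℝ} {X : ℝ} (D : OscData f f' β A B e X) (k : ℤ) (x y : ℝ) (hx : X ≤ x) (hxy : x < y)
    (h0 : k * π ≤ β x) (h1 : β y = (k+1) * π) :
    (0 ≤ (-1)^k * f x → zc f y = zc f x + 1) ∧ ((-1)^k * f x < 0 → zc f y = zc f x) := by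
  have x0 : 0 < x := D.X0.trans_le hx
  have hXy := hx.trans hxy.le
  have hfy : (-1)^k * f y < 0 := by
    have a1 := D.h1 y hXy
    have a2 := D.hA y hXy
    have a3 := D.he y hXy
    have e1 : cos (β y) = -(-1)^k := by
      rw [h1, show ((k:ℝ)+1)*π = ((k+1:ℤ):ℝ) * π by push_cast; ring, cos_int_mul_pi, zpow_add₀ (nz)]; simp
    rw [e1] at a1
    have a4 := abs_le.1 a1
    rcases Int.even_or_odd k with hk | hk
    · rw [hk.neg_one_zpow] at a4 ⊢; nlinarith
    · rw [hk.neg_one_zpow] at a4 ⊢; nlinarith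
  have hz : ∀ z, f z = 0 → (-1:ℝ)^k * f z = 0 := fun z h => by rw [h, mul_zero]
  have hle : ∀ z, x ≤ z → z ≤ y → k * π ≤ β z ∧ β z ≤ (k+1)*π := fun z h h' =>
    ⟨h0.trans (D.hmono.monotoneOn hx (hx.trans h) h), (D.hmono.monotoneOn (hx.trans h) hXy h').trans h1.le⟩
  constructor
  · intro hpos
    have hc : ContinuousOn (fun z => (-1)^k * f z) (Icc x y) := fun z hz =>
      ((D.hf z (hx.trans hz.1)).continuousAt.const_mul _).continuousWithinAt
    obtain ⟨z, hz1, hz2⟩ := intermediate_value_Icc' hxy.le hc (show (0:ℝ) ∈ Icc _ _ from ⟨hfy.le, hpos⟩)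
    have hfz : f z = 0 := (mul_eq_zero.1 hz2).resolve_left (sgn_ne k)
    have : ({z | 0 < z ∧ z < y ∧ f z = 0} : Set ℝ) = insert z {z | 0 < z ∧ z < x ∧ f z = 0} := by
      ext t; constructor
      · rintro ⟨t0, t1, t2⟩
        rcases lt_or_ge t x with h | h
        · grind
        · left
          rcases lt_trichotomy t z with h' | h' | h'
          · have := D.persist k t z (hx.trans h) h' (hle t h t1.le).1 (hle z hz1.1 hz1.2).2 (hz t t2).le
            linarith [hz z hfz]
          · exact h'
          · have := D.persist k z t (hx.trans hz1.1) h' (hle z hz1.1 hz1.2).1 (hle t h t1.le).2 (hz z hfz).le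
            linarith [hz t t2]
      grind
    unfold zc
    rw [this, ncard_insert_of_notMem _ (D.fin x)]
    grind
  · intro hneg
    unfold zc; congr 1
    ext t; constructor
    · rintro ⟨t0, t1, t2⟩
      refine ⟨t0, ?_, t2⟩
      by_contra h; push Not at h
      rcases h.eq_or_lt with rfl | h
      · linarith [hz _ t2]
      · have := D.persist k x t hx h h0 (hle t h.le t1.le).2 hneg.le
        linarith [hz _ t2]
    grind

lemma OscData.reach {f f' β A B e : ℝ → ℝ} {X : ℝ} (D : OscData f f' β A B e X) (x s : ℝ) (hx : X ≤ x) (h : β x < s) :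
    ∃ y, x < y ∧ β y = s := by
  obtain ⟨T, hT⟩ := (D.hlim.eventually_gt_atTop s).exists_forall_of_atTop
  have hc : ContinuousOn β (Icc x (max x T)) := D.hcont.mono fun z hz => hx.trans hz.1
  obtain ⟨y, hy, h2⟩ := intermediate_value_Icc (le_max_left x T) hc (show s ∈ Icc _ _ from ⟨h.le, (hT _ (le_max_right _ _)).le⟩)
  grind

theorem OscData.count {f f' β A B e : ℝ → ℝ} {X : ℝ} (D : OscData f f' β A B e X) :
    ∃ c : ℤ, ∀ x, X ≤ x → ⌊β x / π + 1/2 - e x⌋ + c ≤ zc f x ∧ (zc f x : ℤ) ≤ ⌊β x / π + 1/2 + e x⌋ + c := by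
  have hpi := pi_pos
  have hpos : ∀ (k : ℤ) x, X ≤ x → β x = k * π → 0 ≤ (-1)^k * f x := by
    intro k x hx h
    have a1 := D.h1 x hx
    have a2 := D.hA x hx
    have a3 := D.he x hx
    rw [h, cos_int_mul_pi] at a1
    have a4 := abs_le.1 a1
    rcases Int.even_or_odd k with hk | hk
    · rw [hk.neg_one_zpow] at a4 ⊢; nlinarith
    · rw [hk.neg_one_zpow] at a4 ⊢; nlinarith
  obtain ⟨k0, hk0, hk0'⟩ : ∃ k0 : ℤ, β X < k0 * π ∧ k0 = ⌊β X / π⌋ + 1 := by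
    refine ⟨⌊β X / π⌋ + 1, ?_, rfl⟩
    have := Int.lt_floor_add_one (β X / π)
    rw [div_lt_iff₀ hpi] at this; push_cast; exact this
  -- all x with β x = k π, k ≥ k0
  obtain ⟨y0, hy0, hy0'⟩ := D.reach X _ le_rfl hk0
  have hEx : ∀ j : ℕ, ∃ y, X ≤ y ∧ β y = ((k0 + j : ℤ):ℝ) * π ∧ (zc f y : ℤ) = j + zc f y0 := by
    intro j
    induction j with
    | zero => grind
    | succ j ih =>
      obtain ⟨y, h1, h2, h3⟩ := ih
      obtain ⟨y', h4, h5⟩ := D.reach y (((k0 + j : ℤ):ℝ) * π + π) h1 (lz)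
      refine ⟨y', h1.trans h4.le, by rw [h5]; push_cast; ring, ?_⟩
      rw [(D.cell (k0+j) y y' h1 h4 h2.ge (by rw [h5]; ring)).1 (hpos _ _ h1 h2)]
      push_cast; linarith
  refine ⟨zc f y0 - k0, fun x hx => ?_⟩
  set k := ⌊β x / π⌋ with hk
  have k1 : k * π ≤ β x := by have := Int.floor_le (β x / π); rwa [le_div_iff₀ hpi] at this
  have k2 : β x < (k + 1) * π := by have := Int.lt_floor_add_one (β x / π); rwa [div_lt_iff₀ hpi] at this
  have k3 : k0 ≤ k + 1 := by
    have h1 : β X ≤ β x := D.hmono.monotoneOn (mem_Ici.2 le_rfl) (mem_Ici.2 hx) hx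
    have : ⌊β X / π⌋ ≤ k := Int.floor_le_floor (by gcongr)
    omega
  obtain ⟨y, h1, h2⟩ := D.reach x _ hx k2
  have hzy : (zc f y : ℤ) = k + 1 - k0 + zc f y0 := by
    obtain ⟨y', g1, g2, g3⟩ := hEx (k + 1 - k0).toNat
    rw [Int.toNat_of_nonneg (oz)] at g2 g3
    have : y' = y := D.hmono.injOn (mem_Ici.2 g1) (mem_Ici.2 (hx.trans h1.le)) (by rw [g2, h2]; push_cast; ring)
    rw [← this, g3]
  have hcell := D.cell k x y hx h1 k1 h2
  have a2 := D.hA x hx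
  have a4 := D.he0 x hx
  set u := β x / π with hu
  have hβ : β x = u * π := by rw [hu]; field_simp
  have u1 : (k:ℝ) ≤ u := Int.floor_le _
  have u2 : u < k + 1 := Int.lt_floor_add_one _
  have hγ : (-1)^k * cos (β x) = sin ((k + 1/2 - u) * π) := by
    rw [← cos_sub_int_mul_pi, hβ, ← cos_pi_div_two_sub]; congr 1; ring
  have hs1 : |(-1:ℝ)^k * (f x - A x * cos (β x))| ≤ A x * e x := by
    simpa using D.h1 x hx
  rw [mul_sub, mul_left_comm, hγ, abs_le] at hs1
  rcases lt_or_ge ((-1)^k * f x) 0 with hneg | hnn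
  · have e1 := hcell.2 hneg
    constructor
    · have : ⌊u + 1/2 - e x⌋ < k + 2 := by rw [Int.floor_lt]; push_cast; linarith
      omega
    · have : k + 1 ≤ ⌊u + 1/2 + e x⌋ := by
        rw [Int.le_floor]; push_cast
        by_contra hcon; push Not at hcon
        have := mul_le_sin (x := (k + 1/2 - u) * π) (by apply mul_nonneg _ hpi.le; linarith) (by
          linarith)
        have e5 : 2 / π * ((k + 1/2 - u) * π) = 2 * (k + 1/2 - u) := by field_simp
        have h8 := mul_lt_mul_of_pos_left (show 2 * e x < sin ((k + 1/2 - u) * π) by linarith) a2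
        linarith [mul_pos a2 a4]
      omega
  · have e1 := hcell.1 hnn
    have e2 : (zc f x : ℤ) = k + (zc f y0 - k0) := by
      linarith
    constructor
    · have : ⌊u + 1/2 - e x⌋ < k + 1 := by
        rw [Int.floor_lt]; push_cast
        by_contra hcon; push Not at hcon
        have := mul_le_sin (x := (u - (k + 1/2)) * π) (by apply mul_nonneg _ hpi.le; linarith) (by
          linarith)
        have e5 : 2 / π * ((u - (k + 1/2)) * π) = 2 * (u - (k + 1/2)) := by field_simp
        have e6 : sin ((k + 1/2 - u) * π) = - sin ((u - (k + 1/2)) * π) := by rw [← sin_neg]; congr 1; ring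
        rw [e6] at hs1
        have h8 := mul_le_mul_of_nonneg_left (show 2 * e x ≤ sin ((u - (k + 1/2)) * π) by linarith) a2.le
        linarith [mul_pos a2 a4]
      omega
    · have : k ≤ ⌊u + 1/2 + e x⌋ := by rw [Int.le_floor]; linarith
      omega

abbrev zs (f : ℝ → ℝ) (x : ℝ) : Set ℝ := {z | 0 < z ∧ z < x ∧ f z = 0}

lemma fin_zeros (f f' : ℝ → ℝ) (hc : Continuous f) (x a : ℝ) (h0 : ∀ z, 0 < z → f z = 0 → a ≤ z)
    (hd : ∀ p, 0 ≤ p → a ≤ p → f p = 0 → HasDerivAt f (f' p) p ∧ f' p ≠ 0) : (zs f x).Finite := by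
  by_contra hcon
  have hsub : zs f x ⊆ Icc 0 x ∩ {z | a ≤ z ∧ f z = 0} := fun z hz => ⟨⟨hz.1.le, hz.2.1.le⟩, h0 z hz.1 hz.2.2, hz.2.2⟩
  have hcl : IsClosed {z | a ≤ z ∧ f z = 0} := (isClosed_le continuous_const continuous_id).inter (isClosed_eq hc continuous_const)
  have hK : IsCompact (Icc 0 x ∩ {z | a ≤ z ∧ f z = 0}) := isCompact_Icc.inter_right hcl
  obtain ⟨p, hp, hacc⟩ := Set.Infinite.exists_accPt_of_subset_isCompact hcon hK hsub
  obtain ⟨h1, h2⟩ := hd p hp.1.1 hp.2.1 hp.2.2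
  rw [accPt_iff_frequently_nhdsNE] at hacc
  have := h1.eventually_ne h2 (c := 0)
  obtain ⟨z, hz1, hz2⟩ := (hacc.and_eventually this).exists
  exact hz2 hz1.2.2

lemma finJ (n : ℕ) (x : ℝ) : (zs (bJ n) x).Finite := by
  refine fin_zeros (bJ n) (fun p => bK n p / p) (bJ_cont n) x n ?_ ?_
  · intro z hz h
    by_contra hcon; push Not at hcon
    exact bJ_ne n z hz hcon.le h
  · intro p p0 hp h
    have hp0 : 0 < p := by
      rcases p0.eq_or_lt with rfl | h'
      · have : n = 0 := by have : (n:ℝ) ≤ 0 := hp; exact_mod_cast le_antisymm this (pz)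
        subst this; simp [bJ_zero_zero] at h
      · exact h'
    exact ⟨bJ_deriv n p hp0.ne', div_ne_zero (fun h2 => JK_ne n p hp0 h h2) hp0.ne'⟩

lemma zsK0 (x : ℝ) : zs (bK 0) x = zs (bJ 1) x := by
  ext z; simp only [mem_ofPred_eq, bK]
  grind

lemma finK (n : ℕ) (x : ℝ) : (zs (bK n) x).Finite := by
  rcases Nat.eq_zero_or_pos n with rfl | hn
  · rw [zsK0]; exact finJ 1 x
  have hn' : (0:ℝ) < n := by exact_mod_cast hn
  refine fin_zeros (bK n) (fun x => -((x^2-n^2)/x * bJ n x)) (bK_cont n) x n ?_ ?_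
  · intro z hz h
    by_contra hcon; push Not at hcon
    exact bK_ne n z hz hcon.le h
  · intro p p0 hp h
    have hp0 : 0 < p := hn'.trans_le hp
    refine ⟨bK_deriv n p hp0.ne', ?_⟩
    have hpn : (n:ℝ) < p := lt_of_le_of_ne hp (by rintro rfl; exact bK_ne n n hp0 le_rfl h)
    have h1 := Qpos n p hpn
    have h2 : bJ n p ≠ 0 := fun h2 => JK_ne n p hp0 h2 h
    simp [h1.ne', h2, hp0.ne']

lemma inter_one (f g : ℝ → ℝ) (x : ℝ) (hf : (zs f x).Finite) (hg : (zs g x).Finite)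
    (h : ∀ a b, 0 < a → a < b → f a = 0 → f b = 0 → ∃ z, a < z ∧ z < b ∧ g z = 0) : zc f x ≤ zc g x + 1 := by
  unfold zc
  rw [ncard_eq_toFinset_card _ hf, ncard_eq_toFinset_card _ hg]
  refine Finset.card_le_of_interleaved ?_
  intro a ha b hb hab _
  simp only [Finite.mem_toFinset, mem_ofPred_eq] at ha hb ⊢
  grind

lemma inter_zero (f : ℝ → ℝ) (T : Set ℝ) (x : ℝ) (hf : (zs f x).Finite) (hg : (T ∩ Ioo 0 x).Finite)
    (h : ∀ a b, 0 ≤ a → a < b → (a = 0 ∨ f a = 0) → f b = 0 → (∀ z ∈ Ioo a b, f z ≠ 0) → ∃ z, a < z ∧ z < b ∧ z ∈ T) : zc f x ≤ (T ∩ Ioo 0 x).ncard := by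
  have hs : (insert 0 (zs f x)).Finite := hf.insert 0
  have : (insert 0 (zs f x)).ncard ≤ (T ∩ Ioo 0 x).ncard + 1 := by
    rw [ncard_eq_toFinset_card _ hs, ncard_eq_toFinset_card _ hg]
    refine Finset.card_le_of_interleaved ?_
    intro a ha b hb hab hcons
    simp only [Finite.mem_toFinset, mem_insert_iff, mem_ofPred_eq] at ha hb hcons ⊢
    grind
  rw [ncard_insert_of_notMem (sz) hf] at this
  exact Nat.le_of_add_le_add_right this

lemma zc_eq (g : ℝ → ℝ) (x : ℝ) : {z | g z = 0} ∩ Ioo 0 x = zs g x := by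
  ext z; grind

lemma rolleJ_up (n : ℕ) (a b : ℝ) (ha : 0 ≤ a) (hab : a < b) (h1 : a = 0 ∨ bJ (n+1) a = 0) (h2 : bJ (n+1) b = 0) :
    ∃ z, a < z ∧ z < b ∧ bJ n z = 0 := by
  obtain ⟨z, hz, h⟩ := exists_hasDerivAt_eq_zero (f := fun x => x^(n+1) * bJ (n+1) x) (f' := fun x => x^(n+1) * bJ n x) hab
    (((continuous_pow _).mul (bJ_cont _)).continuousOn) (by
      grind) (by
      intro x hx
      have hx0 : x ≠ 0 := (ha.trans_lt hx.1).ne'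
      refine ((hasDerivAt_pow (n+1) x).mul (bJ_deriv (n+1) x hx0)).congr_deriv ?_
      rw [bK_succ]; push_cast; field_simp; ring)
  have hz0 : z ≠ 0 := (ha.trans_lt hz.1).ne'
  exact ⟨z, hz.1, hz.2, (mul_eq_zero.1 h).resolve_left (pow_ne_zero _ hz0)⟩

lemma rolleJ_down (n : ℕ) (a b : ℝ) (ha : 0 < a) (hab : a < b) (h1 : bJ n a = 0) (h2 : bJ n b = 0) :
    ∃ z, a < z ∧ z < b ∧ bJ (n+1) z = 0 := by
  have hg : ∀ y, 0 < y → bJ n y = 0 → bg n (y^2/4) = 0 := fun y hy h =>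
    (mul_eq_zero.1 h).resolve_left (pow_ne_zero _ (pz))
  obtain ⟨z, hz, h⟩ := exists_hasDerivAt_eq_zero (f := fun x => bg n (x^2/4)) (f' := fun x => -bg (n+1) (x^2/4) * (x/2)) hab
    (((bg_cont n).comp (fz)).continuousOn) (by
      grind) (by
      intro x hx
      have : HasDerivAt (fun x : ℝ => x^2/4) (x/2) x := by
        refine ((hasDerivAt_pow 2 x).div_const 4).congr_deriv (rz)
      exact (bg_deriv n (x^2/4)).comp x this)
  have hz0 : z ≠ 0 := (ha.trans hz.1).ne'
  refine ⟨z, hz.1, hz.2, ?_⟩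
  have : bg (n+1) (z^2/4) = 0 := by simpa [hz0] using h
  unfold bJ; rw [this, mul_zero]

lemma rolleJK (n : ℕ) (a b : ℝ) (ha : 0 ≤ a) (hab : a < b) (h1 : bJ n a = 0) (h2 : bJ n b = 0) :
    ∃ z, a < z ∧ z < b ∧ bK n z = 0 := by
  obtain ⟨z, hz, h⟩ := exists_hasDerivAt_eq_zero (f := bJ n) (f' := fun x => bK n x / x) hab
    (bJ_cont n).continuousOn (by rw [h1, h2]) (fun x hx => bJ_deriv n x (ha.trans_lt hx.1).ne')
  grind

lemma rolleKJ (n : ℕ) (a b : ℝ) (ha : 0 < a) (hab : a < b) (h1 : bK n a = 0) (h2 : bK n b = 0) :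
    ∃ z, a < z ∧ z < b ∧ bJ n z = 0 := by
  have han : (n:ℝ) < a := by
    by_contra hcon; push Not at hcon; exact bK_ne n a ha hcon h1
  obtain ⟨z, hz, h⟩ := exists_hasDerivAt_eq_zero (f := bK n) (f' := fun x => -((x^2-n^2)/x * bJ n x)) hab
    (bK_cont n).continuousOn (by rw [h1, h2]) (fun x hx => bK_deriv n x (ha.trans hx.1).ne')
  have hQ := Qpos n z (han.trans hz.1)
  have hz0 : z ≠ 0 := (ha.trans hz.1).ne'
  refine ⟨z, hz.1, hz.2, ?_⟩
  simpa [hQ.ne', hz0] using h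

lemma zcJ_up (n : ℕ) (x : ℝ) : zc (bJ (n+1)) x ≤ zc (bJ n) x := by
  have := inter_zero (bJ (n+1)) {z | bJ n z = 0} x (finJ _ x) (by rw [zc_eq]; exact finJ _ x)
    (fun a b ha hab h1 h2 _ => rolleJ_up n a b ha hab h1 h2)
  rwa [zc_eq] at this

lemma zcJ_down (n : ℕ) (x : ℝ) : zc (bJ n) x ≤ zc (bJ (n+1)) x + 1 :=
  inter_one _ _ x (finJ _ x) (finJ _ x) (rolleJ_down n)

lemma zcJK (n : ℕ) (hn : n ≠ 0) (x : ℝ) : zc (bJ n) x ≤ zc (bK n) x := by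
  have h0 : bJ n 0 = 0 := by obtain ⟨m, rfl⟩ := Nat.exists_eq_succ_of_ne_zero hn; exact bJ_zero_succ m
  have := inter_zero (bJ n) {z | bK n z = 0} x (finJ _ x) (by rw [zc_eq]; exact finK _ x)
    (fun a b ha hab h1 h2 _ => rolleJK n a b ha hab (by grind) h2)
  rwa [zc_eq] at this

lemma zcKJ (n : ℕ) (x : ℝ) : zc (bK n) x ≤ zc (bJ n) x + 1 :=
  inter_one _ _ x (finK _ x) (finJ _ x) (rolleKJ n)

/-- Sturm comparison with the sine function -/
noncomputable def st (n : ℕ) (x : ℝ) : ℝ := √x * (bJ n x * cos x - (bJ n x/2 + bK n x) * sinc x)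

lemma st_cont (n : ℕ) : Continuous (st n) := by
  have := bJ_cont n; have := bK_cont n; unfold st; fun_prop

lemma st_pos (n : ℕ) (x : ℝ) (hx : 0 < x) : st n x = √x * bJ n x * cos x - (bJ n x/2 + bK n x) * sin x / √x := by
  unfold st; rw [sinc_of_ne_zero hx.ne']
  have h2 : √x * √x = x := mul_self_sqrt hx.le
  have h1 : 0 < √x := sqrt_pos.2 hx
  generalize √x = s at *
  subst h2
  field_simp

lemma st_deriv (n : ℕ) (x : ℝ) (hx : 0 < x) : HasDerivAt (st n) ((1/4 - n^2) / (x * √x) * bJ n x * sin x) x := by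
  have h2 : √x * √x = x := mul_self_sqrt hx.le
  have h1 : 0 < √x := sqrt_pos.2 hx
  have hs := (hasDerivAt_sqrt hx.ne')
  have hJ := bJ_deriv n x hx.ne'
  have hK := bK_deriv n x hx.ne'
  have h := ((hs.mul hJ).mul (hasDerivAt_cos x)).sub ((((hJ.div_const 2).add hK).mul (hasDerivAt_sin x)).div hs h1.ne')
  have he : st n =ᶠ[nhds x] ((fun x => √x) * bJ n * cos - ((fun x => bJ n x / 2) + bK n) * sin / fun x => √x) := by
    filter_upwards [eventually_gt_nhds hx] with y hy
    rw [st_pos n y hy]; rfl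
  refine (h.congr_of_eventuallyEq he).congr_deriv ?_
  simp only [Pi.mul_apply, Pi.add_apply]
  generalize √x = s at *
  subst h2
  field_simp
  ring

lemma sign_const (f : ℝ → ℝ) (hf : Continuous f) (a b : ℝ) (hab : a < b) (h : ∀ x ∈ Ioo a b, f x ≠ 0) :
    ∃ τ : ℝ, (∀ x ∈ Ioo a b, 0 < τ * f x) ∧ (∀ x ∈ Icc a b, 0 ≤ τ * f x) := by
  obtain ⟨τ, h1⟩ : ∃ τ : ℝ, (∀ x ∈ Ioo a b, 0 < τ * f x) := by
    refine ⟨f ((a+b)/2), fun x hx => ?_⟩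
    have hm : (a+b)/2 ∈ Ioo a b := ⟨lz, lz⟩
    by_contra hcon; push Not at hcon
    have hsub : uIcc ((a+b)/2) x ⊆ Ioo a b := (ordConnected_Ioo).uIcc_subset hm hx
    have hne := h _ hm
    have h0 : (0:ℝ) ∈ f '' (uIcc ((a+b)/2) x) := by
      refine intermediate_value_uIcc hf.continuousOn ?_
      rw [mem_uIcc]
      rcases lt_or_gt_of_ne hne with h' | h'
      · left; exact ⟨h'.le, by by_contra hc; nlinarith⟩
      · right; exact ⟨by by_contra hc; nlinarith, h'.le⟩
    grind
  refine ⟨τ, h1, fun x hx => ?_⟩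
  have hcl : IsClosed {x | 0 ≤ τ * f x} := isClosed_le continuous_const (fz)
  rw [← closure_Ioo hab.ne] at hx
  exact hcl.closure_subset_iff.2 (fun y hy => (h1 y hy).le) hx

lemma sturm0 (j : ℕ) : ∃ z, j * π < z ∧ z < (j+1) * π ∧ bJ 0 z = 0 := by
  by_contra hcon; push Not at hcon
  have hpi := pi_pos
  set a := (j:ℝ) * π with ha
  have hb : ((j:ℝ)+1) * π = a + π := rz
  have hab : a < a + π := lz
  have a0 : 0 ≤ a := pz
  rw [hb] at hcon
  obtain ⟨τ, t1, t2⟩ := sign_const (bJ 0) (bJ_cont 0) a (a+π) hab (fun x hx => hcon x hx.1 hx.2)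
  have hs : ∀ x ∈ Ioo a (a+π), 0 < (-1)^j * sin x := by
    intro x hx
    rw [← sin_sub_nat_mul_pi]; exact sin_pos_of_pos_of_lt_pi (by linarith [hx.1]) (by linarith [hx.2])
  have sq : ((-1:ℝ)^j)*(-1)^j = 1 := by rw [← mul_pow]; norm_num
  have hm : StrictMonoOn (fun x => τ * (-1)^j * st 0 x) (Icc a (a+π)) := by
    have := st_cont 0
    refine strictMonoOn_of_hasDerivWithinAt_pos (convex_Icc _ _) (fz)
      (fun x hx => ((st_deriv 0 x ?_).const_mul _).hasDerivWithinAt) ?_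
    · rw [interior_Icc] at hx; exact a0.trans_lt hx.1
    · intro x hx
      rw [interior_Icc] at hx
      have x0 := a0.trans_lt hx.1
      have := mul_pos (t1 x hx) (hs x hx)
      have h2 : 0 < (1/4:ℝ) / (x * √x) := pz
      have := mul_pos h2 this
      refine this.trans_eq ?_
      ring
  have := hm ⟨le_rfl, hab.le⟩ ⟨hab.le, le_rfl⟩ hab
  have e1 : st 0 a = √a * (bJ 0 a * (-1)^j) := by
    rcases a0.eq_or_lt with h | h
    · rw [← h]; simp [st]
    · rw [st_pos 0 a h, ha, cos_nat_mul_pi, sin_nat_mul_pi]; ring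
  have e2 : st 0 (a+π) = -(√(a+π) * (bJ 0 (a+π) * (-1)^j)) := by
    rw [st_pos 0 (a+π) (lz)]
    rw [show a + π = ((j+1:ℕ):ℝ) * π by push_cast; ring, cos_nat_mul_pi, sin_nat_mul_pi, pow_succ]; ring
  simp only [e1, e2] at this
  have k1 := mul_nonneg (sqrt_nonneg a) (t2 a ⟨le_rfl, hab.le⟩)
  have k2 := mul_nonneg (sqrt_nonneg (a+π)) (t2 (a+π) ⟨hab.le, le_rfl⟩)
  have k3 : τ * (-1)^j * (√a * (bJ 0 a * (-1)^j)) = √a * (τ * bJ 0 a) * ((-1)^j*(-1)^j) := rz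
  have k4 : τ * (-1)^j * -(√(a+π) * (bJ 0 (a+π) * (-1)^j)) = -(√(a+π) * (τ * bJ 0 (a+π)) * ((-1)^j*(-1)^j)) := rz
  rw [k3, k4, sq] at this
  linarith

lemma zc0_ge (k : ℕ) : k ≤ zc (bJ 0) (k * π) := by
  choose z h1 h2 h3 using sturm0
  have hm : StrictMono z := strictMono_nat_of_lt_succ fun j => (h2 j).trans (by grind)
  have : ((rg k).image z : Set ℝ) ⊆ zs (bJ 0) (k*π) := by
    intro y hy
    simp only [Finset.coe_image, mem_image, Finset.coe_range, mem_Iio] at hy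
    obtain ⟨j, hj, rfl⟩ := hy
    refine ⟨lt_of_le_of_lt (pz) (h1 j), (h2 j).trans_le ?_, h3 j⟩
    have : (j:ℝ) + 1 ≤ k := by exact_mod_cast hj
    gcongr
  have h4 := ncard_le_ncard this (finJ 0 _)
  rw [ncard_coe_finset, Finset.card_image_of_injective _ hm.injective, card_range] at h4
  exact h4

lemma edge_sign (a b : ℝ) (ha : 0 < a) (hab : a < b) (τ : ℝ) (n : ℕ) (h1 : ∀ x ∈ Ioo a b, 0 < τ * bJ n x) :
    (bJ n a = 0 → 0 ≤ τ * bK n a) ∧ (bJ n b = 0 → τ * bK n b ≤ 0) := by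
  have hK := bK_cont n
  constructor
  · intro h0
    have hcl : IsClosed {x | 0 ≤ τ * bK n x} := isClosed_le continuous_const (fz)
    refine hcl.closure_subset (Metric.mem_closure_iff.2 fun ε hε => ?_)
    set x := min (a+ε/2) ((a+b)/2)
    have hx1 : a < x := lt_min (lz) (lz)
    have hx2 : x < b := (min_le_right _ _).trans_lt (lz)
    have hx3 : x ≤ a + ε/2 := min_le_left _ _
    obtain ⟨c, hc, hc2⟩ := exists_hasDerivAt_eq_slope (bJ n) (fun x => bK n x / x) hx1 (bJ_cont n).continuousOn
      (fun y hy => bJ_deriv n y (ha.trans hy.1).ne')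
    refine ⟨c, ?_, by rw [dist_comm, Real.dist_eq, abs_lt]; constructor <;> linarith [hc.1, hc.2]⟩
    rw [h0, sub_zero] at hc2
    have c0 := ha.trans hc.1
    have : bK n c = bJ n x / (x - a) * c := by rw [← hc2]; field_simp
    have h5 := h1 x ⟨hx1, hx2⟩
    change 0 ≤ τ * bK n c
    rw [this, show τ * (bJ n x / (x - a) * c) = (τ * bJ n x) / (x-a) * c by ring]
    positivity
  · intro h0
    have hcl : IsClosed {x | τ * bK n x ≤ 0} := isClosed_le (fz) continuous_const
    refine hcl.closure_subset (Metric.mem_closure_iff.2 fun ε hε => ?_)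
    set x := max (b-ε/2) ((a+b)/2)
    have hx1 : x < b := max_lt (lz) (lz)
    have hx2 : a < x := lt_of_lt_of_le (lz) (le_max_right _ _)
    have hx3 : b - ε/2 ≤ x := le_max_left _ _
    obtain ⟨c, hc, hc2⟩ := exists_hasDerivAt_eq_slope (bJ n) (fun x => bK n x / x) hx1 (bJ_cont n).continuousOn
      (fun y hy => bJ_deriv n y ((ha.trans hx2).trans hy.1).ne')
    refine ⟨c, ?_, by rw [dist_comm, Real.dist_eq, abs_lt]; constructor <;> linarith [hc.1, hc.2]⟩
    rw [h0, zero_sub] at hc2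
    have c0 := (ha.trans hx2).trans hc.1
    have : bK n c = -bJ n x / (b - x) * c := by rw [← hc2]; field_simp
    have h5 := h1 x ⟨hx2, hx1⟩
    change τ * bK n c ≤ 0
    rw [this, show τ * (-bJ n x / (b - x) * c) = -((τ * bJ n x) / (b-x) * c) by ring, neg_nonpos]
    positivity

lemma sturm1 (a b : ℝ) (ha : 0 ≤ a) (hab : a < b) (h1 : a = 0 ∨ bJ 1 a = 0) (h2 : bJ 1 b = 0)
    (h3 : ∀ z ∈ Ioo a b, bJ 1 z ≠ 0) : ∃ z, a < z ∧ z < b ∧ sin z = 0 := by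
  by_contra hcon; push Not at hcon
  obtain ⟨τ, t1, t2⟩ := sign_const (bJ 1) (bJ_cont 1) a b hab h3
  obtain ⟨σ, s1, s2⟩ := sign_const sin continuous_sin a b hab (fun x hx => hcon x hx.1 hx.2)
  have hm : StrictMonoOn (fun x => -(τ * σ) * st 1 x) (Icc a b) := by
    have := st_cont 1
    refine strictMonoOn_of_hasDerivWithinAt_pos (convex_Icc _ _) (fz)
      (fun x hx => ((st_deriv 1 x ?_).const_mul _).hasDerivWithinAt) ?_
    · rw [interior_Icc] at hx; exact ha.trans_lt hx.1
    · intro x hx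
      rw [interior_Icc] at hx
      have x0 := ha.trans_lt hx.1
      have := mul_pos (t1 x hx) (s1 x hx)
      have h2 : 0 < (3/4:ℝ) / (x * √x) := pz
      have := mul_pos h2 this
      refine this.trans_eq ?_
      ring
  have hlt := hm ⟨le_rfl, hab.le⟩ ⟨hab.le, le_rfl⟩ hab
  have b0 := ha.trans_lt hab
  have e2 : -(τ * σ) * st 1 b ≤ 0 := by
    obtain ⟨d, hd⟩ : ∃ d, a < d ∧ d < b := exists_between hab
    have := (edge_sign d b (ha.trans_lt hd.1) hd.2 τ 1 (fun x hx => t1 x ⟨hd.1.trans hx.1, hx.2⟩)).2 h2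
    rw [st_pos 1 b b0, h2, show -(τ * σ) * (√b * 0 * cos b - (0 / 2 + bK 1 b) * sin b / √b) = (τ * bK 1 b) * (σ * sin b) / √b by ring]
    exact div_nonpos_of_nonpos_of_nonneg (mul_nonpos_of_nonpos_of_nonneg this (s2 b ⟨hab.le, le_rfl⟩)) (sqrt_nonneg _)
  have e1 : 0 ≤ -(τ * σ) * st 1 a := by
    rcases ha.eq_or_lt with h | h
    · rw [← h]; simp [st]
    · have h1 := h1.resolve_left h.ne'
      have := (edge_sign a b h hab τ 1 t1).1 h1
      rw [st_pos 1 a h, h1, show -(τ * σ) * (√a * 0 * cos a - (0 / 2 + bK 1 a) * sin a / √a) = (τ * bK 1 a) * (σ * sin a) / √a by ring]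
      exact div_nonneg (mul_nonneg this (s2 a ⟨le_rfl, hab.le⟩)) (sqrt_nonneg _)
  linarith

lemma zc1_le (k : ℕ) : zc (bJ 1) ((k+1) * π) ≤ k := by
  have hpi := pi_pos
  have hsub : {z | sin z = 0} ∩ Ioo 0 ((k+1)*π) ⊆ ((rg k).image (fun j : ℕ => ((j:ℝ)+1)*π) : Set ℝ) := by
    rintro z ⟨h1, h2, h3⟩
    obtain ⟨m, rfl⟩ := sin_eq_zero_iff.1 h1
    have m0 : 0 < m := by have := pos_of_mul_pos_left h2 hpi.le; exact_mod_cast this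
    have m1 : m < k + 1 := by have := lt_of_mul_lt_mul_right h3 hpi.le; exact_mod_cast this
    simp only [Finset.coe_image, mem_image, Finset.coe_range, mem_Iio]
    refine ⟨(m-1).toNat, oz, ?_⟩
    have : (((m-1).toNat : ℤ) : ℝ) = ((m-1:ℤ):ℝ) := by rw [Int.toNat_of_nonneg (oz)]
    rw [Int.cast_natCast] at this
    rw [this]; push_cast; ring
  have hfin : ({z | sin z = 0} ∩ Ioo 0 ((k+1)*π)).Finite := (Finset.finite_toSet _).subset hsub
  have h := inter_zero (bJ 1) {z | sin z = 0} ((k+1)*π) (finJ _ _) hfin (fun a b ha hab h1 h2 h3 => sturm1 a b ha hab h1 h2 h3)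
  refine h.trans ((ncard_le_ncard hsub (Finset.finite_toSet _)).trans ?_)
  rw [ncard_coe_finset]
  exact Finset.card_image_le.trans (sz)

lemma ph_mono (n : ℕ) (X c : ℝ) (hX : (n:ℝ) < X) : StrictMonoOn (fun x => ph n x + c) (Ici X) ∧ ContinuousOn (fun x => ph n x + c) (Ici X) := by
  have hc : ContinuousOn (fun x => ph n x + c) (Ici X) := fun x hx =>
    ((ph_deriv n x (hX.trans_le hx)).continuousAt.add continuousAt_const).continuousWithinAt
  refine ⟨?_, hc⟩
  refine strictMonoOn_of_hasDerivWithinAt_pos (convex_Ici X) hc (fun x hx => ((ph_deriv n x (hX.trans_le (interior_subset hx))).add_const c).hasDerivWithinAt) ?_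
  intro x hx
  have hx := interior_subset hx
  have := qq_pos n x (hX.trans_le hx); have := xpos n x (hX.trans_le hx)
  positivity

lemma ph_lim (n : ℕ) (c : ℝ) : Tendsto (fun x => ph n x + c) atTop atTop := by
  have h1 := ph_tendsto n
  have h2 : Tendsto (fun x : ℝ => x + (c - n * (π/2))) atTop atTop := Filter.tendsto_atTop_add_const_right _ _ tendsto_id
  have := h1.add_atTop h2
  refine this.congr fun x => rz

lemma oscJ (n : ℕ) (X : ℝ) (hX : (n:ℝ) < X) (he : er n X ≤ 1/4) :
    OscData (bJ n) (fun x => bK n x / x) (fun x => ph n x + -(π/4)) (fun x => rho / qq n x) (fun x => rho * qq n x / x) (er n) X where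
  X0 := xpos n X hX
  hf x hx := bJ_deriv n x (xpos n x (hX.trans_le hx)).ne'
  hmono := (ph_mono n X _ hX).1
  hcont := (ph_mono n X _ hX).2
  hlim := ph_lim n _
  hA x hx := by have := qq_pos n x (hX.trans_le hx); have := rho_pos; positivity
  hB x hx := by have := qq_pos n x (hX.trans_le hx); have := rho_pos; have := xpos n x (hX.trans_le hx); positivity
  he x hx := (er_anti n X x hX hx).trans he
  he0 x hx := er_pos n x (hX.trans_le hx)
  h1 x hx := (JK_asymp n x (hX.trans_le hx) ((er_anti n X x hX hx).trans he)).1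
  h2 x hx := by
    have h := (JK_asymp n x (hX.trans_le hx) ((er_anti n X x hX hx).trans he)).2
    have x0 := xpos n x (hX.trans_le hx)
    rw [← sub_eq_add_neg, show bK n x / x + rho * qq n x / x * sin (ph n x - π/4) = (bK n x + rho * qq n x * sin (ph n x - π/4)) / x by ring,
      abs_div, abs_of_pos x0, div_mul_eq_mul_div]
    gcongr
  fin x := finJ n x

lemma oscK (n : ℕ) (X : ℝ) (hX : (n:ℝ) < X) (he : er n X ≤ 1/4) :
    OscData (bK n) (fun x => -((x^2-n^2)/x * bJ n x)) (fun x => ph n x + π/4) (fun x => rho * qq n x) (fun x => rho * qq n x^3 / x) (er n) X where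
  X0 := xpos n X hX
  hf x hx := bK_deriv n x (xpos n x (hX.trans_le hx)).ne'
  hmono := (ph_mono n X _ hX).1
  hcont := (ph_mono n X _ hX).2
  hlim := ph_lim n _
  hA x hx := by have := qq_pos n x (hX.trans_le hx); have := rho_pos; positivity
  hB x hx := by have := qq_pos n x (hX.trans_le hx); have := rho_pos; have := xpos n x (hX.trans_le hx); positivity
  he x hx := (er_anti n X x hX hx).trans he
  he0 x hx := er_pos n x (hX.trans_le hx)
  h1 x hx := by
    have h := (JK_asymp n x (hX.trans_le hx) ((er_anti n X x hX hx).trans he)).2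
    rw [show ph n x + π/4 = (ph n x - π/4) + π/2 by ring, cos_add_pi_div_two, mul_neg, sub_neg_eq_add]
    exact h
  h2 x hx := by
    have h := (JK_asymp n x (hX.trans_le hx) ((er_anti n X x hX hx).trans he)).1
    have x0 := xpos n x (hX.trans_le hx)
    have q0 := qq_pos n x (hX.trans_le hx)
    rw [show ph n x + π/4 = (ph n x - π/4) + π/2 by ring, sin_add_pi_div_two, ← qq_four n x (hX.trans_le hx),
     show -(qq n x ^4 / x * bJ n x) + rho * qq n x^3 / x * cos (ph n x - π/4) = -(qq n x^4/x) * (bJ n x - rho / qq n x * cos (ph n x - π/4)) by field_simp; ring,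
      abs_mul, abs_neg, abs_of_pos (show 0 < qq n x^4/x by positivity),
      show rho * qq n x^3/x * er n x = qq n x^4 / x * (rho / qq n x * er n x) by field_simp]
    gcongr
  fin x := finK n x

def EvC (f β e : ℝ → ℝ) (c : ℤ) : Prop :=
  ∀ᶠ x in atTop, ⌊β x / π + 1/2 - e x⌋ + c ≤ zc f x ∧ (zc f x : ℤ) ≤ ⌊β x / π + 1/2 + e x⌋ + c

lemma ev_eval (f β e : ℝ → ℝ) (a : ℝ) (c : ℤ) (hβ : Tendsto (fun x => β x - (x - a * π)) atTop (nhds 0))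
    (he : Tendsto e atTop (nhds 0)) (H : EvC f β e c) (r : ℝ) (r0 : 0 < r) (r1 : r < 1) :
    ∀ᶠ j : ℕ in atTop, (zc f ((j + (a - 1/2 + r)) * π) : ℤ) = j + c := by
  have hpi := pi_pos
  have hx : Tendsto (fun j : ℕ => ((j:ℝ) + (a - 1/2 + r)) * π) atTop atTop :=
    (Filter.tendsto_atTop_add_const_right _ _ tendsto_natCast_atTop_atTop).atTop_mul_const hpi
  obtain ⟨ε, ε0, ε1, ε2⟩ : ∃ ε > 0, 2 * ε < r ∧ 2 * ε < 1 - r := by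
    refine ⟨min r (1-r) / 3, ?_, ?_, ?_⟩
    · positivity
    · have := min_le_left r (1-r); linarith
    grind
  have E1 : ∀ᶠ x in atTop, |β x - (x - a * π)| < ε * π := by
    have := hβ.abs; rw [abs_zero] at this
    exact this.eventually_lt_const (pz)
  have E2 : ∀ᶠ x in atTop, |e x| < ε := by
    have := he.abs; rw [abs_zero] at this
    exact this.eventually_lt_const (pz)
  filter_upwards [hx.eventually E1, hx.eventually E2, hx.eventually H] with j h1 h2 h3
  set x := ((j:ℝ) + (a - 1/2 + r)) * π with hxd
  set u := β x / π with hu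
  have hβ : β x = u * π := by rw [hu]; field_simp
  have h4 : |u - (j - 1/2 + r)| < ε := by
    rw [hβ, hxd, show u * π - ((j + (a - 1/2 + r)) * π - a * π) = (u - (j - 1/2 + r)) * π by ring, abs_mul, abs_of_pos hpi] at h1
    exact lt_of_mul_lt_mul_right h1 hpi.le
  have h5 := abs_lt.1 h4
  have h6 := abs_lt.1 h2
  have f1 : ⌊u + 1/2 - e x⌋ = j := by
    rw [Int.floor_eq_iff]; push_cast; constructor <;> linarith
  have f2 : ⌊u + 1/2 + e x⌋ = j := by
    rw [Int.floor_eq_iff]; push_cast; constructor <;> linarith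
  omega

lemma exist_X (n : ℕ) : ∃ X : ℝ, (n:ℝ) < X ∧ er n X ≤ 1/4 := by
  have := (er_tendsto n).eventually_lt_const (show (0:ℝ) < 1/4 by norm_num)
  obtain ⟨X, h1, h2⟩ := (this.and (eventually_gt_atTop (n:ℝ))).exists
  exact ⟨X, h2, h1.le⟩

lemma evJ (n : ℕ) (c : ℤ) (H : EvC (bJ n) (fun x => ph n x + -(π/4)) (er n) c) (r : ℝ) (r0 : 0 < r) (r1 : r < 1) :
    ∀ᶠ j : ℕ in atTop, (zc (bJ n) ((j + (n/2 - 1/4 + r)) * π) : ℤ) = j + c := by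
  have := ev_eval _ _ _ ((n:ℝ)/2 + 1/4) c ?_ (er_tendsto n) H r r0 r1
  · grind
  · refine (ph_tendsto n).congr fun x => rz

lemma evK (n : ℕ) (c : ℤ) (H : EvC (bK n) (fun x => ph n x + π/4) (er n) c) (r : ℝ) (r0 : 0 < r) (r1 : r < 1) :
    ∀ᶠ j : ℕ in atTop, (zc (bK n) ((j + (n/2 - 3/4 + r)) * π) : ℤ) = j + c := by
  have := ev_eval _ _ _ ((n:ℝ)/2 - 1/4) c ?_ (er_tendsto n) H r r0 r1
  · grind
  · refine (ph_tendsto n).congr fun x => rz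

lemma cJ_zero (n : ℕ) (c : ℤ) (H : EvC (bJ n) (fun x => ph n x + -(π/4)) (er n) c) : c = 0 := by
  have hex : ∀ n : ℕ, ∃ c, EvC (bJ n) (fun x => ph n x + -(π/4)) (er n) c := by
    intro n
    obtain ⟨X, h1, h2⟩ := exist_X n
    obtain ⟨c, hc⟩ := (oscJ n X h1 h2).count
    exact ⟨c, (eventually_ge_atTop X).mono hc⟩
  have hstep : ∀ n c c', EvC (bJ n) (fun x => ph n x + -(π/4)) (er n) c → EvC (bJ (n+1)) (fun x => ph (n+1) x + -(π/4)) (er (n+1)) c' → c = c' := by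
    intro n c c' H H'
    obtain ⟨j, h1, h2⟩ := ((evJ n c H (3/4) (nz) (nz)).and (evJ (n+1) c' H' (1/4) (nz) (nz))).exists
    obtain ⟨i, h3, h4⟩ := (((Filter.tendsto_add_atTop_nat 1).eventually (evJ n c H (1/4) (nz) (nz))).and (evJ (n+1) c' H' (3/4) (nz) (nz))).exists
    rw [show (j + ((n:ℝ)/2 - 1/4 + 3/4)) * π = (j + (((n+1:ℕ):ℝ)/2 - 1/4 + 1/4)) * π by push_cast; ring] at h1
    rw [show (((i+1:ℕ):ℝ) + ((n:ℝ)/2 - 1/4 + 1/4)) * π = (i + (((n+1:ℕ):ℝ)/2 - 1/4 + 3/4)) * π by push_cast; ring] at h3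
    have a1 := zcJ_up n ((j + (((n+1:ℕ):ℝ)/2 - 1/4 + 1/4)) * π)
    have a2 := zcJ_down n ((i + (((n+1:ℕ):ℝ)/2 - 1/4 + 3/4)) * π)
    omega
  have h0 : ∀ c, EvC (bJ 0) (fun x => ph 0 x + -(π/4)) (er 0) c → 0 ≤ c := by
    intro c H
    obtain ⟨j, h1⟩ := (evJ 0 c H (1/4) (nz) (nz)).exists
    rw [show (j + (((0:ℕ):ℝ)/2 - 1/4 + 1/4)) * π = j * π by ring] at h1
    have := zc0_ge j
    omega
  have h1 : ∀ c, EvC (bJ 1) (fun x => ph 1 x + -(π/4)) (er 1) c → c ≤ 0 := by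
    intro c H
    obtain ⟨j, h1⟩ := (evJ 1 c H (3/4) (nz) (nz)).exists
    rw [show (j + (((1:ℕ):ℝ)/2 - 1/4 + 3/4)) * π = (j+1) * π by ring] at h1
    have := zc1_le j
    omega
  induction n generalizing c with
  | zero =>
    grind
  | succ n ih =>
    grind

theorem countJ (n : ℕ) (x : ℝ) (hx : (n:ℝ) < x) (he : er n x ≤ 1/4) :
    ⌊ph n x / π + 1/4 - er n x⌋ ≤ zc (bJ n) x ∧ (zc (bJ n) x : ℤ) ≤ ⌊ph n x / π + 1/4 + er n x⌋ := by
  obtain ⟨c, hc⟩ := (oscJ n x hx he).count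
  have := cJ_zero n c ((eventually_ge_atTop x).mono hc)
  have h := hc x le_rfl
  have e : (ph n x + -(π/4)) / π + 1/2 = ph n x / π + 1/4 := by field_simp; ring
  rw [this, e, add_zero, add_zero] at h
  exact h

lemma cK_val (n : ℕ) (c : ℤ) (H : EvC (bK n) (fun x => ph n x + π/4) (er n) c) : c = if n = 0 then -1 else 0 := by
  have hJ : ∀ n : ℕ, EvC (bJ n) (fun x => ph n x + -(π/4)) (er n) 0 := by
    intro n
    obtain ⟨X, h1, h2⟩ := exist_X n
    obtain ⟨c, hc⟩ := (oscJ n X h1 h2).count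
    have := (eventually_ge_atTop X).mono hc
    have h0 := cJ_zero n c this
    rw [h0] at this; exact this
  rcases Nat.eq_zero_or_pos n with rfl | hn
  · obtain ⟨j, h1, h2⟩ := (((Filter.tendsto_add_atTop_nat 1).eventually (evK 0 c H (1/2) (nz) (nz))).and (evJ 1 0 (hJ 1) (1/2) (nz) (nz))).exists
    rw [show (((j+1:ℕ):ℝ) + (((0:ℕ):ℝ)/2 - 3/4 + 1/2)) * π = (j + (((1:ℕ):ℝ)/2 - 1/4 + 1/2)) * π by push_cast; ring] at h1
    have : ∀ x, zc (bK 0) x = zc (bJ 1) x := fun x => by have := zsK0 x; exact congrArg ncard this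
    rw [this] at h1
    omega
  · have hn' : n ≠ 0 := oz
    obtain ⟨j, h1, h2⟩ := ((evK n c H (3/4) (nz) (nz)).and (evJ n 0 (hJ n) (1/4) (nz) (nz))).exists
    obtain ⟨i, h3, h4⟩ := (((Filter.tendsto_add_atTop_nat 1).eventually (evK n c H (1/4) (nz) (nz))).and (evJ n 0 (hJ n) (3/4) (nz) (nz))).exists
    rw [show (j + ((n:ℝ)/2 - 3/4 + 3/4)) * π = (j + ((n:ℝ)/2 - 1/4 + 1/4)) * π by ring] at h1
    rw [show (((i+1:ℕ):ℝ) + ((n:ℝ)/2 - 3/4 + 1/4)) * π = (i + ((n:ℝ)/2 - 1/4 + 3/4)) * π by push_cast; ring] at h3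
    have a1 := zcJK n hn' ((j + ((n:ℝ)/2 - 1/4 + 1/4)) * π)
    have a2 := zcKJ n ((i + ((n:ℝ)/2 - 1/4 + 3/4)) * π)
    omega

theorem countK (n : ℕ) (x : ℝ) (hx : (n:ℝ) < x) (he : er n x ≤ 1/4) :
    ⌊ph n x / π + 3/4 - er n x⌋ ≤ zc (bK n) x + (if n = 0 then 1 else 0) ∧
    (zc (bK n) x : ℤ) + (if n = 0 then 1 else 0) ≤ ⌊ph n x / π + 3/4 + er n x⌋ := by
  obtain ⟨c, hc⟩ := (oscK n x hx he).count
  have := cK_val n c ((eventually_ge_atTop x).mono hc)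
  have h := hc x le_rfl
  have e : (ph n x + π/4) / π + 1/2 = ph n x / π + 3/4 := by field_simp; ring
  rw [this, e] at h
  split_ifs at * <;> omega

lemma FF_bd (M x : ℝ) (h0 : 0 ≤ x) (h1 : x < M) : 0 ≤ FF M x ∧ FF M x ≤ (M - x) * (arccos (x/M)/π) := by
  have hM : 0 < M := lz
  have hs : √(M^2 - x^2) = M * sin (arccos (x/M)) := by
    rw [sin_arccos, ← sqrt_sq hM.le, ← Real.sqrt_mul (pz), sqrt_sq hM.le]
    congr 1; field_simp
  have hc : x = M * cos (arccos (x/M)) := by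
    rw [cos_arccos (by have : 0 ≤ x/M := pz
                       linarith) (by rw [div_le_one hM]; exact h1.le)]; field_simp
  have hp : 0 < x ∨ x = 0 := h0.lt_or_eq.imp id Eq.symm
  have t0 := arccos_nonneg (x/M)
  unfold FF
  have key : arccos (x/M) * cos (arccos (x/M)) ≤ sin (arccos (x/M)) := by
    rcases hp with hp | rfl
    · have h2 : arccos (x/M) < π/2 := by rw [arccos_lt_pi_div_two]; positivity
      have h3 : 0 < cos (arccos (x/M)) := cos_pos_of_mem_Ioo ⟨lz, h2⟩
      have := le_tan t0 h2
      rwa [tan_eq_sin_div_cos, le_div_iff₀ h3] at this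
    · simp
  have key2 : sin (arccos (x/M)) ≤ arccos (x/M) := sin_le t0
  rw [hs]
  generalize arccos (x/M) = a at *
  constructor
  · apply mul_nonneg (pz)
    have := mul_le_mul_of_nonneg_left key hM.le
    rw [hc]; linarith
  · rw [← mul_div_assoc, one_div, inv_mul_eq_div]
    gcongr
    have := mul_le_mul_of_nonneg_left key2 hM.le
    linarith

noncomputable def GI (M x : ℝ) : ℝ := x * FF M x / 2 + (x * √(M^2 - x^2) - M^2 * arccos (x/M)) / (4*π) + M^2/8

lemma GI_deriv (M x : ℝ) (h1 : -M < x) (h2 : x < M) : HasDerivAt (GI M) (FF M x) x := by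
  have hM : 0 < M := lz
  have hq : 0 < M^2 - x^2 := by nlinarith
  have d1 : HasDerivAt (fun x => √(M^2 - x^2)) (-(2*x) / (2 * √(M^2 - x^2))) x := by
    have : HasDerivAt (fun x : ℝ => M^2 - x^2) (-(2*x)) x := by
      simpa using (hasDerivAt_pow 2 x).const_sub (M^2)
    exact this.sqrt hq.ne'
  have hx1 : x / M ≠ -1 := by intro h; rw [div_eq_iff hM.ne'] at h; linarith
  have hx2 : x / M ≠ 1 := by intro h; rw [div_eq_iff hM.ne'] at h; linarith
  have d2 : HasDerivAt (fun x => arccos (x/M)) (-(1 / √(1 - (x/M)^2)) * (1/M)) x :=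
    HasDerivAt.comp (h₂ := arccos) x (hasDerivAt_arccos hx1 hx2) ((hasDerivAt_id x).div_const M)
  have e : √(1 - (x/M)^2) = √(M^2 - x^2) / M := by
    have h0 : √(M^2 - x^2) / M = √((M^2 - x^2) / M^2) := by rw [sqrt_div hq.le, sqrt_sq hM.le]
    rw [h0]; congr 1; field_simp
  have hF := FF_deriv M x h1 h2
  have := ((((hasDerivAt_id x).mul hF).div_const 2).add ((((hasDerivAt_id x).mul d1).sub (d2.const_mul (M^2))).div_const (4*π))).add_const (M^2/8)
  refine HasDerivAt.congr_deriv (f := GI M) this ?_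
  rw [e]
  have hS : √(M^2 - x^2) ^ 2 = M^2 - x^2 := sq_sqrt hq.le
  have hS0 : 0 < √(M^2 - x^2) := sqrt_pos.2 hq
  unfold FF
  simp only [id]
  generalize √(M^2 - x^2) = S at *
  have hp := pi_pos
  field_simp
  rw [show M^2 = S^2 + x^2 by linarith]
  ring

lemma GI_cell (M x : ℝ) (h0 : -M < x) (h1 : x + 1 < M) :
    |GI M (x+1) - GI M x - (FF M x + FF M (x+1))/2| ≤ (arccos (x/M)/π - arccos ((x+1)/M)/π)/2 := by
  have hM : 0 < M := lz
  have := Convex.norm_image_sub_le_of_norm_hasDerivWithin_le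
    (f := fun y => GI M y - (y - x) * (FF M x + FF M y)/2)
    (f' := fun y => FF M y - (1 * (FF M x + FF M y) + (y - x) * (-(arccos (y/M)/π)))/2)
    (s := Icc x (x+1)) (x := x) (y := x+1) (C := (arccos (x/M)/π - arccos ((x+1)/M)/π)/2)
    (fun y hy => by
      have h1 : -M < y := by linarith [hy.1]
      have h2 : y < M := by linarith [hy.2]
      exact ((GI_deriv M y h1 h2).sub ((((hasDerivAt_id y).sub_const x).mul ((FF_deriv M y h1 h2).const_add _)).div_const 2)).hasDerivWithinAt)
    (fun y hy => by
      obtain ⟨a, b⟩ := FF_slope M x y h0 hy.1 (by linarith [hy.2])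
      have c1 : arccos ((x+1)/M)/π ≤ arccos (y/M)/π := by gcongr; exact hy.2
      have c2 : arccos (y/M)/π ≤ arccos (x/M)/π := by gcongr; exact hy.1
      have c3 : (arccos (x/M)/π - arccos (y/M)/π) * (y - x) ≤ (arccos (x/M)/π - arccos ((x+1)/M)/π) * 1 :=
        mul_le_mul (lz) (by linarith [hy.2]) (by linarith [hy.1]) (lz)
      rw [norm_eq_abs, abs_le]; constructor <;> linarith)
    (convex_Icc _ _) ⟨le_rfl, lz⟩ ⟨lz, le_rfl⟩
  rw [norm_eq_abs, norm_eq_abs] at this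
  simp only [sub_self, add_sub_cancel_left, zero_mul, zero_div, sub_zero, one_mul, abs_one, mul_one] at this
  convert this using 2; ring

lemma trap (M : ℝ) (hM : 1 < M) (K : ℕ) (hK : K = ⌈M⌉₊) :
    |2 * ∑ n ∈ rg K, FF M n - FF M 0 - M^2/4| ≤ 2 := by
  obtain ⟨L, rfl⟩ : ∃ L, K = L + 1 := Nat.exists_eq_succ_of_ne_zero (by rw [hK]; exact (Nat.ceil_pos.2 (lz)).ne')
  have hL1 : (L:ℝ) < M := by have := Nat.lt_ceil.1 (show L < ⌈M⌉₊ by omega); exact this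
  have hL2 : M ≤ L + 1 := by have := le_ceil M; rw [← hK] at this; exact_mod_cast this
  have ind : ∀ k : ℕ, (k:ℝ) < M → |GI M k - (∑ n ∈ rg (k+1), FF M n - (FF M 0 + FF M k)/2)| ≤ (1/2 - arccos (k/M)/π)/2 := by
    intro k
    induction k with
    | zero => intro _; simp [GI]; field_simp; norm_num
    | succ k ih =>
      intro hk
      push_cast at hk
      have h1 := ih (lz)
      have h2 := GI_cell M k (by have : (0:ℝ) ≤ k := pz
                                 linarith) hk
      rw [sum_range_succ]
      push_cast
      rw [abs_le] at *
      constructor <;> linarith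
  have h := ind L hL1
  obtain ⟨f0, f1⟩ := FF_bd M L (pz) hL1
  have fx : ∀ x, (L:ℝ) ≤ x → x < M → 0 ≤ FF M x ∧ FF M x ≤ 1/2 := by
    intro x hx hxM
    have hx0 : 0 ≤ x := le_trans (pz) hx
    obtain ⟨g0, g1⟩ := FF_bd M x hx0 hxM
    refine ⟨g0, g1.trans ?_⟩
    have : arccos (x/M)/π ≤ 1/2 := by
      rw [div_le_iff₀ pi_pos]
      have : arccos (x/M) ≤ π/2 := arccos_le_pi_div_two.2 (pz)
      linarith
    have t0 : 0 ≤ arccos (x/M)/π := div_nonneg (arccos_nonneg _) pi_pos.le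
    nlinarith
  have hcont : Continuous (GI M) := by
    unfold GI FF; fun_prop
  obtain ⟨c, hc, hc'⟩ := exists_hasDerivAt_eq_slope (GI M) (FF M) hL1 hcont.continuousOn
    (fun z hz => GI_deriv M z (by have := hz.1; have : (0:ℝ) ≤ L := pz
                                  linarith) hz.2)
  rw [eq_div_iff (lz)] at hc'
  have hGM : GI M M = M^2/8 := by
    have : M / M = 1 := div_self (lz)
    simp [GI, FF, this]
  have := fx c hc.1.le hc.2
  have h5 : 0 ≤ FF M c * (M - L) := mul_nonneg this.1 (lz)
  have h6 : FF M c * (M - L) ≤ 1/2 := by nlinarith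
  have h7 := fx L le_rfl hL1
  have h8 : 0 ≤ arccos (L/M)/π := div_nonneg (arccos_nonneg _) pi_pos.le
  rw [abs_le] at *
  constructor <;> linarith

lemma er_bd (n : ℕ) (x d v : ℝ) (hv : 0 < v) (h : n ≤ x - d) (hd : 0 < d) (hvd : v^4 ≤ x * d) : er n x ≤ 5 * (x^2 / v^6) := by
  have hn : (n:ℝ) < x := lz
  have h0 : (0:ℝ) ≤ n := pz
  have h4 := qq_four n x hn
  have hq := qq_pos n x hn
  have : v^4 ≤ qq n x ^ 4 := by
    rw [h4]
    have : x * d ≤ (x + n) * (x - n) := mul_le_mul (lz) (lz) hd.le (lz)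
    nlinarith
  have : v ≤ qq n x := le_of_pow_le_pow_left₀ (nz) hq.le this
  unfold er
  gcongr

lemma FF_edge (M x s : ℝ) (h0 : 0 ≤ x) (h1 : x < M) (hs : 0 ≤ s) (h : 2 * (M - x) ≤ M * s^2) : 0 ≤ FF M x ∧ FF M x ≤ (M - x) * s := by
  have hM : 0 < M := lz
  obtain ⟨a, b⟩ := FF_bd M x h0 h1
  refine ⟨a, b.trans ?_⟩
  refine mul_le_mul_of_nonneg_left ?_ (lz)
  have h2 := mul_le_sin (arccos_nonneg (x/M)) (arccos_le_pi_div_two.2 (pz))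
  have h3 : sin (arccos (x/M)) ≤ s := by
    rw [sin_arccos]
    apply Real.sqrt_le_iff.2 ⟨hs, _⟩
    rw [div_pow, sub_le_iff_le_add, ← sub_le_iff_le_add', le_div_iff₀ (pz)]
    nlinarith
  have h4 : arccos (x/M)/π = (2/π * arccos (x/M))/2 := rz
  rw [h4]; linarith

lemma assemble : ∃ C > 0, ∀ t : ℝ, 1000 ≤ t → ∀ c : ℝ, 0 ≤ c → c ≤ 1 → ∀ N : ℕ → ℝ,
    (∀ n : ℕ, (n:ℝ) < t^1000 → er n (t^1000) ≤ 1/4 → (⌊FF (t^1000) n + c - er n (t^1000)⌋:ℝ) ≤ N n ∧ N n ≤ ⌊FF (t^1000) n + c + er n (t^1000)⌋) →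
    (∀ m n, m ≤ n → 0 ≤ N n ∧ N n ≤ N m + 2) →
    |2 * ∑ n ∈ rg ⌈t^1000⌉₊, N n - N 0 - ((t^1000)^2/4 + (2*c-1) * t^1000)| ≤ C * t^664 := by
  obtain ⟨C, hC, hmain⟩ := count_main
  refine ⟨2 * C + 1, pz, fun t ht c c0 c1 N h1 h2 => ?_⟩
  have t0 : 0 < t := lz
  have p1 := pw t ht 660 1000 (nz)
  have p2 := pw t ht 0 100 (nz)
  have p3 := pw t ht 400 660 (nz)
  have p4 := pw t ht 500 664 (nz)
  have p5 := pw t ht 660 664 (nz)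
  have p6 := pw t ht 100 400 (nz)
  have p7 := pw t ht 336 490 (nz)
  have e1 : (t^415)^4 = t^1000 * t^660 := by rw [← pow_mul, ← pow_add]
  have e2 : (t^350)^4 = t^1000 * t^400 := by rw [← pow_mul, ← pow_add]
  have e3 : 5 * ((t^1000)^2 / (t^415)^6) = 5 / t^490 := by
    rw [show (t^415)^6 = (t^1000)^2 * t^490 by rw [← pow_mul, ← pow_mul, ← pow_add]]
    rw [div_mul_cancel_left₀ (pz), div_eq_mul_inv]
  have e4 : 5 * ((t^1000)^2 / (t^350)^6) = 5 / t^100 := by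
    rw [show (t^350)^6 = (t^1000)^2 * t^100 by rw [← pow_mul, ← pow_mul, ← pow_add]]
    rw [div_mul_cancel_left₀ (pz), div_eq_mul_inv]
  have e5 : t^1000 * (2 / t^300)^2 = 4 * t^400 := by
    rw [div_pow, ← pow_mul, show t^1000 = t^400 * t^(300*2) by rw [← pow_add]]
    have : 0 < t^(300*2) := pz
    generalize t^(300*2) = z at *
    field_simp; norm_num
  have e6 : 2 * t^400 * (2 / t^300) = 4 * t^100 := by
    rw [show t^400 = t^100 * t^300 by rw [← pow_add]]
    have : 0 < t^300 := pz
    generalize t^300 = z at *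
    field_simp; norm_num
  have e7 : t^100 * t^400 = t^500 := by rw [← pow_add]
  have q1 : 0 < t^660 := pz
  have q2 : 0 < t^400 := pz
  have q3 : 0 < t^415 := pz
  have q4 : 0 < t^350 := pz
  have q5 : 0 < t^490 := pz
  have q6 : 0 < t^336 := pz
  have q7 : 0 < t^300 := pz
  have hm := hmain t ht ⌊t^1000 - t^660⌋₊
  rw [pow_zero] at p2
  clear hmain
  generalize t^1000 = M at *
  generalize t^660 = a at *
  generalize t^400 = d at *
  generalize t^100 = s at *
  generalize t^415 = v at *
  generalize t^350 = w at *
  generalize t^490 = y at *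
  generalize t^336 = z at *
  generalize t^500 = k at *
  generalize t^664 = R at *
  generalize t^300 = r at *
  clear ht
  set b := ⌊M - a⌋₊ with hb
  set B := ⌊M - d⌋₊ with hB
  set K := ⌈M⌉₊ with hK
  have b1 : (b:ℝ) ≤ M - a := Nat.floor_le (lz)
  have b2 : M - a < b + 1 := lt_floor_add_one _
  have B1 : (B:ℝ) ≤ M - d := Nat.floor_le (lz)
  have B2 : M - d < B + 1 := lt_floor_add_one _
  have K1 : M ≤ K := le_ceil M
  have K2 : (K:ℝ) < M + 1 := ceil_lt_add_one (lz)
  have hbB : b ≤ B := Nat.floor_le_floor (lz)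
  have hBK : B ≤ K := by have : (B:ℝ) ≤ K := lz
                         exact_mod_cast this
  have er2 : ∀ n : ℕ, (n:ℝ) ≤ M - d → er n M ≤ 1/4 := fun n hn => by
    refine (er_bd n M d w q4 hn q2 e2.le).trans ?_
    rw [e4, div_le_div_iff₀ (lz) (nz)]; linarith
  have E2 : ∀ n : ℕ, (n:ℝ) ≤ M - d → |N n - (FF M n + c - 1/2)| ≤ 2 := fun n hn => by
    have he := er2 n hn
    obtain ⟨x1, x2⟩ := h1 n (lz) he
    have y1 := Int.lt_floor_add_one (FF M n + c - er n M)
    have y2 := Int.floor_le (FF M n + c + er n M)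
    rw [abs_le]; constructor <;> linarith
  have S1 : |∑ n ∈ rg b, (N n - (FF M n + c - 1/2))| ≤ C * R := by
    refine hm (lz) b1 c N fun n hn => ?_
    have hn' : (n:ℝ) ≤ M - a := by
      have : (n:ℝ) ≤ b := by exact_mod_cast hn.le
      linarith
    have he : er n M ≤ 1 / z := by
      refine (er_bd n M a v q3 hn' q1 e1.le).trans ?_
      rw [e3, div_le_div_iff₀ q5 q6]; linarith
    obtain ⟨x1, x2⟩ := h1 n (lz) (er2 n (lz))
    refine ⟨le_trans ?_ x1, x2.trans ?_⟩
    · exact_mod_cast Int.floor_le_floor (lz)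
    · exact_mod_cast Int.floor_le_floor (lz)
  have S2 : |∑ n ∈ fIco b B, (N n - (FF M n + c - 1/2))| ≤ (B - b) * 2 := by
    refine (abs_sum_le_sum_abs _ _).trans ((Finset.sum_le_card_nsmul _ _ 2 fun n hn => E2 n ?_).trans ?_)
    · have : (n:ℝ) ≤ B := by exact_mod_cast (mem_fIco.1 hn).2.le
      linarith
    · rw [card_Ico, nsmul_eq_mul, Nat.cast_sub hbB]
  have F3 : ∀ n : ℕ, B ≤ n → (n:ℝ) < M → 0 ≤ FF M n ∧ FF M n ≤ 4 * s := fun n hn hn' => by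
    have hn2 : (B:ℝ) ≤ n := by exact_mod_cast hn
    obtain ⟨x1, x2⟩ := FF_edge M n (2/r) (pz) hn' (pz) (by rw [e5]; linarith)
    refine ⟨x1, x2.trans ?_⟩
    rw [← e6]; gcongr; linarith
  have S3 : |∑ n ∈ fIco B K, (N n - (FF M n + c - 1/2))| ≤ (K - B) * (5 * s) := by
    refine (abs_sum_le_sum_abs _ _).trans ((Finset.sum_le_card_nsmul _ _ (5*s) fun n hn => ?_).trans ?_)
    · obtain ⟨n1, n2⟩ := mem_fIco.1 hn
      obtain ⟨f1, f2⟩ := F3 n n1 (Nat.lt_ceil.1 n2)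
      obtain ⟨f3, f4⟩ := F3 B le_rfl (lz)
      obtain ⟨g1, g2⟩ := h2 B n n1
      have := E2 B B1
      rw [abs_le] at *
      constructor <;> linarith
    · rw [card_Ico, nsmul_eq_mul, Nat.cast_sub hBK]
  have hsum : ∑ n ∈ rg K, (N n - (FF M n + c - 1/2)) = ∑ n ∈ rg b, (N n - (FF M n + c - 1/2))
      + ∑ n ∈ fIco b B, (N n - (FF M n + c - 1/2)) + ∑ n ∈ fIco B K, (N n - (FF M n + c - 1/2)) := by
    rw [Finset.sum_range_add_sum_Ico _ hbB, Finset.sum_range_add_sum_Ico _ hBK]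
  have hsum2 : ∑ n ∈ rg K, (N n - (FF M n + c - 1/2)) = ∑ n ∈ rg K, N n - ∑ n ∈ rg K, FF M n - K * (c - 1/2) := by
    simp only [sum_sub_distrib, sum_add_distrib, sum_const, card_range, nsmul_eq_mul]; ring
  have hT := trap M (lz) K hK
  have h00 := E2 0 (by simp; linarith)
  have S3' : ((K:ℝ) - B) * (5 * s) ≤ 10 * k := by
    rw [← e7]
    have : ((K:ℝ) - B) ≤ 2 * d := lz
    calc ((K:ℝ) - B) * (5 * s) ≤ 2 * d * (5 * s) := by gcongr
      _ = _ := rz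
  have hk : |(2*c-1) * (K - M)| ≤ 1 := by
    rw [abs_mul, abs_of_nonneg (lz : (0:ℝ) ≤ K - M)]
    have : |2*c-1| ≤ 1 := by rw [abs_le]; constructor <;> linarith
    exact (mul_le_mul this (lz : (K:ℝ) - M ≤ 1) (lz) zero_le_one).trans (nz)
  rw [hsum2] at hsum
  simp only [Nat.cast_zero] at h00
  generalize ∑ n ∈ rg b, (N n - (FF M n + c - 1/2)) = Z1 at *
  generalize ∑ n ∈ fIco b B, (N n - (FF M n + c - 1/2)) = Z2 at *
  generalize ∑ n ∈ fIco B K, (N n - (FF M n + c - 1/2)) = Z3 at *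
  rw [abs_le] at *
  constructor <;> linarith

lemma big_t (k : ℕ) : ∃ T : ℝ, 1 ≤ T ∧ ∀ μ : ℝ, T ≤ μ → ∃ t : ℝ, 1000 ≤ t ∧ t^1000 = μ ∧ t^k = μ^((k:ℝ)/1000) := by
  have key : ∀ m : ℕ, m ≠ 0 → ∃ T : ℝ, 1 ≤ T ∧ ∀ μ : ℝ, T ≤ μ → ∃ t : ℝ, 1000 ≤ t ∧ t^m = μ ∧ t^k = μ^((k:ℝ)/m) := by
    intro m hm
    refine ⟨1000^m, one_le_pow₀ (nz), fun μ hμ => ?_⟩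
    have h0 : 0 ≤ μ := le_trans (pz) hμ
    refine ⟨μ^((m:ℝ)⁻¹), ?_, Real.rpow_inv_natCast_pow h0 hm, ?_⟩
    · have := Real.rpow_le_rpow (pz) hμ (pz : (0:ℝ) ≤ (m:ℝ)⁻¹)
      rwa [Real.pow_rpow_inv_natCast (nz) hm] at this
    · rw [← Real.rpow_natCast, ← Real.rpow_mul h0]; congr 1; ring
  exact_mod_cast key 1000 (nz)

lemma final_bd (c : ℝ) (c0 : 0 ≤ c) (c1 : c ≤ 1) (N : ℝ → ℕ → ℝ)
    (h1 : ∀ x (n : ℕ), (n:ℝ) < x → er n x ≤ 1/4 → (⌊FF x n + c - er n x⌋:ℝ) ≤ N x n ∧ N x n ≤ ⌊FF x n + c + er n x⌋)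
    (h2 : ∀ x m n, m ≤ n → 0 ≤ N x n ∧ N x n ≤ N x m + 2)
    (h3 : ∀ T, ∃ A, ∀ x ≤ T, N x 0 ≤ A) : ∃ C > 0, ∀ μ : ℝ, 1 < μ →
    |2 * ∑ n ∈ rg ⌈μ⌉₊, N μ n - N μ 0 - (μ^2/4 + (2*c-1) * μ)| ≤ C * μ^((2:ℝ)/3 - 1/495) := by
  obtain ⟨C, hC, hbig⟩ := assemble
  obtain ⟨T, hT, hT'⟩ := big_t 664
  obtain ⟨A, hA⟩ := h3 T
  have hAA : 0 ≤ A := ((h2 T 0 0 le_rfl).1).trans (hA T le_rfl)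
  refine ⟨C + (2 * ((T+1) * (A+2)) + A + T^2 + T), pz, fun μ hμ => ?_⟩
  have hp : 1 ≤ μ^((2:ℝ)/3 - 1/495) := Real.one_le_rpow hμ.le (nz)
  rcases le_total T μ with h | h
  · obtain ⟨t, ht, hm, hk⟩ := hT' μ h
    have := hbig t ht c c0 c1 (N μ)
    rw [hm, hk] at this
    have := this (h1 μ) (h2 μ)
    have e : μ^(((664:ℕ):ℝ)/1000) ≤ μ^((2:ℝ)/3 - 1/495) := Real.rpow_le_rpow_of_exponent_le hμ.le (nz)
    refine this.trans (mul_le_mul ?_ e (pz) (pz))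
    have : 0 ≤ 2 * ((T+1) * (A+2)) + A + T^2 + T := pz
    linarith
  · have n0 := hA μ h
    have n00 := (h2 μ 0 0 le_rfl).1
    have K2 : (⌈μ⌉₊:ℝ) < μ + 1 := ceil_lt_add_one (lz)
    have s0 : 0 ≤ ∑ n ∈ rg ⌈μ⌉₊, N μ n := Finset.sum_nonneg fun n _ => (h2 μ 0 n (oz)).1
    have s1 : ∑ n ∈ rg ⌈μ⌉₊, N μ n ≤ (T+1) * (A+2) := by
      refine (Finset.sum_le_card_nsmul _ _ (A+2) fun n _ => (h2 μ 0 n (oz)).2.trans (lz)).trans ?_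
      rw [card_range, nsmul_eq_mul]
      gcongr; linarith
    have s2 : μ^2 ≤ T^2 := by gcongr
    have s3 : |(2*c-1) * μ| ≤ 1 * T := by
      rw [abs_mul, abs_of_pos (lz : 0 < μ)]
      have : |2*c-1| ≤ 1 := by rw [abs_le]; constructor <;> linarith
      gcongr
    have s4 : 0 ≤ μ^2 := pz
    have hX : 0 ≤ C + (2 * ((T+1) * (A+2)) + A + T^2 + T) := pz
    refine le_trans ?_ (le_mul_of_one_le_right hX hp)
    rw [abs_le] at *
    constructor <;> linarith

lemma ph_FF (n : ℕ) (x : ℝ) : ph n x / π = FF x n := by unfold ph FF; ring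

lemma zc_mono0 (f : ℕ → ℝ → ℝ) (n : ℕ) (hf : ∀ x, (zs (f n) x).Finite) {x T : ℝ} (h : x ≤ T) : zc (f n) x ≤ zc (f n) T :=
  Set.ncard_le_ncard (fun _ hz => ⟨hz.1, hz.2.1.trans_le h, hz.2.2⟩) (hf T)

lemma zcJ_anti (x : ℝ) : Antitone fun n => zc (bJ n) x := antitone_nat_of_succ_le fun n => zcJ_up n x

lemma zcK_comp (x : ℝ) (n : ℕ) : zc (bJ n) x ≤ zc (bK n) x + (if n = 0 then 1 else 0) ∧ zc (bK n) x + (if n = 0 then 1 else 0) ≤ zc (bJ n) x + 1 := by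
  rcases n with _ | n
  · have h : zc (bK 0) x = zc (bJ 1) x := congrArg Set.ncard (zsK0 x)
    have := zcJ_up 0 x
    have := zcJ_down 0 x
    simp only [h, if_true]; constructor <;> simp_all
  · have := zcJK (n+1) (oz) x
    have := zcKJ (n+1) x
    simp; omega

noncomputable def NJ (μ : ℝ) : ℝ := 2 * ∑ n ∈ rg ⌈μ⌉₊, (zc (bJ n) μ : ℝ) - zc (bJ 0) μ
noncomputable def NK (μ : ℝ) : ℝ := 2 * ∑ n ∈ rg ⌈μ⌉₊, ((zc (bK n) μ + (if n = 0 then 1 else 0) : ℕ) : ℝ) - (zc (bK 0) μ + 1)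

lemma weylJ : ∃ C > 0, ∀ μ : ℝ, 1 < μ → |NJ μ - (μ^2/4 + (2*(1/4)-1) * μ)| ≤ C * μ^((2:ℝ)/3 - 1/495) := by
  refine final_bd (1/4) (nz) (nz) (fun x n => (zc (bJ n) x : ℝ)) (fun x n hn he => ?_) (fun x m n hmn => ?_) (fun T => ⟨zc (bJ 0) T, fun x hx => ?_⟩)
  · have := countJ n x hn he
    rw [ph_FF] at this
    exact_mod_cast this
  · have : zc (bJ n) x ≤ zc (bJ m) x := zcJ_anti x hmn
    have : (zc (bJ n) x : ℝ) ≤ zc (bJ m) x := by exact_mod_cast this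
    exact ⟨pz, lz⟩
  · exact_mod_cast zc_mono0 bJ 0 (finJ 0) hx

lemma weylK : ∃ C > 0, ∀ μ : ℝ, 1 < μ → |NK μ - (μ^2/4 + (2*(3/4)-1) * μ)| ≤ C * μ^((2:ℝ)/3 - 1/495) := by
  have := final_bd (3/4) (nz) (nz) (fun x n => ((zc (bK n) x + (if n = 0 then 1 else 0) : ℕ) : ℝ)) (fun x n hn he => ?_) (fun x m n hmn => ?_) (fun T => ⟨zc (bJ 0) T + 1, fun x hx => ?_⟩)
  · simpa [NK] using this
  · have := countK n x hn he
    rw [ph_FF] at this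
    exact_mod_cast this
  · refine ⟨pz, ?_⟩
    have h1 : zc (bJ n) x ≤ zc (bJ m) x := zcJ_anti x hmn
    have h2 := (zcK_comp x n).2
    have h3 := (zcK_comp x m).1
    exact_mod_cast (show _ ≤ _ + 2 by omega)
  · have h2 := (zcK_comp x 0).2
    have := zc_mono0 bJ 0 (finJ 0) hx
    exact_mod_cast h2.trans (oz)

lemma param_deriv (f f' : ℝ → ℝ → ℝ) (hf : ContinuousOn (Function.uncurry f) (Ioo 0 1 ×ˢ univ))
    (hf' : ContinuousOn (Function.uncurry f') (Ioo 0 1 ×ˢ univ))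
    (hd : ∀ r ∈ Ioo (0:ℝ) 1, ∀ θ, HasDerivAt (fun r => f r θ) (f' r θ) r) (r : ℝ) (hr : r ∈ Ioo (0:ℝ) 1) :
    HasDerivAt (fun r => ∫ θ in (0:ℝ)..2*π, f r θ) (∫ θ in (0:ℝ)..2*π, f' r θ) r := by
  have sl : ∀ g : ℝ → ℝ → ℝ, ContinuousOn (Function.uncurry g) (Ioo 0 1 ×ˢ univ) → ∀ s ∈ Ioo (0:ℝ) 1, Continuous (g s) := fun g hg s hs =>
    continuousOn_univ.1 (hg.comp (f := fun θ : ℝ => (s, θ)) (fz) fun θ _ => ⟨hs, mem_univ _⟩)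
  have hsub : Icc (r/2) ((1+r)/2) ⊆ Ioo (0:ℝ) 1 := fun s hs => ⟨by linarith [hs.1, hr.1], by linarith [hs.2, hr.2]⟩
  obtain ⟨C, hC⟩ := (isCompact_Icc.prod isCompact_uIcc).exists_bound_of_continuousOn
    (hf'.mono (prod_mono hsub (subset_univ (uIcc 0 (2*π)))))
  refine (intervalIntegral.hasDerivAt_integral_of_dominated_loc_of_deriv_le (bound := fun _ => C)
    (Icc_mem_nhds (by linarith [hr.1] : r/2 < r) (by linarith [hr.2] : r < (1+r)/2)) ?_ ((sl f hf r hr).intervalIntegrable _ _)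
    (sl f' hf' r hr).aestronglyMeasurable ?_ intervalIntegrable_const ?_).2
  · filter_upwards [Ioo_mem_nhds hr.1 hr.2] with s hs using (sl f hf s hs).aestronglyMeasurable
  · exact Filter.Eventually.of_forall fun θ hθ s hs => hC (s, θ) ⟨hs, uIoc_subset_uIcc hθ⟩
  · exact Filter.Eventually.of_forall fun θ _ s hs => hd s (hsub hs) θ

lemma param_cont (f : ℝ → ℝ → ℝ) (hf : ContinuousOn (Function.uncurry f) (Icc 0 1 ×ˢ univ)) :
    ContinuousOn (fun r => ∫ θ in (0:ℝ)..2*π, f r θ) (Icc 0 1) := by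
  have h : Continuous (Function.uncurry fun r θ => f (projIcc (0:ℝ) 1 zero_le_one r) θ) :=
    continuousOn_univ.1 (hf.comp (f := fun p : ℝ × ℝ => ((projIcc (0:ℝ) 1 zero_le_one p.1 : ℝ), p.2)) (fz)
      fun p _ => ⟨(projIcc (0:ℝ) 1 zero_le_one p.1).2, mem_univ _⟩)
  refine (intervalIntegral.continuous_parametric_intervalIntegral_of_continuous' (μ := volume) h 0 (2*π)).continuousOn.congr fun r hr => ?_
  simp only [projIcc_of_mem zero_le_one hr]

lemma const_of_deriv (g g' : ℝ → ℝ) (hg : ContinuousOn g (Icc 0 1)) (hd : ∀ r ∈ Ioo (0:ℝ) 1, HasDerivAt g (g' r) r)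
    (h0 : ∀ r ∈ Ioo (0:ℝ) 1, 0 ≤ g' r) (e : g 0 = g 1) : ∀ r ∈ Ioo (0:ℝ) 1, g' r = 0 ∧ g r = g 1 := by
  have hm : MonotoneOn g (Icc 0 1) := monotoneOn_of_hasDerivWithinAt_nonneg (convex_Icc 0 1) hg
    (fun x hx => (hd x (by simpa using hx)).hasDerivWithinAt) (fun x hx => h0 x (by simpa using hx))
  have hc : ∀ r ∈ Icc (0:ℝ) 1, g r = g 1 := fun r hr =>
    le_antisymm (hm hr ⟨zero_le_one, le_rfl⟩ hr.2) (e ▸ hm ⟨le_rfl, zero_le_one⟩ hr hr.1)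
  intro r hr
  refine ⟨?_, hc r ⟨hr.1.le, hr.2.le⟩⟩
  refine (hd r hr).unique ((hasDerivAt_const r (g 1)).congr_of_eventuallyEq ?_)
  filter_upwards [Ioo_mem_nhds hr.1 hr.2] with s hs using hc s ⟨hs.1.le, hs.2.le⟩

structure Rad (a D : ℝ → ℝ) (n : ℕ) (l : ℝ) : Prop where
  ca : ContinuousOn a (Icc 0 1)
  cD : ContinuousOn D (Icc 0 1)
  da : ∀ r ∈ Ioo (0:ℝ) 1, HasDerivAt a (D r) r
  dD : ∀ r ∈ Ioo (0:ℝ) 1, HasDerivAt (fun r => r * D r) ((n^2 - l*r^2)*a r/r) r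
  a0 : n ≠ 0 → a 0 = 0

lemma Rad.wr {a D : ℝ → ℝ} {n : ℕ} {l : ℝ} (h : Rad a D n l) (hl : 0 < l) : D 1 * bJ n (√l) = a 1 * bK n (√l) := by
  have hk : 0 < √l := sqrt_pos.2 hl
  have hk2 : √l^2 = l := sq_sqrt hl.le
  generalize √l = k at *
  have hb := bJ_cont n
  have hK := bK_cont n
  have key : ∀ r ∈ Ioo (0:ℝ) 1, HasDerivAt (fun r => r * D r * bJ n (k*r) - a r * bK n (k*r)) 0 r := by
    intro r hr
    have hr0 := hr.1
    have hkr : k * r ≠ 0 := pz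
    have d0 : HasDerivAt (fun r => k * r) k r := by simpa using (hasDerivAt_id r).const_mul k
    have d1 := HasDerivAt.comp r (bJ_deriv n (k*r) hkr) d0
    have d2 := HasDerivAt.comp r (bK_deriv n (k*r) hkr) d0
    refine (((h.dD r hr).mul d1).sub ((h.da r hr).mul d2)).congr_deriv ?_
    simp only [Function.comp]
    rw [← hk2]
    have := hr0.ne'
    field_simp
    ring
  have c : ContinuousOn (fun r => r * D r * bJ n (k*r) - a r * bK n (k*r)) (Icc 0 1) :=
    ((continuousOn_id.mul h.cD).mul (fz)).sub (h.ca.mul (fz))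
  obtain ⟨x, -, hx⟩ := exists_hasDerivAt_eq_slope _ (fun _ => 0) zero_lt_one c key
  simp [bK_zero] at hx
  linarith

lemma Rad.zero {a D : ℝ → ℝ} {n : ℕ} {l : ℝ} (h : Rad a D n l) (hl : 0 < l) (ha : a 1 = 0) (hD : D 1 = 0) : ∀ r ∈ Ioo (0:ℝ) 1, a r = 0 := by
  have := const_of_deriv (fun r => (r * D r)^2 + (l * r^2 - n^2) * a r^2) (fun r => 2 * l * r * a r^2)
    (((continuousOn_id.mul h.cD).pow 2).add ((fz : ContinuousOn (fun r : ℝ => l * r^2 - n^2) _).mul (h.ca.pow 2)))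
    (fun r hr => by
      have hr0 := hr.1.ne'
      have d1 : HasDerivAt (fun r : ℝ => l * r^2 - n^2) (l * (2 * r)) r := by
        simpa using ((hasDerivAt_pow 2 r).const_mul l).sub_const ((n:ℝ)^2)
      refine (((h.dD r hr).pow 2).add (d1.mul ((h.da r hr).pow 2))).congr_deriv ?_
      simp only [Pi.pow_apply, Nat.cast_ofNat, Nat.add_one_sub_one, pow_one]
      field_simp; ring)
    (fun r hr => by have := hr.1; positivity)
    (by by_cases hn : n = 0
        · simp [ha, hD, hn]
        · simp [ha, hD, h.a0 hn])
  intro r hr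
  have := (this r hr).1
  have h0 := hr.1
  simpa [hl.ne', h0.ne'] using this

lemma Rad.neg {a D : ℝ → ℝ} {n : ℕ} {l : ℝ} (h : Rad a D n l) (hl : l ≤ 0) (hb : a 1 * D 1 = 0) (r : ℝ) (hr : r ∈ Ioo (0:ℝ) 1) :
    (l < 0 ∨ n ≠ 0 → a r = 0) ∧ a r = a 1 := by
  have key := const_of_deriv (fun r => r * D r * a r) (fun r => (n^2 - l*r^2)*a r/r * a r + r * D r * D r)
    ((continuousOn_id.mul h.cD).mul h.ca)
    (fun r hr => (h.dD r hr).mul (h.da r hr))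
    (fun r hr => by
      have h1 : 0 ≤ n^2 - l*r^2 := by nlinarith [sq_nonneg r, sq_nonneg (n:ℝ)]
      have := hr.1
      rw [show (n^2 - l*r^2)*a r/r * a r + r * D r * D r = (n^2 - l*r^2)*(a r^2)/r + r * D r^2 by ring]
      positivity)
    (by rw [zero_mul, zero_mul, one_mul, mul_comm, hb])
  have hz : ∀ r ∈ Ioo (0:ℝ) 1, (n^2 - l*r^2)*(a r^2) = 0 ∧ D r = 0 := fun r hr => by
    have h2 := (key r hr).1
    have h1 : 0 ≤ n^2 - l*r^2 := by nlinarith [sq_nonneg r, sq_nonneg (n:ℝ)]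
    have h0 := hr.1
    rw [show (n^2 - l*r^2)*a r/r * a r + r * D r * D r = (n^2 - l*r^2)*(a r^2)/r + r * D r^2 by ring] at h2
    have := (add_eq_zero_iff_of_nonneg (pz) (pz)).1 h2
    simpa [h0.ne'] using this
  constructor
  · intro hc
    have h0 := hr.1
    have h3 : 0 < n^2 - l*r^2 := by
      rcases hc with hc | hc
      · have : 0 < r^2 := pz
        nlinarith [sq_nonneg (n:ℝ)]
      · have : 0 < (n:ℝ)^2 := pz
        nlinarith [sq_nonneg r]
    simpa [h3.ne'] using (hz r hr).1
  · obtain ⟨x, hx, hx'⟩ := exists_hasDerivAt_eq_slope a D hr.2 (h.ca.mono (Icc_subset_Icc hr.1.le le_rfl)) (fun z hz => h.da z ⟨hr.1.trans hz.1, hz.2⟩)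
    rw [(hz x ⟨hr.1.trans hx.1, hx.2⟩).2, eq_div_iff (by linarith [hr.2])] at hx'
    linarith

lemma open_disk : IsOpen unitDisk := isOpen_lt (fz) (fz)
lemma disk_sub : unitDisk ⊆ closedDisk := fun _ h => le_of_lt (Set.mem_ofPred_eq.mp h)
lemma disk_conv : Convex ℝ closedDisk := by
  intro x hx y hy a b ha hb hab
  have hx : x.1^2 + x.2^2 ≤ 1 := hx
  have hy : y.1^2 + y.2^2 ≤ 1 := hy
  show (a * x.1 + b * y.1)^2 + (a * x.2 + b * y.2)^2 ≤ 1
  obtain rfl : b = 1 - a := lz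
  nlinarith [mul_nonneg (mul_nonneg ha hb) (add_nonneg (sq_nonneg (x.1-y.1)) (sq_nonneg (x.2-y.2)))]
lemma disk_uniq : UniqueDiffOn ℝ closedDisk :=
  uniqueDiffOn_convex disk_conv ⟨0, mem_interior.2 ⟨unitDisk, disk_sub, open_disk, by simp [unitDisk]⟩⟩
lemma disk_nhds {x : ℝ × ℝ} (h : x ∈ unitDisk) : closedDisk ∈ nhds x := Filter.mem_of_superset (open_disk.mem_nhds h) disk_sub

/-- polar coordinates -/
noncomputable def po (r θ : ℝ) : ℝ × ℝ := (r * cos θ, r * sin θ)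
lemma po_sq (r θ : ℝ) : (po r θ).1^2 + (po r θ).2^2 = r^2 := by
  show (r * cos θ)^2 + (r * sin θ)^2 = r^2
  linear_combination r^2 * (sin_sq_add_cos_sq θ)
lemma po_disk {r : ℝ} (h : r ∈ Ioo (0:ℝ) 1) (θ : ℝ) : po r θ ∈ unitDisk := by
  show _ < (1:ℝ); rw [po_sq]; nlinarith [h.1, h.2]
lemma po_closed {r : ℝ} (h : r ∈ Icc (0:ℝ) 1) (θ : ℝ) : po r θ ∈ closedDisk := by
  show _ ≤ (1:ℝ); rw [po_sq]; nlinarith [h.1, h.2]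
lemma po_cont : Continuous (fun x : ℝ × ℝ => po x.1 x.2) := by unfold po; fun_prop

lemma fd_lin (w : ℝ × ℝ → ℝ) (x : ℝ × ℝ) (a b : ℝ) : fderiv ℝ w x (a, b) = pd1 w x * a + pd2 w x * b := by
  have : (a, b) = a • ((1:ℝ), (0:ℝ)) + b • ((0:ℝ), (1:ℝ)) := sz
  rw [this, map_add, map_smul, map_smul, pd1, pd2, smul_eq_mul, smul_eq_mul]; ring

lemma po_dr (w : ℝ × ℝ → ℝ) (r θ : ℝ) (h : DifferentiableAt ℝ w (po r θ)) :
    HasDerivAt (fun r => w (po r θ)) (pd1 w (po r θ) * cos θ + pd2 w (po r θ) * sin θ) r := by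
  have d : HasDerivAt (fun r => po r θ) (cos θ, sin θ) r :=
    ((by simpa using (hasDerivAt_id r).mul_const (cos θ)) : HasDerivAt (fun r => r * cos θ) _ r).prodMk
      ((by simpa using (hasDerivAt_id r).mul_const (sin θ)) : HasDerivAt (fun r => r * sin θ) _ r)
  rw [← fd_lin]
  exact h.hasFDerivAt.comp_hasDerivAt r d

lemma po_dt (w : ℝ × ℝ → ℝ) (r θ : ℝ) (h : DifferentiableAt ℝ w (po r θ)) :
    HasDerivAt (fun θ => w (po r θ)) (pd1 w (po r θ) * (r * -sin θ) + pd2 w (po r θ) * (r * cos θ)) θ := by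
  have d : HasDerivAt (fun θ => po r θ) (r * -sin θ, r * cos θ) θ :=
    ((hasDerivAt_cos θ).const_mul r).prodMk ((hasDerivAt_sin θ).const_mul r)
  rw [← fd_lin]
  exact h.hasFDerivAt.comp_hasDerivAt θ d

lemma pd_smooth {u : ℝ × ℝ → ℝ} (h : ContDiffOn ℝ (⊤ : ℕ∞) u unitDisk) :
    ContDiffOn ℝ (⊤ : ℕ∞) (pd1 u) unitDisk ∧ ContDiffOn ℝ (⊤ : ℕ∞) (pd2 u) unitDisk := by
  have := h.fderiv_of_isOpen open_disk (m := (⊤ : ℕ∞)) (sz)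
  exact ⟨this.clm_apply contDiffOn_const, this.clm_apply contDiffOn_const⟩

noncomputable def ez (m : ℤ) (θ : ℝ) : ℝ := if 0 ≤ m then cos (m * θ) else sin (m * θ)
noncomputable def ez1 (m : ℤ) (θ : ℝ) : ℝ := if 0 ≤ m then -sin (m * θ) * m else cos (m * θ) * m

lemma ez_d (m : ℤ) (θ : ℝ) : HasDerivAt (ez m) (ez1 m θ) θ ∧ HasDerivAt (ez1 m) (-(m^2 * ez m θ)) θ := by
  have d : HasDerivAt (fun θ : ℝ => (m:ℝ) * θ) m θ := by simpa using (hasDerivAt_id θ).const_mul (m:ℝ)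
  unfold ez ez1
  split_ifs
  · exact ⟨d.cos, (d.sin.neg.mul_const _).congr_deriv (rz)⟩
  · exact ⟨d.sin, (d.cos.mul_const _).congr_deriv (rz)⟩
lemma ez_cont (m : ℤ) : Continuous (ez m) := continuous_iff_continuousAt.2 fun θ => (ez_d m θ).1.continuousAt
lemma ez1_cont (m : ℤ) : Continuous (ez1 m) := continuous_iff_continuousAt.2 fun θ => (ez_d m θ).2.continuousAt
lemma ez_per (m : ℤ) : ez m (2*π) = ez m 0 ∧ ez1 m (2*π) = ez1 m 0 := by
  have h2 : sin ((m:ℝ) * (2*π)) = 0 := by simpa using sin_periodic.int_mul_eq m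
  unfold ez ez1; simp_all

noncomputable def cA (u : ℝ × ℝ → ℝ) (m : ℤ) (r : ℝ) : ℝ := ∫ θ in (0:ℝ)..2*π, u (po r θ) * ez m θ
noncomputable def cD (u : ℝ × ℝ → ℝ) (m : ℤ) (r : ℝ) : ℝ :=
  ∫ θ in (0:ℝ)..2*π, fderivWithin ℝ u closedDisk (po r θ) (cos θ, sin θ) * ez m θ

lemma po_on {w : ℝ × ℝ → ℝ} (h : ContinuousOn w unitDisk) : ContinuousOn (fun x : ℝ × ℝ => w (po x.1 x.2)) (Ioo 0 1 ×ˢ univ) :=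
  h.comp po_cont.continuousOn fun _ hx => po_disk hx.1 _

lemma ez_int (m : ℤ) (hm : m ≠ 0) : ∫ θ in (0:ℝ)..2*π, ez m θ = 0 := by
  have h := intervalIntegral.integral_eq_sub_of_hasDerivAt (a := 0) (b := 2*π) (fun θ _ => (ez_d m θ).2)
    ((((ez_cont m).const_mul _).neg).intervalIntegrable _ _)
  rw [(ez_per m).2, sub_self, intervalIntegral.integral_neg, integral_const_mul] at h
  simpa [hm] using h

lemma radOf (u : ℝ × ℝ → ℝ) (hu : ContDiffOn ℝ (⊤ : ℕ∞) u closedDisk) (l : ℝ)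
    (hl : ∀ x ∈ unitDisk, lap u x = -l * u x) (m : ℤ) : Rad (cA u m) (cD u m) m.natAbs l := by
  have hu' := hu.mono disk_sub
  obtain ⟨s1, s2⟩ := pd_smooth hu'
  obtain ⟨s11, s12⟩ := pd_smooth s1
  obtain ⟨s21, s22⟩ := pd_smooth s2
  have df : ∀ w : ℝ × ℝ → ℝ, ContDiffOn ℝ (⊤ : ℕ∞) w unitDisk → ∀ r ∈ Ioo (0:ℝ) 1, ∀ θ, DifferentiableAt ℝ w (po r θ) :=
    fun w hw r hr θ => (hw.differentiableOn (sz)).differentiableAt (open_disk.mem_nhds (po_disk hr θ))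
  have c0 := po_on hu'.continuousOn
  have c1 := po_on s1.continuousOn
  have c2 := po_on s2.continuousOn
  have c11 := po_on s11.continuousOn
  have c12 := po_on s12.continuousOn
  have c21 := po_on s21.continuousOn
  have c22 := po_on s22.continuousOn
  have cc : ContinuousOn (fun x : ℝ × ℝ => cos x.2) (Ioo (0:ℝ) 1 ×ˢ univ) := fz
  have cs : ContinuousOn (fun x : ℝ × ℝ => sin x.2) (Ioo (0:ℝ) 1 ×ˢ univ) := fz
  have cr : ContinuousOn (fun x : ℝ × ℝ => x.1) (Ioo (0:ℝ) 1 ×ˢ univ) := fz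
  have ce : ContinuousOn (fun x : ℝ × ℝ => ez m x.2) (Ioo (0:ℝ) 1 ×ˢ univ) := ((ez_cont m).comp continuous_snd).continuousOn
  have cA1 := (c1.mul cc).add (c2.mul cs)
  have cA2 := (((c11.mul cc).add (c12.mul cs)).mul cc).add (((c21.mul cc).add (c22.mul cs)).mul cs)
  have hD : ∀ r ∈ Ioo (0:ℝ) 1, cD u m r = ∫ θ in (0:ℝ)..2*π, (pd1 u (po r θ) * cos θ + pd2 u (po r θ) * sin θ) * ez m θ := fun r hr => by
    unfold cD
    congr 1; ext θ
    rw [fderivWithin_of_mem_nhds (disk_nhds (po_disk hr θ)), fd_lin]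
  refine ⟨?_, ?_, ?_, ?_, ?_⟩
  · exact param_cont _ ((hu.continuousOn.comp po_cont.continuousOn fun x hx => po_closed hx.1 _).mul ((ez_cont m).comp continuous_snd).continuousOn)
  · refine param_cont _ (ContinuousOn.mul (ContinuousOn.clm_apply (((hu.continuousOn_fderivWithin disk_uniq (sz)).comp po_cont.continuousOn fun x hx => po_closed hx.1 _)) ?_) ((ez_cont m).comp continuous_snd).continuousOn)
    fun_prop
  · intro r hr
    rw [hD r hr]
    exact param_deriv (fun r θ => u (po r θ) * ez m θ) (fun r θ => (pd1 u (po r θ) * cos θ + pd2 u (po r θ) * sin θ) * ez m θ)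
      (c0.mul ce) (cA1.mul ce) (fun r hr θ => (po_dr u r θ (df u hu' r hr θ)).mul_const _) r hr
  · intro r hr
    have k := param_deriv (fun r θ => r * (pd1 u (po r θ) * cos θ + pd2 u (po r θ) * sin θ) * ez m θ)
      (fun r θ => (1 * (pd1 u (po r θ) * cos θ + pd2 u (po r θ) * sin θ) + r *
        ((pd1 (pd1 u) (po r θ) * cos θ + pd2 (pd1 u) (po r θ) * sin θ) * cos θ + (pd1 (pd2 u) (po r θ) * cos θ + pd2 (pd2 u) (po r θ) * sin θ) * sin θ)) * ez m θ)
      ((cr.mul cA1).mul ce) ((((continuousOn_const (c := (1:ℝ))).mul cA1).add (cr.mul cA2)).mul ce)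
      (fun r hr θ => (((hasDerivAt_id r).mul (((po_dr _ r θ (df _ s1 r hr θ)).mul_const _).add ((po_dr _ r θ (df _ s2 r hr θ)).mul_const _))).mul_const _)) r hr
    refine (k.congr_of_eventuallyEq ?_).congr_deriv ?_
    · filter_upwards [Ioo_mem_nhds hr.1 hr.2] with s hs
      rw [hD s hs, ← integral_const_mul]
      congr 1; ext θ; ring
    · have sl : ∀ w : ℝ × ℝ → ℝ, ContDiffOn ℝ (⊤ : ℕ∞) w unitDisk → Continuous (fun θ => w (po r θ)) := fun w hw =>
        continuous_iff_continuousAt.2 fun θ => (po_dt w r θ (df w hw r hr θ)).continuousAt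
      have g0 := sl _ hu'
      have g1 := sl _ s1
      have g2 := sl _ s2
      have g11 := sl _ s11
      have g12 := sl _ s12
      have g21 := sl _ s21
      have g22 := sl _ s22
      have ge := ez_cont m
      have G : Continuous fun θ => r * ((1 * (pd1 u (po r θ) * cos θ + pd2 u (po r θ) * sin θ) + r *
          ((pd1 (pd1 u) (po r θ) * cos θ + pd2 (pd1 u) (po r θ) * sin θ) * cos θ + (pd1 (pd2 u) (po r θ) * cos θ + pd2 (pd2 u) (po r θ) * sin θ) * sin θ)) * ez m θ) := fz
      have G' : Continuous fun θ => (m^2 - l*r^2) * (u (po r θ) * ez m θ) := (g0.mul ge).const_mul _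
      have z := intervalIntegral.integral_eq_sub_of_hasDerivAt (a := 0) (b := 2*π)
        (f := fun θ => (pd1 u (po r θ) * (r * -sin θ) + pd2 u (po r θ) * (r * cos θ)) * ez m θ - u (po r θ) * ez1 m θ)
        (fun θ _ => HasDerivAt.congr_deriv ((((po_dt _ r θ (df _ s1 r hr θ)).mul ((hasDerivAt_sin θ).neg.const_mul r)).add
          ((po_dt _ r θ (df _ s2 r hr θ)).mul ((hasDerivAt_cos θ).const_mul r))).mul (ez_d m θ).1 |>.sub
          ((po_dt _ r θ (df _ hu' r hr θ)).mul (ez_d m θ).2)) (by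
            have e := hl _ (po_disk hr θ)
            have e2 := sin_sq_add_cos_sq θ
            rw [lap] at e
            show _ = (m^2 - l*r^2) * (u (po r θ) * ez m θ) - r * ((1 * (pd1 u (po r θ) * cos θ + pd2 u (po r θ) * sin θ) + r *
          ((pd1 (pd1 u) (po r θ) * cos θ + pd2 (pd1 u) (po r θ) * sin θ) * cos θ + (pd1 (pd2 u) (po r θ) * cos θ + pd2 (pd2 u) (po r θ) * sin θ) * sin θ)) * ez m θ)
            simp only [Pi.add_apply, Pi.mul_apply, Pi.neg_apply]
            grind))
        ((G'.sub G).intervalIntegrable _ _)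
      have ep : po r (2*π) = po r 0 := by simp [po]
      simp only [Pi.sub_apply, ep, ez_per m, cos_two_pi, sin_two_pi, cos_zero, sin_zero, sub_self] at z
      rw [intervalIntegral.integral_sub (G'.intervalIntegrable _ _) (G.intervalIntegrable _ _), integral_const_mul, integral_const_mul] at z
      rw [eq_div_iff hr.1.ne', mul_comm, ← sub_eq_zero, ← neg_sub, Nat.cast_natAbs, Int.cast_abs, sq_abs, cA, z, neg_zero]
  · intro hm
    have hm : m ≠ 0 := by simpa using hm
    have : ∀ θ, po 0 θ = 0 := fun θ => by simp [po]
    simp only [cA, this, integral_const_mul, ez_int m hm, mul_zero]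

lemma four_zero (g : ℝ → ℝ) (hg : Continuous g) (hp : g 0 = g (2*π)) (h : ∀ m, ∫ θ in (0:ℝ)..2*π, g θ * ez m θ = 0) (θ : ℝ) (hθ : θ ∈ Ico 0 (2*π)) : g θ = 0 := by
  have : Fact (0 < 2*π) := ⟨pz⟩
  have hc : ∀ n : ℤ, ∫ θ in (0:ℝ)..2*π, g θ * cos (n * θ) = 0 := fun n => by
    rcases le_total 0 n with hn | hn
    · simpa [ez, hn] using h n
    · simpa [ez, hn] using h (-n)
  have hs : ∀ n : ℤ, ∫ θ in (0:ℝ)..2*π, g θ * sin (n * θ) = 0 := fun n => by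
    rcases lt_trichotomy n 0 with hn | rfl | hn
    · simpa [ez, hn.not_ge] using h n
    · simp
    · simpa [ez, hn.not_ge] using h (-n)
  have hcont : Continuous (fun θ => (g θ : ℂ)) := Complex.continuous_ofReal.comp hg
  let f : C(AddCircle (2*π), ℂ) := ⟨AddCircle.liftIco (2*π) 0 (fun θ => (g θ : ℂ)),
    AddCircle.liftIco_zero_continuous (by simp [hp]) hcont.continuousOn⟩
  have hf : fourierCoeff f = 0 := by
    ext n
    show fourierCoeff (AddCircle.liftIco (2*π) 0 (fun θ => (g θ : ℂ))) n = 0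
    rw [fourierCoeff_liftIco_eq, fourierCoeffOn_eq_integral]
    have e : ∀ x : ℝ, fourier (-n) (x : AddCircle (0 + 2*π - 0)) • (g x : ℂ) = ((g x * cos (n * x) : ℝ) : ℂ) - I * ((g x * sin (n * x) : ℝ) : ℂ) := fun x => by
      rw [fourier_coe_apply]
      have : 2 * (π:ℂ) * I * ((-n : ℤ):ℂ) * x / ((0 + 2*π - 0 : ℝ):ℂ) = ((-(n * x) : ℝ):ℂ) * I := by
        have : (π:ℂ) ≠ 0 := by simp [pi_ne_zero]
        push_cast; field_simp; ring
      rw [this, Complex.exp_mul_I, ← Complex.ofReal_cos, ← Complex.ofReal_sin, cos_neg, sin_neg, smul_eq_mul]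
      push_cast; ring
    simp only [e, zero_add]
    rw [intervalIntegral.integral_sub (Continuous.intervalIntegrable (fz) _ _) (Continuous.intervalIntegrable (fz) _ _),
      integral_const_mul, intervalIntegral.integral_ofReal, intervalIntegral.integral_ofReal, hc, hs]
    simp
  have := has_pointwise_sum_fourier_series_of_summable (f := f) (by rw [hf]; exact summable_zero) (θ : AddCircle (2*π))
  rw [hf] at this
  simp only [Pi.zero_apply, zero_smul] at this
  have e := this.unique hasSum_zero
  have e2 : f (θ : AddCircle (2*π)) = (g θ : ℂ) := AddCircle.liftIco_zero_coe_apply (f := fun θ => (g θ : ℂ)) hθ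
  rw [e2] at e
  exact_mod_cast e

lemma po_surj (x : ℝ × ℝ) : ∃ θ ∈ Ico 0 (2*π), x = po (√(x.1^2+x.2^2)) θ := by
  set z : ℂ := ⟨x.1, x.2⟩
  have hz : ‖z‖ = √(x.1^2+x.2^2) := by rw [Complex.norm_eq_sqrt_sq_add_sq]
  obtain ⟨y, hy, hy'⟩ : ∃ y ∈ Ico 0 (2*π), ∃ n : ℤ, y = Complex.arg z + n * (2*π) := by
    have := toIcoMod_mem_Ico (two_pi_pos) 0 (Complex.arg z)
    rw [zero_add] at this
    exact ⟨_, this, -toIcoDiv two_pi_pos 0 (Complex.arg z), by rw [← self_sub_toIcoDiv_zsmul, zsmul_eq_mul]; push_cast; ring⟩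
  obtain ⟨n, rfl⟩ := hy'
  refine ⟨_, hy, ?_⟩
  rw [← hz, po, cos_add_int_mul_two_pi, sin_add_int_mul_two_pi, Complex.norm_mul_cos_arg, Complex.norm_mul_sin_arg]

lemma zero_of_coef (u : ℝ × ℝ → ℝ) (hu : ContinuousOn u closedDisk) (ho : ∀ x, x ∉ closedDisk → u x = 0)
    (h : ∀ m, ∀ r ∈ Ioo (0:ℝ) 1, cA u m r = 0) : u = 0 := by
  have h1 : ∀ x ∈ unitDisk, x ≠ 0 → u x = 0 := by
    intro x hx hx0
    obtain ⟨θ, hθ, e⟩ := po_surj x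
    have hpos : 0 < x.1^2+x.2^2 := by
      by_contra hc
      apply hx0
      have : x.1 = 0 := by nlinarith [sq_nonneg x.1, sq_nonneg x.2]
      have : x.2 = 0 := by nlinarith [sq_nonneg x.1, sq_nonneg x.2]
      ext <;> assumption
    have hr : √(x.1^2+x.2^2) ∈ Ioo (0:ℝ) 1 := ⟨sqrt_pos.2 hpos, by rw [Real.sqrt_lt' one_pos, one_pow]; exact hx⟩
    generalize √(x.1^2+x.2^2) = r at *
    rw [e]
    refine four_zero (fun θ => u (po r θ)) ?_ (by simp [po]) (fun m => h m r hr) θ hθ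
    exact continuousOn_univ.1 (hu.comp (f := fun θ => po r θ) (by unfold po; fun_prop) fun θ _ => po_closed ⟨hr.1.le, hr.2.le⟩ θ)
  have hd : closedDisk ⊆ closure (unitDisk \ {0}) := by
    intro x hx
    by_cases hx0 : x = 0
    · have ht : Tendsto (fun s : ℝ => (s, (0:ℝ))) (nhdsWithin 0 (Ioo 0 1)) (nhds x) := by
        rw [hx0]; exact ((fz : Continuous fun s : ℝ => (s, (0:ℝ))).tendsto 0).mono_left nhdsWithin_le_nhds
      have : (nhdsWithin (0:ℝ) (Ioo 0 1)).NeBot := left_nhdsWithin_Ioo_neBot zero_lt_one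
      refine mem_closure_of_tendsto ht ?_
      filter_upwards [self_mem_nhdsWithin] with s hs
      refine ⟨?_, by simp [hs.1.ne']⟩
      show s^2 + 0^2 < (1:ℝ)
      nlinarith [hs.1, hs.2]
    · have ht : Tendsto (fun s : ℝ => s • x) (nhdsWithin 1 (Ioo 0 1)) (nhds x) := by
        have := ((fz : Continuous fun s : ℝ => s • x).tendsto 1).mono_left (nhdsWithin_le_nhds (s := Ioo 0 1))
        rwa [one_smul] at this
      have : (nhdsWithin (1:ℝ) (Ioo 0 1)).NeBot := right_nhdsWithin_Ioo_neBot zero_lt_one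
      refine mem_closure_of_tendsto ht ?_
      filter_upwards [self_mem_nhdsWithin] with s hs
      refine ⟨?_, by simp [hs.1.ne', hx0]⟩
      have hx : x.1^2 + x.2^2 ≤ 1 := hx
      show (s * x.1)^2 + (s*x.2)^2 < (1:ℝ)
      have : s^2 < 1 := by nlinarith [hs.1, hs.2]
      nlinarith [sq_nonneg s]
  funext x
  by_cases hx : x ∈ closedDisk
  · obtain ⟨s, hs, hs'⟩ := mem_closure_iff_seq_limit.1 (hd hx)
    have ht : Tendsto (fun n => u (s n)) atTop (nhds (u x)) :=
      (hu x hx).tendsto.comp (tendsto_nhdsWithin_iff.2 ⟨hs', Filter.Eventually.of_forall fun n => disk_sub (hs n).1⟩)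
    exact (tendsto_nhds_unique ht (tendsto_const_nhds.congr fun n => (h1 _ (hs n).1 (hs n).2).symm))
  · exact ho x hx

lemma pd_add {u v : ℝ × ℝ → ℝ} {x : ℝ × ℝ} (hu : DifferentiableAt ℝ u x) (hv : DifferentiableAt ℝ v x) :
    pd1 (u + v) x = pd1 u x + pd1 v x ∧ pd2 (u + v) x = pd2 u x + pd2 v x := by
  simp [pd1, pd2, fderiv_add hu hv]
lemma pd_smul {u : ℝ × ℝ → ℝ} {x : ℝ × ℝ} (c : ℝ) (hu : DifferentiableAt ℝ u x) :
    pd1 (c • u) x = c * pd1 u x ∧ pd2 (c • u) x = c * pd2 u x := by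
  simp [pd1, pd2, fderiv_const_smul hu c]
lemma pd_congr {u v : ℝ × ℝ → ℝ} (h : EqOn u v unitDisk) : EqOn (pd1 u) (pd1 v) unitDisk ∧ EqOn (pd2 u) (pd2 v) unitDisk := by
  have : ∀ x ∈ unitDisk, fderiv ℝ u x = fderiv ℝ v x := fun x hx =>
    Filter.EventuallyEq.fderiv_eq (Filter.eventuallyEq_of_mem (open_disk.mem_nhds hx) h)
  constructor <;> intro x hx <;> simp [pd1, pd2, this x hx]
lemma lap_congr {u v : ℝ × ℝ → ℝ} (h : EqOn u v unitDisk) : EqOn (lap u) (lap v) unitDisk := fun x hx => by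
  simp only [lap, (pd_congr (pd_congr h).1).1 hx, (pd_congr (pd_congr h).2).2 hx]
lemma diff_at {u : ℝ × ℝ → ℝ} (h : ContDiffOn ℝ (⊤ : ℕ∞) u unitDisk) {x} (hx : x ∈ unitDisk) : DifferentiableAt ℝ u x :=
  (h.differentiableOn (sz)).differentiableAt (open_disk.mem_nhds hx)

/-- the eigen-equation without boundary conditions -/
def VS (l : ℝ) : Submodule ℝ (ℝ × ℝ → ℝ) where
  carrier := {u | ContDiffOn ℝ (⊤ : ℕ∞) u closedDisk ∧ (∀ x ∈ unitDisk, lap u x = -l * u x) ∧ (∀ x, x ∉ closedDisk → u x = 0)}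
  zero_mem' := by
    refine ⟨contDiffOn_const, fun x _ => ?_, fun _ _ => rfl⟩
    have h1 : ∀ x, fderiv ℝ (0 : ℝ × ℝ → ℝ) x = 0 := fun x => sz
    have : pd1 (0 : ℝ × ℝ → ℝ) = 0 := by funext x; simp [pd1]
    have h2 : pd2 (0 : ℝ × ℝ → ℝ) = 0 := by funext x; simp [pd2]
    simp [lap, this, h2]
  add_mem' := by
    rintro u v ⟨hu, hu1, hu2⟩ ⟨hv, hv1, hv2⟩
    refine ⟨hu.add hv, fun x hx => ?_, fun x hx => by simp [hu2 x hx, hv2 x hx]⟩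
    have su := hu.mono disk_sub
    have sv := hv.mono disk_sub
    have e1 : EqOn (pd1 (u + v)) (pd1 u + pd1 v) unitDisk := fun y hy => (pd_add (diff_at su hy) (diff_at sv hy)).1
    have e2 : EqOn (pd2 (u + v)) (pd2 u + pd2 v) unitDisk := fun y hy => (pd_add (diff_at su hy) (diff_at sv hy)).2
    have h1 := hu1 x hx
    have h2 := hv1 x hx
    simp only [lap] at h1 h2 ⊢
    rw [(pd_congr e1).1 hx, (pd_congr e2).2 hx, (pd_add (diff_at (pd_smooth su).1 hx) (diff_at (pd_smooth sv).1 hx)).1,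
      (pd_add (diff_at (pd_smooth su).2 hx) (diff_at (pd_smooth sv).2 hx)).2, Pi.add_apply]
    linarith
  smul_mem' := by
    rintro c u ⟨hu, hu1, hu2⟩
    refine ⟨contDiffOn_const.smul hu, fun x hx => ?_, fun x hx => by simp [hu2 x hx]⟩
    have su := hu.mono disk_sub
    have e1 : EqOn (pd1 (c • u)) (c • pd1 u) unitDisk := fun y hy => (pd_smul c (diff_at su hy)).1
    have e2 : EqOn (pd2 (c • u)) (c • pd2 u) unitDisk := fun y hy => (pd_smul c (diff_at su hy)).2
    have h1 := hu1 x hx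
    simp only [lap] at h1 ⊢
    rw [(pd_congr e1).1 hx, (pd_congr e2).2 hx, (pd_smul c (diff_at (pd_smooth su).1 hx)).1,
      (pd_smul c (diff_at (pd_smooth su).2 hx)).2, Pi.smul_apply, smul_eq_mul]
    linear_combination c * h1

lemma VS.rad {l : ℝ} {u} (h : u ∈ VS l) (m : ℤ) : Rad (cA u m) (cD u m) m.natAbs l := radOf u h.1 l h.2.1 m

lemma dw {u : ℝ × ℝ → ℝ} (h : ContDiffOn ℝ (⊤ : ℕ∞) u closedDisk) {x} (hx : x ∈ closedDisk) : DifferentiableWithinAt ℝ u closedDisk x :=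
  h.differentiableOn (sz) x hx

def VD (l : ℝ) : Submodule ℝ (ℝ × ℝ → ℝ) where
  carrier := {u | u ∈ VS l ∧ ∀ x ∈ unitCircle, u x = 0}
  zero_mem' := ⟨zero_mem _, fun _ _ => rfl⟩
  add_mem' h g := ⟨add_mem h.1 g.1, fun x hx => by simp [h.2 x hx, g.2 x hx]⟩
  smul_mem' c _ h := ⟨Submodule.smul_mem _ c h.1, fun x hx => by simp [h.2 x hx]⟩

lemma circ_sub : unitCircle ⊆ closedDisk := fun _ h => le_of_eq (Set.mem_ofPred_eq.mp h)

def VN (l : ℝ) : Submodule ℝ (ℝ × ℝ → ℝ) where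
  carrier := {u | u ∈ VS l ∧ ∀ x ∈ unitCircle, fderivWithin ℝ u closedDisk x x = 0}
  zero_mem' := ⟨zero_mem _, fun _ _ => sz⟩
  add_mem' h g := ⟨add_mem h.1 g.1, fun x hx => by
    rw [fderivWithin_add (disk_uniq x (circ_sub hx)) (dw h.1.1 (circ_sub hx)) (dw g.1.1 (circ_sub hx))]
    simp [h.2 x hx, g.2 x hx]⟩
  smul_mem' c _ h := ⟨Submodule.smul_mem _ c h.1, fun x hx => by
    rw [fderivWithin_const_smul (disk_uniq x (circ_sub hx)) (dw h.1.1 (circ_sub hx))]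
    simp [h.2 x hx]⟩

lemma multD_eq (l : ℝ) : multD l = Module.finrank ℝ (VD l) := by
  have : dirichletEigSet l = VD l := by ext u; exact ⟨fun h => ⟨⟨h.1, h.2.2⟩, h.2.1⟩, fun h => ⟨h.1.1, h.2, h.1.2⟩⟩
  rw [multD, this, Submodule.span_eq]
lemma multN_eq (l : ℝ) : multN l = Module.finrank ℝ (VN l) := by
  have : neumannEigSet l = VN l := by ext u; exact ⟨fun h => ⟨⟨h.1, h.2.2⟩, h.2.1⟩, fun h => ⟨h.1.1, h.2, h.1.2⟩⟩
  rw [multN, this, Submodule.span_eq]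

lemma cA_int {u : ℝ × ℝ → ℝ} (h : ContDiffOn ℝ (⊤ : ℕ∞) u closedDisk) (m : ℤ) {r : ℝ} (hr : r ∈ Icc (0:ℝ) 1) :
    IntervalIntegrable (fun θ => u (po r θ) * ez m θ) volume 0 (2*π) := by
  refine Continuous.intervalIntegrable ?_ _ _
  exact (continuousOn_univ.1 (h.continuousOn.comp (f := fun θ => po r θ) (by unfold po; fun_prop) fun θ _ => po_closed hr θ)).mul (ez_cont m)
lemma cD_int {u : ℝ × ℝ → ℝ} (h : ContDiffOn ℝ (⊤ : ℕ∞) u closedDisk) (m : ℤ) {r : ℝ} (hr : r ∈ Icc (0:ℝ) 1) :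
    IntervalIntegrable (fun θ => fderivWithin ℝ u closedDisk (po r θ) (cos θ, sin θ) * ez m θ) volume 0 (2*π) := by
  refine Continuous.intervalIntegrable ?_ _ _
  exact (((continuousOn_univ.1 ((h.continuousOn_fderivWithin disk_uniq (sz)).comp (f := fun θ => po r θ) (by unfold po; fun_prop) fun θ _ => po_closed hr θ))).clm_apply (fz)).mul (ez_cont m)

noncomputable def lA (l : ℝ) (m : ℤ) (r : ℝ) (hr : r ∈ Icc (0:ℝ) 1) : VS l →ₗ[ℝ] ℝ where
  toFun u := cA u m r
  map_add' u v := by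
    simp only [cA, Submodule.coe_add, Pi.add_apply, add_mul]
    exact intervalIntegral.integral_add (cA_int u.2.1 m hr) (cA_int v.2.1 m hr)
  map_smul' c u := by
    simp only [cA, Submodule.coe_smul, Pi.smul_apply, smul_eq_mul, mul_assoc, RingHom.id_apply]
    exact integral_const_mul _ _
noncomputable def lD (l : ℝ) (m : ℤ) (r : ℝ) (hr : r ∈ Icc (0:ℝ) 1) : VS l →ₗ[ℝ] ℝ where
  toFun u := cD u m r
  map_add' u v := by
    rw [cD, cD, cD, ← intervalIntegral.integral_add (cD_int u.2.1 m hr) (cD_int v.2.1 m hr)]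
    congr 1; ext θ
    rw [Submodule.coe_add, fderivWithin_add (disk_uniq _ (po_closed hr θ)) (dw u.2.1 (po_closed hr θ)) (dw v.2.1 (po_closed hr θ)), ← add_mul]
    rfl
  map_smul' c u := by
    rw [cD, cD, RingHom.id_apply, smul_eq_mul, ← integral_const_mul]
    congr 1; ext θ
    rw [Submodule.coe_smul, fderivWithin_const_smul (disk_uniq _ (po_closed hr θ)) (dw u.2.1 (po_closed hr θ)), ← mul_assoc]
    rfl

lemma mult_gen (l : ℝ) (V : Submodule ℝ (ℝ × ℝ → ℝ)) (hV : V ≤ VS l) (S : Finset ℤ) (T : ℤ → VS l →ₗ[ℝ] ℝ)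
    (hi : ∀ u (h : u ∈ V), (∀ m ∈ S, T m ⟨u, hV h⟩ = 0) → u = 0) (w : ℤ → ℝ × ℝ → ℝ) (hw : ∀ m ∈ S, w m ∈ V)
    (r : ℤ → ℝ) (hr : ∀ m, r m ∈ Icc (0:ℝ) 1) (h0 : ∀ m ∈ S, ∀ j ∈ S, j ≠ m → cA (w m) j (r j) = 0)
    (h1 : ∀ m ∈ S, cA (w m) m (r m) ≠ 0) : Module.finrank ℝ V = S.card := by
  classical
  let L : V →ₗ[ℝ] (S → ℝ) := LinearMap.pi fun m => (T m).comp (Submodule.inclusion hV)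
  let M : V →ₗ[ℝ] (S → ℝ) := LinearMap.pi fun m => (lA l m (r m) (hr m)).comp (Submodule.inclusion hV)
  have hL : Function.Injective L := by
    rw [← LinearMap.ker_eq_bot, LinearMap.ker_eq_bot']
    intro u hu
    exact Subtype.ext (hi u u.2 fun m hm => congrFun hu ⟨m, hm⟩)
  have hM : Function.Surjective M := by
    intro y
    refine ⟨∑ m : S, (y m / cA (w m) m (r m)) • ⟨w m, hw m m.2⟩, ?_⟩
    rw [map_sum]
    ext j
    rw [Finset.sum_apply, Finset.sum_eq_single j]
    · rw [map_smul]
      exact div_mul_cancel₀ _ (h1 j j.2)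
    · intro m _ hm
      rw [map_smul]
      have : M ⟨w m, hw m m.2⟩ j = 0 := h0 m m.2 j j.2 fun h => hm (Subtype.ext h.symm)
      rw [Pi.smul_apply, this, smul_zero]
    · simp
  have : FiniteDimensional ℝ V := FiniteDimensional.of_injective L hL
  have e : Module.finrank ℝ (S → ℝ) = S.card := sz
  exact le_antisymm (e ▸ LinearMap.finrank_le_finrank_of_injective hL) (e ▸ LinearMap.finrank_le_finrank_of_surjective hM)

lemma ez_orth (m j : ℤ) (h : j ≠ m) : ∫ θ in (0:ℝ)..2*π, ez m θ * ez j θ = 0 := by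
  have cm := ez_cont m
  have cj := ez_cont j
  by_cases hs : m^2 = j^2
  · obtain rfl : j = -m := by
      rcases sq_eq_sq_iff_eq_or_eq_neg.1 hs.symm with e | e
      · exact absurd e h
      · exact e
    have hm : m ≠ 0 := by rintro rfl; simp at h
    have key : ∀ m : ℤ, 0 < m → ∫ θ in (0:ℝ)..2*π, ez m θ * ez (-m) θ = 0 := fun m hm => by
      have c1 := ez1_cont m
      have c0 := ez_cont m
      have z := intervalIntegral.integral_eq_sub_of_hasDerivAt (a := 0) (b := 2*π) (fun θ _ => ((ez_d m θ).1.pow 2))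
        (Continuous.intervalIntegrable (fz) _ _)
      rw [Pi.pow_apply, Pi.pow_apply, (ez_per m).1, sub_self] at z
      have e : ∀ θ, ez m θ * ez (-m) θ = (1/(2*m)) * (((2:ℕ):ℝ) * ez m θ ^ (2-1) * ez1 m θ) := fun θ => by
        have h1 : ez (-m) θ = - sin (m * θ) := by simp [ez, hm]
        have h2 : ez1 m θ = -sin (m * θ) * m := by simp [ez1, hm.le]
        rw [h1, h2]; push_cast; field_simp
      simp only [e, integral_const_mul]
      rw [z, mul_zero]
    rcases lt_or_gt_of_ne hm with hm | hm
    · have := key (-m) (oz)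
      rw [neg_neg] at this
      simpa only [mul_comm] using this
    · exact key m hm
  · have z := intervalIntegral.integral_eq_sub_of_hasDerivAt (a := 0) (b := 2*π)
      (f := fun θ => ez1 m θ * ez j θ - ez m θ * ez1 j θ) (f' := fun θ => (j^2 - m^2 : ℝ) * (ez m θ * ez j θ))
      (fun θ _ => HasDerivAt.congr_deriv (((ez_d m θ).2.mul (ez_d j θ).1).sub ((ez_d m θ).1.mul (ez_d j θ).2)) (rz))
      (Continuous.intervalIntegrable (fz) _ _)
    rw [(ez_per m).1, (ez_per m).2, (ez_per j).1, (ez_per j).2, sub_self, integral_const_mul] at z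
    refine (mul_eq_zero.1 z).resolve_left fun e => hs ?_
    exact_mod_cast (sub_eq_zero.1 e).symm

lemma ez_norm (m : ℤ) : ∫ θ in (0:ℝ)..2*π, ez m θ * ez m θ ≠ 0 := by
  intro h
  have z : ∀ θ ∈ Ico 0 (2*π), ez m θ = 0 := four_zero (ez m) (ez_cont m) (ez_per m).1.symm fun j => by
    by_cases hj : j = m
    · rw [hj, h]
    · exact ez_orth m j hj
  by_cases hm : 0 ≤ m
  · have := z 0 ⟨le_rfl, pz⟩
    simp [ez, hm] at this
  · have hm1 : (m:ℝ) ≤ -1 := by exact_mod_cast (oz : m ≤ -1)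
    have := z (π / (2 * -m)) ⟨by have : (0:ℝ) < -m := lz
                                 positivity, by
      rw [div_lt_iff₀ (lz)]; nlinarith [pi_pos]⟩
    have e : (m:ℝ) * (π / (2 * -m)) = -(π/2) := by have : (m:ℝ) ≠ 0 := lz
                                                   field_simp
    rw [ez, if_neg hm, e] at this
    simp at this

/-- harmonic polynomials -/
noncomputable def hp (n : ℕ) (c : ℂ) (x : ℝ × ℝ) : ℝ := (c * ((x.1 : ℂ) + x.2 * I)^n).re
noncomputable def qk (k : ℝ) (x : ℝ × ℝ) : ℝ := k^2 * (x.1^2 + x.2^2) / 4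
noncomputable def hf (n : ℕ) (c : ℂ) (k : ℝ) (j : ℕ) (x : ℝ × ℝ) : ℝ := hp n c x * bg j (qk k x)

lemma hp_smooth (n : ℕ) (c : ℂ) : ContDiff ℝ (⊤ : ℕ∞) (hp n c) := by
  have h1 : ContDiff ℝ (⊤ : ℕ∞) fun x : ℝ × ℝ => (x.1 : ℂ) := Complex.ofRealCLM.contDiff.comp contDiff_fst
  have h2 : ContDiff ℝ (⊤ : ℕ∞) fun x : ℝ × ℝ => (x.2 : ℂ) := Complex.ofRealCLM.contDiff.comp contDiff_snd
  exact Complex.reCLM.contDiff.comp (contDiff_const.mul ((h1.add (h2.mul contDiff_const)).pow n))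
lemma hf_smooth (n : ℕ) (c : ℂ) (k : ℝ) (j : ℕ) : ContDiff ℝ (⊤ : ℕ∞) (hf n c k j) :=
  (hp_smooth n c).mul ((bg_contDiff j).comp (by unfold qk; fun_prop))

lemma pd_of {w : ℝ × ℝ → ℝ} (h : ContDiff ℝ (⊤ : ℕ∞) w) (x : ℝ × ℝ) :
    HasDerivAt (fun t => w (t, x.2)) (pd1 w x) x.1 ∧ HasDerivAt (fun t => w (x.1, t)) (pd2 w x) x.2 := by
  have hd : HasFDerivAt w (fderiv ℝ w x) (x.1, x.2) := (h.differentiable (sz) x).hasFDerivAt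
  exact ⟨hd.comp_hasDerivAt x.1 ((hasDerivAt_id _).prodMk (hasDerivAt_const _ _)), hd.comp_hasDerivAt x.2 ((hasDerivAt_const _ _).prodMk (hasDerivAt_id _))⟩

lemma hp_d (n : ℕ) (c : ℂ) (x : ℝ × ℝ) :
    HasDerivAt (fun t => hp n c (t, x.2)) (n * hp (n-1) c x) x.1 ∧ HasDerivAt (fun t => hp n c (x.1, t)) (n * hp (n-1) (c*I) x) x.2 := by
  unfold hp
  have o : ∀ t : ℝ, HasDerivAt (fun t : ℝ => (t:ℂ)) 1 t := fun t => (hasDerivAt_id t).ofReal_comp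
  have h1 := Complex.reCLM.hasFDerivAt.comp_hasDerivAt x.1 ((((o x.1).add_const ((x.2:ℂ) * I)).pow n).const_mul c)
  have h2 := Complex.reCLM.hasFDerivAt.comp_hasDerivAt x.2 (((((o x.2).mul_const I).const_add (x.1:ℂ)).pow n).const_mul c)
  refine ⟨h1.congr_deriv ?_, h2.congr_deriv ?_⟩
  · show (c * _).re = _
    rw [← re_ofReal_mul]; congr 1; push_cast; ring
  · show (c * _).re = _
    rw [← re_ofReal_mul]; congr 1; push_cast; ring

lemma hf_pd (n : ℕ) (c : ℂ) (k : ℝ) (j : ℕ) :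
    pd1 (hf n c k j) = (fun x => n * hf (n-1) c k j x - k^2/2 * (x.1 * hf n c k (j+1) x)) ∧
    pd2 (hf n c k j) = (fun x => n * hf (n-1) (c*I) k j x - k^2/2 * (x.2 * hf n c k (j+1) x)) := by
  constructor
  · funext x
    have q : HasDerivAt (fun t => qk k (t, x.2)) (k^2 / 2 * x.1) x.1 :=
      ((((hasDerivAt_id x.1).pow 2).add_const (x.2^2)).const_mul (k^2)).div_const 4 |>.congr_deriv (by simp; ring)
    have := (hp_d n c x).1.mul ((bg_deriv j (qk k x)).comp x.1 q)
    refine (pd_of (hf_smooth n c k j) x).1.unique (this.congr_deriv ?_)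
    simp only [hf, Function.comp]; ring
  · funext x
    have q : HasDerivAt (fun t => qk k (x.1, t)) (k^2 / 2 * x.2) x.2 :=
      ((((hasDerivAt_id x.2).pow 2).const_add (x.1^2)).const_mul (k^2)).div_const 4 |>.congr_deriv (by simp; ring)
    have := (hp_d n c x).2.mul ((bg_deriv j (qk k x)).comp x.2 q)
    refine (pd_of (hf_smooth n c k j) x).2.unique (this.congr_deriv ?_)
    simp only [hf, Function.comp]; ring

lemma hp_eu (n : ℕ) (c : ℂ) (x : ℝ × ℝ) : n * (x.1 * hp (n-1) c x + x.2 * hp (n-1) (c*I) x) = n * hp n c x := by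
  rcases n with _ | n
  · simp
  · congr 1
    simp only [hp, Nat.add_sub_cancel]
    rw [← re_ofReal_mul, ← re_ofReal_mul, ← Complex.add_re]
    congr 1; ring

lemma hf_lap (n : ℕ) (c : ℂ) (k : ℝ) (x : ℝ × ℝ) : lap (hf n c k n) x = -k^2 * hf n c k n x := by
  have s := hf_smooth
  have e1 := (pd_of ((contDiff_const (c := (n:ℝ))).mul (s (n-1) c k n) |>.sub ((contDiff_const (c := k^2/2)).mul (contDiff_fst.mul (s n c k (n+1))))) x).1.unique
    (((pd_of (s (n-1) c k n) x).1.const_mul (n:ℝ)).sub (((hasDerivAt_id x.1).mul (pd_of (s n c k (n+1)) x).1).const_mul (k^2/2)))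
  have e2 := (pd_of ((contDiff_const (c := (n:ℝ))).mul (s (n-1) (c*I) k n) |>.sub ((contDiff_const (c := k^2/2)).mul (contDiff_snd.mul (s n c k (n+1))))) x).2.unique
    (((pd_of (s (n-1) (c*I) k n) x).2.const_mul (n:ℝ)).sub (((hasDerivAt_id x.2).mul (pd_of (s n c k (n+1)) x).2).const_mul (k^2/2)))
  rw [lap, (hf_pd n c k n).1, (hf_pd n c k n).2, e1, e2]
  simp only [(hf_pd _ _ _ _).1, (hf_pd _ _ _ _).2, id]
  have r := bg_rec n (qk k x)
  have u := hp_eu n c x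
  have z : hp (n-1-1) (c * I * I) x = - hp (n-1-1) c x := by
    simp [hp, mul_assoc, Complex.I_mul_I]
  simp only [hf, z]
  have hq : qk k x = k^2 * (x.1^2 + x.2^2) / 4 := rfl
  generalize qk k x = q at *
  generalize bg n q = g0 at *
  generalize bg (n+1) q = g1 at *
  generalize bg (n+2) q = g2 at *
  generalize hp (n-1-1) c x = a at *
  linear_combination (-k^2 * hp n c x) * r - k^2 * g1 * u + (-k^2 * hp n c x * g2) * hq

lemma hf_bd (n : ℕ) (c : ℂ) (k : ℝ) (x : ℝ × ℝ) (hx : x ∈ unitCircle) :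
    fderiv ℝ (hf n c k n) x x = hp n c x * (n * bg n (k^2/4) - k^2/2 * bg (n+1) (k^2/4)) := by
  have hx : x.1^2 + x.2^2 = 1 := hx
  have := fd_lin (hf n c k n) x x.1 x.2
  rw [this, (hf_pd n c k n).1, (hf_pd n c k n).2]
  have u := hp_eu n c x
  simp only [hf, qk, hx, mul_one]
  grind

noncomputable def cc (m : ℤ) : ℂ := if 0 ≤ m then 1 else I
/-- explicit eigenfunctions -/
noncomputable def ef (m : ℤ) (k : ℝ) : ℝ × ℝ → ℝ := closedDisk.indicator (hf m.natAbs (cc m) k m.natAbs)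

lemma ef_on (m : ℤ) (k : ℝ) : EqOn (ef m k) (hf m.natAbs (cc m) k m.natAbs) closedDisk := fun _ hx => Set.indicator_of_mem hx _

lemma ef_VS (m : ℤ) (k : ℝ) : ef m k ∈ VS (k^2) := by
  refine ⟨((hf_smooth _ _ _ _).contDiffOn).congr (ef_on m k), fun x hx => ?_, fun x hx => Set.indicator_of_notMem hx _⟩
  rw [lap_congr ((ef_on m k).mono disk_sub) hx, ef_on m k (disk_sub hx), hf_lap]

lemma ef_po (m : ℤ) (k r : ℝ) (hr : r ∈ Icc (0:ℝ) 1) (θ : ℝ) :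
    ef m k (po r θ) = r^m.natAbs * bg m.natAbs (k^2*r^2/4) * ez m θ := by
  rw [ef_on m k (po_closed hr θ), hf, qk, po_sq]
  have e : hp m.natAbs (cc m) (po r θ) = r^m.natAbs * ez m θ := by
    have : (((po r θ).1 : ℂ) + (po r θ).2 * I) = r * cexp (θ * I) := by
      rw [Complex.exp_mul_I, ← Complex.ofReal_cos, ← Complex.ofReal_sin, po]; push_cast; ring
    rw [hp, this, mul_pow, ← Complex.exp_nat_mul]
    have : cc m * ((r:ℂ)^m.natAbs * cexp (m.natAbs * (θ * I))) = ((r^m.natAbs : ℝ):ℂ) * (cc m * cexp (((m.natAbs * θ : ℝ):ℂ) * I)) := by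
      push_cast; ring_nf
    rw [this, re_ofReal_mul, Complex.exp_mul_I, ← Complex.ofReal_cos, ← Complex.ofReal_sin]
    congr 1
    unfold cc ez
    rw [Nat.cast_natAbs, Int.cast_abs]
    split_ifs with hm
    · rw [abs_of_nonneg (by exact_mod_cast hm)]; simp only [one_mul, Complex.add_re, Complex.mul_re, Complex.ofReal_re, Complex.ofReal_im, Complex.I_re, Complex.I_im]; ring
    · rw [abs_of_neg (by simp_all), neg_mul, cos_neg, sin_neg]; simp only [one_mul, Complex.add_re, Complex.mul_re, Complex.add_im, Complex.mul_im, Complex.ofReal_re, Complex.ofReal_im, Complex.I_re, Complex.I_im]; ring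
  rw [e]; ring

lemma ef_cA (m j : ℤ) (k r : ℝ) (hr : r ∈ Icc (0:ℝ) 1) :
    cA (ef m k) j r = r^m.natAbs * bg m.natAbs (k^2*r^2/4) * ∫ θ in (0:ℝ)..2*π, ez m θ * ez j θ := by
  simp only [cA, ef_po m k r hr, mul_assoc, integral_const_mul]

lemma ef_D (m : ℤ) (k : ℝ) (hk : 0 < k) (h : bJ m.natAbs k = 0) : ef m k ∈ VD (k^2) := by
  refine ⟨ef_VS m k, fun x hx => ?_⟩
  have hx' : x.1^2 + x.2^2 = 1 := hx
  have : bg m.natAbs (k^2/4) = 0 := (mul_eq_zero.1 h).resolve_left (pz)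
  rw [ef_on m k (circ_sub hx), hf, qk, hx', mul_one, this, mul_zero]

lemma ef_N (m : ℤ) (k : ℝ) (h : (0 < k ∧ bK m.natAbs k = 0) ∨ (k = 0 ∧ m = 0)) : ef m k ∈ VN (k^2) := by
  refine ⟨ef_VS m k, fun x hx => ?_⟩
  rw [fderivWithin_congr (ef_on m k) (ef_on m k (circ_sub hx)),
    ((hf_smooth m.natAbs (cc m) k m.natAbs).differentiable (sz) x).fderivWithin (disk_uniq x (circ_sub hx)), hf_bd _ _ _ _ hx]
  rcases h with ⟨hk, h⟩ | ⟨rfl, rfl⟩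
  · have : (k/2)^m.natAbs * (m.natAbs * bg m.natAbs (k^2/4) - k^2/2 * bg (m.natAbs+1) (k^2/4)) = 0 := by
      rw [← h, bK, bJ, bJ]; ring
    rw [(mul_eq_zero.1 this).resolve_left (pz), mul_zero]
  · simp

lemma ef_r (m : ℤ) (k : ℝ) : ∃ r ∈ Icc (0:ℝ) 1, cA (ef m k) m r ≠ 0 := by
  have hc : ContinuousAt (fun r : ℝ => bg m.natAbs (k^2*r^2/4)) 0 := ((bg_cont _).comp (fz)).continuousAt
  have h0 : bg m.natAbs (k^2*0^2/4) ≠ 0 := by simp [bg_zero, Nat.factorial_ne_zero]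
  have := (hc.eventually_ne h0).filter_mono (nhdsWithin_le_nhds (s := Ioi 0))
  obtain ⟨r, h1, h2⟩ := (this.and (Ioo_mem_nhdsGT zero_lt_one)).exists
  refine ⟨r, ⟨h2.1.le, h2.2.le⟩, ?_⟩
  rw [ef_cA m m k r ⟨h2.1.le, h2.2.le⟩]
  exact mul_ne_zero (mul_ne_zero (pow_ne_zero _ h2.1.ne') h1) (ez_norm m)

lemma bdD {l : ℝ} {u} (h : u ∈ VD l) (m : ℤ) : cA u m 1 = 0 := by
  have : ∀ θ, u (po 1 θ) = 0 := fun θ => h.2 _ (by show _ = (1:ℝ); rw [po_sq, one_pow])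
  simp [cA, this]
lemma bdN {l : ℝ} {u} (h : u ∈ VN l) (m : ℤ) : cD u m 1 = 0 := by
  have : ∀ θ, fderivWithin ℝ u closedDisk (po 1 θ) (cos θ, sin θ) = 0 := fun θ => by
    have := h.2 (po 1 θ) (by show _ = (1:ℝ); rw [po_sq, one_pow])
    have e : po 1 θ = (cos θ, sin θ) := by simp [po]
    rwa [← e]
  simp [cD, this]

lemma one_Icc : (1:ℝ) ∈ Icc (0:ℝ) 1 := ⟨zero_le_one, le_rfl⟩

lemma multD_card (l : ℝ) [DecidablePred fun m : ℤ => 0 < l ∧ bJ m.natAbs (√l) = 0] (I : Finset ℤ) (hI : ∀ m : ℤ, 0 < l ∧ bJ m.natAbs (√l) = 0 → m ∈ I) :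
    multD l = (I.filter fun m : ℤ => 0 < l ∧ bJ m.natAbs (√l) = 0).card := by
  choose r hr h1 using fun m => ef_r m (√l)
  rw [multD_eq]
  refine mult_gen l (VD l) (fun _ h => h.1) _ (fun m => lD l m 1 one_Icc) ?_ (fun m => ef m (√l)) ?_ r hr ?_ (fun m _ => h1 m)
  · intro u hu h
    refine zero_of_coef u hu.1.1.continuousOn hu.1.2.2 fun m s hs => ?_
    have R := VS.rad hu.1 m
    have h0 := bdD hu m
    rcases le_or_gt l 0 with hl | hl
    · rw [(R.neg hl (by rw [h0, zero_mul]) s hs).2, h0]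
    · refine R.zero hl h0 ?_ s hs
      by_cases hJ : bJ m.natAbs (√l) = 0
      · exact h m (Finset.mem_filter.2 ⟨hI m ⟨hl, hJ⟩, hl, hJ⟩)
      · have := R.wr hl
        rw [h0, zero_mul] at this
        exact (mul_eq_zero.1 this).resolve_right hJ
  · intro m hm
    have hm := (Finset.mem_filter.1 hm).2
    have := ef_D m (√l) (sqrt_pos.2 hm.1) hm.2
    rwa [sq_sqrt hm.1.le] at this
  · intro m _ j _ hj
    rw [ef_cA m j _ _ (hr j), ez_orth m j hj, mul_zero]

lemma multN_card (l : ℝ) [DecidablePred fun m : ℤ => (0 < l ∧ bK m.natAbs (√l) = 0) ∨ (l = 0 ∧ m = 0)] (I : Finset ℤ) (hI : ∀ m : ℤ, (0 < l ∧ bK m.natAbs (√l) = 0) ∨ (l = 0 ∧ m = 0) → m ∈ I) :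
    multN l = (I.filter fun m : ℤ => (0 < l ∧ bK m.natAbs (√l) = 0) ∨ (l = 0 ∧ m = 0)).card := by
  choose r hr h1 using fun m => ef_r m (√l)
  rw [multN_eq]
  refine mult_gen l (VN l) (fun _ h => h.1) _ (fun m => lA l m 1 one_Icc) ?_ (fun m => ef m (√l)) ?_ r hr ?_ (fun m _ => h1 m)
  · intro u hu h
    refine zero_of_coef u hu.1.1.continuousOn hu.1.2.2 fun m s hs => ?_
    have R := VS.rad hu.1 m
    have h0 := bdN hu m
    have h' : (0 < l ∧ bK m.natAbs (√l) = 0) ∨ (l = 0 ∧ m = 0) → cA u m 1 = 0 := fun H => h m (Finset.mem_filter.2 ⟨hI m H, H⟩)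
    rcases le_or_gt l 0 with hl | hl
    · have N := R.neg hl (by rw [h0, mul_zero]) s hs
      by_cases H : l = 0 ∧ m = 0
      · rw [N.2, h' (Or.inr H)]
      · refine N.1 ?_
        rcases hl.lt_or_eq with g | g
        · exact Or.inl g
        · exact Or.inr fun e => H ⟨g, by simpa using e⟩
    · refine R.zero hl ?_ h0 s hs
      by_cases hJ : bK m.natAbs (√l) = 0
      · grind
      · have := R.wr hl
        rw [h0, zero_mul] at this
        exact (mul_eq_zero.1 this.symm).resolve_right hJ
  · intro m hm
    have hm := (Finset.mem_filter.1 hm).2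
    have h0 : 0 ≤ l := by rcases hm with h | h <;> linarith [h.1]
    have := ef_N m (√l) (hm.imp (fun h => ⟨sqrt_pos.2 h.1, h.2⟩) (fun h => ⟨by rw [h.1, Real.sqrt_zero], h.2⟩))
    rwa [sq_sqrt h0] at this
  · intro m _ j _ hj
    rw [ef_cA m j _ _ (hr j), ez_orth m j hj, mul_zero]

open Classical in
lemma count (mu : ℝ → ℕ) (P : ℤ → ℝ → Prop) (X : ℝ) (I : Finset ℤ) (f : ℤ → ℕ) (h : ∀ l < X, mu l = (I.filter fun m => P m l).card)
    (hf : ∀ m, {l | l < X ∧ P m l}.Finite) (hc : ∀ m, {l | l < X ∧ P m l}.ncard = f m) :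
    ∑' l : ℝ, Set.indicator {l : ℝ | l < X} (fun l => (mu l : ℝ)) l = ∑ m ∈ I, (f m : ℝ) := by
  have e : (fun l => Set.indicator {l : ℝ | l < X} (fun l => (mu l : ℝ)) l) = fun l => ∑ m ∈ I, Set.indicator {l | l < X ∧ P m l} (fun _ => (1:ℝ)) l := by
    funext l
    by_cases hl : l < X
    · rw [Set.indicator_of_mem (show l ∈ {l : ℝ | l < X} from hl), h l hl, Finset.card_filter]
      push_cast
      refine sum_congr rfl fun m _ => ?_
      simp [Set.indicator, hl]
    · simp [Set.indicator, hl]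
  rw [e]
  refine HasSum.tsum_eq (hasSum_sum fun m _ => ?_)
  have := hasSum_sum_of_ne_finset_zero (L := SummationFilter.unconditional ℝ) (s := (hf m).toFinset) (f := Set.indicator {l | l < X ∧ P m l} (fun _ => (1:ℝ))) (fun l hl => by
    rw [Set.Finite.mem_toFinset] at hl; exact Set.indicator_of_notMem hl _)
  rwa [sum_congr rfl (fun l hl => Set.indicator_of_mem ((hf m).mem_toFinset.1 hl) _), sum_const, nsmul_eq_mul, mul_one,
    ← Set.ncard_eq_toFinset_card _ (hf m), hc m] at this

lemma sum_sym (f : ℕ → ℝ) (K : ℕ) : ∑ m ∈ fIoo (-((K+1:ℕ):ℤ)) ((K+1:ℕ):ℤ), f m.natAbs = 2 * ∑ n ∈ rg (K+1), f n - f 0 := by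
  induction K with
  | zero =>
    have : fIoo (-((0+1:ℕ):ℤ)) ((0+1:ℕ):ℤ) = {0} := by decide
    rw [this]; simp; ring
  | succ K ih =>
    have : fIoo (-((K+1+1:ℕ):ℤ)) ((K+1+1:ℕ):ℤ) = insert ((K+1:ℕ):ℤ) (insert (-((K+1:ℕ):ℤ)) (fIoo (-((K+1:ℕ):ℤ)) ((K+1:ℕ):ℤ))) := by
      ext m; simp only [Finset.mem_insert, Finset.mem_Ioo]; omega
    rw [this, Finset.sum_insert (by simp only [Finset.mem_insert, Finset.mem_Ioo]; omega), Finset.sum_insert (sz), ih, sum_range_succ _ (K+1),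
      Int.natAbs_neg, Int.natAbs_natCast]
    ring

lemma sq_set (f : ℝ → ℝ) (μ : ℝ) (hμ : 0 < μ) : {l | l < μ^2 ∧ 0 < l ∧ f (√l) = 0} = (fun z => z^2) '' zs f μ := by
  ext l
  constructor
  · rintro ⟨h1, h2, h3⟩
    exact ⟨√l, ⟨sqrt_pos.2 h2, (Real.sqrt_lt' hμ).2 h1, h3⟩, sq_sqrt h2.le⟩
  · rintro ⟨z, ⟨h1, h2, h3⟩, rfl⟩
    exact ⟨by show z^2 < μ^2; gcongr, by show 0 < z^2; positivity, by rwa [sqrt_sq h1.le]⟩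
lemma sq_inj (f : ℝ → ℝ) (μ : ℝ) : InjOn (fun z : ℝ => z^2) (zs f μ) := fun _ ha _ hb h =>
  (pow_left_inj₀ ha.1.le hb.1.le two_ne_zero).1 h

lemma small_m {l μ : ℝ} (hl : l < μ^2) (hμ : 0 < μ) (m : ℤ) (h : ¬ √l ≤ m.natAbs) : m ∈ fIoo (-(⌈μ⌉₊:ℤ)) (⌈μ⌉₊:ℤ) := by
  have h1 : √l < μ := (Real.sqrt_lt' hμ).2 hl
  have h2 : (m.natAbs:ℝ) < (⌈μ⌉₊:ℝ) := (not_le.1 h).trans (h1.trans_le (le_ceil μ))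
  have h3 : m.natAbs < ⌈μ⌉₊ := by exact_mod_cast h2
  rw [Finset.mem_Ioo]; omega

lemma ND_eq (μ : ℝ) (hμ : 1 < μ) : NdiskD μ = NJ μ := by
  have h0 : 0 < μ := lz
  rw [NdiskD, count multD (fun m l => 0 < l ∧ bJ m.natAbs (√l) = 0) (μ^2) (fIoo (-(⌈μ⌉₊:ℤ)) (⌈μ⌉₊:ℤ)) (fun m => zc (bJ m.natAbs) μ)
    (fun l hl => by convert multD_card l _ fun m h => small_m hl h0 m fun g => bJ_ne _ _ (sqrt_pos.2 h.1) g h.2)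
    (fun m => by rw [sq_set _ _ h0]; exact (finJ _ _).image _)
    (fun m => by rw [sq_set _ _ h0, Set.ncard_image_of_injOn (sq_inj _ _)]; rfl), NJ]
  obtain ⟨K, hK⟩ := Nat.exists_eq_succ_of_ne_zero (Nat.ceil_pos.2 h0).ne'
  rw [hK]
  exact sum_sym (fun n => (zc (bJ n) μ : ℝ)) K

lemma NN_eq (μ : ℝ) (hμ : 1 < μ) : NdiskN μ = NK μ := by
  have h0 : 0 < μ := lz
  have e : ∀ m : ℤ, {l | l < μ^2 ∧ ((0 < l ∧ bK m.natAbs (√l) = 0) ∨ (l = 0 ∧ m = 0))} =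
      (fun z => z^2) '' zs (bK m.natAbs) μ ∪ (if m = 0 then {0} else ∅) := fun m => by
    rw [← sq_set _ _ h0]
    have : 0 < μ^2 := pz
    ext l
    by_cases hm : m = 0
    · simp only [hm, and_true, if_true, Set.mem_union, Set.mem_ofPred_eq, Set.mem_singleton_iff]
      constructor
      · rintro ⟨a, b | b⟩
        · exact Or.inl ⟨a, b⟩
        · exact Or.inr b
      · rintro (b | b)
        · exact ⟨b.1, Or.inl b.2⟩
        · exact ⟨by rw [b]; exact this, Or.inr b⟩
    · simp [hm]
  have hI : ∀ l < μ^2, ∀ m : ℤ, (0 < l ∧ bK m.natAbs (√l) = 0) ∨ (l = 0 ∧ m = 0) → m ∈ fIoo (-(⌈μ⌉₊:ℤ)) (⌈μ⌉₊:ℤ) := fun l hl m h => by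
    rcases h with h | ⟨_, rfl⟩
    · exact small_m hl h0 m fun g => bK_ne _ _ (sqrt_pos.2 h.1) g h.2
    · have := Nat.ceil_pos.2 h0
      rw [Finset.mem_Ioo]; omega
  rw [NdiskN, count multN (fun m l => (0 < l ∧ bK m.natAbs (√l) = 0) ∨ (l = 0 ∧ m = 0)) (μ^2) (fIoo (-(⌈μ⌉₊:ℤ)) (⌈μ⌉₊:ℤ))
    (fun m => zc (bK m.natAbs) μ + (if m.natAbs = 0 then 1 else 0))
    (fun l hl => by convert multN_card l _ (hI l hl))
    (fun m => by rw [e]; exact ((finK _ _).image _).union (by split_ifs <;> simp))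
    (fun m => ?_), NK]
  · obtain ⟨K, hK⟩ := Nat.exists_eq_succ_of_ne_zero (Nat.ceil_pos.2 h0).ne'
    rw [hK]
    have := sum_sym (fun n => ((zc (bK n) μ + (if n = 0 then 1 else 0) : ℕ) : ℝ)) K
    simpa using this
  · rw [e, Set.ncard_union_eq ?_ ((finK _ _).image _) (by split_ifs <;> simp), Set.ncard_image_of_injOn (sq_inj _ _)]
    · congr 1
      by_cases hm : m = 0 <;> simp [hm]
    · split_ifs
      · rw [Set.disjoint_singleton_right]
        rintro ⟨z, hz, h⟩
        exact hz.1.ne' (by simpa using h)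
      · simp

theorem weyl_remainder_disk :
    ∃ C : ℝ, 0 < C ∧ ∀ μ : ℝ, 1 < μ →
      |NdiskD μ - (π / (4 * π)) * μ^2 + ((2 * π) / (4 * π)) * μ| ≤
          C * μ ^ ((2:ℝ)/3 - 1/495) ∧
      |NdiskN μ - (π / (4 * π)) * μ^2 - ((2 * π) / (4 * π)) * μ| ≤
          C * μ ^ ((2:ℝ)/3 - 1/495) := by
  obtain ⟨C, hC, h1⟩ := weylJ
  obtain ⟨D, hD, h2⟩ := weylK
  refine ⟨C + D, pz, fun μ hμ => ?_⟩
  have p : 0 < μ ^ ((2:ℝ)/3 - 1/495) := Real.rpow_pos_of_pos (lz) _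
  have a : π / (4 * π) = 1/4 := by field_simp
  have b : (2 * π) / (4 * π) = 1/2 := by field_simp; norm_num
  rw [a, b, ND_eq μ hμ, NN_eq μ hμ]
  have g1 := h1 μ hμ
  have g2 := h2 μ hμ
  constructor
  · refine le_trans (le_of_eq (congrArg abs ?_)) (g1.trans (by nlinarith))
    ring
  · refine le_trans (le_of_eq (congrArg abs ?_)) (g2.trans (by nlinarith))
    ring
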